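/- Let q ∈ ℂ* be transcendental, let 𝔤 be a complex semisimple Lie algebra, and let G be the connected simply connected complex semisimple algebraic group with Lie algebra 𝔤. Then the quantised coordinate ring O_q(G) is a noetherian unique factorisation domain in the sense of Chatters and Jordan; that is, O_q(G) is a noetherian domain in which every height one prime ideal is generated by a normal element. -/

import Mathlib

open scoped TensorProduct

/-- The `q`-factorial `(q - q⁻¹)(q² - q⁻²)⋯(qᵐ - q⁻ᵐ)`. -/
noncomputable def qfac (t : ℂ) (m : ℕ) : ℂ :=
  ∏ j ∈ Finset.range m, (t ^ (j + 1) - t⁻¹ ^ (j + 1))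

/-- The `q`-binomial coefficient `[m k]` at parameter `t`. -/
noncomputable def qbinom (t : ℂ) (m k : ℕ) : ℂ :=
  qfac t m / (qfac t k * qfac t (m - k))

/-- The defining relations of the quantised enveloping algebra `U_q(𝔤)` associated to a
Cartan matrix `a` with symmetrising integers `d`, on elements `E i`, `F i`, `K i` of a
`ℂ`-algebra `B`: the `K i` are commuting units, conjugation by `K i` rescales `E j` and
`F j` by `q_i^{±a i j}` (where `q_i = q^{d i}`), the commutator `[E i, F j]` is
`δ_{ij} (K_i - K_i⁻¹)/(q_i - q_i⁻¹)`, and the quantum Serre relations hold. -/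
def UqRels (q : ℂ) {n : ℕ} (a : Fin n → Fin n → ℤ) (d : Fin n → ℕ)
    (B : Type) [Ring B] [Algebra ℂ B] (E F : Fin n → B) (K : Fin n → Bˣ) : Prop :=
  (∀ i j, (K i : B) * (K j : B) = (K j : B) * (K i : B)) ∧
  (∀ i j, (K i : B) * E j = (q ^ ((d i : ℤ) * a i j)) • (E j * (K i : B))) ∧
  (∀ i j, (K i : B) * F j = (q ^ (-((d i : ℤ) * a i j))) • (F j * (K i : B))) ∧
  (∀ i j, E i * F j - F j * E i =
    if i = j then (q ^ (d i : ℤ) - q ^ (-(d i : ℤ)))⁻¹ • ((K i : B) - (((K i)⁻¹ : Bˣ) : B))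
    else 0) ∧
  (∀ i j, i ≠ j → ∑ k ∈ Finset.range ((1 - a i j).toNat + 1),
      ((-1 : ℂ) ^ k * qbinom (q ^ (d i : ℤ)) ((1 - a i j).toNat) k) •
        (E i ^ ((1 - a i j).toNat - k) * E j * E i ^ k) = 0) ∧
  (∀ i j, i ≠ j → ∑ k ∈ Finset.range ((1 - a i j).toNat + 1),
      ((-1 : ℂ) ^ k * qbinom (q ^ (d i : ℤ)) ((1 - a i j).toNat) k) •
        (F i ^ ((1 - a i j).toNat - k) * F j * F i ^ k) = 0)

/-- The weight space of weight `μ = ∑ μ i ϖ i` in a `U_q(𝔤)`-module: the set of vectors on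
which each `K i` acts by the scalar `q^{(μ, α_i)} = q^{μ i * d i}`. -/
noncomputable def wtSp (q : ℂ) {n : ℕ} (d : Fin n → ℕ)
    {U : Type} [Ring U] [Algebra ℂ U] (K : Fin n → Uˣ)
    {Vc : Type} [AddCommGroup Vc] [Module ℂ Vc] (ρ : U →ₐ[ℂ] Module.End ℂ Vc)
    (μ : Fin n → ℤ) : Submodule ℂ Vc :=
  ⨅ i : Fin n, LinearMap.ker (ρ (K i : U) - (q ^ (μ i * (d i : ℤ))) • (1 : Module.End ℂ Vc))

/-- `ξ` is a dual vector of weight `μ`:  equivalently (via the antipode-twisted action on the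
dual module), `ξ` vanishes on every weight space of weight `ν ≠ -μ`. -/
noncomputable def inDualWt (q : ℂ) {n : ℕ} (d : Fin n → ℕ)
    {U : Type} [Ring U] [Algebra ℂ U] (K : Fin n → Uˣ)
    {Vc : Type} [AddCommGroup Vc] [Module ℂ Vc] (ρ : U →ₐ[ℂ] Module.End ℂ Vc)
    (μ : Fin n → ℤ) (ξ : Module.Dual ℂ Vc) : Prop :=
  ∀ ν : Fin n → ℤ, ν ≠ -μ → ∀ x ∈ wtSp q d K ρ ν, ξ x = 0

/-- The Demazure-type submodule generated by the weight space of weight `ν` under the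
subalgebra of `U` generated by `gens` (take `gens = Set.range E` for `V⁺_w(λ)` with
`ν = wλ`, and `gens = Set.range F` for `V⁻_w(λ)`). -/
noncomputable def demazure (q : ℂ) {n : ℕ} (d : Fin n → ℕ)
    {U : Type} [Ring U] [Algebra ℂ U] (gens : Set U) (K : Fin n → Uˣ)
    {Vc : Type} [AddCommGroup Vc] [Module ℂ Vc] (ρ : U →ₐ[ℂ] Module.End ℂ Vc)
    (ν : Fin n → ℤ) : Submodule ℂ Vc :=
  Submodule.span ℂ
    {x | ∃ y ∈ Algebra.adjoin ℂ gens, ∃ u ∈ wtSp q d K ρ ν, x = ρ y u}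

/-- A two-sided ideal of a (possibly noncommutative) ring is prime if it is proper and
`x R y ⊆ P` implies `x ∈ P` or `y ∈ P`. -/
def IsPrimeTwoSided {R : Type*} [Ring R] (P : TwoSidedIdeal R) : Prop :=
  P ≠ ⊤ ∧ ∀ x y : R, (∀ r : R, x * r * y ∈ P) → x ∈ P ∨ y ∈ P

/-- An element `r` of a ring is normal if `rR = Rr`. -/
def IsNormalElem {R : Type*} [Ring R] (r : R) : Prop :=
  (∀ x, ∃ y, r * x = y * r) ∧ ∀ x, ∃ y, x * r = r * y

/-- The ideal `Q⁺_{w}` of `O_q(G)`: generated by the coordinate functions `c^{ϖ_j}_{ξ,v}` with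
`v` a highest weight vector of `V(ϖ_j)` and `ξ` orthogonal to the Demazure module
`V⁺_w(ϖ_j)`. -/
noncomputable def Qplus (q : ℂ) {n : ℕ} (d : Fin n → ℕ)
    {U : Type} [Ring U] [Algebra ℂ U] (E : Fin n → U) (K : Fin n → Uˣ)
    {V : (Fin n → ℕ) → Type} [∀ c, AddCommGroup (V c)] [∀ c, Module ℂ (V c)]
    (ρ : ∀ c, U →ₐ[ℂ] Module.End ℂ (V c))
    {W : Type} [Group W] (σ : W →* Multiplicative (AddAut (Fin n → ℤ)))
    {A : Type} [Ring A]
    (cf : ∀ c : Fin n → ℕ, Module.Dual ℂ (V c) → V c → A)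
    (w : W) : TwoSidedIdeal A :=
  TwoSidedIdeal.span
    {x | ∃ j : Fin n, ∃ ξ : Module.Dual ℂ (V (Pi.single j 1)),
      ∃ v ∈ wtSp q d K (ρ (Pi.single j 1)) (fun k => ((Pi.single j 1 : Fin n → ℕ) k : ℤ)),
        (∀ y ∈ demazure q d (Set.range E) K (ρ (Pi.single j 1))
            (σ w (fun k => ((Pi.single j 1 : Fin n → ℕ) k : ℤ))), ξ y = 0) ∧
        x = cf (Pi.single j 1) ξ v}

/-- The ideal `Q⁻_{w}` of `O_q(G)`: generated by the coordinate functions `c^{ϖ_j}_{ξ,v}` with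
`v` a lowest weight vector of `V(ϖ_j)` and `ξ` orthogonal to the Demazure module
`V⁻_{w w₀}(ϖ_j)`. -/
noncomputable def Qminus (q : ℂ) {n : ℕ} (d : Fin n → ℕ)
    {U : Type} [Ring U] [Algebra ℂ U] (F : Fin n → U) (K : Fin n → Uˣ)
    {V : (Fin n → ℕ) → Type} [∀ c, AddCommGroup (V c)] [∀ c, Module ℂ (V c)]
    (ρ : ∀ c, U →ₐ[ℂ] Module.End ℂ (V c))
    {W : Type} [Group W] (σ : W →* Multiplicative (AddAut (Fin n → ℤ))) (w₀ : W)
    {A : Type} [Ring A]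
    (cf : ∀ c : Fin n → ℕ, Module.Dual ℂ (V c) → V c → A)
    (w : W) : TwoSidedIdeal A :=
  TwoSidedIdeal.span
    {x | ∃ j : Fin n, ∃ ξ : Module.Dual ℂ (V (Pi.single j 1)),
      ∃ v ∈ wtSp q d K (ρ (Pi.single j 1)) (σ w₀ (fun k => ((Pi.single j 1 : Fin n → ℕ) k : ℤ))),
        (∀ y ∈ demazure q d (Set.range F) K (ρ (Pi.single j 1))
            (σ (w * w₀) (fun k => ((Pi.single j 1 : Fin n → ℕ) k : ℤ))), ξ y = 0) ∧
        x = cf (Pi.single j 1) ξ v}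



section
open Submodule (smul_mem subset_span mem_iSup_of_mem span_induction)
open Finset (sum_congr sum_eq_zero sum_sub_distrib sum_add_distrib smul_sum)
open Module.End (mul_apply)

/-! ## Basic facts on `q` -/

lemma tr_ne_zero {q : ℂ} (hq : Transcendental ℚ q) : q ≠ 0 := by
  rintro rfl; exact hq isAlgebraic_zero

lemma tr_pow {q : ℂ} (hq : Transcendental ℚ q) {m : ℕ} (hm : 0 < m) : Transcendental ℚ (q ^ m) := fun h => hq (h.of_pow hm)

lemma tr_zpow_ne_one {q : ℂ} (hq : Transcendental ℚ q) {m : ℤ} (hm : m ≠ 0) : q ^ m ≠ 1 := by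
  have key : ∀ k : ℕ, 0 < k → q ^ k ≠ 1 := fun k hk h =>
    tr_pow hq hk (by rw [h]; exact isAlgebraic_one)
  intro h
  rcases Int.natAbs_eq m with h' | h'
  · rw [h', zpow_natCast] at h; exact key _ (Int.natAbs_pos.2 hm) h
  · rw [h', zpow_neg, zpow_natCast, inv_eq_one] at h; exact key _ (Int.natAbs_pos.2 hm) h

lemma tr_zpow_inj {q : ℂ} (hq : Transcendental ℚ q) {m k : ℤ} (h : q ^ m = q ^ k) : m = k := by
  by_contra hne
  apply tr_zpow_ne_one hq (sub_ne_zero.2 hne)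
  rw [zpow_sub₀ (tr_ne_zero hq), h, div_self (zpow_ne_zero _ (tr_ne_zero hq))]

open Polynomial in
/-- If `∑ q^{m_b} = ∑ q^{-m_b}` then `∑ m_b = 0`. -/
lemma tr_sum_zero {q : ℂ} (hq : Transcendental ℚ q) {κ : Type*} (s : Finset κ) (m : κ → ℤ) (h : ∑ b ∈ s, q ^ (m b) = ∑ b ∈ s, q ^ (-(m b))) : ∑ b ∈ s, m b = 0 := by
  classical
  obtain ⟨M, hM⟩ : ∃ M : ℕ, ∀ b ∈ s, (m b).natAbs ≤ M := ⟨s.sup fun b => (m b).natAbs, fun b hb => Finset.le_sup (f := fun b => (m b).natAbs) hb⟩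
  let P : ℚ[X] := ∑ b ∈ s, (X ^ (m b + M).toNat - X ^ (-(m b) + M).toNat)
  have hP : aeval q P = 0 := by
    have e1 : ∀ b ∈ s, aeval q ((X ^ (m b + M).toNat - X ^ (-(m b) + M).toNat) : ℚ[X])
        = (q ^ (m b) - q ^ (-(m b))) * q ^ M := by
      intro b hb
      have := hM b hb
      simp only [map_sub, map_pow, aeval_X]
      rw [sub_mul, ← zpow_natCast, ← zpow_natCast, ← zpow_natCast, ← zpow_add₀ (tr_ne_zero hq), ← zpow_add₀ (tr_ne_zero hq), Int.toNat_of_nonneg (by omega), Int.toNat_of_nonneg (by omega)]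
    simp only [P]
    rw [map_sum, sum_congr rfl e1, ← Finset.sum_mul, sum_sub_distrib, h, sub_self, zero_mul]
  have hP0 : P = 0 := by
    by_contra hne; exact hq ⟨P, hne, hP⟩
  have hd : (derivative P).eval 1 = 0 := by rw [hP0]; simp
  simp only [P, derivative_sum, derivative_sub, derivative_X_pow, eval_finsetSum, eval_sub, eval_mul, eval_pow, eval_X, one_pow, mul_one, eval_C] at hd
  have e2 : ∀ b ∈ s, (((m b + M).toNat : ℚ) - ((-(m b) + M).toNat : ℚ)) = 2 * (m b : ℚ) := by
    intro b hb
    have := hM b hb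
    have h1 : (((m b + M).toNat : ℤ) : ℚ) = (m b : ℚ) + M := by
      rw [Int.toNat_of_nonneg (by omega)]; push_cast; rfl
    have h2 : (((-(m b) + M).toNat : ℤ) : ℚ) = -(m b : ℚ) + M := by
      rw [Int.toNat_of_nonneg (by omega)]; push_cast; rfl
    push_cast at h1 h2
    rw [h1, h2]; ring
  rw [sum_congr rfl e2, ← Finset.mul_sum] at hd
  have : (∑ b ∈ s, (m b : ℚ)) = 0 := by linarith
  exact_mod_cast this

open Polynomial in
/-- A nonzero polynomial with natural coefficients does not vanish at `q`. -/
lemma tr_nat_poly {q : ℂ} (hq : Transcendental ℚ q) (P : ℕ[X]) (hP : P ≠ 0) : P.eval₂ (Nat.castRingHom ℂ) q ≠ 0 := by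
  intro h
  apply hq
  refine ⟨P.map (Nat.castRingHom ℚ), ?_, ?_⟩
  · rwa [Ne, Polynomial.map_eq_zero_iff (by simpa using Nat.cast_injective)]
  · rw [aeval_def, eval₂_map, ← h]
    congr 1

/-! ## Quantum integers -/

/-- The quantum integer `[m]` at parameter `t`. -/
noncomputable def br (t : ℂ) (m : ℤ) : ℂ := (t ^ m - t ^ (-m)) / (t - t⁻¹)

/-- `t` is nonzero and not a root of unity. -/
def NRU (t : ℂ) : Prop := t ≠ 0 ∧ ∀ m : ℤ, m ≠ 0 → t ^ m ≠ 1

lemma tr_NRU {q : ℂ} (hq : Transcendental ℚ q) {m : ℤ} (hm : m ≠ 0) : NRU (q ^ m) := by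
  refine ⟨zpow_ne_zero _ (tr_ne_zero hq), fun k hk h => ?_⟩
  rw [← zpow_mul] at h
  exact tr_zpow_ne_one hq (mul_ne_zero hm hk) h

lemma NRU.kap {t : ℂ} (ht : NRU t) : t - t⁻¹ ≠ 0 := by
  intro h
  have h0 := ht.1
  apply ht.2 2 (by norm_num)
  have : t = t⁻¹ := sub_eq_zero.1 h
  rw [zpow_two]; nth_rewrite 2 [this]; exact mul_inv_cancel₀ h0

lemma NRU.br_ne {t : ℂ} (ht : NRU t) {m : ℤ} (hm : m ≠ 0) : br t m ≠ 0 := by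
  unfold br
  refine div_ne_zero ?_ ht.kap
  intro h
  apply ht.2 (2 * m) (by omega)
  have : t ^ m = t ^ (-m) := sub_eq_zero.1 h
  rw [two_mul, zpow_add₀ ht.1]; nth_rewrite 2 [this]
  rw [← zpow_add₀ ht.1]; simp

@[simp] lemma br_zero (t : ℂ) : br t 0 = 0 := by simp [br]

lemma br_neg (t : ℂ) (m : ℤ) : br t (-m) = - br t m := by
  unfold br; rw [neg_neg, ← neg_div, neg_sub]

lemma NRU.br_one {t : ℂ} (ht : NRU t) : br t 1 = 1 := by
  unfold br; simp [div_self ht.kap]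

lemma NRU.br_rec {t : ℂ} (ht : NRU t) (k m : ℤ) : br t k * br t (m - k + 1) + br t (m - 2 * k) = br t (k + 1) * br t (m - k) := by
  have h0 := ht.1
  have hk := ht.kap
  unfold br
  have e : ∀ x : ℤ, t ^ (-x) = (t ^ x)⁻¹ := fun x => zpow_neg t x
  have e1 : t ^ (m - k + 1) = t ^ m / t ^ k * t := by
    rw [zpow_add₀ h0, zpow_sub₀ h0, zpow_one]
  have e2 : t ^ (m - 2 * k) = t ^ m / (t ^ k * t ^ k) := by
    rw [zpow_sub₀ h0, two_mul, zpow_add₀ h0]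
  have e3 : t ^ (k + 1) = t ^ k * t := by rw [zpow_add₀ h0, zpow_one]
  have e4 : t ^ (m - k) = t ^ m / t ^ k := by rw [zpow_sub₀ h0]
  rw [e, e, e, e, e, e1, e2, e3, e4]
  have hm0 : t ^ m ≠ 0 := zpow_ne_zero _ h0
  have hk0 : t ^ k ≠ 0 := zpow_ne_zero _ h0
  generalize t ^ m = x at *
  generalize t ^ k = y at *
  have hk' : t ^ 2 - 1 ≠ 0 := by
    intro h
    apply hk
    field_simp
    rw [h, mul_zero]
  field_simp
  ring

/-! ## Abstract weight modules -/

/-- The simple root `α i` in fundamental coordinates. -/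
def rt {n : ℕ} (a : Fin n → Fin n → ℤ) (i : Fin n) : Fin n → ℤ := fun j => a j i

/-- Abstract weight modules: weight spaces with raising and lowering operators. -/
structure WM {n : ℕ} (t : Fin n → ℂ) (a : Fin n → Fin n → ℤ) (M : Type*) [AddCommGroup M] [Module ℂ M] where
  wt : (Fin n → ℤ) → Submodule ℂ M
  E : Fin n → Module.End ℂ M
  F : Fin n → Module.End ℂ M
  E_mem : ∀ i μ x, x ∈ wt μ → E i x ∈ wt (μ + rt a i)
  F_mem : ∀ i μ x, x ∈ wt μ → F i x ∈ wt (μ - rt a i)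
  comm : ∀ i j μ x, x ∈ wt μ → E i (F j x) - F j (E i x) = if i = j then br (t i) (μ i) • x else 0

namespace WM

variable {n : ℕ} {t : Fin n → ℂ} {a : Fin n → Fin n → ℤ} {M : Type*} [AddCommGroup M] [Module ℂ M] (W : WM t a M)

/-- The opposite weight module. -/
def op : WM t a M where
  wt μ := W.wt (-μ)
  E := W.F
  F := W.E
  E_mem i μ x h := by
    have := W.F_mem i _ x h
    rwa [show -μ - rt a i = -(μ + rt a i) by abel] at this
  F_mem i μ x h := by
    have := W.E_mem i _ x h
    rwa [show -μ + rt a i = -(μ - rt a i) by abel] at this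
  comm i j μ x h := by
    have := W.comm j i _ x h
    rw [← neg_sub, this]
    by_cases hij : i = j
    · subst hij; simp [br_neg]
    · rw [if_neg hij, if_neg (Ne.symm hij), neg_zero]

variable {W}

lemma F_pow_mem {i : Fin n} {μ : Fin n → ℤ} {x : M} (hx : x ∈ W.wt μ) (k : ℕ) : (W.F i ^ k) x ∈ W.wt (μ - (k : ℤ) • rt a i) := by
  induction k with
  | zero => simpa using hx
  | succ k ih =>
    rw [pow_succ', mul_apply]
    have := W.F_mem i _ _ ih
    convert this using 2
    rw [Nat.cast_succ, add_smul, one_smul]; abel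

lemma E_pow_mem {i : Fin n} {μ : Fin n → ℤ} {x : M} (hx : x ∈ W.wt μ) (k : ℕ) : (W.E i ^ k) x ∈ W.wt (μ + (k : ℤ) • rt a i) := by
  induction k with
  | zero => simpa using hx
  | succ k ih =>
    rw [pow_succ', mul_apply]
    have := W.E_mem i _ _ ih
    convert this using 2
    rw [Nat.cast_succ, add_smul, one_smul]; abel

lemma EF_pow (ht : ∀ i, NRU (t i)) (h2 : ∀ i, a i i = 2) {i : Fin n} {μ : Fin n → ℤ} {x : M} (hx : x ∈ W.wt μ) (hE : W.E i x = 0) (k : ℕ) : W.E i ((W.F i ^ (k + 1)) x) =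
      (br (t i) ((k : ℤ) + 1) * br (t i) (μ i - k)) • (W.F i ^ k) x := by
  induction k with
  | zero =>
    have := W.comm i i μ x hx
    simp only [hE, map_zero, sub_zero, if_true] at this
    simp [this, (ht i).br_one]
  | succ k ih =>
    have h1 := W.comm i i _ _ (F_pow_mem (i := i) hx (k + 1))
    rw [if_pos rfl, sub_eq_iff_eq_add] at h1
    rw [pow_succ', mul_apply, h1, ih, map_smul]
    have e2 : W.F i ((W.F i ^ k) x) = (W.F i ^ (k + 1)) x := by
      rw [pow_succ', mul_apply]
    rw [e2, ← add_smul]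
    congr 1
    have e3 : (μ - ((k + 1 : ℕ) : ℤ) • rt a i) i = μ i - 2 * ((k : ℤ) + 1) := by
      simp [rt, h2]; ring
    rw [e3]
    have := (ht i).br_rec ((k : ℤ) + 1) (μ i)
    push_cast
    rw [← this, add_comm]
    congr 3
    ring

/-- Dominance of highest weights. -/
lemma dominant (ht : ∀ i, NRU (t i)) (h2 : ∀ i, a i i = 2) {i : Fin n} {μ : Fin n → ℤ} {x : M} (hx : x ∈ W.wt μ) (hE : W.E i x = 0) (hx0 : x ≠ 0) (hN : ∃ N, (W.F i ^ N) x = 0) :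
    ∃ m : ℕ, μ i = m ∧ (∀ k ≤ m, (W.F i ^ k) x ≠ 0) ∧ (W.F i ^ (m + 1)) x = 0 := by
  classical
  have hfind := Nat.find_spec hN
  have hmin : ∀ k, k < Nat.find hN → (W.F i ^ k) x ≠ 0 := fun k hk => Nat.find_min hN hk
  rcases h : Nat.find hN with _ | m
  · rw [h] at hfind; simp at hfind; exact absurd hfind hx0
  · rw [h] at hfind hmin
    have h1 := EF_pow ht h2 hx hE m
    rw [hfind, map_zero] at h1
    have h3 := (smul_eq_zero.1 h1.symm).resolve_right (hmin m (by omega))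
    have h4 := (mul_eq_zero.1 h3).resolve_left ((ht i).br_ne (by omega))
    refine ⟨m, ?_, fun k hk => hmin k (by omega), hfind⟩
    by_contra hne
    exact (ht i).br_ne (sub_ne_zero.2 hne) h4

/-- exhaust the nilpotent raising operator -/
lemma exists_top {M : Type*} [AddCommGroup M] [Module ℂ M] (T : Module.End ℂ M) {y : M} (hy : y ≠ 0) (hN : ∃ N, (T ^ N) y = 0) : ∃ r : ℕ, (T ^ r) y ≠ 0 ∧ (T ^ (r + 1)) y = 0 := by
  classical
  have hfind := Nat.find_spec hN
  rcases h : Nat.find hN with _ | m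
  · rw [h] at hfind; simp at hfind; exact absurd hfind hy
  · exact ⟨m, Nat.find_min hN (by omega), by rw [h] at hfind; exact hfind⟩

lemma refl_aux (ht : ∀ i, NRU (t i)) (h2 : ∀ i, a i i = 2) {i : Fin n} {N : Submodule ℂ M} (hNE : ∀ x ∈ N, W.E i x ∈ N) (hNF : ∀ x ∈ N, W.F i x ∈ N)
    (hE : ∀ x ∈ N, ∃ k, (W.E i ^ k) x = 0) (hF : ∀ x ∈ N, ∃ k, (W.F i ^ k) x = 0) {μ : Fin n → ℤ} {y : M} (hy : y ∈ W.wt μ) (hyN : y ∈ N) (hy0 : y ≠ 0) (hμ : 0 ≤ μ i) :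
    ∃ y' ∈ W.wt (μ - μ i • rt a i), y' ∈ N ∧ y' ≠ 0 := by
  have hpE : ∀ k, ∀ x ∈ N, (W.E i ^ k) x ∈ N := by
    intro k; induction k with
    | zero => simp
    | succ k ih => intro x hx; rw [pow_succ']; exact hNE _ (ih x hx)
  have hpF : ∀ k, ∀ x ∈ N, (W.F i ^ k) x ∈ N := by
    intro k; induction k with
    | zero => simp
    | succ k ih => intro x hx; rw [pow_succ']; exact hNF _ (ih x hx)
  obtain ⟨r, hr, hr1⟩ := exists_top (W.E i) hy0 (hE y hyN)
  have hw := E_pow_mem (i := i) hy r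
  obtain ⟨m, hm, hm1, -⟩ := dominant ht h2 hw (by rw [← mul_apply, ← pow_succ']; exact hr1)
    hr (hF _ (hpE r y hyN))
  have hm' : μ i + 2 * r = m := by
    rw [← hm]; simp [rt, h2]; ring
  obtain ⟨k, hk⟩ : ∃ k : ℕ, μ i + r = k := ⟨(μ i + r).toNat, by omega⟩
  refine ⟨(W.F i ^ k) ((W.E i ^ r) y), ?_, hpF _ _ (hpE r y hyN), hm1 k (by omega)⟩
  have := F_pow_mem (i := i) hw k
  convert this using 2
  rw [← hk, add_smul]; abel

/-- Reflection symmetry of the set of weights. -/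
lemma refl (ht : ∀ i, NRU (t i)) (h2 : ∀ i, a i i = 2) {i : Fin n} {N : Submodule ℂ M} (hNE : ∀ x ∈ N, W.E i x ∈ N) (hNF : ∀ x ∈ N, W.F i x ∈ N)
    (hE : ∀ x ∈ N, ∃ k, (W.E i ^ k) x = 0) (hF : ∀ x ∈ N, ∃ k, (W.F i ^ k) x = 0) {μ : Fin n → ℤ} {y : M} (hy : y ∈ W.wt μ) (hyN : y ∈ N) (hy0 : y ≠ 0) :
    ∃ y' ∈ W.wt (μ - μ i • rt a i), y' ∈ N ∧ y' ≠ 0 := by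
  rcases le_total 0 (μ i) with h | h
  · exact refl_aux ht h2 hNE hNF hE hF hy hyN hy0 h
  · obtain ⟨y', h1, h2, h3⟩ := refl_aux (W := W.op) ht h2 (i := i) (N := N) hNF hNE hF hE
      (μ := -μ) (y := y) (by simpa [op] using hy) hyN hy0 (by simpa using h)
    refine ⟨y', ?_, h2, h3⟩
    have h1' : y' ∈ W.wt (-(-μ - (-μ) i • rt a i)) := h1
    convert h1' using 2
    simp; abel

/-- Lists of operators applied. -/
def Fw (W : WM t a M) : List (Fin n) → Module.End ℂ M := fun l => (l.map W.F).prod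

/-- The span of all `F`-words applied to a highest weight vector is `E`-stable. -/
lemma span_F_E_stable {μ : Fin n → ℤ} {x : M} (hx : x ∈ W.wt μ) (hE : ∀ i, W.E i x = 0) (i : Fin n) {y : M} (hy : y ∈ Submodule.span ℂ (Set.range fun l => W.Fw l x)) :
    W.E i y ∈ Submodule.span ℂ (Set.range fun l => W.Fw l x) := by
  have hw : ∀ l : List (Fin n), ∃ ν, W.Fw l x ∈ W.wt ν := by
    intro l
    induction l with
    | nil => exact ⟨μ, by simpa [Fw] using hx⟩
    | cons j l ih =>
      obtain ⟨ν, hν⟩ := ih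
      exact ⟨_, by simpa [Fw] using W.F_mem j _ _ hν⟩
  have hF : ∀ (j : Fin n) (z : M), z ∈ Submodule.span ℂ (Set.range fun l => W.Fw l x) → W.F j z ∈ Submodule.span ℂ (Set.range fun l => W.Fw l x) := by
    intro j z hz
    induction hz using span_induction with
    | mem z hz =>
      obtain ⟨l, rfl⟩ := hz
      exact subset_span ⟨j :: l, by simp [Fw]⟩
    | zero => simp
    | add u v _ _ h1 h2 => rw [map_add]; exact add_mem h1 h2
    | smul c u _ h1 => rw [map_smul]; exact smul_mem _ _ h1
  induction hy using span_induction with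
  | mem z hz =>
    obtain ⟨l, rfl⟩ := hz
    induction l with
    | nil => simp [Fw, hE]
    | cons j l ih =>
      obtain ⟨ν, hν⟩ := hw l
      have := W.comm i j ν _ hν
      rw [sub_eq_iff_eq_add] at this
      have e : W.Fw (j :: l) x = W.F j (W.Fw l x) := by simp [Fw]
      simp only [e, this]
      refine add_mem ?_ (hF j _ ih)
      split_ifs
      · exact smul_mem _ _ (subset_span ⟨l, rfl⟩)
      · simp
  | zero => simp
  | add u v _ _ h1 h2 => rw [map_add]; exact add_mem h1 h2
  | smul c u _ h1 => rw [map_smul]; exact smul_mem _ _ h1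

end WM

/-- the inverse of a unit, as an element of the ring -/
local notation:max "⇃" x:max => Units.val (Inv.inv x)

/-! ## Joint eigenspaces -/

/-- Joint eigenvectors for pairwise distinct systems of eigenvalues are independent. -/
lemma joint_eig {M : Type*} [AddCommGroup M] [Module ℂ M] {κ Γ : Type*} (D : κ → Module.End ℂ M) (e : Γ → κ → ℂ) (he : Function.Injective e) (s : Finset Γ)
    (x : Γ → M) (hx : ∀ g ∈ s, ∀ k, D k (x g) = e g k • x g) (h0 : ∑ g ∈ s, x g = 0) : ∀ g ∈ s, x g = 0 := by
  classical
  induction s using Finset.induction_on generalizing x with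
  | empty => simp
  | insert g1 s hg1 ih =>
    have key : ∀ g ∈ s, x g = 0 := by
      intro g hg
      have hne : e g ≠ e g1 := fun h => hg1 (he h ▸ hg)
      obtain ⟨k, hk⟩ := Function.ne_iff.1 hne
      have h1 : ∑ g ∈ s, (e g k - e g1 k) • x g = 0 := by
        have h2 := congrArg (D k) h0
        rw [map_sum, map_zero, Finset.sum_insert hg1, hx g1 (by simp)] at h2
        rw [sum_congr rfl (fun g hg => hx g (Finset.mem_insert_of_mem hg) k)] at h2
        have h3 := congrArg (fun y => e g1 k • y) h0
        simp only [Finset.sum_insert hg1, smul_add, smul_zero, smul_sum] at h3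
        simp only [sub_smul, sum_sub_distrib]
        rw [← add_sub_add_left_eq_sub _ _ (e g1 k • x g1), h2, h3, sub_zero]
      have h4 := ih (fun g => (e g k - e g1 k) • x g) (by
        intro g hg k'
        rw [map_smul, hx g (Finset.mem_insert_of_mem hg), smul_comm]) h1 g hg
      exact (smul_eq_zero.1 h4).resolve_left (sub_ne_zero.2 hk)
    intro g hg
    rcases Finset.mem_insert.1 hg with rfl | hg
    · rwa [Finset.sum_insert hg1, sum_eq_zero key, add_zero] at h0
    · exact key g hg

/-- Version with suprema. -/
lemma joint_eig_iSup {M : Type*} [AddCommGroup M] [Module ℂ M] {κ Γ : Type*} (D : κ → Module.End ℂ M) (e : Γ → κ → ℂ) (he : Function.Injective e)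
    (w : Γ → Submodule ℂ M) (hw : ∀ g, ∀ x ∈ w g, ∀ k, D k x = e g k • x) (S : Set Γ) (g : Γ) (hg : g ∉ S) (x : M) (hx : x ∈ w g) (hx' : x ∈ ⨆ g' ∈ S, w g') : x = 0 := by
  classical
  rw [iSup_subtype', Submodule.mem_iSup_iff_exists_finsupp] at hx'
  obtain ⟨f, hf, hsum⟩ := hx'
  let y : Γ → M := fun g' => if h : g' ∈ S then f ⟨g', h⟩ else -x
  let s : Finset Γ := insert g (f.support.map (Function.Embedding.subtype _))
  have hgs : g ∉ f.support.map (Function.Embedding.subtype (· ∈ S)) := by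
    intro h
    obtain ⟨⟨g', hg'⟩, -, rfl⟩ := Finset.mem_map.1 h
    exact hg hg'
  have := joint_eig D e he s y (by
    intro g' hg' k
    rcases Finset.mem_insert.1 hg' with rfl | hg'
    · simp only [y, dif_neg hg]
      exact hw _ _ (Submodule.neg_mem _ hx) k
    · obtain ⟨⟨g'', hg''⟩, -, rfl⟩ := Finset.mem_map.1 hg'
      have : g'' ∈ S := hg''
      simp only [y, Function.Embedding.subtype_apply, dif_pos this]
      exact hw _ _ (hf _) k) (by
    rw [Finset.sum_insert hgs, Finset.sum_map]
    simp only [y, dif_neg hg, Function.Embedding.subtype_apply]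
    have : ∀ i ∈ f.support, (if h : (i : Γ) ∈ S then f ⟨i, h⟩ else -x) = f i := by
      intro i _; rw [dif_pos i.2]
    rw [sum_congr rfl this]
    have h' : ∑ i ∈ f.support, f i = x := hsum
    rw [h', neg_add_cancel]) g (Finset.mem_insert_self _ _)
  simpa [y, dif_neg hg] using this

/-! ## Cartan data, relations, representations -/

/-- The part of the Cartan data hypotheses that we use. -/
structure Cartan (q : ℂ) {n : ℕ} (a : Fin n → Fin n → ℤ) (d : Fin n → ℕ) : Prop where
  hq : Transcendental ℚ q
  diag : ∀ i, a i i = 2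
  d_pos : ∀ i, 0 < d i
  symm : ∀ i j, (d i : ℤ) * a i j = (d j : ℤ) * a j i

/-- `q_i`. -/
noncomputable def qi (q : ℂ) {n : ℕ} (d : Fin n → ℕ) (i : Fin n) : ℂ := q ^ (d i : ℤ)

lemma Cartan.nru {q : ℂ} {n : ℕ} {a : Fin n → Fin n → ℤ} {d : Fin n → ℕ} (hC : Cartan q a d) (i : Fin n) : NRU (qi q d i) := tr_NRU hC.hq (by have := hC.d_pos i; omega)

lemma Cartan.q0 {q : ℂ} {n : ℕ} {a : Fin n → Fin n → ℤ} {d : Fin n → ℕ} (hC : Cartan q a d) : q ≠ 0 := tr_ne_zero hC.hq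

/-- The relations of `U` that we use, plus generation. -/
structure URel (q : ℂ) {n : ℕ} (a : Fin n → Fin n → ℤ) (d : Fin n → ℕ) {U : Type} [Ring U] [Algebra ℂ U] (E F : Fin n → U) (K : Fin n → Uˣ) : Prop where
  KK : ∀ i j, (K i : U) * (K j : U) = (K j : U) * (K i : U)
  KE : ∀ i j, (K i : U) * E j = (q ^ ((d i : ℤ) * a i j)) • (E j * (K i : U))
  KF : ∀ i j, (K i : U) * F j = (q ^ (-((d i : ℤ) * a i j))) • (F j * (K i : U))
  EF : ∀ i j, E i * F j - F j * E i = if i = j then (q ^ (d i : ℤ) - q ^ (-(d i : ℤ)))⁻¹ • ((K i : U) - ⇃(K i))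
    else 0
  gen : ∀ S : Subalgebra ℂ U, (∀ i, E i ∈ S) → (∀ i, F i ∈ S) → (∀ i, (K i : U) ∈ S) → (∀ i, ⇃(K i) ∈ S) → S = ⊤

section

variable {q : ℂ} {n : ℕ} {a : Fin n → Fin n → ℤ} {d : Fin n → ℕ} {U : Type} [Ring U] [Algebra ℂ U] {E F : Fin n → U} {K : Fin n → Uˣ}

lemma URel.induct (hU : URel q a d E F K) (S : Subalgebra ℂ U) (hE : ∀ i, E i ∈ S) (hF : ∀ i, F i ∈ S) (hK : ∀ i, (K i : U) ∈ S) (hK' : ∀ i, ⇃(K i) ∈ S) (u : U) :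
    u ∈ S := by rw [hU.gen S hE hF hK hK']; trivial

/-- algebra maps agreeing on generators agree -/
lemma URel.ext (hU : URel q a d E F K) {B : Type*} [Ring B] [Algebra ℂ B] {f g : U →ₐ[ℂ] B} (hE : ∀ i, f (E i) = g (E i)) (hF : ∀ i, f (F i) = g (F i))
    (hK : ∀ i, f (K i : U) = g (K i : U)) : f = g := by
  have hmem : ∀ u, u ∈ AlgHom.equalizer f g := fun u => hU.induct _ hE hF hK (by
    intro i
    change f _ = g _
    have h1 : f ⇃(K i) * f (K i : U) = 1 := by rw [← map_mul]; simp
    have h2 : g (K i : U) * g ⇃(K i) = 1 := by rw [← map_mul]; simp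
    rw [hK] at h1
    exact left_inv_eq_right_inv h1 h2) u
  ext u; exact hmem u

lemma URel.of_univ (hrel : UqRels q a d U E F K) (hUuniv : ∀ (B : Type) [Ring B] [Algebra ℂ B] (E' F' : Fin n → B) (K' : Fin n → Bˣ), UqRels q a d B E' F' K' → ∃! φ : U →ₐ[ℂ] B,
        (∀ i, φ (E i) = E' i) ∧ (∀ i, φ (F i) = F' i) ∧ (∀ i, φ (K i : U) = (K' i : B))) :
    URel q a d E F K := by
  refine ⟨hrel.1, hrel.2.1, hrel.2.2.1, hrel.2.2.2.1, fun S hE hF hK hK' => ?_⟩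
  let E' : Fin n → S := fun i => ⟨E i, hE i⟩
  let F' : Fin n → S := fun i => ⟨F i, hF i⟩
  let K' : Fin n → Sˣ := fun i => ⟨⟨K i, hK i⟩, ⟨_, hK' i⟩, Subtype.ext (by simp), Subtype.ext (by simp)⟩
  obtain ⟨h1, h2, h3, h4, h5, h6⟩ := hrel
  obtain ⟨φ, ⟨hφE, hφF, hφK⟩, -⟩ := hUuniv S E' F' K' (by
    refine ⟨fun i j => Subtype.ext (h1 i j), fun i j => Subtype.ext (h2 i j), fun i j => Subtype.ext (h3 i j), fun i j => Subtype.ext ?_, fun i j hij => Subtype.ext ?_, fun i j hij => Subtype.ext ?_⟩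
    · have := h4 i j
      by_cases hij : i = j
      · subst hij
        simp only [if_true] at this ⊢
        exact this
      · rw [if_neg hij] at this ⊢
        exact this
    · have := h5 i j hij
      simpa [E'] using this
    · have := h6 i j hij
      simpa [F'] using this)
  obtain ⟨ψ, -, hψ⟩ := hUuniv U E F K ⟨h1, h2, h3, h4, h5, h6⟩
  have e1 : S.val.comp φ = ψ := hψ _ ⟨fun i => by simp [hφE, E'], fun i => by simp [hφF, F'], fun i => by simp [hφK, K']⟩
  have e2 : AlgHom.id ℂ U = ψ := hψ _ ⟨fun i => rfl, fun i => rfl, fun i => rfl⟩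
  rw [eq_top_iff]
  intro u _
  have : u = S.val (φ u) := by
    have := congrArg (fun f : U →ₐ[ℂ] U => f u) (e2.trans e1.symm)
    simpa using this
  rw [this]; exact (φ u).2

variable {M : Type*} [AddCommGroup M] [Module ℂ M]

/-- weight spaces (generic universe version of `wtSp`) -/
noncomputable def wsp (q : ℂ) {n : ℕ} (d : Fin n → ℕ) (K : Fin n → Uˣ) (ρ : U →ₐ[ℂ] Module.End ℂ M) (μ : Fin n → ℤ) : Submodule ℂ M :=
  ⨅ i : Fin n, LinearMap.ker (ρ (K i : U) - (q ^ (μ i * (d i : ℤ))) • (1 : Module.End ℂ M))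

lemma mem_wsp {ρ : U →ₐ[ℂ] Module.End ℂ M} {μ : Fin n → ℤ} {x : M} : x ∈ wsp q d K ρ μ ↔ ∀ i, ρ (K i : U) x = q ^ (μ i * (d i : ℤ)) • x := by
  simp [wsp, sub_eq_zero]

lemma Cartan.eig_inj (hC : Cartan q a d) : Function.Injective (fun (μ : Fin n → ℤ) (i : Fin n) => q ^ (μ i * (d i : ℤ))) := by
  intro μ ν h
  ext i
  have := tr_zpow_inj hC.hq (congrFun h i)
  have hd := hC.d_pos i
  exact mul_right_cancel₀ (by omega) this

lemma wsp_indep (hC : Cartan q a d) (ρ : U →ₐ[ℂ] Module.End ℂ M) (S : Set (Fin n → ℤ)) (μ : Fin n → ℤ) (hμ : μ ∉ S) (x : M) (hx : x ∈ wsp q d K ρ μ) (hx' : x ∈ ⨆ ν ∈ S, wsp q d K ρ ν) : x = 0 :=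
  joint_eig_iSup (fun i => ρ (K i : U)) _ hC.eig_inj (wsp q d K ρ)
    (fun _ _ hx k => mem_wsp.1 hx k) S μ hμ x hx hx'

lemma wsp_inv (hC : Cartan q a d) {ρ : U →ₐ[ℂ] Module.End ℂ M} {μ : Fin n → ℤ} {x : M} (hx : x ∈ wsp q d K ρ μ) (i : Fin n) : ρ ⇃(K i) x = q ^ (-(μ i * (d i : ℤ))) • x := by
  have h1 := mem_wsp.1 hx i
  have h2 : ρ ⇃(K i) (ρ (K i : U) x) = x := by
    rw [← mul_apply, ← map_mul]; simp
  rw [h1, map_smul] at h2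
  rw [zpow_neg]
  exact (eq_inv_smul_iff₀ (zpow_ne_zero _ hC.q0)).2 h2

/-- Representations are weight modules. -/
noncomputable def repWM (hC : Cartan q a d) (hU : URel q a d E F K) (ρ : U →ₐ[ℂ] Module.End ℂ M) : WM (qi q d) a M where
  wt := wsp q d K ρ
  E i := ρ (E i)
  F i := ρ (F i)
  E_mem i μ x hx := by
    rw [mem_wsp] at hx ⊢
    intro j
    rw [← mul_apply, ← map_mul, hU.KE, map_smul, map_mul, LinearMap.smul_apply, mul_apply, hx, map_smul, smul_smul, ← zpow_add₀ hC.q0]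
    congr 2
    simp only [Pi.add_apply, rt]; ring
  F_mem i μ x hx := by
    rw [mem_wsp] at hx ⊢
    intro j
    rw [← mul_apply, ← map_mul, hU.KF, map_smul, map_mul, LinearMap.smul_apply, mul_apply, hx, map_smul, smul_smul, ← zpow_add₀ hC.q0]
    congr 2
    simp only [Pi.sub_apply, rt]; ring
  comm i j μ x hx := by
    have h := congrArg (fun u => ρ u x) (hU.EF i j)
    simp only [map_sub, map_mul, LinearMap.sub_apply, mul_apply] at h
    rw [h]
    split_ifs with hij
    · rw [map_smul, map_sub, LinearMap.smul_apply, LinearMap.sub_apply, wsp_inv hC hx, mem_wsp.1 hx, ← sub_smul, smul_smul]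
      congr 1
      unfold br qi
      rw [div_eq_inv_mul, ← zpow_mul, ← zpow_mul, mul_comm (d i : ℤ), ← zpow_neg, mul_comm (d i : ℤ), neg_mul]
    · simp

variable (hC : Cartan q a d) (hU : URel q a d E F K)

@[simp] lemma repWM_E (ρ : U →ₐ[ℂ] Module.End ℂ M) (i : Fin n) : (repWM hC hU ρ).E i = ρ (E i) := rfl
@[simp] lemma repWM_F (ρ : U →ₐ[ℂ] Module.End ℂ M) (i : Fin n) : (repWM hC hU ρ).F i = ρ (F i) := rfl
@[simp] lemma repWM_wt (ρ : U →ₐ[ℂ] Module.End ℂ M) : (repWM hC hU ρ).wt = wsp q d K ρ := rfl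

/-- The weight of a word. -/
def bw {n : ℕ} (a : Fin n → Fin n → ℤ) (l : List (Fin n)) : Fin n → ℤ := (l.map (rt a)).sum

@[simp] lemma bw_nil {n : ℕ} (a : Fin n → Fin n → ℤ) : bw a [] = 0 := rfl
@[simp] lemma bw_cons {n : ℕ} (a : Fin n → Fin n → ℤ) (i : Fin n) (l : List (Fin n)) : bw a (i :: l) = rt a i + bw a l := by simp [bw]

lemma WM.Fw_mem {t : Fin n → ℂ} (W : WM t a M) {μ : Fin n → ℤ} {x : M} (hx : x ∈ W.wt μ) (l : List (Fin n)) : W.Fw l x ∈ W.wt (μ - bw a l) := by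
  induction l with
  | nil => simpa [WM.Fw] using hx
  | cons i l ih =>
    have := W.F_mem i _ _ ih
    have e : W.Fw (i :: l) x = W.F i (W.Fw l x) := by simp [WM.Fw]
    rw [e, bw_cons]
    convert this using 2; abel

include hC hU in
/-- The span of `F`-words on a highest weight vector is a submodule. -/
lemma hw_span_stable (ρ : U →ₐ[ℂ] Module.End ℂ M) {μ : Fin n → ℤ} {x : M} (hx : x ∈ wsp q d K ρ μ) (hE : ∀ i, ρ (E i) x = 0) (u : U) {y : M}
    (hy : y ∈ Submodule.span ℂ (Set.range fun l => (repWM hC hU ρ).Fw l x)) : ρ u y ∈ Submodule.span ℂ (Set.range fun l => (repWM hC hU ρ).Fw l x) := by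
  set W := repWM hC hU ρ with hW
  set N := Submodule.span ℂ (Set.range fun l => W.Fw l x) with hN
  let S : Subalgebra ℂ U :=
    { carrier := {u | ∀ y ∈ N, ρ u y ∈ N}
      mul_mem' := fun {u v} hu hv y hy => by rw [map_mul]; exact hu _ (hv _ hy)
      add_mem' := fun {u v} hu hv y hy => by
        rw [map_add]; exact N.add_mem (hu _ hy) (hv _ hy)
      algebraMap_mem' := fun c y hy => by
        rw [AlgHom.commutes]; exact N.smul_mem c hy }
  have hgen : ∀ (v : U), (∀ l, ρ v (W.Fw l x) ∈ N) → v ∈ S := by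
    intro v hv y hy
    induction hy using span_induction with
    | mem z hz => obtain ⟨l, rfl⟩ := hz; exact hv l
    | zero => simp
    | add u v _ _ h1 h2 => rw [map_add]; exact add_mem h1 h2
    | smul c u _ h1 => rw [map_smul]; exact smul_mem _ _ h1
  refine hU.induct S (fun i y hy => W.span_F_E_stable hx hE i hy) (fun i => hgen _ fun l => ?_)
    (fun i => hgen _ fun l => ?_) (fun i => hgen _ fun l => ?_) u y hy
  · exact subset_span ⟨i :: l, by simp [WM.Fw, hW, repWM]⟩
  · rw [mem_wsp.1 (W.Fw_mem hx l) i]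
    exact smul_mem _ _ (subset_span ⟨l, rfl⟩)
  · rw [wsp_inv hC (W.Fw_mem hx l) i]
    exact smul_mem _ _ (subset_span ⟨l, rfl⟩)

/-- Simplicity of a representation. -/
def IsSimp (ρ : U →ₐ[ℂ] Module.End ℂ M) : Prop :=
  ∀ N : Submodule ℂ M, (∀ (u : U), ∀ v ∈ N, ρ u v ∈ N) → N = ⊥ ∨ N = ⊤

include hC hU in
lemma hw_span_top {ρ : U →ₐ[ℂ] Module.End ℂ M} (hs : IsSimp ρ) {μ : Fin n → ℤ} {x : M} (hx : x ∈ wsp q d K ρ μ) (hE : ∀ i, ρ (E i) x = 0) (hx0 : x ≠ 0) :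
    Submodule.span ℂ (Set.range fun l => (repWM hC hU ρ).Fw l x) = ⊤ := by
  refine (hs _ fun u v hv => hw_span_stable hC hU ρ hx hE u hv).resolve_left fun h => hx0 ?_
  have : x ∈ Submodule.span ℂ (Set.range fun l => (repWM hC hU ρ).Fw l x) := subset_span ⟨[], by simp [WM.Fw]⟩
  rwa [h, Submodule.mem_bot] at this

include hC hU in
/-- weights of a simple highest weight module are below the highest one -/
lemma hw_weights {ρ : U →ₐ[ℂ] Module.End ℂ M} (hs : IsSimp ρ) {μ : Fin n → ℤ} {x : M} (hx : x ∈ wsp q d K ρ μ) (hE : ∀ i, ρ (E i) x = 0) (hx0 : x ≠ 0) {ν : Fin n → ℤ} {y : M}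
    (hy : y ∈ wsp q d K ρ ν) (hy0 : y ≠ 0) : ∃ l, ν = μ - bw a l := by
  by_contra hcon
  push Not at hcon
  apply hy0
  refine wsp_indep (a := a) hC ρ (Set.range fun l => μ - bw a l) ν (by
    rintro ⟨l, rfl⟩; exact hcon l rfl) y hy ?_
  have : y ∈ Submodule.span ℂ (Set.range fun l => (repWM hC hU ρ).Fw l x) := by
    rw [hw_span_top hC hU hs hx hE hx0]; trivial
  refine (Submodule.span_le.2 ?_) this
  rintro _ ⟨l, rfl⟩
  exact mem_iSup_of_mem (μ - bw a l) (mem_iSup_of_mem ⟨l, rfl⟩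
    ((repWM hC hU ρ).Fw_mem hx l))

/-- Weight bases. -/
lemma exists_wt_basis (w : (Fin n → ℤ) → Submodule ℂ M) [FiniteDimensional ℂ M] (h : (⨆ μ, w μ) = ⊤) : ∃ (m : ℕ) (b : Module.Basis (Fin m) ℂ M) (β : Fin m → (Fin n → ℤ)), ∀ k, b k ∈ w (β k) := by
  obtain ⟨s, hs, hspan, hli⟩ := exists_linearIndependent ℂ (⋃ μ, (w μ : Set M))
  have htop : ⊤ ≤ Submodule.span ℂ (Set.range ((↑) : s → M)) := by
    rw [Subtype.range_coe, hspan, ← h]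
    exact iSup_le fun μ => (Set.subset_iUnion (fun μ => (w μ : Set M)) μ).trans
      subset_span
  let b := Module.Basis.mk hli htop
  have : Finite s := Module.Finite.finite_basis b
  obtain ⟨m, ⟨e⟩⟩ := Finite.exists_equiv_fin s
  have : ∀ k : Fin m, ∃ μ, b.reindex e k ∈ w μ := by
    intro k
    rw [Module.Basis.reindex_apply, Module.Basis.mk_apply]
    simpa using hs (e.symm k).2
  choose β hβ using this
  exact ⟨m, b.reindex e, β, hβ⟩

lemma repr_wt (hC : Cartan q a d) {ρ : U →ₐ[ℂ] Module.End ℂ M} {m : ℕ} {b : Module.Basis (Fin m) ℂ M} {β : Fin m → (Fin n → ℤ)} (hb : ∀ k, b k ∈ wsp q d K ρ (β k))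
    {μ : Fin n → ℤ} {x : M} (hx : x ∈ wsp q d K ρ μ) (k : Fin m) (hk : β k ≠ μ) : b.repr x k = 0 := by
  obtain ⟨i, hi⟩ := Function.ne_iff.1 (fun h => hk (hC.eig_inj h) : (fun i => q ^ (β k i * (d i : ℤ))) ≠
    fun i => q ^ (μ i * (d i : ℤ)))
  have h1 := congrArg (fun y => b.repr y k) (mem_wsp.1 hx i)
  have h2 : b.repr (ρ (K i : U) x) k = q ^ (β k i * (d i : ℤ)) * b.repr x k := by
    conv_lhs => rw [← b.sum_repr x]
    simp only [map_sum, map_smul, Finsupp.coe_finsetSum, Finset.sum_apply, Finsupp.smul_apply, mem_wsp.1 (hb _) i, Module.Basis.repr_self, smul_eq_mul]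
    rw [Finset.sum_eq_single k]
    · simp [mul_comm]
    · intro j _ hj; simp [hj]
    · simp
  simp only [h2, map_smul, Finsupp.smul_apply, smul_eq_mul] at h1
  by_contra h0
  exact hi (mul_right_cancel₀ h0 h1)

end

section
variable {q : ℂ} {n : ℕ} {a : Fin n → Fin n → ℤ} {d : Fin n → ℕ}

/-- Derived combinatorial data: height function, bicharacter, finiteness. -/
structure CD (q : ℂ) {n : ℕ} (a : Fin n → Fin n → ℤ) (d : Fin n → ℕ) where
  ht : (Fin n → ℤ) →+ ℤ
  hp : ℤ
  hp_pos : 0 < hp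
  ht_rt : ∀ i, ht (rt a i) = hp
  χ : (Fin n → ℤ) → (Fin n → ℤ) → ℂ
  χ_ne : ∀ μ ν, χ μ ν ≠ 0
  χ_add_left : ∀ μ μ' ν, χ (μ + μ') ν = χ μ ν * χ μ' ν
  χ_add_right : ∀ μ ν ν', χ μ (ν + ν') = χ μ ν * χ μ ν'
  χ_rt_left : ∀ i ν, χ (rt a i) ν = q ^ (ν i * (d i : ℤ))
  χ_rt_right : ∀ i ν, χ ν (rt a i) = q ^ (ν i * (d i : ℤ))
  fin : ∀ Ω : Set (Fin n → ℤ), (∀ j μ, μ ∈ Ω → μ - μ j • rt a j ∈ Ω) → (∃ B, ∀ μ ∈ Ω, ht μ ≤ B) → ∃ B, ∀ μ ∈ Ω, B ≤ ht μ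

lemma ht_bw_of {ht : (Fin n → ℤ) →+ ℤ} {hp : ℤ} (h : ∀ i, ht (rt a i) = hp) (l : List (Fin n)) : ht (bw a l) = l.length * hp := by
  induction l with
  | nil => simp
  | cons i l ih => rw [bw_cons, map_add, h, ih]; push_cast [List.length_cons]; ring

/-- The additive functional with given coefficients. -/
def linF {n : ℕ} (y : Fin n → ℤ) : (Fin n → ℤ) →+ ℤ where
  toFun μ := ∑ j, y j * μ j
  map_zero' := by simp
  map_add' μ ν := by simp [mul_add, sum_add_distrib]

variable {U : Type} [Ring U] [Algebra ℂ U] {E F : Fin n → U} {K : Fin n → Uˣ} (hC : Cartan q a d) (hU : URel q a d E F K)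

include hC hU in
/-- The weights of a finite dimensional weight module sum to zero. -/
lemma sum_weights {M : Type*} [AddCommGroup M] [Module ℂ M] {ρ : U →ₐ[ℂ] Module.End ℂ M} {m : ℕ} {b : Module.Basis (Fin m) ℂ M} {β : Fin m → (Fin n → ℤ)}
    (hb : ∀ k, b k ∈ wsp q d K ρ (β k)) : ∑ k, β k = 0 := by
  ext i
  have h1 : LinearMap.trace ℂ M (ρ (K i : U)) = ∑ k, q ^ (β k i * (d i : ℤ)) := by
    rw [LinearMap.trace_eq_matrix_trace ℂ b, Matrix.trace]
    refine sum_congr rfl fun k _ => ?_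
    rw [Matrix.diag_apply, LinearMap.toMatrix_apply, mem_wsp.1 (hb k) i]
    simp
  have h2 : LinearMap.trace ℂ M (ρ ⇃(K i)) = ∑ k, q ^ (-(β k i * (d i : ℤ))) := by
    rw [LinearMap.trace_eq_matrix_trace ℂ b, Matrix.trace]
    refine sum_congr rfl fun k _ => ?_
    rw [Matrix.diag_apply, LinearMap.toMatrix_apply, wsp_inv hC (hb k) i]
    simp
  have h3 : LinearMap.trace ℂ M (ρ (K i : U)) = LinearMap.trace ℂ M (ρ ⇃(K i)) := by
    have := congrArg (fun u => LinearMap.trace ℂ M (ρ u)) (hU.EF i i)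
    simp only [if_true, map_sub, map_mul, map_smul, smul_eq_mul] at this
    rw [LinearMap.trace_mul_comm, sub_self] at this
    have hk : (q ^ (d i : ℤ) - q ^ (-(d i : ℤ)))⁻¹ ≠ 0 := by
      have := (hC.nru i).kap
      unfold qi at this
      rw [← zpow_neg] at this
      exact inv_ne_zero this
    exact sub_eq_zero.1 ((mul_eq_zero.1 this.symm).resolve_left hk)
  rw [h1, h2] at h3
  have h4 := tr_sum_zero hC.hq _ _ h3
  rw [← Finset.sum_mul] at h4
  have := hC.d_pos i
  simpa using (mul_eq_zero.1 h4).resolve_right (by omega)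

variable {V : (Fin n → ℕ) → Type} [∀ c, AddCommGroup (V c)] [∀ c, Module ℂ (V c)] {ρ : ∀ c, U →ₐ[ℂ] Module.End ℂ (V c)}

/-- A family of simple modules of all dominant highest weights. -/
structure Fam (q : ℂ) {n : ℕ} (d : Fin n → ℕ) {U : Type} [Ring U] [Algebra ℂ U] (E : Fin n → U) (K : Fin n → Uˣ) {V : (Fin n → ℕ) → Type} [∀ c, AddCommGroup (V c)] [∀ c, Module ℂ (V c)]
    (ρ : ∀ c, U →ₐ[ℂ] Module.End ℂ (V c)) : Prop where
  fd : ∀ c, FiniteDimensional ℂ (V c)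
  simp : ∀ c, IsSimp (ρ c)
  hw : ∀ c, ∃ v : V c, v ≠ 0 ∧ v ∈ wsp q d K (ρ c) (fun i => (c i : ℤ)) ∧ ∀ i, ρ c (E i) v = 0
  sum : ∀ c, (⨆ μ : Fin n → ℤ, wsp q d K (ρ c) μ) = ⊤

variable (hV : Fam q d E K ρ)

include hC hU hV

/-- sum of values of an additive functional over the weights -/
lemma sum_functional (φ : (Fin n → ℤ) →+ ℤ) (c : Fin n → ℕ) (hφ : ∀ i, 0 ≤ φ (rt a i)) : 0 ≤ φ (fun i => (c i : ℤ)) := by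
  have := hV.fd c
  obtain ⟨v, hv0, hv, hE⟩ := hV.hw c
  obtain ⟨m, b, β, hb⟩ := exists_wt_basis (wsp q d K (ρ c)) (hV.sum c)
  have h1 := congrArg φ (sum_weights hC hU hb)
  rw [map_sum, map_zero] at h1
  have h2 : ∀ k, φ (β k) ≤ φ (fun i => (c i : ℤ)) := by
    intro k
    obtain ⟨l, hl⟩ := hw_weights hC hU (hV.simp c) hv hE hv0 (hb k) (b.ne_zero k)
    rw [hl, map_sub]
    have : 0 ≤ φ (bw a l) := by
      induction l generalizing k with
      | nil => simp
      | cons i l ih =>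
        rw [bw_cons, map_add]
        have h3 : ∀ l : List (Fin n), 0 ≤ φ (bw a l) := by
          intro l
          induction l with
          | nil => simp
          | cons i l ih => rw [bw_cons, map_add]; exact add_nonneg (hφ i) ih
        exact add_nonneg (hφ i) (h3 l)
    linarith
  by_contra hneg
  push Not at hneg
  have hm : 0 < m := by
    rcases Nat.eq_zero_or_pos m with rfl | h
    · exfalso; apply hv0
      rw [← b.sum_repr v]; simp
    · exact h
  have h4 : ∑ k, φ (β k) < 0 := Finset.sum_neg (fun k _ => lt_of_le_of_lt (h2 k) hneg) ⟨⟨0, hm⟩, by simp⟩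
  omega

lemma det_ne : (Matrix.of a).det ≠ 0 := by
  intro h
  obtain ⟨y, hy0, hy⟩ := Matrix.exists_vecMul_eq_zero_iff.2 h
  have h1 : ∀ i, linF y (rt a i) = 0 := by
    intro i
    have := congrFun hy i
    simpa [Matrix.vecMul, dotProduct, linF, rt] using this
  apply hy0
  ext j
  have e : linF y (fun i => ((Pi.single j 1 : Fin n → ℕ) i : ℤ)) = y j := by
    simp [linF, Pi.single_apply]
  have h2 := sum_functional hC hU hV (linF y) (Pi.single j 1) (fun i => (h1 i).ge)
  have h3 := sum_functional hC hU hV (-linF y) (Pi.single j 1) (fun i => by simp [h1 i])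
  rw [AddMonoidHom.neg_apply, e] at h3
  rw [e] at h2
  simp; omega

omit hU in
/-- Finitely many weights. -/
lemma fin_weights (c : Fin n → ℕ) : {μ : Fin n → ℤ | wsp q d K (ρ c) μ ≠ ⊥}.Finite := by
  have := hV.fd c
  obtain ⟨m, b, β, hb⟩ := exists_wt_basis (wsp q d K (ρ c)) (hV.sum c)
  refine (Set.finite_range β).subset fun μ hμ => ?_
  obtain ⟨x, hx, hx0⟩ := Submodule.exists_mem_ne_zero_of_ne_bot hμ
  by_contra hcon
  apply hx0
  rw [← b.sum_repr x]
  refine sum_eq_zero fun k _ => ?_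
  rw [repr_wt hC hb hx k (fun h => hcon ⟨k, h⟩), zero_smul]

omit hC hU hV in
/-- Nilpotency of an operator shifting weights in a nonzero direction. -/
lemma nilp_of_fin {M : Type*} [AddCommGroup M] [Module ℂ M] (w : (Fin n → ℤ) → Submodule ℂ M) (hfin : {μ | w μ ≠ ⊥}.Finite) (hsum : (⨆ μ, w μ) = ⊤) (T : Module.End ℂ M) (α : Fin n → ℤ)
    (hα : α ≠ 0) (hT : ∀ μ x, x ∈ w μ → T x ∈ w (μ + α)) (x : M) : ∃ k, (T ^ k) x = 0 := by
  have hx : x ∈ ⨆ μ, w μ := by rw [hsum]; trivial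
  have hpow : ∀ μ y, y ∈ w μ → ∀ k : ℕ, (T ^ k) y ∈ w (μ + (k : ℤ) • α) := by
    intro μ y hy k
    induction k with
    | zero => simpa using hy
    | succ k ih =>
      rw [pow_succ', mul_apply]
      have := hT _ _ ih
      convert this using 2
      rw [Nat.cast_succ, add_smul, one_smul]; abel
  induction hx using Submodule.iSup_induction' with
  | mem μ y hy =>
    by_contra hcon
    push Not at hcon
    have : Set.Infinite {μ | w μ ≠ ⊥} := by
      refine Set.infinite_of_injective_forall_mem (f := fun k : ℕ => μ + (k : ℤ) • α) ?_ ?_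
      · intro k l h
        have h1 := add_left_cancel h
        have := smul_left_injective ℤ hα h1
        exact_mod_cast this
      · intro k h
        have := hpow μ y hy k
        rw [h] at this
        exact hcon k this
    exact this hfin
  | zero => exact ⟨0, by simp⟩
  | add y z _ _ h1 h2 =>
    obtain ⟨k, hk⟩ := h1
    obtain ⟨l, hl⟩ := h2
    refine ⟨k + l, ?_⟩
    rw [map_add]
    nth_rewrite 1 [add_comm k l]
    rw [pow_add, pow_add, mul_apply, mul_apply, hk, hl]; simp

omit hU hV in
lemma rt_ne (i : Fin n) : rt a i ≠ 0 := fun h => by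
  have := congrFun h i
  simp [rt, hC.diag] at this

theorem exists_CD : Nonempty (CD q a d) := by
  have hdet := det_ne hC hU hV
  set D := (Matrix.of a).det with hD
  let h : Fin n → ℤ := fun j => D * ∑ k, (Matrix.of a).adjugate k j
  have hht : ∀ i, linF h (rt a i) = D * D := by
    intro i
    simp only [linF, AddMonoidHom.coe_mk, ZeroHom.coe_mk, rt, h]
    have e : ∀ k, ∑ j, (Matrix.of a).adjugate k j * a j i = if k = i then D else 0 := by
      intro k
      have := congrFun (congrFun (Matrix.adjugate_mul (Matrix.of a)) k) i
      simpa [Matrix.mul_apply, Matrix.one_apply, Matrix.smul_apply] using this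
    calc ∑ j, D * (∑ k, (Matrix.of a).adjugate k j) * a j i
        = D * ∑ k, ∑ j, (Matrix.of a).adjugate k j * a j i := by
          rw [Finset.sum_comm, Finset.mul_sum]
          exact sum_congr rfl fun j _ => by rw [mul_assoc, Finset.sum_mul]
      _ = D * D := by simp [e]
  have hDD : 0 < D * D := mul_self_pos.2 hdet
  -- the bicharacter
  obtain ⟨s, hs0, hs⟩ : ∃ s : ℂ, s ≠ 0 ∧ s ^ D = q := by
    obtain ⟨w, hw⟩ := IsAlgClosed.exists_pow_nat_eq q (Int.natAbs_pos.2 hdet)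
    have hw0 : w ≠ 0 := by
      rintro rfl
      rw [zero_pow (by simpa using hdet)] at hw
      exact hC.q0 hw.symm
    rcases Int.natAbs_eq D with h' | h'
    · exact ⟨w, hw0, by rw [h', zpow_natCast, hw]⟩
    · exact ⟨w⁻¹, inv_ne_zero hw0, by rw [h', inv_zpow, zpow_neg, zpow_natCast, hw, inv_inv]⟩
  let X : Matrix (Fin n) (Fin n) ℤ := (Matrix.of a).transpose.adjugate * Matrix.diagonal (fun i => (d i : ℤ))
  let B : (Fin n → ℤ) → (Fin n → ℤ) → ℤ := fun μ ν => dotProduct μ (X.mulVec ν)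
  have hrtM : ∀ i, rt a i = (Matrix.of a).mulVec (Pi.single i 1) := by
    intro i; ext j; simp [rt]
  have hX1 : (Matrix.of a).transpose * X = D • Matrix.diagonal (fun i => (d i : ℤ)) := by
    rw [← Matrix.mul_assoc, Matrix.mul_adjugate, Matrix.det_transpose, Matrix.smul_mul, Matrix.one_mul]
  have hsym : Matrix.diagonal (fun i => (d i : ℤ)) * Matrix.of a
      = (Matrix.of a).transpose * Matrix.diagonal (fun i => (d i : ℤ)) := by
    ext i j
    rw [Matrix.diagonal_mul, Matrix.mul_diagonal]
    simp only [Matrix.of_apply, Matrix.transpose_apply]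
    rw [hC.symm, mul_comm]
  have hX2 : X * Matrix.of a = D • Matrix.diagonal (fun i => (d i : ℤ)) := by
    rw [Matrix.mul_assoc, hsym, ← Matrix.mul_assoc, Matrix.adjugate_mul, Matrix.det_transpose, Matrix.smul_mul, Matrix.one_mul]
  have hB1 : ∀ i ν, B (rt a i) ν = D * (ν i * (d i : ℤ)) := by
    intro i ν
    simp only [B]
    rw [hrtM, ← Matrix.vecMul_transpose, ← Matrix.dotProduct_mulVec, Matrix.mulVec_mulVec, hX1, single_one_dotProduct, Matrix.smul_mulVec, Pi.smul_apply, Matrix.mulVec_diagonal, smul_eq_mul,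
      mul_comm (ν i)]
  have hB2 : ∀ i ν, B ν (rt a i) = D * (ν i * (d i : ℤ)) := by
    intro i ν
    simp only [B]
    rw [hrtM, Matrix.mulVec_mulVec, hX2, Matrix.smul_mulVec, dotProduct_smul, smul_eq_mul]
    congr 1
    simp [dotProduct, Matrix.mulVec_diagonal, Pi.single_apply]
  -- heights of fundamental weights
  have hpos : ∀ j, 0 < linF h (fun i => ((Pi.single j 1 : Fin n → ℕ) i : ℤ)) := by
    intro j
    set c : Fin n → ℕ := Pi.single j 1
    have h0 := sum_functional hC hU hV (linF h) c (fun i => by rw [hht]; exact hDD.le)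
    refine lt_of_le_of_ne h0 fun h00 => ?_
    have := hV.fd c
    obtain ⟨v, hv0, hv, hE⟩ := hV.hw c
    obtain ⟨m, b, β, hb⟩ := exists_wt_basis (wsp q d K (ρ c)) (hV.sum c)
    have h1 := congrArg (linF h) (sum_weights hC hU hb)
    rw [map_sum, map_zero] at h1
    have h2 : ∀ k, ∃ l : List (Fin n), β k = (fun i => (c i : ℤ)) - bw a l := fun k =>
      hw_weights hC hU (hV.simp c) hv hE hv0 (hb k) (b.ne_zero k)
    choose l hl using h2
    have h3 : ∀ k, linF h (β k) = -((l k).length * (D * D)) := fun k => by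
      rw [hl, map_sub, ← h00, ht_bw_of hht, zero_sub]
    have h4 : ∀ k, linF h (β k) = 0 := by
      have : ∀ k ∈ Finset.univ, linF h (β k) ≤ 0 := fun k _ => by
        rw [h3]; have : 0 ≤ ((l k).length : ℤ) * (D * D) := by positivity
        omega
      intro k
      exact (Finset.sum_eq_zero_iff_of_nonpos this).1 h1 k (Finset.mem_univ k)
    have h5 : ∀ k, β k = fun i => (c i : ℤ) := by
      intro k
      have h6 := h4 k
      rw [h3] at h6
      have h7 : (l k).length = 0 := by
        have := mul_eq_zero.1 (neg_eq_zero.1 h6)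
        have := this.resolve_right hDD.ne'
        exact_mod_cast this
      rw [hl, List.length_eq_zero_iff.1 h7]; simp
    have hFv : ρ c (F j) v = 0 := by
      have hFm : ρ c (F j) v ∈ wsp q d K (ρ c) _ := (repWM hC hU (ρ c)).F_mem j _ _ hv
      rw [← b.sum_repr (ρ c (F j) v)]
      refine sum_eq_zero fun k _ => ?_
      rw [repr_wt hC hb hFm k, zero_smul]
      rw [h5]
      intro h
      exact rt_ne hC j (sub_eq_self.1 h.symm)
    obtain ⟨m, hm, hm1, -⟩ := WM.dominant (W := repWM hC hU (ρ c)) hC.nru hC.diag (i := j) hv (hE j) hv0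
      ⟨1, by simpa using hFv⟩
    have hm2 : m = 1 := by simpa [c] using hm.symm
    exact hm1 1 (by omega) (by simpa using hFv)
  -- weights of V c are stable under reflections
  have hrefl : ∀ c j μ, wsp q d K (ρ c) μ ≠ ⊥ → wsp q d K (ρ c) (μ - μ j • rt a j) ≠ ⊥ := by
    intro c j μ hμ
    obtain ⟨x, hx, hx0⟩ := Submodule.exists_mem_ne_zero_of_ne_bot hμ
    obtain ⟨y, hy, -, hy0⟩ := WM.refl (W := repWM hC hU (ρ c)) hC.nru hC.diag (i := j) (N := ⊤)
      (fun _ _ => trivial) (fun _ _ => trivial)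
      (fun x _ => nilp_of_fin _ (fin_weights hC hV c) (hV.sum c) _ _ (rt_ne hC j)
        (fun μ x hx => (repWM hC hU (ρ c)).E_mem j μ x hx) x)
      (fun x _ => nilp_of_fin _ (fin_weights hC hV c) (hV.sum c) _ _ (neg_ne_zero.2 (rt_ne hC j))
        (fun μ x hx => by
          rw [← sub_eq_add_neg]; exact (repWM hC hU (ρ c)).F_mem j μ x hx) x)
      hx trivial hx0
    intro h
    have : y ∈ wsp q d K (ρ c) (μ - μ j • rt a j) := hy
    rw [h] at this
    exact hy0 this
  refine ⟨⟨linF h, D * D, hDD, hht, fun μ ν => s ^ B μ ν, fun μ ν => zpow_ne_zero _ hs0, fun μ μ' ν => ?_, fun μ ν ν' => ?_, fun i ν => ?_, fun i ν => ?_, ?_⟩⟩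
  · rw [← zpow_add₀ hs0]; simp only [B]; rw [add_dotProduct]
  · rw [← zpow_add₀ hs0]; simp only [B]; rw [Matrix.mulVec_add, dotProduct_add]
  · rw [hB1, zpow_mul, hs]
  · rw [hB2, zpow_mul, hs]
  · rintro Ω hΩ ⟨B0, hB0⟩
    have key : ∀ N : ℕ, ∀ μ ∈ Ω, (B0 - linF h μ).toNat < N → ∃ c : Fin n → ℕ, linF h (fun i => (c i : ℤ)) ≤ B0 ∧ wsp q d K (ρ c) μ ≠ ⊥ := by
      intro N
      induction N with
      | zero => intro μ hμ hN; omega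
      | succ N ih =>
        intro μ hμ hN
        by_cases hdom : ∀ j, 0 ≤ μ j
        · have e : (fun i => (((fun i => (μ i).toNat) i : ℕ) : ℤ)) = μ := by
            ext i; simp [hdom i]
          refine ⟨fun i => (μ i).toNat, by rw [e]; exact hB0 μ hμ, ?_⟩
          obtain ⟨v, hv0, hv, -⟩ := hV.hw (fun i => (μ i).toNat)
          rw [e] at hv
          intro h
          rw [h] at hv
          exact hv0 hv
        · push Not at hdom
          obtain ⟨j, hj⟩ := hdom
          have h1 := hΩ j μ hμ
          have h2 : linF h (μ - μ j • rt a j) = linF h μ - μ j * (D * D) := by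
            rw [map_sub, map_zsmul, hht, smul_eq_mul]
          have h3 := hB0 _ h1
          have h4 : 0 < (-μ j) * (D * D) := mul_pos (by omega) hDD
          obtain ⟨c, hc, hc'⟩ := ih _ h1 (by rw [h2] at h3 ⊢; rw [neg_mul] at h4; omega)
          refine ⟨c, hc, ?_⟩
          have h5 := hrefl c j _ hc'
          have e : μ - μ j • rt a j - (μ - μ j • rt a j) j • rt a j = μ := by
            have : (μ - μ j • rt a j) j = - μ j := by
              simp [rt, hC.diag]; ring
            rw [this]; simp
          rwa [e] at h5
    have hfin : {c : Fin n → ℕ | linF h (fun i => (c i : ℤ)) ≤ B0}.Finite := by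
      refine (Set.Finite.pi' (fun _ : Fin n => Set.finite_Iic B0.toNat)).subset ?_
      intro c hc j
      have hhp : ∀ j, 0 < h j := by
        intro j
        have := hpos j
        simpa [linF, Pi.single_apply] using this
      have h1 : h j * (c j : ℤ) ≤ linF h (fun i => (c i : ℤ)) := by
        simp only [linF, AddMonoidHom.coe_mk, ZeroHom.coe_mk]
        exact Finset.single_le_sum (f := fun j => h j * (c j : ℤ))
          (fun i _ => mul_nonneg (hhp i).le (by positivity)) (Finset.mem_univ j)
      have h2 : (c j : ℤ) ≤ h j * (c j : ℤ) := by
        have := hhp j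
        nlinarith [Int.natCast_nonneg (c j)]
      have h3 : linF h (fun i => (c i : ℤ)) ≤ B0 := hc
      change c j ≤ B0.toNat
      omega
    have hfin2 : (⋃ c ∈ {c : Fin n → ℕ | linF h (fun i => (c i : ℤ)) ≤ B0}, {μ : Fin n → ℤ | wsp q d K (ρ c) μ ≠ ⊥}).Finite := hfin.biUnion fun c _ => fin_weights hC hV c
    obtain ⟨B1, hB1⟩ := (hfin2.image (linF h)).bddBelow
    refine ⟨B1, fun μ hμ => hB1 ⟨μ, ?_, rfl⟩⟩
    obtain ⟨c, hc, hc'⟩ := key _ μ hμ (Nat.lt_succ_self _)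
    exact Set.mem_biUnion hc hc'
end

/-! ## Words, the bilinear form `G` and its generalised inverse -/

section

variable {n : ℕ}

/-- Linear combinations of words. -/
abbrev Wd (n : ℕ) := List (Fin n) →₀ ℂ

/-- a word as an element -/
noncomputable abbrev sg (l : List (Fin n)) : Wd n := Finsupp.single l 1

/-- prepend a letter -/
noncomputable def cn (j : Fin n) : Wd n →ₗ[ℂ] Wd n := Finsupp.lmapDomain ℂ ℂ (fun l => j :: l)
/-- append a letter -/
noncomputable def sn (j : Fin n) : Wd n →ₗ[ℂ] Wd n := Finsupp.lmapDomain ℂ ℂ (fun l => l ++ [j])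

@[simp] lemma cn_sg (j : Fin n) (l : List (Fin n)) : cn j (sg l) = sg (j :: l) := by simp [cn]
@[simp] lemma sn_sg (j : Fin n) (l : List (Fin n)) : sn j (sg l) = sg (l ++ [j]) := by simp [sn]

/-- evaluation of words -/
noncomputable def wev {B : Type*} [Ring B] [Algebra ℂ B] (f : Fin n → B) : Wd n →ₗ[ℂ] B :=
  Finsupp.linearCombination ℂ (fun l => (l.map f).prod)

@[simp] lemma wev_sg {B : Type*} [Ring B] [Algebra ℂ B] (f : Fin n → B) (l : List (Fin n)) : wev f (sg l) = (l.map f).prod := by simp [wev]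

lemma wd_ext {X : Type*} [AddCommGroup X] [Module ℂ X] {f g : Wd n →ₗ[ℂ] X} (h : ∀ l, f (sg l) = g (sg l)) : f = g := by
  ext l; simpa using h l

lemma wev_cn {B : Type*} [Ring B] [Algebra ℂ B] (f : Fin n → B) (j : Fin n) (u : Wd n) : wev f (cn j u) = f j * wev f u := by
  have : (wev f).comp (cn j) = (LinearMap.mulLeft ℂ (f j)).comp (wev f) := wd_ext fun l => by simp
  exact congrArg (fun g : Wd n →ₗ[ℂ] B => g u) this

lemma wev_sn {B : Type*} [Ring B] [Algebra ℂ B] (f : Fin n → B) (j : Fin n) (u : Wd n) : wev f (sn j u) = wev f u * f j := by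
  have : (wev f).comp (sn j) = (LinearMap.mulRight ℂ (f j)).comp (wev f) := wd_ext fun l => by simp
  exact congrArg (fun g : Wd n →ₗ[ℂ] B => g u) this

/-- integral multidegree of a word -/
def deg (l : List (Fin n)) : Fin n → ℤ := (l.map fun j => Pi.single j 1).sum

@[simp] lemma deg_nil : deg ([] : List (Fin n)) = 0 := rfl
@[simp] lemma deg_cons (j : Fin n) (l : List (Fin n)) : deg (j :: l) = Pi.single j 1 + deg l := by
  simp [deg]
@[simp] lemma deg_append (l l' : List (Fin n)) : deg (l ++ l') = deg l + deg l' := by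
  simp [deg]

lemma bw_deg (a : Fin n → Fin n → ℤ) (l : List (Fin n)) : bw a l = ∑ j, deg l j • rt a j := by
  induction l with
  | nil => simp
  | cons i l ih =>
    rw [bw_cons, ih, deg_cons]
    simp [add_smul, sum_add_distrib, Pi.single_apply]

lemma length_deg (l : List (Fin n)) : (l.length : ℤ) = ∑ j, deg l j := by
  induction l with
  | nil => simp
  | cons i l ih =>
    simp only [List.length_cons, Nat.cast_add, Nat.cast_one, ih, deg_cons, Pi.add_apply, sum_add_distrib]
    simp [add_comm]

/-- homogeneous elements -/
noncomputable def Wt (c : Fin n → ℤ) : Submodule ℂ (Wd n) := Finsupp.supported ℂ ℂ {l | deg l = c}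

lemma sg_mem (l : List (Fin n)) : sg l ∈ Wt (deg l) := by
  simp [Wt, Finsupp.mem_supported]

lemma Wt_induct {c : Fin n → ℤ} {p : Wd n → Prop} (h0 : p 0) (hadd : ∀ u v, p u → p v → p (u + v)) (hs : ∀ (x : ℂ) u, p u → p (x • u)) (hw : ∀ l, deg l = c → p (sg l)) {u : Wd n} (hu : u ∈ Wt c) :
    p u := by
  rw [Wt, Finsupp.supported_eq_span_single] at hu
  induction hu using span_induction with
  | mem x hx => obtain ⟨l, hl, rfl⟩ := hx; exact hw l hl
  | zero => exact h0
  | add u v _ _ h1 h2 => exact hadd u v h1 h2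
  | smul c u _ h => exact hs c u h

lemma Wt_map {c c' : Fin n → ℤ} (f : Wd n →ₗ[ℂ] Wd n) (h : ∀ l, deg l = c → f (sg l) ∈ Wt c') {u : Wd n} (hu : u ∈ Wt c) : f u ∈ Wt c' :=
  Wt_induct (p := fun u => f u ∈ Wt c') (by simp) (fun u v h1 h2 => by rw [map_add]; exact add_mem h1 h2)
    (fun x u h1 => by rw [map_smul]; exact smul_mem _ _ h1) h hu

lemma cn_mem (j : Fin n) {c : Fin n → ℤ} {u : Wd n} (hu : u ∈ Wt c) : cn j u ∈ Wt (Pi.single j 1 + c) :=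
  Wt_map _ (fun l hl => by rw [cn_sg, ← hl, ← deg_cons]; exact sg_mem _) hu

variable (q : ℂ) (a : Fin n → Fin n → ℤ) (d : Fin n → ℕ)

/-- `1/(q_i - q_i⁻¹)` -/
noncomputable def kin (i : Fin n) : ℂ := (q ^ (d i : ℤ) - q ^ (-(d i : ℤ)))⁻¹

/-- left skew derivation on words -/
noncomputable def lrw (i : Fin n) : List (Fin n) → Wd n
  | [] => 0
  | j :: l => (if i = j then kin q d i • sg l else 0) + q ^ (-((d i : ℤ) * a i j)) • cn j (lrw i l)

/-- right skew derivation on words -/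
noncomputable def rrw (i : Fin n) : List (Fin n) → Wd n
  | [] => 0
  | j :: l => (if i = j then (kin q d i * q ^ (-((d i : ℤ) * bw a l i))) • sg l else 0) + cn j (rrw i l)

/-- left skew derivation -/
noncomputable def lr (i : Fin n) : Wd n →ₗ[ℂ] Wd n := Finsupp.linearCombination ℂ (lrw q a d i)
/-- right skew derivation -/
noncomputable def rr (i : Fin n) : Wd n →ₗ[ℂ] Wd n := Finsupp.linearCombination ℂ (rrw q a d i)

@[simp] lemma lr_nil (i : Fin n) : lr q a d i (sg []) = 0 := by simp [lr, lrw]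
@[simp] lemma rr_nil (i : Fin n) : rr q a d i (sg []) = 0 := by simp [rr, rrw]
lemma lr_sg_cons (i j : Fin n) (l : List (Fin n)) : lr q a d i (sg (j :: l)) = (if i = j then kin q d i • sg l else 0) + q ^ (-((d i : ℤ) * a i j)) • cn j (lr q a d i (sg l)) := by
  simp [lr, lrw]
lemma rr_sg_cons (i j : Fin n) (l : List (Fin n)) : rr q a d i (sg (j :: l)) = (if i = j then (kin q d i * q ^ (-((d i : ℤ) * bw a l i))) • sg l else 0) + cn j (rr q a d i (sg l)) := by
  simp [rr, rrw]

lemma lr_mem (i : Fin n) {c : Fin n → ℤ} {u : Wd n} (hu : u ∈ Wt c) : lr q a d i u ∈ Wt (c - Pi.single i 1) := by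
  refine Wt_map _ (fun l hl => ?_) hu
  clear hu
  subst hl
  induction l with
  | nil => simp
  | cons j l ih =>
    rw [lr_sg_cons, deg_cons]
    refine add_mem ?_ (smul_mem _ _ ?_)
    · split_ifs with h
      · subst h
        rw [add_sub_cancel_left]
        exact smul_mem _ _ (sg_mem l)
      · simp
    · have := cn_mem j ih
      rwa [← add_sub_assoc] at this

lemma rr_mem (i : Fin n) {c : Fin n → ℤ} {u : Wd n} (hu : u ∈ Wt c) : rr q a d i u ∈ Wt (c - Pi.single i 1) := by
  refine Wt_map _ (fun l hl => ?_) hu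
  clear hu
  subst hl
  induction l with
  | nil => simp
  | cons j l ih =>
    rw [rr_sg_cons, deg_cons]
    refine add_mem ?_ ?_
    · split_ifs with h
      · subst h
        rw [add_sub_cancel_left]
        exact smul_mem _ _ (sg_mem l)
      · simp
    · have := cn_mem j ih
      rwa [← add_sub_assoc] at this

lemma lr_cn (i j : Fin n) (u : Wd n) : lr q a d i (cn j u) = (if i = j then kin q d i • u else 0) + q ^ (-((d i : ℤ) * a i j)) • cn j (lr q a d i u) := by
  have : (lr q a d i).comp (cn j) = (if i = j then kin q d i • LinearMap.id else 0) + q ^ (-((d i : ℤ) * a i j)) • (cn j).comp (lr q a d i) := wd_ext fun l => by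
    simp only [LinearMap.comp_apply, cn_sg, lr_sg_cons, LinearMap.add_apply, LinearMap.smul_apply]
    split_ifs <;> simp
  have h2 := congrArg (fun g : Wd n →ₗ[ℂ] Wd n => g u) this
  simp only [LinearMap.comp_apply, LinearMap.add_apply, LinearMap.smul_apply] at h2
  rw [h2]; split_ifs <;> simp

/-- weight in `P` of a multidegree -/
def degw (c : Fin n → ℤ) : Fin n → ℤ := ∑ j, c j • rt a j

lemma rr_cn (i j : Fin n) {c : Fin n → ℤ} {u : Wd n} (hu : u ∈ Wt c) : rr q a d i (cn j u) = (if i = j then (kin q d i * q ^ (-((d i : ℤ) * degw a c i))) • u else 0) + cn j (rr q a d i u) := by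
  refine Wt_induct (p := fun u => rr q a d i (cn j u) = (if i = j then (kin q d i * q ^ (-((d i : ℤ) * degw a c i))) • u else 0) +
      cn j (rr q a d i u)) (by simp) (fun u v h1 h2 => ?_) (fun x u h1 => ?_) (fun l hl => ?_) hu
  · simp only [map_add, h1, h2]; split_ifs <;> (try simp only [smul_add]) <;> abel
  · simp only [map_smul, h1]; split_ifs
    · rw [smul_add, smul_comm]
    · rw [smul_add, smul_zero]
  · rw [cn_sg, rr_sg_cons, bw_deg, hl]; rfl

lemma degw_sub (c : Fin n → ℤ) (j i : Fin n) : degw a (c - Pi.single j 1) i = degw a c i - a i j := by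
  simp only [degw, Finset.sum_apply, Pi.smul_apply, Pi.sub_apply, sub_smul, sum_sub_distrib, smul_eq_mul, rt]
  congr 1
  rw [Finset.sum_eq_single j] <;> simp +contextual [Pi.single_apply]

variable {q a d}

lemma lr_rr_comm (hC : Cartan q a d) (i j : Fin n) (u : Wd n) : lr q a d j (rr q a d i u) = rr q a d i (lr q a d j u) := by
  have : (lr q a d j).comp (rr q a d i) = (rr q a d i).comp (lr q a d j) := wd_ext fun l => by
    simp only [LinearMap.comp_apply]
    induction l with
    | nil => simp
    | cons k l ih =>
      rw [rr_sg_cons, lr_sg_cons, map_add, map_add, lr_cn, ih, map_smul, rr_cn q a d i k (lr_mem q a d j (sg_mem l))]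
      by_cases hik : i = k
      · subst hik
        simp only [if_true, map_smul, degw_sub]
        have e : q ^ (-((d j : ℤ) * a j i)) * (kin q d i * q ^ (-((d i : ℤ) * (degw a (deg l) i - a i j))))
            = kin q d i * q ^ (-((d i : ℤ) * bw a l i)) := by
          rw [mul_left_comm, ← zpow_add₀ hC.q0, bw_deg, hC.symm j i]
          congr 2; simp only [degw]; ring
        rw [smul_add, smul_smul, e]
        split_ifs <;> simp only [map_smul, map_zero] <;> abel
      · simp only [if_neg hik, map_zero, zero_add]
        split_ifs <;> simp only [map_smul, map_zero, map_add, zero_add, cn_sg]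
  exact congrArg (fun g : Wd n →ₗ[ℂ] Wd n => g u) this

variable (q a d)

/-- the bilinear form, first argument a word -/
noncomputable def Gw : List (Fin n) → (Wd n →ₗ[ℂ] ℂ)
  | [] => Finsupp.lapply []
  | i :: x => (Gw x).comp (lr q a d i)

/-- the bilinear form -/
noncomputable def Gf : Wd n →ₗ[ℂ] Wd n →ₗ[ℂ] ℂ := Finsupp.linearCombination ℂ (Gw q a d)

@[simp] lemma Gf_sg (x : List (Fin n)) : Gf q a d (sg x) = Gw q a d x := by simp [Gf]

lemma Gw_deg (x : List (Fin n)) {c : Fin n → ℤ} {u : Wd n} (hu : u ∈ Wt c) (hc : deg x ≠ c) : Gw q a d x u = 0 := by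
  induction x generalizing c u with
  | nil =>
    simp only [Gw, Finsupp.lapply_apply]
    rw [Wt, Finsupp.mem_supported'] at hu
    exact hu [] hc
  | cons i x ih =>
    simp only [Gw, LinearMap.comp_apply]
    refine ih (lr_mem q a d i hu) fun h => hc ?_
    rw [deg_cons, h]; abel

lemma Gf_cn_left (i : Fin n) (u v : Wd n) : Gf q a d (cn i u) v = Gf q a d u (lr q a d i v) := by
  have : (Gf q a d).comp (cn i) = (LinearMap.lcomp ℂ ℂ (lr q a d i)).comp (Gf q a d) := wd_ext fun l => by
      simp only [LinearMap.comp_apply, cn_sg, Gf_sg]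
      rfl
  exact congrArg (fun g : Wd n →ₗ[ℂ] Wd n →ₗ[ℂ] ℂ => g u v) this

lemma cn_nil (j : Fin n) (v : Wd n) : cn j v [] = 0 := by
  rw [cn, Finsupp.lmapDomain_apply]
  exact Finsupp.mapDomain_of_notMem_range _ _ (by simp)

variable {q a d}

lemma Gf_cn_right (hC : Cartan q a d) (j : Fin n) (u v : Wd n) : Gf q a d u (cn j v) = Gf q a d (lr q a d j u) v := by
  have key : ∀ (l : List (Fin n)) (v : Wd n), Gf q a d (sg l) (cn j v) = Gf q a d (lr q a d j (sg l)) v := by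
    intro l
    induction l with
    | nil => intro v; simp [Gw, cn_nil]
    | cons i l ih =>
      intro v
      rw [← cn_sg, Gf_cn_left, lr_cn, lr_cn, map_add, map_add, LinearMap.add_apply, map_smul, map_smul, ih, LinearMap.smul_apply, Gf_cn_left, hC.symm i j]
      congr 1
      by_cases h : i = j
      · subst h; simp only [if_true, map_smul, LinearMap.smul_apply]
      · simp [h, Ne.symm h]
  have : (LinearMap.lcomp ℂ ℂ (cn j)).comp (Gf q a d) = (Gf q a d).comp (lr q a d j) := wd_ext fun l => by
      refine LinearMap.ext fun v => ?_
      exact key l v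
  exact congrArg (fun g : Wd n →ₗ[ℂ] Wd n →ₗ[ℂ] ℂ => g u v) this

lemma Gf_symm (hC : Cartan q a d) (u v : Wd n) : Gf q a d u v = Gf q a d v u := by
  have key : ∀ (l : List (Fin n)) (v : Wd n), Gf q a d (sg l) v = Gf q a d v (sg l) := by
    intro l
    induction l with
    | nil =>
      intro v
      have : Gf q a d (sg []) = (Gf q a d).flip (sg []) := wd_ext fun y => by
        cases y with
        | nil => simp
        | cons j y => rw [LinearMap.flip_apply, ← cn_sg, Gf_cn_left]; simp [Gw, cn_nil]
      exact congrArg (fun g : Wd n →ₗ[ℂ] ℂ => g v) this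
    | cons i l ih =>
      intro v
      rw [← cn_sg, Gf_cn_left, ih, Gf_cn_right hC]
  have : Gf q a d = (Gf q a d).flip := wd_ext fun l => LinearMap.ext fun v => key l v
  exact congrArg (fun g : Wd n →ₗ[ℂ] Wd n →ₗ[ℂ] ℂ => g u v) this

lemma Gf_sn_left (hC : Cartan q a d) (i : Fin n) (u v : Wd n) : Gf q a d (sn i u) v = Gf q a d u (rr q a d i v) := by
  have key : ∀ (l : List (Fin n)) (v : Wd n), Gf q a d (sn i (sg l)) v = Gf q a d (sg l) (rr q a d i v) := by
    intro l
    induction l with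
    | nil =>
      intro v
      have : Gf q a d (sn i (sg [])) = (Gf q a d (sg [])).comp (rr q a d i) := wd_ext fun y => by
        cases y with
        | nil => simp [Gw]
        | cons j y =>
          rw [sn_sg, List.nil_append, ← cn_sg, Gf_cn_left, LinearMap.comp_apply, lr_sg_cons, rr_sg_cons]
          cases y with
          | nil => simp [Gw]
          | cons k y => simp [Gw, cn_nil]; split_ifs <;> simp
      exact congrArg (fun g : Wd n →ₗ[ℂ] ℂ => g v) this
    | cons j l ih =>
      intro v
      have e : sn i (sg (j :: l)) = cn j (sn i (sg l)) := by simp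
      rw [e, Gf_cn_left, ih, ← lr_rr_comm hC, ← cn_sg, Gf_cn_left]
  have : (Gf q a d).comp (sn i) = (LinearMap.lcomp ℂ ℂ (rr q a d i)).comp (Gf q a d) := wd_ext fun l => LinearMap.ext fun v => key l v
  exact congrArg (fun g : Wd n →ₗ[ℂ] Wd n →ₗ[ℂ] ℂ => g u v) this

lemma Gf_sn_right (hC : Cartan q a d) (i : Fin n) (u v : Wd n) : Gf q a d u (sn i v) = Gf q a d (rr q a d i u) v := by
  rw [Gf_symm hC, Gf_sn_left hC, Gf_symm hC]

end

section
variable {q : ℂ} {n : ℕ} {a : Fin n → Fin n → ℤ} {d : Fin n → ℕ}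
variable {U : Type} [Ring U] [Algebra ℂ U] {E F : Fin n → U} {K : Fin n → Uˣ}

/-! ## Simple representations, radical, dual bases -/

section

lemma smul_flip {B : Type*} [Ring B] [Algebra ℂ B] {x y : B} {s : ℂ} (hs : s ≠ 0) (h : x = s • y) : y = s⁻¹ • x := by rw [h, smul_smul, inv_mul_cancel₀ hs, one_smul]

lemma inv_comm_of {B : Type*} [Ring B] [Algebra ℂ B] {k : Bˣ} {x : B} {s : ℂ} (hs : s ≠ 0) (h : (k : B) * x = s • (x * (k : B))) : ((k⁻¹ : Bˣ) : B) * x = s⁻¹ • (x * ((k⁻¹ : Bˣ) : B)) := by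
  have h1 : x * (k : B) = s⁻¹ • ((k : B) * x) := smul_flip hs h
  have h2 : ((k⁻¹ : Bˣ) : B) * (x * (k : B)) * ((k⁻¹ : Bˣ) : B) = ((k⁻¹ : Bˣ) : B) * (s⁻¹ • ((k : B) * x)) * ((k⁻¹ : Bˣ) : B) := by rw [h1]
  simpa [mul_assoc] using h2

/-- exchanging the roles of `E` and `F` -/
lemma URel.op (hC : Cartan q a d) (hU : URel q a d E F K) : URel q a d F E (fun i => (K i)⁻¹) where
  KK i j := by
    have : K i * K j = K j * K i := Units.ext (hU.KK i j)
    have h2 : (K i)⁻¹ * (K j)⁻¹ = (K j)⁻¹ * (K i)⁻¹ := by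
      rw [← mul_inv_rev, ← mul_inv_rev, this]
    exact congrArg Units.val h2
  KE i j := by
    have := inv_comm_of (zpow_ne_zero _ hC.q0) (hU.KF i j)
    rwa [← zpow_neg, neg_neg] at this
  KF i j := by
    have := inv_comm_of (zpow_ne_zero _ hC.q0) (hU.KE i j)
    rwa [← zpow_neg] at this
  EF i j := by
    have := hU.EF j i
    rw [← neg_sub, this]
    by_cases h : i = j
    · subst h; simp only [if_true, inv_inv, ← smul_neg, neg_sub]
    · simp [h, Ne.symm h]
  gen S h1 h2 h3 h4 := hU.gen S h2 h1 (fun i => by simpa using h4 i) h3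

/-- The commutator of `E_i` with a word in the `F`'s. -/
lemma URel.commF (hC : Cartan q a d) (hU : URel q a d E F K) (i : Fin n) (u : Wd n) : E i * wev F u - wev F u * E i = wev F (rr q a d i u) * (K i : U) - ⇃(K i) * wev F (lr q a d i u) := by
  have key : ∀ l : List (Fin n), (K i : U) * wev F (sg l) = q ^ (-((d i : ℤ) * bw a l i)) • (wev F (sg l) * (K i : U)) := by
    intro l
    induction l with
    | nil => simp
    | cons j l ih =>
      rw [← cn_sg, wev_cn, ← mul_assoc, hU.KF, smul_mul_assoc, mul_assoc, ih, mul_smul_comm, smul_smul, ← zpow_add₀ hC.q0, mul_assoc, bw_cons]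
      congr 2
      simp [rt]; ring
  have : (LinearMap.mulLeft ℂ (E i)).comp (wev F) - (LinearMap.mulRight ℂ (E i)).comp (wev F) = ((LinearMap.mulRight ℂ (K i : U)).comp (wev F)).comp (rr q a d i) -
      ((LinearMap.mulLeft ℂ ⇃(K i)).comp (wev F)).comp (lr q a d i) := wd_ext fun l => by
      simp only [LinearMap.sub_apply, LinearMap.comp_apply, LinearMap.mulLeft_apply, LinearMap.mulRight_apply]
      induction l with
      | nil => simp
      | cons j l ih =>
        rw [rr_sg_cons, lr_sg_cons, ← cn_sg, wev_cn, map_add, map_add, map_smul, wev_cn, wev_cn]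
        have e1 : E i * (F j * wev F (sg l)) - F j * wev F (sg l) * E i = (E i * F j - F j * E i) * wev F (sg l) + F j * (E i * wev F (sg l) - wev F (sg l) * E i) := by noncomm_ring
        have e2 := inv_comm_of (zpow_ne_zero _ hC.q0) (hU.KF i j)
        rw [← zpow_neg, neg_neg] at e2
        have e3 : q ^ (-((d i : ℤ) * a i j)) • (⇃(K i) * F j) = F j * ⇃(K i) := by
          rw [e2, smul_smul, ← zpow_add₀ hC.q0]; simp
        have e4 : ⇃(K i) * q ^ (-((d i : ℤ) * a i j)) • (F j * wev F (lr q a d i (sg l)))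
            = F j * (⇃(K i) * wev F (lr q a d i (sg l))) := by
          rw [mul_smul_comm, ← mul_assoc, ← smul_mul_assoc, e3, mul_assoc]
        rw [e1, ih, hU.EF, add_mul, mul_add, e4]
        by_cases h : i = j
        · subst h
          simp only [if_true, map_smul, mul_smul, smul_mul_assoc, sub_mul, key, smul_sub, mul_sub, mul_assoc, mul_smul_comm, kin]
          abel
        · simp only [h, if_false, map_zero, zero_mul, mul_zero, zero_add, mul_sub, mul_assoc]
  exact congrArg (fun g : Wd n →ₗ[ℂ] U => g u) this

lemma URel.commE (hC : Cartan q a d) (hU : URel q a d E F K) (i : Fin n) (u : Wd n) : wev E u * F i - F i * wev E u = (K i : U) * wev E (lr q a d i u) - wev E (rr q a d i u) * ⇃(K i) := by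
  have := (hU.op hC).commF hC i u
  rw [inv_inv] at this
  rw [← neg_sub, this]; abel

/-- Simple finite-dimensional weight representations. -/
structure SR (q : ℂ) {n : ℕ} (d : Fin n → ℕ) (K : Fin n → Uˣ) {M : Type*} [AddCommGroup M] [Module ℂ M] (ρ : U →ₐ[ℂ] Module.End ℂ M) : Prop where
  fd : FiniteDimensional ℂ M
  simp : IsSimp ρ
  sum : (⨆ μ : Fin n → ℤ, wsp q d K ρ μ) = ⊤
  nt : Nontrivial M

variable {M : Type*} [AddCommGroup M] [Module ℂ M] {ρ : U →ₐ[ℂ] Module.End ℂ M}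

lemma wsp_op (hC : Cartan q a d) (ρ : U →ₐ[ℂ] Module.End ℂ M) (μ : Fin n → ℤ) : wsp q d (fun i => (K i)⁻¹) ρ μ = wsp q d K ρ (-μ) := by
  ext x
  constructor
  · intro h
    rw [mem_wsp]; intro i
    have := wsp_inv hC h i
    simpa using this
  · intro h
    rw [mem_wsp]; intro i
    have := wsp_inv hC h i
    simpa using this

lemma SR.op (hC : Cartan q a d) (h : SR q d K ρ) : SR q d (fun i => (K i)⁻¹) ρ where
  fd := h.fd
  simp := h.simp
  sum := by
    rw [← h.sum, ← (Equiv.neg (Fin n → ℤ)).iSup_comp]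
    simp only [wsp_op hC, Equiv.neg_apply, neg_neg]
  nt := h.nt

lemma SR.fin (hC : Cartan q a d) (h : SR q d K ρ) : {μ : Fin n → ℤ | wsp q d K ρ μ ≠ ⊥}.Finite := by
  have := h.fd
  obtain ⟨m, b, β, hb⟩ := exists_wt_basis _ h.sum
  refine (Set.finite_range β).subset fun μ hμ => ?_
  by_contra hcon
  apply hμ
  rw [eq_bot_iff]
  intro x hx
  rw [Submodule.mem_bot, ← b.sum_repr x]
  refine sum_eq_zero fun k _ => ?_
  rw [repr_wt hC hb hx k (fun h => hcon ⟨k, h⟩), zero_smul]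

lemma CD.ht_bw (cd : CD q a d) (l : List (Fin n)) : cd.ht (bw a l) = cd.hp * l.length := by
  have := ht_bw_of cd.ht_rt l
  rw [this]; ring

lemma SR.wordF (hC : Cartan q a d) (hU : URel q a d E F K) (cd : CD q a d) (h : SR q d K ρ) : ∃ N : ℕ, ∀ l : List (Fin n), N < l.length → ρ (wev F (sg l)) = 0 := by
  obtain ⟨B, hB⟩ : ∃ B : ℕ, ∀ μ, wsp q d K ρ μ ≠ ⊥ → (cd.ht μ).natAbs ≤ B := by
    obtain ⟨B, hB⟩ := ((h.fin hC).image (fun μ => (cd.ht μ).natAbs)).bddAbove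
    exact ⟨B, fun μ hμ => hB ⟨μ, hμ, rfl⟩⟩
  refine ⟨2 * B, fun l hl => ?_⟩
  have e : ρ (wev F (sg l)) = (repWM hC hU ρ).Fw l := by
    simp only [wev_sg, WM.Fw, map_list_prod, List.map_map]; rfl
  ext x
  have hx : x ∈ ⨆ μ, wsp q d K ρ μ := by rw [h.sum]; trivial
  induction hx using Submodule.iSup_induction' with
  | mem μ y hy =>
    by_contra hcon
    have h1 := (repWM hC hU ρ).Fw_mem (x := y) (μ := μ) hy l
    rw [← e, repWM_wt] at h1
    have hne : wsp q d K ρ (μ - bw a l) ≠ ⊥ := fun h0 => hcon (by rw [h0] at h1; simpa using h1)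
    have hne' : wsp q d K ρ μ ≠ ⊥ := fun h0 => hcon (by
      rw [h0, Submodule.mem_bot] at hy; simp [hy])
    have i1 := hB _ hne
    have i2 := hB _ hne'
    rw [map_sub, cd.ht_bw] at i1
    have := cd.hp_pos
    have i3 : (l.length : ℤ) ≤ cd.hp * l.length := by nlinarith
    omega
  | zero => simp
  | add y z _ _ h1 h2 => simp_all

lemma SR.wordE (hC : Cartan q a d) (hU : URel q a d E F K) (cd : CD q a d) (h : SR q d K ρ) : ∃ N : ℕ, ∀ l : List (Fin n), N < l.length → ρ (wev E (sg l)) = 0 :=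
  (h.op hC).wordF hC (hU.op hC) cd

lemma SR.exists_hw (hC : Cartan q a d) (hU : URel q a d E F K) (cd : CD q a d) (h : SR q d K ρ) : ∃ (μ : Fin n → ℤ) (v : M), v ≠ 0 ∧ v ∈ wsp q d K ρ μ ∧ ∀ i, ρ (E i) v = 0 := by
  have hne : {μ : Fin n → ℤ | wsp q d K ρ μ ≠ ⊥}.Nonempty := by
    by_contra hcon
    rw [Set.not_nonempty_iff_eq_empty] at hcon
    have : ∀ μ, wsp q d K ρ μ = ⊥ := fun μ => by
      by_contra h0
      have : μ ∈ (∅ : Set (Fin n → ℤ)) := by rw [← hcon]; exact h0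
      exact this
    have hs := h.sum
    simp only [this, iSup_bot] at hs
    have := h.nt
    exact bot_ne_top hs
  obtain ⟨μ, hμ, hmax⟩ := Set.exists_max_image _ cd.ht (h.fin hC) hne
  obtain ⟨v, hv, hv0⟩ := Submodule.exists_mem_ne_zero_of_ne_bot hμ
  refine ⟨μ, v, hv0, hv, fun i => ?_⟩
  by_contra hcon
  have h1 : ρ (E i) v ∈ wsp q d K ρ (μ + rt a i) := (repWM hC hU ρ).E_mem i μ v hv
  have := hmax (μ + rt a i) (fun h0 => hcon (by rw [h0] at h1; simpa using h1))
  rw [map_add, cd.ht_rt] at this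
  have := cd.hp_pos
  omega

lemma SR.exists_lw (hC : Cartan q a d) (hU : URel q a d E F K) (cd : CD q a d) (h : SR q d K ρ) : ∃ (μ : Fin n → ℤ) (v : M), v ≠ 0 ∧ v ∈ wsp q d K ρ μ ∧ ∀ i, ρ (F i) v = 0 := by
  obtain ⟨μ, v, h0, h1, h2⟩ := (h.op hC).exists_hw hC (hU.op hC) cd
  rw [wsp_op hC] at h1
  exact ⟨_, v, h0, h1, h2⟩

lemma Wt_zero {u : Wd n} (hu : u ∈ Wt (0 : Fin n → ℤ)) : u = u [] • sg [] := by
  ext l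
  cases l with
  | nil => simp
  | cons j l =>
    rw [Wt, Finsupp.mem_supported'] at hu
    rw [hu]
    · simp
    · intro h
      have h : deg (j :: l) = 0 := h
      have := length_deg (j :: l)
      rw [h] at this
      simp at this
      omega

lemma Wt_neg {c : Fin n → ℤ} (hc : ∑ j, c j < 0) {u : Wd n} (hu : u ∈ Wt c) : u = 0 := by
  rw [Wt, Finsupp.mem_supported'] at hu
  ext l
  rw [hu]
  · rfl
  · intro h
    have h : deg l = c := h
    have := length_deg l
    rw [h] at this
    omega

/-- The radical acts by zero (words in `F`). -/
lemma SR.radF (hC : Cartan q a d) (hU : URel q a d E F K) (cd : CD q a d) (h : SR q d K ρ) {c : Fin n → ℤ} {u : Wd n} (hu : u ∈ Wt c) (hrad : ∀ v, Gf q a d u v = 0) : ρ (wev F u) = 0 := by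
  have key : ∀ (m : ℕ) (c : Fin n → ℤ) (u : Wd n), u ∈ Wt c → ∑ j, c j < m → (∀ v, Gf q a d u v = 0) → ρ (wev F u) = 0 := by
    intro m
    induction m with
    | zero => intro c u hu hc _; rw [Wt_neg hc hu]; simp
    | succ m ih =>
      intro c u hu hc hr
      by_cases hc0 : c = 0
      · subst hc0
        have h1 := hr (sg [])
        rw [Wt_zero hu, map_smul] at h1
        simp [Gw] at h1
        rw [Wt_zero hu, h1]; simp
      have hs : ∀ i, ∑ j, (c - Pi.single i 1 : Fin n → ℤ) j < m := fun i => by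
        simp only [Pi.sub_apply, sum_sub_distrib, Finset.sum_pi_single', Finset.mem_univ, if_true]
        push_cast at hc
        omega
      have hl : ∀ i, ρ (wev F (lr q a d i u)) = 0 := fun i =>
        ih _ _ (lr_mem q a d i hu) (hs i) fun v => by rw [← Gf_cn_right hC]; exact hr _
      have hr' : ∀ i, ρ (wev F (rr q a d i u)) = 0 := fun i =>
        ih _ _ (rr_mem q a d i hu) (hs i) fun v => by rw [← Gf_sn_right hC]; exact hr _
      obtain ⟨μ, v, hv0, hv, hFv⟩ := h.exists_lw hC hU cd
      have hcomm : ∀ i, ρ (E i) * ρ (wev F u) = ρ (wev F u) * ρ (E i) := fun i => by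
        have := congrArg ρ (hU.commF hC i u)
        rw [map_sub, map_sub, map_mul, map_mul, map_mul, map_mul, hl, hr', zero_mul, mul_zero, sub_zero] at this
        exact sub_eq_zero.1 this
      have hspan := hw_span_top hC (hU.op hC) h.simp (μ := -μ) (x := v)
        (by rw [wsp_op hC, neg_neg]; exact hv) hFv hv0
      have hkill : ρ (wev F u) v = 0 := by
        refine Wt_induct (p := fun u => ρ (wev F u) v = 0) (by simp) (fun u w h1 h2 => ?_)
          (fun x u h1 => ?_) (fun l hl => ?_) hu
        · rw [map_add, map_add, LinearMap.add_apply, h1, h2, add_zero]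
        · rw [map_smul, map_smul, LinearMap.smul_apply, h1, smul_zero]
        · obtain ⟨l', j, rfl⟩ : ∃ l' j, l = l' ++ [j] := by
            rcases List.eq_nil_or_concat' l with rfl | ⟨l', j, rfl⟩
            · exact absurd hl.symm hc0
            · exact ⟨l', j, rfl⟩
          rw [← sn_sg, wev_sn, map_mul, mul_apply, hFv, map_zero]
      ext x
      have hx : x ∈ Submodule.span ℂ (Set.range fun l => (repWM hC (hU.op hC) ρ).Fw l v) := by
        rw [hspan]; trivial
      induction hx using span_induction with
      | mem y hy =>
        obtain ⟨l, rfl⟩ := hy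
        simp only [LinearMap.zero_apply]
        induction l with
        | nil => simpa [WM.Fw] using hkill
        | cons j l ih' =>
          have e : (repWM hC (hU.op hC) ρ).Fw (j :: l) = ρ (E j) * (repWM hC (hU.op hC) ρ).Fw l := by
            simp [WM.Fw]
          rw [e, mul_apply, ← mul_apply, ← hcomm, mul_apply, ih', map_zero]
      | zero => simp
      | add y z _ _ h1 h2 => rw [map_add, h1, h2]; simp
      | smul s y _ h1 => rw [map_smul, h1]; simp
  obtain ⟨m, hm⟩ : ∃ m : ℕ, ∑ j, c j < m := ⟨(∑ j, c j).toNat + 1, by push_cast; omega⟩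
  exact key m c u hu hm hrad

lemma SR.radE (hC : Cartan q a d) (hU : URel q a d E F K) (cd : CD q a d) (h : SR q d K ρ) {c : Fin n → ℤ} {u : Wd n} (hu : u ∈ Wt c) (hrad : ∀ v, Gf q a d u v = 0) :
    ρ (wev E u) = 0 := (h.op hC).radF hC (hU.op hC) cd hu hrad

lemma Wt_fin (c : Fin n → ℤ) : FiniteDimensional ℂ (Wt c) := by
  have hfin : {l : List (Fin n) | deg l = c}.Finite := by
    refine (List.finite_length_eq (Fin n) (∑ j, c j).toNat).subset fun l hl => ?_
    have := length_deg l
    have hl : deg l = c := hl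
    rw [hl] at this
    simp [← this]
  have := hfin.to_subtype
  exact (Finsupp.supportedEquivFinsupp (M := ℂ) (R := ℂ) {l : List (Fin n) | deg l = c}).symm.finiteDimensional

/-- Dual bases modulo the radical. -/
structure DB (q : ℂ) {n : ℕ} (a : Fin n → Fin n → ℤ) (d : Fin n → ℕ) where
  r : (Fin n → ℤ) → ℕ
  h : ∀ c, Fin (r c) → Wd n
  h' : ∀ c, Fin (r c) → Wd n
  h_mem : ∀ c k, h c k ∈ Wt c
  h'_mem : ∀ c k, h' c k ∈ Wt c
  exp : ∀ c u, u ∈ Wt c → ∀ v, Gf q a d u v = ∑ k, Gf q a d u (h' c k) * Gf q a d (h c k) v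

lemma exists_dual_basis {X : Type*} [AddCommGroup X] [Module ℂ X] [FiniteDimensional ℂ X] (L : X →ₗ[ℂ] X →ₗ[ℂ] ℂ) : ∃ (r : ℕ) (h h' : Fin r → X), ∀ u v, L u v = ∑ k, L u (h' k) * L (h k) v := by
  let b := Module.finBasis ℂ X
  obtain ⟨s, hs⟩ := LinearMap.exists_rightInverse_of_surjective L.rangeRestrict
    (LinearMap.range_rangeRestrict L)
  obtain ⟨g, hg⟩ := LinearMap.exists_extend s
  have hLg : ∀ u, L (g (L u)) = L u := fun u => by
    have h1 : g (L u) = s (L.rangeRestrict u) := by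
      rw [← hg]; rfl
    have h2 := congrArg (fun f : L.range →ₗ[ℂ] L.range => (f (L.rangeRestrict u) : Module.Dual ℂ X)) hs
    rw [h1]; exact h2
  refine ⟨_, fun k => g (b.coord k), fun k => b k, ?_⟩
  intro u w
  have e1 : L u = ∑ k, L u (b k) • b.coord k := by
    refine b.ext fun j => ?_
    simp [Finsupp.single_apply]
  have e2 := hLg u
  rw [e1, map_sum, map_sum, ← e1] at e2
  have e3 := congrArg (fun f : Module.Dual ℂ X => f w) e2
  simp only [map_smul, LinearMap.sum_apply, LinearMap.smul_apply, smul_eq_mul] at e3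
  exact e3.symm

lemma exists_DB (q : ℂ) {n : ℕ} (a : Fin n → Fin n → ℤ) (d : Fin n → ℕ) : Nonempty (DB q a d) := by
  have : ∀ c : Fin n → ℤ, ∃ (r : ℕ) (h h' : Fin r → Wd n), (∀ k, h k ∈ Wt c) ∧ (∀ k, h' k ∈ Wt c) ∧ ∀ u, u ∈ Wt c → ∀ v, Gf q a d u v = ∑ k, Gf q a d u (h' k) * Gf q a d (h k) v := by
    intro c
    have := Wt_fin c
    obtain ⟨r, h, h', hh⟩ := exists_dual_basis (X := Wt c)
      ((LinearMap.lcomp ℂ ℂ (Wt c).subtype).comp ((Gf q a d).comp (Wt c).subtype))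
    refine ⟨r, fun k => h k, fun k => h' k, fun k => (h k).2, fun k => (h' k).2, ?_⟩
    intro u hu v
    have hv : ∀ w : Wd n, w ∈ Wt c → Gf q a d u w = ∑ k, Gf q a d u (h' k) * Gf q a d (h k) w := fun w hw => hh ⟨u, hu⟩ ⟨w, hw⟩
    have hG : ∀ (x : Wd n), x ∈ Wt c → ∀ l : List (Fin n), deg l ≠ c → Gf q a d x (sg l) = 0 := by
      intro x hx l hl
      refine Wt_induct (p := fun x => Gf q a d x (sg l) = 0) (by simp) (fun u w h1 h2 => ?_)
          (fun t u h1 => ?_) (fun y hy => ?_) hx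
      · rw [map_add, LinearMap.add_apply, h1, h2, add_zero]
      · rw [map_smul, LinearMap.smul_apply, h1, smul_zero]
      · rw [Gf_sg]; exact Gw_deg q a d y (sg_mem l) (by rw [hy]; exact hl.symm)
    have : (Gf q a d u) = ∑ k, Gf q a d u (h' k) • Gf q a d (h k) := wd_ext fun l => by
      simp only [LinearMap.sum_apply, LinearMap.smul_apply, smul_eq_mul]
      by_cases hl : deg l = c
      · exact hv _ (by rw [← hl]; exact sg_mem l)
      · rw [hG u hu l hl]
        symm
        refine sum_eq_zero fun k _ => ?_
        rw [hG _ (h k).2 l hl, mul_zero]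
    have h2 := congrArg (fun f : Wd n →ₗ[ℂ] ℂ => f v) this
    simpa only [LinearMap.sum_apply, LinearMap.smul_apply, smul_eq_mul] using h2
  choose r h h' h1 h2 h3 using this
  exact ⟨⟨r, h, h', h1, h2, h3⟩⟩

end

/-! ## The quasi `R`-matrix -/

section

lemma shift_sum {X : Type*} [AddCommGroup X] (T : (Fin n → ℤ) → X) (e : Fin n → ℤ) (s : Finset (Fin n → ℤ)) (h1 : ∀ c, c ∉ s → T c = 0) (h2 : ∀ c, c + e ∉ s → T c = 0) :
    ∑ c ∈ s, T (c - e) = ∑ c ∈ s, T c := by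
  rw [← finsum_eq_sum_of_support_subset (fun c => T (c - e)) (s := s), ← finsum_eq_sum_of_support_subset T (s := s)]
  · exact finsum_comp_equiv (Equiv.subRight e) (f := T)
  · intro c hc
    by_contra h
    exact hc (h1 c h)
  · intro c hc
    by_contra h
    exact hc (h2 (c - e) (by rwa [sub_add_cancel]))

/-- linear maps killing the radical -/
def Kills (q : ℂ) {n : ℕ} (a : Fin n → Fin n → ℤ) (d : Fin n → ℕ) {X : Type*} [AddCommGroup X] [Module ℂ X] (f : Wd n →ₗ[ℂ] X) : Prop :=
  ∀ c u, u ∈ Wt c → (∀ v, Gf q a d u v = 0) → f u = 0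

/-- maps supported on degrees in `s` -/
def SuppIn {n : ℕ} (s : Finset (Fin n → ℤ)) {X : Type*} [AddCommGroup X] [Module ℂ X] (f : Wd n →ₗ[ℂ] X) : Prop :=
  ∀ c, c ∉ s → ∀ u ∈ Wt c, f u = 0

lemma Gf_deg_ne (hC : Cartan q a d) {c c' : Fin n → ℤ} {u v : Wd n} (hu : u ∈ Wt c) (hv : v ∈ Wt c') (h : c ≠ c') : Gf q a d u v = 0 := by
  refine Wt_induct (p := fun x => Gf q a d x v = 0) (by simp) (fun u w h1 h2 => ?_)
          (fun t u h1 => ?_) (fun y hy => ?_) hu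
  · rw [map_add, LinearMap.add_apply, h1, h2, add_zero]
  · rw [map_smul, LinearMap.smul_apply, h1, smul_zero]
  · rw [Gf_sg]; exact Gw_deg q a d y hv (by rw [hy]; exact h)

variable {X X' Y : Type*} [AddCommGroup X] [Module ℂ X] [AddCommGroup X'] [Module ℂ X'] [AddCommGroup Y] [Module ℂ Y] {f : Wd n →ₗ[ℂ] X} {e : Wd n →ₗ[ℂ] X'} (B : X →ₗ[ℂ] X' →ₗ[ℂ] Y) (db : DB q a d)

lemma DB.expand (hf : Kills q a d f) {c : Fin n → ℤ} {u : Wd n} (hu : u ∈ Wt c) : f u = ∑ k, Gf q a d u (db.h' c k) • f (db.h c k) := by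
  rw [← sub_eq_zero]
  have h1 := hf c (u - ∑ k, Gf q a d u (db.h' c k) • db.h c k)
    (sub_mem hu (Submodule.sum_mem _ fun k _ => smul_mem _ _ (db.h_mem c k)))
    (fun v => by
      rw [map_sub, LinearMap.sub_apply, db.exp c u hu v, map_sum, LinearMap.sum_apply]
      simp)
  rw [← h1]; simp [map_sub, map_sum]

lemma DB.expand' (hC : Cartan q a d) (he : Kills q a d e) {c : Fin n → ℤ} {u : Wd n} (hu : u ∈ Wt c) : e u = ∑ k, Gf q a d (db.h c k) u • e (db.h' c k) := by
  rw [← sub_eq_zero]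
  have hmem : u - ∑ k, Gf q a d (db.h c k) u • db.h' c k ∈ Wt c := (sub_mem hu (Submodule.sum_mem _ fun k _ => smul_mem _ _ (db.h'_mem c k)))
  have h1 := he c (u - ∑ k, Gf q a d (db.h c k) u • db.h' c k) hmem
    (fun v => by
      have : Gf q a d (u - ∑ k, Gf q a d (db.h c k) u • db.h' c k) = 0 := wd_ext fun l => by
        by_cases hl : deg l = c
        · have hl' : sg l ∈ Wt c := by rw [← hl]; exact sg_mem l
          rw [Gf_symm hC, map_sub, db.exp c _ hl' u, map_sum]
          simp [mul_comm]
        · exact Gf_deg_ne hC hmem (sg_mem l) (Ne.symm hl)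
      rw [this]; rfl)
  rw [← h1]; simp [map_sub, map_sum]

lemma DB.adj (hC : Cartan q a d) (hf : Kills q a d f) (he : Kills q a d e) {c c' : Fin n → ℤ} {r s : Wd n →ₗ[ℂ] Wd n} (hr : ∀ u ∈ Wt c, r u ∈ Wt c') (hs : ∀ u ∈ Wt c', s u ∈ Wt c)
    (hrs : ∀ u v, Gf q a d (r u) v = Gf q a d u (s v)) : ∑ k, B (f (r (db.h c k))) (e (db.h' c k)) = ∑ k, B (f (db.h c' k)) (e (s (db.h' c' k))) := by
  have e1 : ∀ k, f (r (db.h c k)) = ∑ l, Gf q a d (db.h c k) (s (db.h' c' l)) • f (db.h c' l) := fun k => by rw [db.expand hf (hr _ (db.h_mem c k))]; simp only [hrs]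
  have e2 : ∀ l, e (s (db.h' c' l)) = ∑ k, Gf q a d (db.h c k) (s (db.h' c' l)) • e (db.h' c k) := fun l => db.expand' hC he (hs _ (db.h'_mem c' l))
  simp only [e1, e2, map_sum, LinearMap.sum_apply, map_smul, LinearMap.smul_apply]
  exact Finset.sum_comm

lemma DB.adj' (hC : Cartan q a d) (hf : Kills q a d f) (he : Kills q a d e) {c c' : Fin n → ℤ} {r s : Wd n →ₗ[ℂ] Wd n} (hr : ∀ u ∈ Wt c, r u ∈ Wt c') (hs : ∀ u ∈ Wt c', s u ∈ Wt c)
    (hrs : ∀ u v, Gf q a d (r u) v = Gf q a d u (s v)) : ∑ k, B (f (db.h c k)) (e (r (db.h' c k))) = ∑ k, B (f (s (db.h c' k))) (e (db.h' c' k)) := by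
  have e1 : ∀ k, f (s (db.h c' k)) = ∑ l, Gf q a d (s (db.h c' k)) (db.h' c l) • f (db.h c l) := fun k => db.expand hf (hs _ (db.h_mem c' k))
  have e2 : ∀ l, e (r (db.h' c l)) = ∑ k, Gf q a d (s (db.h c' k)) (db.h' c l) • e (db.h' c' k) := fun l => by
      rw [db.expand' hC he (hr _ (db.h'_mem c l))]
      refine sum_congr rfl fun k _ => ?_
      rw [Gf_symm hC, hrs, Gf_symm hC]
  simp only [e1, e2, map_sum, LinearMap.sum_apply, map_smul, LinearMap.smul_apply]
  exact Finset.sum_comm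

lemma DB.shift (hC : Cartan q a d) (hf : Kills q a d f) (he : Kills q a d e) {S : Finset (Fin n → ℤ)} (hfs : SuppIn S f) (hes : SuppIn S e) (i : Fin n)
    {r s : Wd n →ₗ[ℂ] Wd n} (hr : ∀ c, ∀ u ∈ Wt c, r u ∈ Wt (c - Pi.single i 1)) (hs : ∀ c, ∀ u ∈ Wt c, s u ∈ Wt (c + Pi.single i 1)) (hrs : ∀ u v, Gf q a d (r u) v = Gf q a d u (s v)) :
    ∑ c ∈ S, ∑ k, B (f (r (db.h c k))) (e (db.h' c k)) = ∑ c ∈ S, ∑ k, B (f (db.h c k)) (e (s (db.h' c k))) := by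
  rw [← shift_sum (fun c => ∑ k, B (f (db.h c k)) (e (s (db.h' c k)))) (Pi.single i 1) S]
  · refine sum_congr rfl fun c _ => db.adj B hC hf he (hr c) (fun u hu => ?_) hrs
    have := hs _ u hu
    rwa [sub_add_cancel] at this
  · intro c hc
    refine sum_eq_zero fun k _ => ?_
    rw [hfs c hc _ (db.h_mem c k)]; simp
  · intro c hc
    refine sum_eq_zero fun k _ => ?_
    rw [hes _ hc _ (hs c _ (db.h'_mem c k))]; simp

lemma DB.shift' (hC : Cartan q a d) (hf : Kills q a d f) (he : Kills q a d e) {S : Finset (Fin n → ℤ)} (hfs : SuppIn S f) (hes : SuppIn S e) (i : Fin n)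
    {r s : Wd n →ₗ[ℂ] Wd n} (hr : ∀ c, ∀ u ∈ Wt c, r u ∈ Wt (c - Pi.single i 1)) (hs : ∀ c, ∀ u ∈ Wt c, s u ∈ Wt (c + Pi.single i 1)) (hrs : ∀ u v, Gf q a d (r u) v = Gf q a d u (s v)) :
    ∑ c ∈ S, ∑ k, B (f (db.h c k)) (e (r (db.h' c k))) = ∑ c ∈ S, ∑ k, B (f (s (db.h c k))) (e (db.h' c k)) := by
  rw [← shift_sum (fun c => ∑ k, B (f (s (db.h c k))) (e (db.h' c k))) (Pi.single i 1) S]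
  · refine sum_congr rfl fun c _ => db.adj' B hC hf he (hr c) (fun u hu => ?_) hrs
    have := hs _ u hu
    rwa [sub_add_cancel] at this
  · intro c hc
    refine sum_eq_zero fun k _ => ?_
    rw [hes c hc _ (db.h'_mem c k)]; simp
  · intro c hc
    refine sum_eq_zero fun k _ => ?_
    rw [hfs _ hc _ (hs c _ (db.h_mem c k))]; simp

lemma DB.zero (hf : Kills q a d f) : ∑ k, B (f (db.h 0 k)) (e (db.h' 0 k)) = B (f (sg [])) (e (sg [])) := by
  have h0 : sg ([] : List (Fin n)) ∈ Wt (0 : Fin n → ℤ) := sg_mem []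
  rw [db.expand hf h0]
  simp only [map_sum, LinearMap.sum_apply, map_smul, LinearMap.smul_apply]
  refine sum_congr rfl fun k _ => ?_
  conv_lhs => rw [Wt_zero (db.h'_mem 0 k)]
  rw [map_smul, map_smul]
  simp [Gw]

lemma sn_mem (j : Fin n) {c : Fin n → ℤ} {u : Wd n} (hu : u ∈ Wt c) : sn j u ∈ Wt (c + Pi.single j 1) :=
  Wt_map _ (fun l hl => by
    have := sg_mem (l ++ [j])
    rw [deg_append, hl] at this
    simpa [sn_sg] using this) hu

end

section

variable {M M' : Type*} [AddCommGroup M] [Module ℂ M] [AddCommGroup M'] [Module ℂ M'] {ρ : U →ₐ[ℂ] Module.End ℂ M} {ρ' : U →ₐ[ℂ] Module.End ℂ M'}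

lemma deg_nonneg (l : List (Fin n)) (j : Fin n) : 0 ≤ deg l j := by
  induction l with
  | nil => simp
  | cons i l ih =>
    rw [deg_cons, Pi.add_apply, Pi.single_apply]
    split_ifs <;> omega

/-- the box of degrees -/
noncomputable def boxN (n N : ℕ) : Finset (Fin n → ℤ) := Finset.Icc 0 (fun _ => (N : ℤ))

lemma suppIn_box {X : Type*} [AddCommGroup X] [Module ℂ X] (f : Wd n →ₗ[ℂ] X) {N : ℕ} (h : ∀ l : List (Fin n), N < l.length → f (sg l) = 0) : SuppIn (boxN n N) f := by
  intro c hc u hu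
  refine Wt_induct (p := fun u => f u = 0) (by simp) (fun u w h1 h2 => ?_)
          (fun t u h1 => ?_) (fun l hl => ?_) hu
  · rw [map_add, h1, h2, add_zero]
  · rw [map_smul, h1, smul_zero]
  · apply h
    by_contra hlt
    apply hc
    rw [boxN, Finset.mem_Icc]
    subst hl
    refine ⟨fun j => deg_nonneg l j, fun j => ?_⟩
    have h1 := length_deg l
    have h2 := Finset.single_le_sum (f := fun j => deg l j) (fun i _ => deg_nonneg l i)
      (Finset.mem_univ j)
    simp only at h2 ⊢
    omega

/-- the action of `U ⊗ U` on a tensor product -/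
noncomputable def tact (ρ : U →ₐ[ℂ] Module.End ℂ M) (ρ' : U →ₐ[ℂ] Module.End ℂ M') : U ⊗[ℂ] U →ₐ[ℂ] Module.End ℂ (M ⊗[ℂ] M') :=
  (Module.endTensorEndAlgHom (R := ℂ) (A := ℂ) (M := M) (N := M')).comp
    (Algebra.TensorProduct.map ρ ρ')

@[simp] lemma tact_tmul (x y : U) : tact ρ ρ' (x ⊗ₜ y) = TensorProduct.map (ρ x) (ρ' y) := by
  ext v w; simp [tact, Module.endTensorEndAlgHom_apply]

/-- data for an R-matrix: a finite set of degrees containing those acting nontrivially -/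
structure RD (q : ℂ) {n : ℕ} (a : Fin n → Fin n → ℤ) (d : Fin n → ℕ) {U : Type} [Ring U] [Algebra ℂ U] (E F : Fin n → U) {M M' : Type*} [AddCommGroup M] [Module ℂ M] [AddCommGroup M'] [Module ℂ M']
    (ρ : U →ₐ[ℂ] Module.End ℂ M) (ρ' : U →ₐ[ℂ] Module.End ℂ M') (S : Finset (Fin n → ℤ)) : Prop where
  kF : Kills q a d (ρ.toLinearMap.comp (wev F))
  kE : Kills q a d (ρ'.toLinearMap.comp (wev E))
  sF : SuppIn S (ρ.toLinearMap.comp (wev F))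
  sE : SuppIn S (ρ'.toLinearMap.comp (wev E))

lemma exists_RD (hC : Cartan q a d) (hU : URel q a d E F K) (cd : CD q a d) (h : SR q d K ρ) (h' : SR q d K ρ') : ∃ S, RD q a d E F ρ ρ' S ∧ 0 ∈ S := by
  obtain ⟨N, hN⟩ := h.wordF hC hU cd
  obtain ⟨N', hN'⟩ := h'.wordE hC hU cd
  refine ⟨boxN n (max N N'), ⟨fun c u hu hr => h.radF hC hU cd hu hr, fun c u hu hr => h'.radE hC hU cd hu hr, suppIn_box _ fun l hl => hN l (by omega), suppIn_box _ fun l hl => hN' l (by omega)⟩, ?_⟩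
  rw [boxN, Finset.mem_Icc]
  exact ⟨le_refl _, fun j => by simp⟩

/-- the quasi R-matrix -/
noncomputable def Th (E F : Fin n → U) (ρ : U →ₐ[ℂ] Module.End ℂ M) (ρ' : U →ₐ[ℂ] Module.End ℂ M') (db : DB q a d) (S : Finset (Fin n → ℤ)) : Module.End ℂ (M ⊗[ℂ] M') :=
  ∑ c ∈ S, ∑ k, TensorProduct.map (ρ (wev F (db.h c k))) (ρ' (wev E (db.h' c k)))

lemma Th_E (hC : Cartan q a d) (hU : URel q a d E F K) (db : DB q a d) {S : Finset (Fin n → ℤ)} (h : RD q a d E F ρ ρ' S) (i : Fin n) : Th E F ρ ρ' db S * tact ρ ρ' (E i ⊗ₜ 1 + (K i : U) ⊗ₜ E i) =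
      tact ρ ρ' (E i ⊗ₜ 1 + ⇃(K i) ⊗ₜ E i) * Th E F ρ ρ' db S := by
  have s1 := db.shift (TensorProduct.mapBilinear (RingHom.id ℂ) M M' M M') hC h.kF h.kE h.sF h.sE i
    (r := rr q a d i) (s := sn i) (fun c u hu => rr_mem q a d i hu) (fun c u hu => sn_mem i hu)
    (fun u v => (Gf_sn_right hC i u v).symm)
  have s2 := db.shift (TensorProduct.mapBilinear (RingHom.id ℂ) M M' M M') hC h.kF h.kE h.sF h.sE i
    (r := lr q a d i) (s := cn i) (fun c u hu => lr_mem q a d i hu)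
    (fun c u hu => by rw [add_comm]; exact cn_mem i hu)
    (fun u v => (Gf_cn_right hC i u v).symm)
  simp only [LinearMap.comp_apply, AlgHom.toLinearMap_apply, wev_sn, wev_cn, map_mul, TensorProduct.mapBilinear_apply] at s1 s2
  have t1 := congrArg (fun x => x * TensorProduct.map (ρ (K i : U)) (1 : Module.End ℂ M')) s1
  have t2 := congrArg (fun x => TensorProduct.map (ρ ⇃(K i)) (1 : Module.End ℂ M') * x) s2
  simp only [Finset.sum_mul, Finset.mul_sum, ← TensorProduct.map_mul, mul_one, one_mul] at t1 t2
  have key : ∀ u v, TensorProduct.map (ρ (E i) * ρ (wev F u)) (ρ' v) = TensorProduct.map (ρ (wev F u) * ρ (E i)) (ρ' v) + TensorProduct.map (ρ (wev F (rr q a d i u)) * ρ (K i : U)) (ρ' v) -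
      TensorProduct.map (ρ ⇃(K i) * ρ (wev F (lr q a d i u))) (ρ' v) := by
    intro u v
    have := congrArg ρ (hU.commF hC i u)
    simp only [map_sub, map_mul] at this
    have e : ρ (E i) * ρ (wev F u) = ρ (wev F u) * ρ (E i) + (ρ (wev F (rr q a d i u)) * ρ (K i : U) - ρ ⇃(K i) * ρ (wev F (lr q a d i u))) := by
      rw [← this]; abel
    rw [e]
    ext x y
    simp [TensorProduct.add_tmul, TensorProduct.sub_tmul, add_sub_assoc]
  simp only [Th, map_add, tact_tmul, map_one, mul_add, add_mul, Finset.sum_mul, Finset.mul_sum, ← TensorProduct.map_mul, mul_one, one_mul, key, sum_add_distrib, sum_sub_distrib]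
  rw [t1, t2]
  abel

lemma Th_F (hC : Cartan q a d) (hU : URel q a d E F K) (db : DB q a d) {S : Finset (Fin n → ℤ)} (h : RD q a d E F ρ ρ' S) (i : Fin n) : Th E F ρ ρ' db S * tact ρ ρ' (F i ⊗ₜ ⇃(K i) + 1 ⊗ₜ F i) =
      tact ρ ρ' (F i ⊗ₜ (K i : U) + 1 ⊗ₜ F i) * Th E F ρ ρ' db S := by
  have s1 := db.shift' (TensorProduct.mapBilinear (RingHom.id ℂ) M M' M M') hC h.kF h.kE h.sF h.sE i
    (r := rr q a d i) (s := sn i) (fun c u hu => rr_mem q a d i hu) (fun c u hu => sn_mem i hu)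
    (fun u v => (Gf_sn_right hC i u v).symm)
  have s2 := db.shift' (TensorProduct.mapBilinear (RingHom.id ℂ) M M' M M') hC h.kF h.kE h.sF h.sE i
    (r := lr q a d i) (s := cn i) (fun c u hu => lr_mem q a d i hu)
    (fun c u hu => by rw [add_comm]; exact cn_mem i hu)
    (fun u v => (Gf_cn_right hC i u v).symm)
  simp only [LinearMap.comp_apply, AlgHom.toLinearMap_apply, wev_sn, wev_cn, map_mul, TensorProduct.mapBilinear_apply] at s1 s2
  have t1 := congrArg (fun x => x * TensorProduct.map (1 : Module.End ℂ M) (ρ' ⇃(K i))) s1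
  have t2 := congrArg (fun x => TensorProduct.map (1 : Module.End ℂ M) (ρ' (K i : U)) * x) s2
  simp only [Finset.sum_mul, Finset.mul_sum, ← TensorProduct.map_mul, mul_one, one_mul] at t1 t2
  have key : ∀ u v, TensorProduct.map (ρ v) (ρ' (wev E u) * ρ' (F i)) = TensorProduct.map (ρ v) (ρ' (F i) * ρ' (wev E u)) + TensorProduct.map (ρ v) (ρ' (K i : U) * ρ' (wev E (lr q a d i u))) -
      TensorProduct.map (ρ v) (ρ' (wev E (rr q a d i u)) * ρ' ⇃(K i)) := by
    intro u v
    have := congrArg ρ' (hU.commE hC i u)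
    simp only [map_sub, map_mul] at this
    have e : ρ' (wev E u) * ρ' (F i) = ρ' (F i) * ρ' (wev E u) + (ρ' (K i : U) * ρ' (wev E (lr q a d i u)) -
        ρ' (wev E (rr q a d i u)) * ρ' ⇃(K i)) := by
      rw [← this]; abel
    rw [e]
    ext x y
    simp [TensorProduct.tmul_add, TensorProduct.tmul_sub, add_sub_assoc]
  simp only [Th, map_add, tact_tmul, map_one, mul_add, add_mul, Finset.sum_mul, Finset.mul_sum, ← TensorProduct.map_mul, mul_one, one_mul, key, sum_add_distrib, sum_sub_distrib]
  rw [t1, t2]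
  abel

end

/-! ## The R-matrix and the commutation relations -/

section

variable {M M' : Type*} [AddCommGroup M] [Module ℂ M] [AddCommGroup M'] [Module ℂ M'] {ρ : U →ₐ[ℂ] Module.End ℂ M} {ρ' : U →ₐ[ℂ] Module.End ℂ M'}

lemma wevF_mem (hC : Cartan q a d) (hU : URel q a d E F K) (ρ : U →ₐ[ℂ] Module.End ℂ M) {c : Fin n → ℤ} {u : Wd n} (hu : u ∈ Wt c) {μ : Fin n → ℤ} {x : M} (hx : x ∈ wsp q d K ρ μ) :
    ρ (wev F u) x ∈ wsp q d K ρ (μ - degw a c) := by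
  refine Wt_induct (p := fun u => ρ (wev F u) x ∈ wsp q d K ρ (μ - degw a c)) (by simp)
    (fun u w h1 h2 => ?_) (fun t u h1 => ?_) (fun l hl => ?_) hu
  · rw [map_add, map_add]; exact add_mem h1 h2
  · rw [map_smul, map_smul]; exact smul_mem _ _ h1
  · have h1 := (repWM hC hU ρ).Fw_mem (x := x) (μ := μ) hx l
    have e : ρ (wev F (sg l)) = (repWM hC hU ρ).Fw l := by
      simp only [wev_sg, WM.Fw, map_list_prod, List.map_map]; rfl
    rw [e, degw, ← hl, ← bw_deg]; exact h1

lemma wevE_mem (hC : Cartan q a d) (hU : URel q a d E F K) (ρ : U →ₐ[ℂ] Module.End ℂ M) {c : Fin n → ℤ} {u : Wd n} (hu : u ∈ Wt c) {μ : Fin n → ℤ} {x : M} (hx : x ∈ wsp q d K ρ μ) :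
    ρ (wev E u) x ∈ wsp q d K ρ (μ + degw a c) := by
  have := wevF_mem hC (hU.op hC) ρ hu (μ := -μ) (x := x) (by rwa [wsp_op hC, neg_neg])
  rw [wsp_op hC] at this
  rwa [show -(-μ - degw a c) = μ + degw a c by abel] at this

/-- tensors of weight vectors span -/
lemma wt_tensor_ext {Z : Type*} [AddCommGroup Z] [Module ℂ Z] (h : (⨆ μ : Fin n → ℤ, wsp q d K ρ μ) = ⊤) (h' : (⨆ μ : Fin n → ℤ, wsp q d K ρ' μ) = ⊤) {f g : M ⊗[ℂ] M' →ₗ[ℂ] Z}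
    (hfg : ∀ μ ν x y, x ∈ wsp q d K ρ μ → y ∈ wsp q d K ρ' ν → f (x ⊗ₜ y) = g (x ⊗ₜ y)) : f = g := by
  refine TensorProduct.ext' fun x y => ?_
  have hx : x ∈ ⨆ μ : Fin n → ℤ, wsp q d K ρ μ := by rw [h]; trivial
  have hy : y ∈ ⨆ μ : Fin n → ℤ, wsp q d K ρ' μ := by rw [h']; trivial
  induction hx using Submodule.iSup_induction' with
  | mem μ x hx =>
    induction hy using Submodule.iSup_induction' with
    | mem ν y hy => exact hfg μ ν x y hx hy
    | zero => simp
    | add y z _ _ h1 h2 => simp [TensorProduct.tmul_add, h1, h2]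
  | zero => simp
  | add y z _ _ h1 h2 => simp [TensorProduct.add_tmul, h1, h2]

lemma exists_chi (hC : Cartan q a d) (cd : CD q a d) (h : SR q d K ρ) (h' : SR q d K ρ') : ∃ X : Module.End ℂ (M ⊗[ℂ] M'), ∀ μ ν x y, x ∈ wsp q d K ρ μ → y ∈ wsp q d K ρ' ν →
      X (x ⊗ₜ y) = cd.χ μ ν • (x ⊗ₜ y) := by
  have := h.fd
  have := h'.fd
  obtain ⟨m, b, β, hb⟩ := exists_wt_basis _ h.sum
  obtain ⟨m', b', β', hb'⟩ := exists_wt_basis _ h'.sum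
  let X : Module.End ℂ (M ⊗[ℂ] M') := (b.tensorProduct b').constr ℂ
    (fun p => cd.χ (β p.1) (β' p.2) • (b p.1 ⊗ₜ b' p.2))
  have hX : ∀ k l, X (b k ⊗ₜ b' l) = cd.χ (β k) (β' l) • (b k ⊗ₜ b' l) := fun k l => by
    have := (b.tensorProduct b').constr_basis ℂ
      (fun p => cd.χ (β p.1) (β' p.2) • (b p.1 ⊗ₜ[ℂ] b' p.2)) (k, l)
    rwa [Module.Basis.tensorProduct_apply] at this
  refine ⟨X, fun μ ν x y hx hy => ?_⟩
  rw [← b.sum_repr x, ← b'.sum_repr y]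
  simp only [TensorProduct.sum_tmul, TensorProduct.tmul_sum, map_sum, TensorProduct.smul_tmul_smul, map_smul, hX, smul_sum]
  refine sum_congr rfl fun l _ => sum_congr rfl fun k _ => ?_
  by_cases hk : β k = μ
  · by_cases hl : β' l = ν
    · rw [hk, hl, smul_comm]
    · rw [repr_wt hC hb' hy l hl]; simp
  · rw [repr_wt hC hb hx k hk]; simp

lemma CD.χ_neg_left (cd : CD q a d) (μ ν : Fin n → ℤ) : cd.χ (-μ) ν = (cd.χ μ ν)⁻¹ := by
  have h0 : cd.χ 0 ν = 1 := by
    have := cd.χ_add_left 0 0 ν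
    rw [add_zero] at this
    exact (mul_eq_left₀ (cd.χ_ne 0 ν)).1 this.symm
  have := cd.χ_add_left μ (-μ) ν
  rw [add_neg_cancel, h0] at this
  exact eq_inv_of_mul_eq_one_right this.symm

lemma CD.χ_neg_right (cd : CD q a d) (μ ν : Fin n → ℤ) : cd.χ μ (-ν) = (cd.χ μ ν)⁻¹ := by
  have h0 : cd.χ μ 0 = 1 := by
    have := cd.χ_add_right μ 0 0
    rw [add_zero] at this
    exact (mul_eq_left₀ (cd.χ_ne μ 0)).1 this.symm
  have := cd.χ_add_right μ ν (-ν)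
  rw [add_neg_cancel, h0] at this
  exact eq_inv_of_mul_eq_one_right this.symm

/-- flipped coproduct -/
noncomputable def copp (Δ : U →ₐ[ℂ] U ⊗[ℂ] U) : U →ₐ[ℂ] U ⊗[ℂ] U :=
  (Algebra.TensorProduct.comm ℂ U U).toAlgHom.comp Δ

/-- Hopf structure formulas -/
structure Cop {n : ℕ} (E F : Fin n → U) (K : Fin n → Uˣ) (Δ : U →ₐ[ℂ] U ⊗[ℂ] U) : Prop where
  dE : ∀ i, Δ (E i) = E i ⊗ₜ 1 + (K i : U) ⊗ₜ E i
  dF : ∀ i, Δ (F i) = F i ⊗ₜ ⇃(K i) + 1 ⊗ₜ F i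
  dK : ∀ i, Δ (K i : U) = (K i : U) ⊗ₜ (K i : U)

lemma Cop.dKi {Δ : U →ₐ[ℂ] U ⊗[ℂ] U} (h : Cop E F K Δ) (i : Fin n) : Δ ⇃(K i) = ⇃(K i) ⊗ₜ ⇃(K i) := by
  have h1 : Δ ⇃(K i) * Δ (K i : U) = 1 := by rw [← map_mul]; simp
  have h2 : Δ (K i : U) * (⇃(K i) ⊗ₜ ⇃(K i)) = 1 := by
    rw [h.dK, Algebra.TensorProduct.tmul_mul_tmul]; simp [Algebra.TensorProduct.one_def]
  exact left_inv_eq_right_inv h1 h2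

lemma copp_of {Δ : U →ₐ[ℂ] U ⊗[ℂ] U} {u : U} {x y z w : U} (h : Δ u = x ⊗ₜ y + z ⊗ₜ w) : copp Δ u = y ⊗ₜ x + w ⊗ₜ z := by
  change (Algebra.TensorProduct.comm ℂ U U) (Δ u) = _
  rw [h, map_add, Algebra.TensorProduct.comm_tmul, Algebra.TensorProduct.comm_tmul]

lemma copp_of' {Δ : U →ₐ[ℂ] U ⊗[ℂ] U} {u : U} {x y : U} (h : Δ u = x ⊗ₜ y) : copp Δ u = y ⊗ₜ x := by
  change (Algebra.TensorProduct.comm ℂ U U) (Δ u) = _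
  rw [h, Algebra.TensorProduct.comm_tmul]

lemma R_inter (hC : Cartan q a d) (hU : URel q a d E F K) (cd : CD q a d) (db : DB q a d) {Δ : U →ₐ[ℂ] U ⊗[ℂ] U} (hΔ : Cop E F K Δ) (h : SR q d K ρ) (h' : SR q d K ρ')
    {S : Finset (Fin n → ℤ)} (hS : RD q a d E F ρ ρ' S) {X : Module.End ℂ (M ⊗[ℂ] M')} (hX : ∀ μ ν x y, x ∈ wsp q d K ρ μ → y ∈ wsp q d K ρ' ν → X (x ⊗ₜ y) = cd.χ μ ν • (x ⊗ₜ y)) (u : U) :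
    X * Th E F ρ ρ' db S * tact ρ ρ' (Δ u) = tact ρ ρ' (copp Δ u) * (X * Th E F ρ ρ' db S) := by
  set T := X * Th E F ρ ρ' db S with hT
  let A1 := (tact ρ ρ').comp Δ
  let A2 := (tact ρ ρ').comp (copp Δ)
  let P : Subalgebra ℂ U :=
    { carrier := {u | T * A1 u = A2 u * T}
      mul_mem' := fun {u v} hu hv => by
        simp only [Set.mem_ofPred_eq] at hu hv ⊢
        rw [map_mul, map_mul, ← mul_assoc, hu, mul_assoc, hv, mul_assoc]
      one_mem' := by simp
      add_mem' := fun {u v} hu hv => by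
        simp only [Set.mem_ofPred_eq] at hu hv ⊢
        rw [map_add, map_add, mul_add, add_mul, hu, hv]
      zero_mem' := by simp
      algebraMap_mem' := fun r => by
        simp only [Set.mem_ofPred_eq, AlgHom.commutes]
        exact (Algebra.commutes r T).symm }
  suffices hP : P = ⊤ by
    have : u ∈ P := by rw [hP]; trivial
    exact this
  have hThK : ∀ (k : Uˣ) (s : (Fin n → ℤ) → ℂ), (∀ μ x, x ∈ wsp q d K ρ μ → ρ k x = s μ • x) → (∀ μ x, x ∈ wsp q d K ρ' μ → ρ' k x = s μ • x) → (∀ μ ν, s (μ + ν) = s μ * s ν) →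
      T * tact ρ ρ' ((k : U) ⊗ₜ (k : U)) = tact ρ ρ' ((k : U) ⊗ₜ (k : U)) * T := by
    intro k s h1 h2 hs
    refine wt_tensor_ext h.sum h'.sum fun μ ν x y hx hy => ?_
    have hw : ∀ c k, X ((ρ (wev F (db.h c k)) x) ⊗ₜ (ρ' (wev E (db.h' c k)) y)) = cd.χ (μ - degw a c) (ν + degw a c) • ((ρ (wev F (db.h c k)) x) ⊗ₜ (ρ' (wev E (db.h' c k)) y)) :=
      fun c k => hX _ _ _ _ (wevF_mem hC hU ρ (db.h_mem c k) hx) (wevE_mem hC hU ρ' (db.h'_mem c k) hy)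
    have hT' : T (x ⊗ₜ y) = ∑ c ∈ S, ∑ k, cd.χ (μ - degw a c) (ν + degw a c) •
        ((ρ (wev F (db.h c k)) x) ⊗ₜ[ℂ] (ρ' (wev E (db.h' c k)) y)) := by
      simp only [hT, Th, mul_apply, LinearMap.sum_apply, TensorProduct.map_tmul, map_sum, hw]
    change T (tact ρ ρ' ((k : U) ⊗ₜ (k : U)) (x ⊗ₜ y)) = tact ρ ρ' ((k : U) ⊗ₜ (k : U)) (T (x ⊗ₜ y))
    rw [tact_tmul, TensorProduct.map_tmul, h1 μ x hx, h2 ν y hy, TensorProduct.smul_tmul_smul, map_smul, hT', map_sum, smul_sum]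
    refine sum_congr rfl fun c _ => ?_
    rw [map_sum, smul_sum]
    refine sum_congr rfl fun l _ => ?_
    rw [map_smul, TensorProduct.map_tmul, h1 _ _ (wevF_mem hC hU ρ (db.h_mem c l) hx), h2 _ _ (wevE_mem hC hU ρ' (db.h'_mem c l) hy), TensorProduct.smul_tmul_smul, ← hs, ← hs, smul_comm]
    congr 3; abel
  apply hU.gen
  · intro i
    change T * tact ρ ρ' (Δ (E i)) = tact ρ ρ' (copp Δ (E i)) * T
    rw [hΔ.dE, hT, mul_assoc, Th_E hC hU db hS, ← mul_assoc, ← mul_assoc]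
    congr 1
    refine wt_tensor_ext h.sum h'.sum fun μ ν x y hx hy => ?_
    have e1 : ρ (E i) x ∈ wsp q d K ρ (μ + rt a i) := (repWM hC hU ρ).E_mem i μ x hx
    have e2 : ρ' (E i) y ∈ wsp q d K ρ' (ν + rt a i) := (repWM hC hU ρ').E_mem i ν y hy
    rw [copp_of (hΔ.dE i)]
    simp only [map_add, tact_tmul, mul_apply, LinearMap.add_apply, TensorProduct.map_tmul, map_one, Module.End.one_apply, hX _ _ _ _ hx hy, hX _ _ _ _ e1 hy,
      wsp_inv hC hx i, mem_wsp.1 hy i, map_smul, ← TensorProduct.smul_tmul', TensorProduct.tmul_smul, hX _ _ _ _ hx e2]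
    rw [cd.χ_add_left, cd.χ_add_right, cd.χ_rt_left, cd.χ_rt_right]
    simp only [smul_add, smul_smul]
    have := zpow_ne_zero (μ i * (d i : ℤ)) hC.q0
    rw [add_comm]
    congr 2
    rw [zpow_neg]; field_simp
  · intro i
    change T * tact ρ ρ' (Δ (F i)) = tact ρ ρ' (copp Δ (F i)) * T
    rw [hΔ.dF, hT, mul_assoc, Th_F hC hU db hS, ← mul_assoc, ← mul_assoc]
    congr 1
    refine wt_tensor_ext h.sum h'.sum fun μ ν x y hx hy => ?_
    have e1 : ρ (F i) x ∈ wsp q d K ρ (μ - rt a i) := (repWM hC hU ρ).F_mem i μ x hx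
    have e2 : ρ' (F i) y ∈ wsp q d K ρ' (ν - rt a i) := (repWM hC hU ρ').F_mem i ν y hy
    rw [copp_of (hΔ.dF i)]
    simp only [map_add, tact_tmul, mul_apply, LinearMap.add_apply, TensorProduct.map_tmul, map_one, Module.End.one_apply, hX _ _ _ _ hx hy, hX _ _ _ _ e1 hy,
      wsp_inv hC hx i, mem_wsp.1 hy i, map_smul, ← TensorProduct.smul_tmul', TensorProduct.tmul_smul, hX _ _ _ _ hx e2]
    rw [sub_eq_add_neg, sub_eq_add_neg, cd.χ_add_left, cd.χ_add_right, cd.χ_neg_left, cd.χ_neg_right, cd.χ_rt_left, cd.χ_rt_right]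
    simp only [smul_add, smul_smul]
    have := zpow_ne_zero (ν i * (d i : ℤ)) hC.q0
    rw [add_comm]
    congr 2
    · rw [zpow_neg]
    · field_simp
  · intro i
    change T * tact ρ ρ' (Δ (K i)) = tact ρ ρ' (copp Δ (K i)) * T
    rw [copp_of' (hΔ.dK i), hΔ.dK]
    exact hThK (K i) (fun μ => q ^ (μ i * (d i : ℤ))) (fun μ x hx => mem_wsp.1 hx i)
      (fun μ x hx => mem_wsp.1 hx i) (fun μ ν => by
        rw [← zpow_add₀ hC.q0, Pi.add_apply, add_mul])
  · intro i
    change T * tact ρ ρ' (Δ ((K i)⁻¹ : Uˣ)) = tact ρ ρ' (copp Δ ((K i)⁻¹ : Uˣ)) * T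
    rw [copp_of' (hΔ.dKi i), hΔ.dKi]
    exact hThK ((K i)⁻¹) (fun μ => q ^ (-(μ i * (d i : ℤ)))) (fun μ x hx => wsp_inv hC hx i)
      (fun μ x hx => wsp_inv hC hx i) (fun μ ν => by
        rw [← zpow_add₀ hC.q0, Pi.add_apply]; congr 1; ring)

/-- convolution of linear forms -/
noncomputable def conv (Δ : U →ₐ[ℂ] U ⊗[ℂ] U) (φ ψ : U →ₗ[ℂ] ℂ) : U →ₗ[ℂ] ℂ :=
  (TensorProduct.lid ℂ ℂ).toLinearMap ∘ₗ (TensorProduct.map φ ψ) ∘ₗ Δ.toLinearMap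

/-- matrix coefficients -/
def mc (ρ : U →ₐ[ℂ] Module.End ℂ M) (ξ : Module.Dual ℂ M) (v : M) : U →ₗ[ℂ] ℂ where
  toFun u := ξ (ρ u v)
  map_add' x y := by simp
  map_smul' c x := by simp

@[simp] lemma mc_apply (ξ : Module.Dual ℂ M) (v : M) (u : U) : mc ρ ξ v u = ξ (ρ u v) := rfl

/-- tensor product of functionals -/
noncomputable def tf (ξ : Module.Dual ℂ M) (η : Module.Dual ℂ M') : Module.Dual ℂ (M ⊗[ℂ] M') :=
  (TensorProduct.lid ℂ ℂ).toLinearMap ∘ₗ (TensorProduct.map ξ η)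

@[simp] lemma tf_tmul (ξ : Module.Dual ℂ M) (η : Module.Dual ℂ M') (v : M) (w : M') : tf ξ η (v ⊗ₜ w) = ξ v * η w := by simp [tf]

lemma conv_mc (Δ : U →ₐ[ℂ] U ⊗[ℂ] U) (ξ : Module.Dual ℂ M) (η : Module.Dual ℂ M') (v : M) (w : M') (u : U) : conv Δ (mc ρ ξ v) (mc ρ' η w) u = tf ξ η (tact ρ ρ' (Δ u) (v ⊗ₜ w)) := by
  simp only [conv, LinearMap.comp_apply, AlgHom.toLinearMap_apply]
  induction Δ u using TensorProduct.induction_on with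
  | zero => simp
  | tmul x y => simp
  | add x y h1 h2 => simp only [map_add, LinearMap.add_apply, h1, h2]

lemma conv_mc' (Δ : U →ₐ[ℂ] U ⊗[ℂ] U) (ξ : Module.Dual ℂ M) (η : Module.Dual ℂ M') (v : M) (w : M') (u : U) : conv Δ (mc ρ' η w) (mc ρ ξ v) u = tf ξ η (tact ρ ρ' (copp Δ u) (v ⊗ₜ w)) := by
  simp only [conv, LinearMap.comp_apply, AlgHom.toLinearMap_apply, copp, AlgHom.comp_apply]
  induction Δ u using TensorProduct.induction_on with
  | zero => simp
  | tmul x y => simp [mul_comm]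
  | add x y h1 h2 => simp only [map_add, LinearMap.add_apply, h1, h2]

/-- dual weight vectors -/
def dwt (q : ℂ) {n : ℕ} (d : Fin n → ℕ) (K : Fin n → Uˣ) (ρ : U →ₐ[ℂ] Module.End ℂ M) (μ : Fin n → ℤ) (ξ : Module.Dual ℂ M) : Prop := ∀ ν, ν ≠ μ → ∀ x ∈ wsp q d K ρ ν, ξ x = 0

/-- The commutation relations. -/
theorem R_rel (hC : Cartan q a d) (hU : URel q a d E F K) (cd : CD q a d) (db : DB q a d) {Δ : U →ₐ[ℂ] U ⊗[ℂ] U} (hΔ : Cop E F K Δ) (h : SR q d K ρ) (h' : SR q d K ρ')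
    {S : Finset (Fin n → ℤ)} (hS : RD q a d E F ρ ρ' S) {μ μ' ν ν' : Fin n → ℤ} {ξ : Module.Dual ℂ M} {η : Module.Dual ℂ M'} {v : M} {w : M'}
    (hξ : dwt q d K ρ μ ξ) (hη : dwt q d K ρ' μ' η) (hv : v ∈ wsp q d K ρ ν) (hw : w ∈ wsp q d K ρ' ν') : ∑ c ∈ S, ∑ k, cd.χ μ μ' • conv Δ (mc ρ (ξ ∘ₗ ρ (wev F (db.h c k))) v)
        (mc ρ' (η ∘ₗ ρ' (wev E (db.h' c k))) w) = ∑ c ∈ S, ∑ k, cd.χ (ν - degw a c) (ν' + degw a c) • conv Δ (mc ρ' η (ρ' (wev E (db.h' c k)) w)) (mc ρ ξ (ρ (wev F (db.h c k)) v)) := by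
  obtain ⟨X, hX⟩ := exists_chi hC cd h h'
  have e1 : tf ξ η ∘ₗ X = cd.χ μ μ' • tf ξ η := wt_tensor_ext h.sum h'.sum fun α β x y hx hy => by
    rw [LinearMap.comp_apply, hX _ _ _ _ hx hy, map_smul, LinearMap.smul_apply, tf_tmul]
    by_cases h1 : α = μ
    · by_cases h2 : β = μ'
      · rw [h1, h2]
      · rw [hη β h2 y hy]; simp
    · rw [hξ α h1 x hx]; simp
  ext u
  have key := congrArg (fun T : Module.End ℂ (M ⊗[ℂ] M') => tf ξ η (T (v ⊗ₜ w)))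
    (R_inter hC hU cd db hΔ h h' hS hX u)
  simp only [mul_apply] at key
  have e2 : ∀ z, tf ξ η (X z) = cd.χ μ μ' * tf ξ η z := fun z => by
    rw [← LinearMap.comp_apply, e1]; rfl
  rw [e2] at key
  simp only [LinearMap.sum_apply, LinearMap.smul_apply, conv_mc, smul_eq_mul]
  convert key using 1
  · simp only [Th, LinearMap.sum_apply, map_sum, Finset.mul_sum]
    refine sum_congr rfl fun c _ => sum_congr rfl fun k _ => ?_
    congr 1
    have e3 : tf (ξ ∘ₗ ρ (wev F (db.h c k))) (η ∘ₗ ρ' (wev E (db.h' c k))) = tf ξ η ∘ₗ TensorProduct.map (ρ (wev F (db.h c k))) (ρ' (wev E (db.h' c k))) := TensorProduct.ext' fun x y => by simp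
    rw [e3]; rfl
  · simp only [Th, LinearMap.sum_apply, map_sum, TensorProduct.map_tmul]
    refine sum_congr rfl fun c _ => sum_congr rfl fun k _ => ?_
    rw [hX _ _ _ _ (wevF_mem hC hU ρ (db.h_mem c k) hv) (wevE_mem hC hU ρ' (db.h'_mem c k) hw), map_smul, map_smul, smul_eq_mul, ← conv_mc', conv_mc]

end

/-! ## Comparison of highest weight modules -/

section

variable {M M' : Type*} [AddCommGroup M] [Module ℂ M] [AddCommGroup M'] [Module ℂ M'] {ρ : U →ₐ[ℂ] Module.End ℂ M} {ρ' : U →ₐ[ℂ] Module.End ℂ M'}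

/-- direct sum of representations -/
def prodRep (ρ : U →ₐ[ℂ] Module.End ℂ M) (ρ' : U →ₐ[ℂ] Module.End ℂ M') : U →ₐ[ℂ] Module.End ℂ (M × M') where
  toFun u := (ρ u).prodMap (ρ' u)
  map_one' := by ext <;> simp
  map_mul' x y := by ext <;> simp
  map_zero' := by ext <;> simp
  map_add' x y := by ext <;> simp
  commutes' r := by ext <;> simp [Algebra.algebraMap_eq_smul_one]

@[simp] lemma prodRep_apply (u : U) (x : M × M') : prodRep ρ ρ' u x = (ρ u x.1, ρ' u x.2) := rfl

/-- orbit map -/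
def orb (ρ : U →ₐ[ℂ] Module.End ℂ M) (x : M) : U →ₗ[ℂ] M where
  toFun u := ρ u x
  map_add' x y := by simp
  map_smul' c x := by simp

@[simp] lemma orb_apply (x : M) (u : U) : orb ρ x u = ρ u x := rfl

/-- factorisation of linear maps -/
lemma exists_factor {X Y Z : Type*} [AddCommGroup X] [Module ℂ X] [AddCommGroup Y] [Module ℂ Y] [AddCommGroup Z] [Module ℂ Z] (f : X →ₗ[ℂ] Y) (h : X →ₗ[ℂ] Z) (hk : ∀ x, f x = 0 → h x = 0) :
    ∃ g : Y →ₗ[ℂ] Z, ∀ x, g (f x) = h x := by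
  obtain ⟨s, hs⟩ := f.rangeRestrict.exists_rightInverse_of_surjective (LinearMap.range_rangeRestrict f)
  obtain ⟨g, hg⟩ := LinearMap.exists_extend (h ∘ₗ s)
  refine ⟨g, fun x => ?_⟩
  have h1 : g (f x) = (h ∘ₗ s) (f.rangeRestrict x) := by rw [← hg]; rfl
  rw [h1, LinearMap.comp_apply, ← sub_eq_zero, ← map_sub]
  apply hk
  have h2 : f.rangeRestrict (s (f.rangeRestrict x)) = f.rangeRestrict x := by
    rw [← LinearMap.comp_apply, hs]; rfl
  have h3 := congrArg Subtype.val h2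
  simp only [LinearMap.codRestrict_apply, LinearMap.rangeRestrict] at h3
  rw [map_sub, sub_eq_zero]; exact h3

lemma simp_orbit (hs : IsSimp ρ) {v : M} (hv : v ≠ 0) (x : M) : ∃ u, ρ u v = x := by
  rcases hs (LinearMap.range (orb ρ v)) (by
    rintro u _ ⟨w, rfl⟩; exact ⟨u * w, by simp⟩) with h | h
  · exfalso; apply hv
    have : v ∈ LinearMap.range (orb ρ v) := ⟨1, by simp⟩
    rw [h] at this; simpa using this
  · have : x ∈ LinearMap.range (orb ρ v) := by rw [h]; trivial
    obtain ⟨u, hu⟩ := this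
    exact ⟨u, hu⟩

lemma CD.bw_ne (cd : CD q a d) {l : List (Fin n)} (hl : l ≠ []) : bw a l ≠ 0 := fun h => by
  have h1 := cd.ht_bw l
  rw [h, map_zero] at h1
  have h2 := List.length_pos_iff.2 hl
  have h3 := mul_pos cd.hp_pos (by exact_mod_cast h2 : (0 : ℤ) < l.length)
  omega

/-- Key comparison lemma. -/
lemma hw_compare (hC : Cartan q a d) (hU : URel q a d E F K) (cd : CD q a d) {μ : Fin n → ℤ} {m : M} (hm : m ∈ wsp q d K ρ μ) (hmE : ∀ i, ρ (E i) m = 0) (hm0 : m ≠ 0)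
    (hs : IsSimp ρ') {v : M'} (hv : v ∈ wsp q d K ρ' μ) (hvE : ∀ i, ρ' (E i) v = 0) {u : U} (hu : ρ u m = 0) : ρ' u v = 0 := by
  set W := repWM hC hU (prodRep ρ ρ') with hW
  have hx : ((m, v) : M × M') ∈ wsp q d K (prodRep ρ ρ') μ := mem_wsp.2 fun i => by
    simp [mem_wsp.1 hm i, mem_wsp.1 hv i]
  have hxE : ∀ i, prodRep ρ ρ' (E i) (m, v) = 0 := fun i => by simp [hmE, hvE]
  set N := Submodule.span ℂ (Set.range fun l => W.Fw l (m, v)) with hN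
  have hmem : ((m, v) : M × M') ∈ N := subset_span ⟨[], by simp [WM.Fw]⟩
  have hst : ∀ u y, y ∈ N → prodRep ρ ρ' u y ∈ N := fun u y hy =>
    hw_span_stable hC hU (prodRep ρ ρ') hx hxE u hy
  let N' : Submodule ℂ M' := N.comap (LinearMap.inr ℂ M M')
  rcases hs N' (fun u w hw => by
    have := hst u _ hw
    simpa [N'] using this) with h | h
  · have h1 := hst u _ hmem
    rw [prodRep_apply, hu] at h1
    have h2 : ρ' u v ∈ N' := h1
    rw [h] at h2; simpa using h2
  · have h1 : ((0, v) : M × M') ∈ N := by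
      have : v ∈ N' := by rw [h]; trivial
      exact this
    have hle : N ≤ Submodule.span ℂ {((m, v) : M × M')} ⊔ ⨆ ν ∈ {ν | ν ≠ μ}, wsp q d K (prodRep ρ ρ') ν := by
      rw [hN, Submodule.span_le]
      rintro _ ⟨l, rfl⟩
      by_cases hl : l = []
      · subst hl
        refine Submodule.mem_sup_left (Submodule.mem_span_singleton_self _)
      · refine Submodule.mem_sup_right (mem_iSup_of_mem (μ - bw a l)
          (mem_iSup_of_mem ?_ (W.Fw_mem hx l)))
        intro h; apply cd.bw_ne hl; simpa using h
    obtain ⟨y, hy, z, hz, hyz⟩ := Submodule.mem_sup.1 (hle h1)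
    obtain ⟨t, rfl⟩ := Submodule.mem_span_singleton.1 hy
    have hz0 : z = 0 := by
      refine wsp_indep hC (prodRep ρ ρ') _ μ (by simp) z ?_ hz
      have : z = (0, v) - t • (m, v) := by rw [← hyz]; abel
      rw [this]
      refine sub_mem (mem_wsp.2 fun i => ?_) (smul_mem _ _ hx)
      simp [mem_wsp.1 hv i]
    rw [hz0, add_zero, Prod.ext_iff] at hyz
    obtain ⟨h3, h4⟩ := hyz
    have ht : t = 0 := by simpa [hm0] using h3
    have : v = 0 := by rw [ht] at h4; simpa using h4.symm
    simp [this]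

/-- coefficients of the simple module are coefficients of the big one -/
lemma hw_coef (hC : Cartan q a d) (hU : URel q a d E F K) (cd : CD q a d) {μ : Fin n → ℤ} {m : M} (hm : m ∈ wsp q d K ρ μ) (hmE : ∀ i, ρ (E i) m = 0) (hm0 : m ≠ 0)
    (hs : IsSimp ρ') {v : M'} (hv : v ∈ wsp q d K ρ' μ) (hvE : ∀ i, ρ' (E i) v = 0) (hv0 : v ≠ 0) (ξ : Module.Dual ℂ M') (x : M') : ∃ ζ z, mc ρ' ξ x = mc ρ ζ z := by
  obtain ⟨g, hg⟩ := exists_factor (orb ρ m) (orb ρ' v)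
    (fun u hu => hw_compare hC hU cd hm hmE hm0 hs hv hvE hu)
  obtain ⟨u0, rfl⟩ := simp_orbit hs hv0 x
  refine ⟨ξ ∘ₗ g, ρ u0 m, ?_⟩
  ext u
  have := hg (u * u0)
  simp only [orb_apply, map_mul, mul_apply] at this
  simp [this]

/-- dominance of highest weights of `SR` -/
lemma SR.dom (hC : Cartan q a d) (hU : URel q a d E F K) (cd : CD q a d) (h : SR q d K ρ) {μ : Fin n → ℤ} {v : M} (hv : v ∈ wsp q d K ρ μ) (hE : ∀ i, ρ (E i) v = 0) (hv0 : v ≠ 0) :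
    ∃ c : Fin n → ℕ, μ = fun i => (c i : ℤ) := by
  obtain ⟨N, hN⟩ := h.wordF hC hU cd
  have : ∀ i, ∃ m : ℕ, μ i = m := fun i => by
    obtain ⟨m, hm, -⟩ := (repWM hC hU ρ).dominant (i := i) hC.nru hC.diag hv (hE i) hv0
      ⟨N + 1, by
        have := hN (List.replicate (N + 1) i) (by simp)
        rw [wev_sg, List.map_replicate, List.prod_replicate, map_pow] at this
        change (ρ (F i) ^ (N + 1)) v = 0
        rw [this]; rfl⟩
    exact ⟨m, hm⟩
  choose c hc using this
  exact ⟨c, funext hc⟩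

end

/-! ## Symmetries of the relations -/

section

lemma UqRels.op (hC : Cartan q a d) {B : Type} [Ring B] [Algebra ℂ B] {E F : Fin n → B} {K : Fin n → Bˣ} (h : UqRels q a d B E F K) : UqRels q a d B F E (fun i => (K i)⁻¹) := by
  obtain ⟨h1, h2, h3, h4, h5, h6⟩ := h
  refine ⟨fun i j => ?_, fun i j => ?_, fun i j => ?_, fun i j => ?_, h6, h5⟩
  · have : K i * K j = K j * K i := Units.ext (h1 i j)
    have h' : (K i)⁻¹ * (K j)⁻¹ = (K j)⁻¹ * (K i)⁻¹ := by
      rw [← mul_inv_rev, ← mul_inv_rev, this]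
    exact congrArg Units.val h'
  · have := inv_comm_of (zpow_ne_zero _ hC.q0) (h3 i j)
    rwa [← zpow_neg, neg_neg] at this
  · have := inv_comm_of (zpow_ne_zero _ hC.q0) (h2 i j)
    rwa [← zpow_neg] at this
  · rw [← neg_sub, h4]
    by_cases hij : i = j
    · subst hij
      simp only [if_true, inv_inv]
      rw [← smul_neg, neg_sub]
    · rw [if_neg hij, if_neg (fun h => hij h.symm), neg_zero]

/-- universal property -/
def UnivP (q : ℂ) {n : ℕ} (a : Fin n → Fin n → ℤ) (d : Fin n → ℕ) {U : Type} [Ring U] [Algebra ℂ U] (E F : Fin n → U) (K : Fin n → Uˣ) : Prop :=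
  ∀ (B : Type) [Ring B] [Algebra ℂ B] (E' F' : Fin n → B) (K' : Fin n → Bˣ), UqRels q a d B E' F' K' → ∃! φ : U →ₐ[ℂ] B, (∀ i, φ (E i) = E' i) ∧ (∀ i, φ (F i) = F' i) ∧ (∀ i, φ (K i : U) = (K' i : B))

lemma alg_units {U B : Type*} [Ring U] [Algebra ℂ U] [Ring B] [Algebra ℂ B] (φ : U →ₐ[ℂ] B) {k : Uˣ} {k' : Bˣ} (h : φ (k : U) = k') : φ ((k⁻¹ : Uˣ) : U) = ((k'⁻¹ : Bˣ) : B) := by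
  have h1 : φ ((k⁻¹ : Uˣ) : U) * (k' : B) = 1 := by rw [← h, ← map_mul]; simp
  exact Units.eq_inv_of_mul_eq_one_right h1

lemma UnivP.op (hC : Cartan q a d) {U : Type} [Ring U] [Algebra ℂ U] {E F : Fin n → U} {K : Fin n → Uˣ} (h : UnivP q a d E F K) : UnivP q a d F E (fun i => (K i)⁻¹) := by
  intro B _ _ E' F' K' hB
  obtain ⟨φ, ⟨h1, h2, h3⟩, hu⟩ := h B F' E' (fun i => (K' i)⁻¹) (hB.op hC)
  refine ⟨φ, ⟨h2, h1, fun i => ?_⟩, fun ψ ⟨g1, g2, g3⟩ => hu ψ ⟨g2, g1, fun i => ?_⟩⟩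
  · have := alg_units φ (h3 i)
    simpa using this
  · have := alg_units ψ (g3 i)
    simpa using this

end

open MulOpposite

/-! ## The antipode -/

section

/-- twisting words by `q`-commuting units -/
lemma twist_word {B : Type*} [Ring B] [Algebra ℂ B] (X κ : Fin n → B) (s : Fin n → ℂ) (r : Fin n → Fin n → ℂ) (hr : ∀ i j, r i j = r j i) (hκ : ∀ i j, κ i * κ j = κ j * κ i)
    (hX : ∀ i j, X i * κ j = r i j • (κ j * X i)) : ∃ t : List (Fin n) → ℂ, (∀ l l', l.Perm l' → t l = t l') ∧ ∀ l : List (Fin n), (l.map fun i => s i • (κ i * X i)).prod =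
        t l • ((l.map κ).prod * (l.map X).prod) := by
  let t : List (Fin n) → ℂ := fun l => l.rec 1 (fun i l' t' => s i * (l'.map (r i)).prod * t')
  have tc : ∀ i l, t (i :: l) = s i * (l.map (r i)).prod * t l := fun i l => rfl
  refine ⟨t, fun l l' h => ?_, fun l => ?_⟩
  · induction h with
    | nil => rfl
    | cons x h ih => rw [tc, tc, ih, (h.map (r x)).prod_eq]
    | swap x y l => rw [tc, tc, tc, tc]; simp only [List.map_cons, List.prod_cons, hr y x]; ring
    | trans h1 h2 ih1 ih2 => rw [ih1, ih2]
  · have hm : ∀ i (l : List (Fin n)), X i * (l.map κ).prod = (l.map (r i)).prod • ((l.map κ).prod * X i) := by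
      intro i l
      induction l with
      | nil => simp
      | cons j l ih =>
        simp only [List.map_cons, List.prod_cons]
        rw [← mul_assoc, hX, smul_mul_assoc, mul_assoc, ih, mul_smul_comm, smul_smul, mul_assoc]
    induction l with
    | nil => simp [t]
    | cons i l ih =>
      simp only [List.map_cons, List.prod_cons]
      rw [ih, tc, smul_mul_assoc, mul_smul_comm, smul_smul, mul_assoc, ← mul_assoc (X i), hm, smul_mul_assoc, mul_smul_comm, smul_smul]
      simp only [mul_assoc]
      congr 1; ring

lemma serre_twist {B : Type*} [Ring B] [Algebra ℂ B] (X κ : Fin n → B) (s : Fin n → ℂ) (r : Fin n → Fin n → ℂ) (hr : ∀ i j, r i j = r j i) (hκ : ∀ i j, κ i * κ j = κ j * κ i)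
    (hX : ∀ i j, X i * κ j = r i j • (κ j * X i)) (N : ℕ) (c : ℕ → ℂ) (i j : Fin n) (h : ∑ k ∈ Finset.range (N + 1), c k • (X i ^ (N - k) * X j * X i ^ k) = 0) :
    ∑ k ∈ Finset.range (N + 1), c k • ((s i • (κ i * X i)) ^ (N - k) * (s j • (κ j * X j)) * (s i • (κ i * X i)) ^ k) = 0 := by
  obtain ⟨t, ht, hw⟩ := twist_word X κ s r hr hκ hX
  let L : ℕ → List (Fin n) := fun k => List.replicate (N - k) i ++ j :: List.replicate k i
  have hL : ∀ k ∈ Finset.range (N + 1), (L k).Perm (j :: List.replicate N i) := fun k hk => by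
    have : N = (N - k) + k := by rw [Finset.mem_range] at hk; omega
    refine List.perm_middle.trans (List.Perm.cons j ?_)
    rw [← List.replicate_add, ← this]
  have hm : ∀ (Z : Fin n → B) k, ((L k).map Z).prod = Z i ^ (N - k) * Z j * Z i ^ k := fun Z k => by
    simp [L, mul_assoc]
  have hκL : ∀ k ∈ Finset.range (N + 1), ((L k).map κ).prod = κ i ^ N * κ j := fun k hk => by
    have h2 : Commute (κ i) (κ j) := hκ i j
    rw [hm, mul_assoc, (h2.pow_left k).eq.symm, ← mul_assoc, ← pow_add]
    congr 2
    rw [Finset.mem_range] at hk; omega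
  have : ∀ k ∈ Finset.range (N + 1), c k • ((s i • (κ i * X i)) ^ (N - k) * (s j • (κ j * X j)) * (s i • (κ i * X i)) ^ k) =
      (t (j :: List.replicate N i) • (κ i ^ N * κ j)) * (c k • (X i ^ (N - k) * X j * X i ^ k)) := by
    intro k hk
    rw [← hm (fun i => s i • (κ i * X i)), hw, ht _ _ (hL k hk), hκL k hk, hm, smul_mul_assoc, mul_smul_comm, smul_comm]
  rw [sum_congr rfl this, ← Finset.mul_sum, h, mul_zero]

lemma serre_op {B : Type*} [Ring B] [Algebra ℂ B] (x y : B) (p : ℂ) (N : ℕ) (h : ∑ k ∈ Finset.range (N + 1), ((-1 : ℂ) ^ k * qbinom p N k) • (x ^ (N - k) * y * x ^ k) = 0) :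
    ∑ k ∈ Finset.range (N + 1), ((-1 : ℂ) ^ k * qbinom p N k) • (op x ^ (N - k) * op y * op x ^ k) = 0 := by
  rw [← Finset.sum_flip]
  apply unop_injective
  rw [unop_zero, Finset.unop_sum]
  have : ∀ k ∈ Finset.range (N + 1), unop (((-1 : ℂ) ^ (N - k) * qbinom p N (N - k)) •
      (op x ^ (N - (N - k)) * op y * op x ^ (N - k))) = (-1 : ℂ) ^ N • (((-1 : ℂ) ^ k * qbinom p N k) • (x ^ (N - k) * y * x ^ k)) := by
    intro k hk
    have hk' : k ≤ N := by rw [Finset.mem_range] at hk; omega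
    have e1 : N - (N - k) = k := by omega
    have e2 : qbinom p N (N - k) = qbinom p N k := by
      unfold qbinom; rw [e1, mul_comm]
    have e3 : (-1 : ℂ) ^ (N - k) = (-1) ^ N * (-1) ^ k := by
      rw [← pow_add, show N + k = (N - k) + 2 * k by omega, pow_add, pow_mul]; simp
    rw [e1, e2, e3, unop_smul, unop_mul, unop_mul, unop_pow, unop_pow, unop_op, unop_op, smul_smul, mul_assoc, mul_assoc]
  rw [sum_congr rfl this, ← smul_sum, h, smul_zero]

/-- relations satisfied by the antipode images -/
lemma uqRels_antipode (hC : Cartan q a d) (h : UqRels q a d U E F K) : UqRels q a d Uᵐᵒᵖ (fun i => op (-(⇃(K i) * E i))) (fun i => op (-(F i * (K i : U))))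
      (fun i => Units.opEquiv.symm (op (K i)⁻¹)) := by
  have hU := h.op hC
  obtain ⟨h1, h2, h3, h4, h5, h6⟩ := h
  obtain ⟨g1, g2, g3, -, -, -⟩ := hU
  have q0 := hC.q0
  have eE : ∀ i j, E j * ⇃(K i) = q ^ ((d i : ℤ) * a i j) • (⇃(K i) * E j) := fun i j => by
    have := smul_flip (zpow_ne_zero _ q0) (g3 i j)
    rwa [← zpow_neg, neg_neg] at this
  have eF : ∀ i j, F j * (K i : U) = q ^ ((d i : ℤ) * a i j) • ((K i : U) * F j) := fun i j => by
    have := smul_flip (zpow_ne_zero _ q0) (h3 i j)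
    rwa [← zpow_neg, neg_neg] at this
  have eF' : ∀ i j, F j * ⇃(K i) = q ^ (-((d i : ℤ) * a i j)) • (⇃(K i) * F j) := fun i j => by
    have := smul_flip (zpow_ne_zero _ q0) (g2 i j)
    rwa [← zpow_neg] at this
  have hYF : ∀ i, -(F i * (K i : U)) = (-q ^ ((d i : ℤ) * a i i)) • ((K i : U) * F i) := fun i => by
    rw [eF, neg_smul]
  have hYE : ∀ i, -(⇃(K i) * E i) = (-1 : ℂ) • (⇃(K i) * E i) := fun i => by simp
  have hKK : ∀ i j, (K i : U) * ⇃(K j) = ⇃(K j) * (K i : U) := fun i j => by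
    rw [Units.eq_inv_mul_iff_mul_eq, ← mul_assoc, h1 j i, mul_assoc, Units.mul_inv, mul_one]
  refine ⟨fun i j => ?_, fun i j => ?_, fun i j => ?_, fun i j => ?_, fun i j hij => ?_, fun i j hij => ?_⟩
  · apply unop_injective
    exact g1 j i
  · apply unop_injective
    change -(⇃(K j) * E j) * ⇃(K i) = q ^ ((d i : ℤ) * a i j) • (⇃(K i) * -(⇃(K j) * E j))
    rw [neg_mul, mul_neg, mul_assoc, eE, mul_smul_comm, ← mul_assoc, ← mul_assoc, g1, smul_neg]
  · apply unop_injective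
    change -(F j * (K j : U)) * ⇃(K i) = q ^ (-((d i : ℤ) * a i j)) • (⇃(K i) * -(F j * (K j : U)))
    rw [neg_mul, mul_neg, mul_assoc, hKK, ← mul_assoc, eF', smul_mul_assoc, smul_neg, mul_assoc]
  · apply unop_injective
    have key : F j * (K j : U) * (⇃(K i) * E i) - ⇃(K i) * E i * (F j * (K j : U))
        = -(⇃(K i) * (E i * F j - F j * E i) * (K j : U)) := by
      have e : F j * (K j : U) * (⇃(K i) * E i) = ⇃(K i) * F j * E i * (K j : U) := by
        calc _ = F j * ((K j : U) * ⇃(K i)) * E i := by simp only [mul_assoc]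
          _ = F j * ⇃(K i) * ((K j : U) * E i) := by rw [hKK]; simp only [mul_assoc]
          _ = _ := by
            rw [h2, eF', smul_mul_smul_comm, ← zpow_add₀ q0, hC.symm j i, neg_add_cancel, zpow_zero, one_smul]; simp only [mul_assoc]
      rw [e]; noncomm_ring
    have e1 : ∀ x y : U, unop (op (-x) * op (-y) - op (-y) * op (-x)) = y * x - x * y := fun x y => by
      simp
    rw [e1, key, h4]
    by_cases hij : i = j
    · subst hij
      simp only [if_true]
      change _ = (q ^ (d i : ℤ) - q ^ (-(d i : ℤ)))⁻¹ • (⇃(K i) - ((((K i)⁻¹)⁻¹ : Uˣ) : U))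
      rw [mul_smul_comm, smul_mul_assoc, ← smul_neg, inv_inv, mul_sub, sub_mul]
      simp
    · simp [hij]
  · apply serre_op
    rw [hYE, hYE]
    refine serre_twist E (fun i => ⇃(K i)) (fun _ => -1) (fun j i => q ^ ((d i : ℤ) * a i j))
      (fun i j => by rw [hC.symm]) g1 (fun i j => eE j i) _
      (fun k => (-1 : ℂ) ^ k * qbinom (q ^ (d i : ℤ)) ((1 - a i j).toNat) k) i j (h5 i j hij)
  · apply serre_op
    rw [hYF, hYF]
    refine serre_twist F (fun i => (K i : U)) (fun i => -q ^ ((d i : ℤ) * a i i)) (fun j i => q ^ ((d i : ℤ) * a i j))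
      (fun i j => by rw [hC.symm]) h1 (fun i j => eF j i) _
      (fun k => (-1 : ℂ) ^ k * qbinom (q ^ (d i : ℤ)) ((1 - a i j).toNat) k) i j (h6 i j hij)

/-- The antipode. -/
structure Anti (E F : Fin n → U) (K : Fin n → Uˣ) (S : U →ₐ[ℂ] Uᵐᵒᵖ) : Prop where
  sE : ∀ i, S (E i) = op (-(⇃(K i) * E i))
  sF : ∀ i, S (F i) = op (-(F i * (K i : U)))
  sK : ∀ i, S (K i : U) = op ⇃(K i)
  sKi : ∀ i, S ⇃(K i) = op (K i : U)

lemma exists_anti (hC : Cartan q a d) (h : UqRels q a d U E F K) (hu : UnivP q a d E F K) : ∃ S : U →ₐ[ℂ] Uᵐᵒᵖ, Anti E F K S := by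
  obtain ⟨S, ⟨h1, h2, h3⟩, -⟩ := hu Uᵐᵒᵖ _ _ _ (uqRels_antipode hC h)
  exact ⟨S, h1, h2, h3, fun i => by
    rw [alg_units S (h3 i)]; rfl⟩

/-- the antipode is surjective -/
lemma Anti.surj {S : U →ₐ[ℂ] Uᵐᵒᵖ} (hS : Anti E F K S) (hU : URel q a d E F K) (u : U) : ∃ v, S v = op u := by
  have : u ∈ (S.range).unop := by
    apply hU.induct
    · intro i
      refine ⟨-(E i * ⇃(K i)), ?_⟩
      change S _ = op (E i)
      rw [map_neg, map_mul, hS.sE, hS.sKi, ← op_mul]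
      simp
    · intro i
      refine ⟨-((K i : U) * F i), ?_⟩
      change S _ = op (F i)
      rw [map_neg, map_mul, hS.sF, hS.sK, ← op_mul]
      simp [mul_assoc]
    · intro i; exact ⟨_, hS.sKi i⟩
    · intro i; exact ⟨_, hS.sK i⟩
  exact this

variable {Δ : U →ₐ[ℂ] U ⊗[ℂ] U} {ε : U →ₐ[ℂ] ℂ}

/-- `x ⊗ y ↦ x S(y)` -/
noncomputable def mS (S : U →ₐ[ℂ] Uᵐᵒᵖ) : U ⊗[ℂ] U →ₗ[ℂ] U :=
  LinearMap.mul' ℂ U ∘ₗ TensorProduct.map LinearMap.id ((opLinearEquiv ℂ).symm.toLinearMap ∘ₗ S.toLinearMap)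

@[simp] lemma mS_tmul (S : U →ₐ[ℂ] Uᵐᵒᵖ) (x y : U) : mS S (x ⊗ₜ y) = x * unop (S y) := by
  simp [mS]

lemma mS_mul (S : U →ₐ[ℂ] Uᵐᵒᵖ) (X Y : U ⊗[ℂ] U) (t : ℂ) (h : mS S Y = t • 1) : mS S (X * Y) = t • mS S X := by
  have key : ∀ x y, mS S ((x ⊗ₜ y) * Y) = x * mS S Y * unop (S y) := by
    intro x y
    clear h
    induction Y using TensorProduct.induction_on with
    | zero => simp
    | tmul x' y' => simp [mul_assoc]
    | add Y Y' h1 h2 => rw [mul_add, map_add, h1, h2, map_add, mul_add, add_mul]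
  induction X using TensorProduct.induction_on with
  | zero => simp
  | tmul x y => rw [key, h]; simp
  | add X X' h1 h2 => rw [add_mul, map_add, h1, h2, map_add, smul_add]

lemma anti_right (hU : URel q a d E F K) (hΔ : Cop E F K Δ) (hE : ∀ i, ε (E i) = 0) (hF : ∀ i, ε (F i) = 0) (hK : ∀ i, ε (K i : U) = 1) {S : U →ₐ[ℂ] Uᵐᵒᵖ} (hS : Anti E F K S) (u : U) :
    mS S (Δ u) = ε u • 1 := by
  have hKi : ∀ i, ε ⇃(K i) = 1 := fun i => by
    have : ε ⇃(K i) * ε (K i : U) = 1 := by rw [← map_mul]; simp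
    rwa [hK, mul_one] at this
  let P : Subalgebra ℂ U :=
    { carrier := {u | mS S (Δ u) = ε u • 1}
      mul_mem' := fun {x y} hx hy => by
        simp only [Set.mem_ofPred_eq] at hx hy ⊢
        rw [map_mul, mS_mul S _ _ _ hy, hx, map_mul, smul_smul, mul_comm]
      one_mem' := by simp [Algebra.TensorProduct.one_def]
      add_mem' := fun {x y} hx hy => by
        simp only [Set.mem_ofPred_eq] at hx hy ⊢
        rw [map_add, map_add, hx, hy, map_add, add_smul]
      zero_mem' := by simp
      algebraMap_mem' := fun r => by
        simp [Algebra.algebraMap_eq_smul_one, Algebra.TensorProduct.one_def] }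
  refine hU.induct P ?_ ?_ ?_ ?_ u
  · intro i; change mS S (Δ (E i)) = ε (E i) • 1; simp [hΔ.dE, hE, hS.sE]
  · intro i; change mS S (Δ (F i)) = ε (F i) • 1; simp [hΔ.dF, hF, hS.sF, hS.sKi]
  · intro i; change mS S (Δ (K i)) = ε (K i) • 1; simp [hΔ.dK, hK, hS.sK]
  · intro i; change mS S (Δ _) = ε _ • 1; simp [hΔ.dKi, hKi, hS.sKi]

lemma anti_cop (hU : URel q a d E F K) (hΔ : Cop E F K Δ) {S : U →ₐ[ℂ] Uᵐᵒᵖ} (hS : Anti E F K S) (u : U) : op (Δ (unop (S u))) = Algebra.TensorProduct.opAlgEquiv ℂ ℂ U U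
      (Algebra.TensorProduct.map S S (copp Δ u)) := by
  have : (AlgHom.op Δ).comp S = ((Algebra.TensorProduct.opAlgEquiv ℂ ℂ U U).toAlgHom.comp
      (Algebra.TensorProduct.map S S)).comp (copp Δ) := by
    apply hU.ext
    · intro i
      apply unop_injective
      simp only [AlgHom.comp_apply, copp_of (hΔ.dE i), map_add, hS.sE, Algebra.TensorProduct.map_tmul]
      change Δ (-(⇃(K i) * E i)) = _
      simp only [map_neg, map_mul, hΔ.dKi, hΔ.dE, mul_add, Algebra.TensorProduct.tmul_mul_tmul, hS.sK, map_one]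
      simp [TensorProduct.neg_tmul, TensorProduct.tmul_neg]
    · intro i
      apply unop_injective
      simp only [AlgHom.comp_apply, copp_of (hΔ.dF i), map_add, hS.sF, Algebra.TensorProduct.map_tmul]
      change Δ (-(F i * (K i : U))) = _
      simp only [map_neg, map_mul, hΔ.dK, hΔ.dF, add_mul, Algebra.TensorProduct.tmul_mul_tmul, hS.sKi, map_one]
      simp [TensorProduct.neg_tmul, TensorProduct.tmul_neg]
    · intro i
      apply unop_injective
      simp only [AlgHom.comp_apply, copp_of' (hΔ.dK i), hS.sK, Algebra.TensorProduct.map_tmul]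
      change Δ (⇃(K i)) = _
      simp [hΔ.dKi]
  exact DFunLike.congr_fun this u

end

/-! ## The quantised coordinate ring: basic structure -/

section

lemma lw_of (hC : Cartan q a d) (hrel : UqRels q a d U E F K) (hu : UnivP q a d E F K) (cd : CD q a d) {V : (Fin n → ℕ) → Type} [∀ c, AddCommGroup (V c)] [∀ c, Module ℂ (V c)]
    {ρ : ∀ c, U →ₐ[ℂ] Module.End ℂ (V c)} (hV : Fam q d E K ρ) (c : Fin n → ℕ) : ∃ c', ∃ v : V c', v ≠ 0 ∧ v ∈ wsp q d K (ρ c') (fun j => -(c j : ℤ)) ∧ ∀ j, ρ c' (F j) v = 0 := by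
  have hU := URel.of_univ hrel hu
  obtain ⟨φ, ⟨h1, h2, h3⟩, -⟩ := hu U _ _ _ (hrel.op hC)
  have h3' : ∀ i, φ ⇃(K i) = (K i : U) := fun i => by
    rw [alg_units φ (h3 i), inv_inv]
  have hφ : ∀ u, φ (φ u) = u := fun u => by
    have : φ.comp φ = AlgHom.id ℂ U := hU.ext (fun i => by simp [h1, h2]) (fun i => by simp [h1, h2])
      (fun i => by simp [h3, h3'])
    exact DFunLike.congr_fun this u
  obtain ⟨v, hv0, hv, hvE⟩ := hV.hw c
  have hsr : SR q d K (ρ c) := ⟨hV.fd c, hV.simp c, hV.sum c, ⟨v, 0, hv0⟩⟩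
  let ρω := (ρ c).comp φ
  have hw : ∀ μ, wsp q d K ρω μ = wsp q d (fun i => (K i)⁻¹) (ρ c) μ := fun μ => by
    ext x; simp only [mem_wsp, ρω, AlgHom.comp_apply, h3]
  have hsω : SR q d K ρω := by
    refine ⟨hV.fd c, fun N hN => hV.simp c N fun u x hx => ?_, ?_, ⟨v, 0, hv0⟩⟩
    · have := hN (φ u) x hx
      simpa [ρω, hφ] using this
    · simp only [hw]; exact (hsr.op hC).sum
  obtain ⟨μ, m, hm0, hm, hmE⟩ := hsω.exists_hw hC hU cd
  obtain ⟨c', rfl⟩ := hsω.dom hC hU cd hm hmE hm0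
  obtain ⟨m', hm'0, hm', hm'E⟩ := hV.hw c'
  obtain ⟨u0, hu0⟩ := simp_orbit hsω.simp hm0 v
  have cmp : ∀ u, ρω u m = 0 → ρ c' u m' = 0 := fun u h =>
    hw_compare hC hU cd hm hmE hm0 (hV.simp c') hm' hm'E h
  have cmp' : ∀ u, ρ c' u m' = 0 → ρω u m = 0 := fun u h =>
    hw_compare hC hU cd hm' hm'E hm'0 hsω.simp hm hmE h
  refine ⟨c', ρ c' u0 m', fun h => hv0 ?_, mem_wsp.2 fun i => ?_, fun i => ?_⟩
  · rw [← hu0]; exact cmp' _ h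
  · have hvm : v ∈ wsp q d K ρω (fun j => -(c j : ℤ)) := by
      rw [hw, wsp_op hC]; convert hv using 2; ext j; simp
    have := cmp ((K i : U) * u0 - q ^ (-(c i : ℤ) * (d i : ℤ)) • u0) (by
      simp only [map_sub, map_mul, map_smul, LinearMap.sub_apply, mul_apply, LinearMap.smul_apply, hu0]
      rw [mem_wsp.1 hvm i, sub_self])
    simpa [sub_eq_zero] using this
  · have := cmp (F i * u0) (by
      simp only [map_mul, mul_apply, hu0]
      simp [ρω, h2, hvE])
    simpa using this

/-- All the data of the quantised coordinate ring, symmetric form. -/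
structure QG (q : ℂ) {n : ℕ} (a : Fin n → Fin n → ℤ) (d : Fin n → ℕ) {U : Type} [Ring U] [Algebra ℂ U] (E F : Fin n → U) (K : Fin n → Uˣ)
    (Δ : U →ₐ[ℂ] U ⊗[ℂ] U) (ε : U →ₐ[ℂ] ℂ) {I : Type} {V : I → Type} [∀ i, AddCommGroup (V i)] [∀ i, Module ℂ (V i)] (ρ : ∀ i, U →ₐ[ℂ] Module.End ℂ (V i))
    {A : Type} [Ring A] [Algebra ℂ A] (ι : A →ₗ[ℂ] (U →ₗ[ℂ] ℂ)) : Prop where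
  C : Cartan q a d
  rel : UqRels q a d U E F K
  univ : UnivP q a d E F K
  cop : Cop E F K Δ
  eE : ∀ i, ε (E i) = 0
  eF : ∀ i, ε (F i) = 0
  eK : ∀ i, ε (K i : U) = 1
  sr : ∀ i, SR q d K (ρ i)
  hw : ∀ c : Fin n → ℕ, ∃ i, ∃ v : V i, v ≠ 0 ∧ v ∈ wsp q d K (ρ i) (fun j => (c j : ℤ)) ∧ ∀ j, ρ i (E j) v = 0
  lw : ∀ c : Fin n → ℕ, ∃ i, ∃ v : V i, v ≠ 0 ∧ v ∈ wsp q d K (ρ i) (fun j => -(c j : ℤ)) ∧ ∀ j, ρ i (F j) v = 0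
  inj : Function.Injective ι
  one : ι 1 = ε.toLinearMap
  mul : ∀ x y, ι (x * y) = conv Δ (ι x) (ι y)
  coef : ∀ i ξ v, ∃ x, ι x = mc (ρ i) ξ v
  gen : ∀ B : Subalgebra ℂ A, (∀ i ξ v x, ι x = mc (ρ i) ξ v → x ∈ B) → B = ⊤

variable {Δ : U →ₐ[ℂ] U ⊗[ℂ] U} {ε : U →ₐ[ℂ] ℂ} {I : Type} {V : I → Type} [∀ i, AddCommGroup (V i)] [∀ i, Module ℂ (V i)] {ρ : ∀ i, U →ₐ[ℂ] Module.End ℂ (V i)} {A : Type} [Ring A] [Algebra ℂ A] {ι : A →ₗ[ℂ] (U →ₗ[ℂ] ℂ)}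

lemma conv_copp (φ ψ : U →ₗ[ℂ] ℂ) : conv (copp Δ) φ ψ = conv Δ ψ φ := by
  ext u
  simp only [conv, LinearMap.comp_apply, AlgHom.toLinearMap_apply, copp, AlgHom.comp_apply]
  induction Δ u using TensorProduct.induction_on with
  | zero => simp
  | tmul x y => simp [mul_comm]
  | add x y h1 h2 => simp only [map_add, h1, h2]

/-- the identification of the opposite algebra with forms -/
def iop (ι : A →ₗ[ℂ] (U →ₗ[ℂ] ℂ)) : Aᵐᵒᵖ →ₗ[ℂ] (U →ₗ[ℂ] ℂ) :=
  ι ∘ₗ (opLinearEquiv ℂ).symm.toLinearMap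

@[simp] lemma iop_op (x : A) : iop ι (op x) = ι x := rfl
lemma iop_apply (x : Aᵐᵒᵖ) : iop ι x = ι (unop x) := rfl

lemma QG.uRel (h : QG q a d E F K Δ ε ρ ι) : URel q a d E F K := URel.of_univ h.rel h.univ

lemma QG.eKi (h : QG q a d E F K Δ ε ρ ι) (i : Fin n) : ε ⇃(K i) = 1 := by
  have : ε ⇃(K i) * ε (K i : U) = 1 := by rw [← map_mul]; simp
  rwa [h.eK, mul_one] at this

lemma QG.opp (h : QG q a d E F K Δ ε ρ ι) : QG q a d F E (fun i => (K i)⁻¹) (copp Δ) ε ρ (iop ι) where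
  C := h.C
  rel := h.rel.op h.C
  univ := h.univ.op h.C
  cop := ⟨fun i => by rw [copp_of (h.cop.dF i), add_comm], fun i => by
    rw [copp_of (h.cop.dE i), inv_inv, add_comm], fun i => copp_of' (h.cop.dKi i)⟩
  eE := h.eF
  eF := h.eE
  eK := h.eKi
  sr i := (h.sr i).op h.C
  hw c := by
    obtain ⟨i, v, h0, h1, h2⟩ := h.lw c
    refine ⟨i, v, h0, ?_, h2⟩
    rw [wsp_op h.C]; exact h1
  lw c := by
    obtain ⟨i, v, h0, h1, h2⟩ := h.hw c
    refine ⟨i, v, h0, ?_, h2⟩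
    rw [wsp_op h.C]; convert h1 using 2; ext j; simp
  inj := h.inj.comp (opLinearEquiv ℂ).symm.injective
  one := h.one
  mul x y := by rw [conv_copp]; exact h.mul _ _
  coef i ξ v := by
    obtain ⟨x, hx⟩ := h.coef i ξ v
    exact ⟨op x, hx⟩
  gen B hB := by
    have := h.gen B.unop (fun i ξ v x hx => hB i ξ v (op x) hx)
    rw [eq_top_iff]
    intro x _
    have : unop x ∈ B.unop := by rw [this]; trivial
    exact this

/-- the dual representation -/
def dualRep (S : U →ₐ[ℂ] Uᵐᵒᵖ) {M : Type*} [AddCommGroup M] [Module ℂ M] (ρ' : U →ₐ[ℂ] Module.End ℂ M) : U →ₐ[ℂ] Module.End ℂ (Module.Dual ℂ M) where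
  toFun u := Module.Dual.transpose (ρ' (unop (S u)))
  map_one' := by
    refine LinearMap.ext fun ξ => LinearMap.ext fun v => ?_
    change ξ (ρ' (unop (S 1)) v) = ξ v
    simp
  map_mul' x y := by
    refine LinearMap.ext fun ξ => LinearMap.ext fun v => ?_
    change ξ (ρ' (unop (S (x * y))) v) = ξ (ρ' (unop (S y)) (ρ' (unop (S x)) v))
    simp
  map_zero' := by simp
  map_add' x y := by simp
  commutes' r := by
    refine LinearMap.ext fun ξ => LinearMap.ext fun v => ?_
    change ξ (ρ' (unop (S (algebraMap ℂ U r))) v) = r • ξ v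
    simp [Algebra.algebraMap_eq_smul_one]

lemma dualRep_apply (S : U →ₐ[ℂ] Uᵐᵒᵖ) {M : Type*} [AddCommGroup M] [Module ℂ M] (ρ' : U →ₐ[ℂ] Module.End ℂ M) (u : U) (ξ : Module.Dual ℂ M) (v : M) : dualRep S ρ' u ξ v = ξ (ρ' (unop (S u)) v) := rfl

lemma SR.dual (hC : Cartan q a d) (hU : URel q a d E F K) {S : U →ₐ[ℂ] Uᵐᵒᵖ} (hS : Anti E F K S) {M : Type*} [AddCommGroup M] [Module ℂ M]
    {ρ' : U →ₐ[ℂ] Module.End ℂ M} (hM : SR q d K ρ') : SR q d K (dualRep S ρ') := by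
  have := hM.fd
  have := hM.nt
  refine ⟨inferInstance, fun N hN => ?_, ?_, inferInstance⟩
  · have h1 := hM.simp N.dualCoannihilator (fun u v hv => by
      rw [Submodule.mem_dualCoannihilator] at hv ⊢
      intro ξ hξ
      obtain ⟨w, hw⟩ := hS.surj hU u
      have := hv _ (hN w ξ hξ)
      rwa [dualRep_apply, hw] at this)
    have h2 : N.dualCoannihilator.dualAnnihilator = N := Subspace.dualCoannihilator_dualAnnihilator_eq
    rcases h1 with h1 | h1
    · right; rw [← h2, h1]; simp
    · left; rw [← h2, h1]; simp
  · obtain ⟨m, b, β, hb⟩ := exists_wt_basis _ hM.sum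
    rw [eq_top_iff, ← b.dualBasis.span_eq, Submodule.span_le]
    rintro _ ⟨k, rfl⟩
    refine mem_iSup_of_mem (-β k) (mem_wsp.2 fun i => b.ext fun l => ?_)
    rw [dualRep_apply, hS.sK, unop_op, wsp_inv hC (hb l), map_smul, LinearMap.smul_apply, Module.Basis.coe_dualBasis, Module.Basis.coord_apply, Module.Basis.repr_self]
    by_cases hkl : l = k
    · subst hkl; simp
    · simp [Finsupp.single_eq_of_ne (Ne.symm hkl)]

variable (h : QG q a d E F K Δ ε ρ ι)

include h

/-- induction principle -/
lemma QG.induct (P : A → Prop) (h1 : P 1) (hadd : ∀ x y, P x → P y → P (x + y)) (hs : ∀ (t : ℂ) x, P x → P (t • x)) (hm : ∀ x y, P x → P y → P (x * y))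
    (hc : ∀ i ξ v x, ι x = mc (ρ i) ξ v → P x) (x : A) : P x := by
  let B : Subalgebra ℂ A :=
    { carrier := {x | P x}
      mul_mem' := fun {x y} hx hy => hm x y hx hy
      one_mem' := h1
      add_mem' := fun {x y} hx hy => hadd x y hx hy
      zero_mem' := by have := hs 0 1 h1; rwa [zero_smul] at this
      algebraMap_mem' := fun r => by rw [Algebra.algebraMap_eq_smul_one]; exact hs _ _ h1 }
  have : x ∈ B := by rw [h.gen B hc]; trivial
  exact this

/-- coefficients of all simple modules are in `A` -/
lemma QG.sr_coef (cd : CD q a d) {M : Type*} [AddCommGroup M] [Module ℂ M] {ρ' : U →ₐ[ℂ] Module.End ℂ M} (hM : SR q d K ρ') (ξ : Module.Dual ℂ M) (v : M) : ∃ x, ι x = mc ρ' ξ v := by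
  obtain ⟨μ, m, hm0, hm, hmE⟩ := hM.exists_hw h.C h.uRel cd
  obtain ⟨c, rfl⟩ := hM.dom h.C h.uRel cd hm hmE hm0
  obtain ⟨i, m', hm'0, hm', hm'E⟩ := h.hw c
  obtain ⟨ζ, z, hz⟩ := hw_coef h.C h.uRel cd hm' hm'E hm'0 hM.simp hm hmE hm0 ξ v
  rw [hz]; exact h.coef i ζ z

/-- the two-sided regular action, existence -/
lemma QG.exists_act (w u : U) (f : A) : ∃ g, ∀ x, ι g x = ι f (w * x * u) := by
  revert w u
  refine h.induct (fun f => ∀ w u, ∃ g, ∀ x, ι g x = ι f (w * x * u)) ?_ ?_ ?_ ?_ ?_ f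
  · intro w u
    exact ⟨(ε w * ε u) • 1, fun x => by simp [h.one]; ring⟩
  · intro f f' h1 h2 w u
    obtain ⟨g, hg⟩ := h1 w u
    obtain ⟨g', hg'⟩ := h2 w u
    exact ⟨g + g', fun x => by simp [hg, hg']⟩
  · intro t f h1 w u
    obtain ⟨g, hg⟩ := h1 w u
    exact ⟨t • g, fun x => by simp [hg]⟩
  · intro f f' h1 h2 w u
    have key : ∀ W T : U ⊗[ℂ] U, ∃ g, ∀ x, ι g x = TensorProduct.lid ℂ ℂ (TensorProduct.map (ι f) (ι f') (W * Δ x * T)) := by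
      intro W T
      induction W using TensorProduct.induction_on with
      | zero => exact ⟨0, fun x => by simp⟩
      | add W W' h1 h2 =>
        obtain ⟨g, hg⟩ := h1
        obtain ⟨g', hg'⟩ := h2
        exact ⟨g + g', fun x => by simp [hg, hg', add_mul]⟩
      | tmul w1 w2 =>
        induction T using TensorProduct.induction_on with
        | zero => exact ⟨0, fun x => by simp⟩
        | add W W' h1 h2 =>
          obtain ⟨g, hg⟩ := h1
          obtain ⟨g', hg'⟩ := h2
          exact ⟨g + g', fun x => by simp [hg, hg', mul_add]⟩
        | tmul u1 u2 =>
          obtain ⟨g, hg⟩ := h1 w1 u1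
          obtain ⟨g', hg'⟩ := h2 w2 u2
          refine ⟨g * g', fun x => ?_⟩
          rw [h.mul]
          simp only [conv, LinearMap.comp_apply, AlgHom.toLinearMap_apply]
          induction Δ x using TensorProduct.induction_on with
          | zero => simp
          | tmul x y => simp [hg, hg']
          | add x y h1 h2 => rw [mul_add, add_mul]; simp only [map_add, LinearEquiv.coe_coe] at h1 h2 ⊢; rw [h1, h2]
    obtain ⟨g, hg⟩ := key (Δ w) (Δ u)
    refine ⟨g, fun x => ?_⟩
    rw [hg, h.mul, ← map_mul, ← map_mul]; rfl
  · intro i ξ v x hx w u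
    obtain ⟨g, hg⟩ := h.coef i (ξ ∘ₗ ρ i w) (ρ i u v)
    exact ⟨g, fun y => by rw [hg, hx]; simp⟩

/-- `A` is stable under the antipode. -/
lemma QG.anti_stable (cd : CD q a d) {S : U →ₐ[ℂ] Uᵐᵒᵖ} (hS : Anti E F K S) (f : A) : ∃ g, ∀ x, ι g x = ι f (unop (S x)) := by
  refine h.induct (fun f => ∃ g, ∀ x, ι g x = ι f (unop (S x))) ?_ ?_ ?_ ?_ ?_ f
  · refine ⟨1, fun x => ?_⟩
    have : (AlgHom.op ε).comp S = (AlgEquiv.toOpposite ℂ ℂ).toAlgHom.comp ε := by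
      apply h.uRel.ext
      · intro i; apply unop_injective; simp [hS.sE, h.eE]
      · intro i; apply unop_injective; simp [hS.sF, h.eF]
      · intro i; apply unop_injective; simp [hS.sK, h.eK, h.eKi]
    have := congrArg unop (DFunLike.congr_fun this x)
    rw [h.one]; simpa using this.symm
  · rintro f f' ⟨g, hg⟩ ⟨g', hg'⟩
    exact ⟨g + g', fun x => by simp [hg, hg']⟩
  · rintro t f ⟨g, hg⟩
    exact ⟨t • g, fun x => by simp [hg]⟩
  · rintro f f' ⟨g, hg⟩ ⟨g', hg'⟩
    refine ⟨g' * g, fun x => ?_⟩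
    have h1 := congrArg unop (anti_cop h.uRel h.cop hS x)
    rw [unop_op] at h1
    rw [h.mul, h.mul, ← conv_copp]
    simp only [conv, LinearMap.comp_apply, AlgHom.toLinearMap_apply, h1]
    induction copp Δ x using TensorProduct.induction_on with
    | zero => simp
    | tmul x y => simp [hg, hg']
    | add x y h1 h2 => simp only [map_add, unop_add, h1, h2]
  · intro i ξ v x hx
    obtain ⟨g, hg⟩ := h.sr_coef cd ((h.sr i).dual h.C h.uRel hS) (Module.Dual.eval ℂ _ v) ξ
    exact ⟨g, fun y => by rw [hg, hx]; rfl⟩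

end

variable {Δ : U →ₐ[ℂ] U ⊗[ℂ] U} {ε : U →ₐ[ℂ] ℂ} {I : Type} {V : I → Type} [∀ i, AddCommGroup (V i)]
    [∀ i, Module ℂ (V i)] {ρ : ∀ i, U →ₐ[ℂ] Module.End ℂ (V i)} {A : Type} [Ring A] [Algebra ℂ A] {ι : A →ₗ[ℂ] (U →ₗ[ℂ] ℂ)}

/-! ## Actions of `U` on `A` -/

section

lemma QG.ext (h : QG q a d E F K Δ ε ρ ι) {f g : A} (hfg : ∀ x, ι f x = ι g x) : f = g :=
  h.inj (LinearMap.ext hfg)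

/-- the two-sided regular action -/
noncomputable def QG.bact (h : QG q a d E F K Δ ε ρ ι) (w u : U) : Module.End ℂ A where
  toFun f := (h.exists_act w u f).choose
  map_add' f g := h.ext fun x => by
    have e1 := (h.exists_act w u (f + g)).choose_spec x
    have e2 := (h.exists_act w u f).choose_spec x
    have e3 := (h.exists_act w u g).choose_spec x
    refine e1.trans ?_
    rw [map_add ι f g, LinearMap.add_apply, map_add ι, LinearMap.add_apply, e2, e3]
  map_smul' t f := h.ext fun x => by
    have e1 := (h.exists_act w u (t • f)).choose_spec x
    have e2 := (h.exists_act w u f).choose_spec x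
    refine e1.trans ?_
    rw [map_smul ι t f, LinearMap.smul_apply, RingHom.id_apply, map_smul ι, LinearMap.smul_apply, e2]

variable (h : QG q a d E F K Δ ε ρ ι)

lemma QG.bact_apply (w u : U) (f : A) (x : U) : ι (h.bact w u f) x = ι f (w * x * u) :=
  (h.exists_act w u f).choose_spec x

/-- left action `u ▷ f` -/
noncomputable def QG.lam : U →ₐ[ℂ] Module.End ℂ A where
  toFun u := h.bact 1 u
  map_one' := LinearMap.ext fun f => h.ext fun x => by simp [h.bact_apply]
  map_mul' u v := LinearMap.ext fun f => h.ext fun x => by simp [h.bact_apply, mul_assoc]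
  map_zero' := LinearMap.ext fun f => h.ext fun x => by simp [h.bact_apply]
  map_add' u v := LinearMap.ext fun f => h.ext fun x => by simp [h.bact_apply, mul_add]
  commutes' r := LinearMap.ext fun f => h.ext fun x => by
    simp [h.bact_apply, Algebra.algebraMap_eq_smul_one]

/-- right action `f ◁ u` -/
noncomputable def QG.rac : U →ₐ[ℂ] (Module.End ℂ A)ᵐᵒᵖ where
  toFun u := op (h.bact u 1)
  map_one' := unop_injective <| LinearMap.ext fun f => h.ext fun x => by simp [h.bact_apply]
  map_mul' u v := unop_injective <| LinearMap.ext fun f => h.ext fun x => by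
    simp [h.bact_apply, mul_assoc]
  map_zero' := unop_injective <| LinearMap.ext fun f => h.ext fun x => by simp [h.bact_apply]
  map_add' u v := unop_injective <| LinearMap.ext fun f => h.ext fun x => by
    simp [h.bact_apply, add_mul]
  commutes' r := unop_injective <| LinearMap.ext fun f => h.ext fun x => by
    simp [h.bact_apply, Algebra.algebraMap_eq_smul_one]

/-- the right action as an endomorphism -/
noncomputable def QG.ra (u : U) : Module.End ℂ A := unop (h.rac u)

@[simp] lemma QG.lam_apply (u : U) (f : A) (x : U) : ι (h.lam u f) x = ι f (x * u) := by
  change ι (h.bact 1 u f) x = _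
  simp [h.bact_apply]

@[simp] lemma QG.ra_apply (u : U) (f : A) (x : U) : ι (h.ra u f) x = ι f (u * x) := by
  change ι (h.bact u 1 f) x = _
  simp [h.bact_apply]

lemma QG.ra_mul (u v : U) : h.ra (u * v) = h.ra v * h.ra u := by simp [QG.ra]
lemma QG.ra_add (u v : U) : h.ra (u + v) = h.ra u + h.ra v := by simp [QG.ra]
lemma QG.ra_smul (t : ℂ) (v : U) : h.ra (t • v) = t • h.ra v := by simp [QG.ra]

lemma QG.lam_ra (u v : U) (f : A) : h.lam u (h.ra v f) = h.ra v (h.lam u f) :=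
  h.ext fun x => by simp [mul_assoc]

lemma QG.bact_eq (w u : U) (f : A) : h.bact w u f = h.ra w (h.lam u f) :=
  h.ext fun x => by simp [h.bact_apply, mul_assoc]

lemma QG.mact (w1 w2 u1 u2 : U) (f g : A) (x : U) : TensorProduct.lid ℂ ℂ (TensorProduct.map (ι f) (ι g) ((w1 ⊗ₜ w2) * Δ x * (u1 ⊗ₜ u2))) = ι (h.bact w1 u1 f * h.bact w2 u2 g) x := by
  rw [h.mul]
  simp only [conv, LinearMap.comp_apply, AlgHom.toLinearMap_apply]
  induction Δ x using TensorProduct.induction_on with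
  | zero => simp
  | tmul x y => simp [h.bact_apply]
  | add x y h1 h2 => rw [mul_add, add_mul]; simp only [map_add, LinearEquiv.coe_coe] at h1 h2 ⊢; rw [h1, h2]

include h in
lemma QG.mul_apply (f g : A) (x : U) : ι (f * g) x = TensorProduct.lid ℂ ℂ (TensorProduct.map (ι f) (ι g) (Δ x)) := by
  rw [h.mul]; rfl

lemma QG.lam_two {u u1 u2 u3 u4 : U} (hu : Δ u = u1 ⊗ₜ u2 + u3 ⊗ₜ u4) (f g : A) : h.lam u (f * g) = h.lam u1 f * h.lam u2 g + h.lam u3 f * h.lam u4 g := h.ext fun x => by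
  have e1 := h.mact 1 1 u1 u2 f g x
  have e2 := h.mact 1 1 u3 u4 f g x
  rw [h.lam_apply, h.mul_apply, map_mul, hu, mul_add, map_add, map_add, map_add, LinearMap.add_apply]
  rw [← Algebra.TensorProduct.one_def, one_mul] at e1 e2
  rw [e1, e2]; rfl

lemma QG.lam_one' {u u1 u2 : U} (hu : Δ u = u1 ⊗ₜ u2) (f g : A) : h.lam u (f * g) = h.lam u1 f * h.lam u2 g := by
  have := h.lam_two (u1 := u1) (u2 := u2) (u3 := 0) (u4 := 0) (by rw [hu]; simp) f g
  simpa using this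

lemma QG.ra_two {u u1 u2 u3 u4 : U} (hu : Δ u = u1 ⊗ₜ u2 + u3 ⊗ₜ u4) (f g : A) : h.ra u (f * g) = h.ra u1 f * h.ra u2 g + h.ra u3 f * h.ra u4 g := h.ext fun x => by
  have e1 := h.mact u1 u2 1 1 f g x
  have e2 := h.mact u3 u4 1 1 f g x
  rw [h.ra_apply, h.mul_apply, map_mul, hu, add_mul, map_add, map_add, map_add, LinearMap.add_apply]
  rw [← Algebra.TensorProduct.one_def, mul_one] at e1 e2
  rw [e1, e2]; rfl

lemma QG.ra_one' {u u1 u2 : U} (hu : Δ u = u1 ⊗ₜ u2) (f g : A) : h.ra u (f * g) = h.ra u1 f * h.ra u2 g := by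
  have := h.ra_two (u1 := u1) (u2 := u2) (u3 := 0) (u4 := 0) (by rw [hu]; simp) f g
  simpa [QG.ra] using this

lemma QG.lam_unit (u : U) : h.lam u 1 = ε u • 1 := h.ext fun x => by
  simp [h.one, mul_comm]
lemma QG.ra_unit (u : U) : h.ra u 1 = ε u • 1 := h.ext fun x => by
  simp [h.one]

/-- bigraded pieces -/
noncomputable def QG.BW (μ ν : Fin n → ℤ) : Submodule ℂ A :=
  wsp q d K h.lam ν ⊓ ⨅ i : Fin n, LinearMap.ker (h.ra (K i : U) - (q ^ (μ i * (d i : ℤ))) • (1 : Module.End ℂ A))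

lemma QG.mem_BW {μ ν : Fin n → ℤ} {f : A} : f ∈ h.BW μ ν ↔ (∀ i, h.lam (K i : U) f = q ^ (ν i * (d i : ℤ)) • f) ∧ (∀ i, h.ra (K i : U) f = q ^ (μ i * (d i : ℤ)) • f) := by
  simp [QG.BW, mem_wsp, sub_eq_zero]

lemma QG.mem_BW' {μ ν : Fin n → ℤ} {f : A} : f ∈ h.BW μ ν ↔ (∀ i x, ι f (x * (K i : U)) = q ^ (ν i * (d i : ℤ)) • ι f x) ∧ (∀ i x, ι f ((K i : U) * x) = q ^ (μ i * (d i : ℤ)) • ι f x) := by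
  rw [h.mem_BW]
  constructor
  · rintro ⟨h1, h2⟩
    exact ⟨fun i x => by rw [← h.lam_apply, h1]; simp, fun i x => by rw [← h.ra_apply, h2]; simp⟩
  · rintro ⟨h1, h2⟩
    exact ⟨fun i => h.ext fun x => by rw [h.lam_apply, h1]; simp, fun i => h.ext fun x => by rw [h.ra_apply, h2]; simp⟩

omit h in
lemma dwt_K {M : Type*} [AddCommGroup M] [Module ℂ M] {ρ' : U →ₐ[ℂ] Module.End ℂ M} (hs : (⨆ μ : Fin n → ℤ, wsp q d K ρ' μ) = ⊤) {μ : Fin n → ℤ} {ξ : Module.Dual ℂ M}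
    (hξ : dwt q d K ρ' μ ξ) (i : Fin n) (x : M) : ξ (ρ' (K i : U) x) = q ^ (μ i * (d i : ℤ)) • ξ x := by
  have hx : x ∈ ⨆ μ : Fin n → ℤ, wsp q d K ρ' μ := by rw [hs]; trivial
  induction hx using Submodule.iSup_induction' with
  | zero => simp
  | add x y _ _ h1 h2 => simp only [map_add, h1, h2, smul_add]
  | mem ν x hx =>
    by_cases hν : ν = μ
    · subst hν; rw [mem_wsp.1 hx]; simp
    · rw [mem_wsp.1 hx, map_smul, hξ ν hν x hx]; simp

lemma QG.coef_BW {M : Type*} [AddCommGroup M] [Module ℂ M] {ρ' : U →ₐ[ℂ] Module.End ℂ M} (hs : (⨆ μ : Fin n → ℤ, wsp q d K ρ' μ) = ⊤) {μ ν : Fin n → ℤ} {ξ : Module.Dual ℂ M} {v : M}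
    (hξ : dwt q d K ρ' μ ξ) (hv : v ∈ wsp q d K ρ' ν) {x : A} (hx : ι x = mc ρ' ξ v) : x ∈ h.BW μ ν := h.mem_BW'.2 ⟨fun i y => by
      rw [hx]; simp only [mc_apply, map_mul, Module.End.mul_apply]; rw [mem_wsp.1 hv i]; simp, fun i y => by
      rw [hx]; simp only [mc_apply, map_mul, Module.End.mul_apply]; rw [dwt_K hs hξ]⟩

lemma QG.mul_BW {μ ν μ' ν' : Fin n → ℤ} {f g : A} (hf : f ∈ h.BW μ ν) (hg : g ∈ h.BW μ' ν') : f * g ∈ h.BW (μ + μ') (ν + ν') := by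
  rw [h.mem_BW] at *
  refine ⟨fun i => ?_, fun i => ?_⟩
  · rw [h.lam_one' (h.cop.dK i), hf.1, hg.1, smul_mul_smul_comm, ← zpow_add₀ h.C.q0, ← add_mul]; rfl
  · rw [h.ra_one' (h.cop.dK i), hf.2, hg.2, smul_mul_smul_comm, ← zpow_add₀ h.C.q0, ← add_mul]; rfl

lemma QG.one_BW : (1 : A) ∈ h.BW 0 0 := by
  rw [h.mem_BW]; simp [h.lam_unit, h.ra_unit, h.eK]

omit h in
lemma dwt_coord (hC : Cartan q a d) {M : Type*} [AddCommGroup M] [Module ℂ M] {ρ' : U →ₐ[ℂ] Module.End ℂ M}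
    {m : ℕ} {b : Module.Basis (Fin m) ℂ M} {β : Fin m → (Fin n → ℤ)} (hb : ∀ k, b k ∈ wsp q d K ρ' (β k)) (k : Fin m) : dwt q d K ρ' (β k) (b.coord k) := fun ν hν x hx => by
  rw [Module.Basis.coord_apply, repr_wt hC hb hx k hν.symm]

omit h in
lemma mc_expand {M : Type*} [AddCommGroup M] [Module ℂ M] {ρ' : U →ₐ[ℂ] Module.End ℂ M} {m : ℕ} (b : Module.Basis (Fin m) ℂ M) (ξ : Module.Dual ℂ M) (v : M) :
    mc ρ' ξ v = ∑ k, ∑ l, (ξ (b k) * b.repr v l) • mc ρ' (b.coord k) (b l) := by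
  ext u
  simp only [LinearMap.sum_apply, LinearMap.smul_apply, mc_apply]
  conv_lhs => rw [← b.sum_repr v, map_sum, map_sum]
  rw [Finset.sum_comm]
  refine sum_congr rfl fun l _ => ?_
  rw [map_smul, map_smul]
  conv_lhs => rw [← b.sum_repr (ρ' u (b l)), map_sum, smul_sum]
  refine sum_congr rfl fun k _ => ?_
  simp only [map_smul, smul_eq_mul, Module.Basis.coord_apply]; ring

lemma QG.sum_BW : (⨆ p : (Fin n → ℤ) × (Fin n → ℤ), h.BW p.1 p.2) = ⊤ := by
  rw [eq_top_iff]
  intro x _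
  refine h.induct (fun x => x ∈ ⨆ p : (Fin n → ℤ) × (Fin n → ℤ), h.BW p.1 p.2) ?_
    (fun x y => Submodule.add_mem _) (fun t x => smul_mem _ t) ?_ ?_ x
  · exact mem_iSup_of_mem (0, 0) h.one_BW
  · intro x y hx hy
    induction hx using Submodule.iSup_induction' with
    | zero => rw [zero_mul]; exact zero_mem _
    | add x x' _ _ h1 h2 => rw [add_mul]; exact add_mem h1 h2
    | mem p x hx =>
      induction hy using Submodule.iSup_induction' with
      | zero => rw [mul_zero]; exact zero_mem _
      | add y y' _ _ h1 h2 => rw [mul_add]; exact add_mem h1 h2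
      | mem p' y hy => exact mem_iSup_of_mem (p + p') (h.mul_BW hx hy)
  · intro i ξ v x hx
    have := (h.sr i).fd
    obtain ⟨m, b, β, hb⟩ := exists_wt_basis _ (h.sr i).sum
    choose y hy using fun k l => h.coef i (b.coord k) (b l)
    have : x = ∑ k, ∑ l, (ξ (b k) * b.repr v l) • y k l := h.inj (by
      rw [hx, mc_expand b]; simp only [map_sum, map_smul, hy])
    rw [this]
    refine Submodule.sum_mem _ fun k _ => Submodule.sum_mem _ fun l _ => smul_mem _ _ ?_
    exact mem_iSup_of_mem (β k, β l) (h.coef_BW (h.sr i).sum (dwt_coord h.C hb k) (hb l) (hy k l))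

/-- local finiteness -/
lemma QG.locfin (f : A) : ∃ N : Submodule ℂ A, N.FG ∧ f ∈ N ∧ ∀ w u, ∀ g ∈ N, h.bact w u g ∈ N := by
  refine h.induct (fun f => ∃ N : Submodule ℂ A, N.FG ∧ f ∈ N ∧ ∀ w u, ∀ g ∈ N, h.bact w u g ∈ N) ?_ ?_ ?_ ?_ ?_ f
  · refine ⟨Submodule.span ℂ {1}, Submodule.fg_span_singleton _, Submodule.mem_span_singleton_self _, fun w u g hg => ?_⟩
    rw [Submodule.mem_span_singleton] at hg ⊢
    obtain ⟨t, rfl⟩ := hg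
    refine ⟨t * ε u * ε w, ?_⟩
    rw [h.bact_eq, map_smul, map_smul, h.lam_unit, map_smul, h.ra_unit]; simp [smul_smul, mul_assoc]
  · rintro f g ⟨N, h1, h2, h3⟩ ⟨N', h1', h2', h3'⟩
    refine ⟨N ⊔ N', h1.sup h1', Submodule.add_mem_sup h2 h2', fun w u g hg => ?_⟩
    obtain ⟨x, hx, y, hy, rfl⟩ := Submodule.mem_sup.1 hg
    rw [map_add]
    exact Submodule.add_mem_sup (h3 w u x hx) (h3' w u y hy)
  · rintro t f ⟨N, h1, h2, h3⟩
    exact ⟨N, h1, N.smul_mem t h2, h3⟩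
  · rintro f g ⟨N, h1, h2, h3⟩ ⟨N', h1', h2', h3'⟩
    refine ⟨N * N', h1.mul h1', Submodule.mul_mem_mul h2 h2', fun w u z hz => ?_⟩
    induction hz using Submodule.mul_induction_on' with
    | add x _ y _ hx hy => rw [map_add]; exact add_mem hx hy
    | mem_mul_mem x hx y hy =>
      have key : ∀ W T : U ⊗[ℂ] U, ∃ z ∈ N * N', ∀ t, ι z t = TensorProduct.lid ℂ ℂ (TensorProduct.map (ι x) (ι y) (W * Δ t * T)) := by
        intro W T
        induction W using TensorProduct.induction_on with
        | zero => exact ⟨0, zero_mem _, fun x => by simp⟩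
        | add W W' h1 h2 =>
          obtain ⟨g, hg0, hg⟩ := h1
          obtain ⟨g', hg0', hg'⟩ := h2
          exact ⟨g + g', add_mem hg0 hg0', fun x => by simp [hg, hg', add_mul]⟩
        | tmul w1 w2 =>
          induction T using TensorProduct.induction_on with
          | zero => exact ⟨0, zero_mem _, fun x => by simp⟩
          | add W W' h1 h2 =>
            obtain ⟨g, hg0, hg⟩ := h1
            obtain ⟨g', hg0', hg'⟩ := h2
            exact ⟨g + g', add_mem hg0 hg0', fun x => by simp [hg, hg', mul_add]⟩
          | tmul u1 u2 =>
            exact ⟨_, Submodule.mul_mem_mul (h3 w1 u1 x hx) (h3' w2 u2 y hy), fun t => (h.mact _ _ _ _ _ _ _).symm⟩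
      obtain ⟨z, hz, hz'⟩ := key (Δ w) (Δ u)
      have : h.bact w u (x * y) = z := h.ext fun t => by
        rw [h.bact_apply, h.mul_apply, map_mul Δ, map_mul Δ, hz']
      rwa [this]
  · intro i ξ v x hx
    have := (h.sr i).fd
    let R : Submodule ℂ (U →ₗ[ℂ] ℂ) := LinearMap.range ((ρ i).toLinearMap.dualMap)
    refine ⟨R.comap ι, ?_, ?_, ?_⟩
    · rw [← Submodule.fg_top]
      let g : R.comap ι →ₗ[ℂ] R := ι.restrict (fun x hx => hx)
      have hg : Function.Injective g := fun x y hxy => Subtype.ext (h.inj (congrArg Subtype.val hxy))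
      exact (FiniteDimensional.of_injective g hg).fg_top
    · refine ⟨ξ ∘ₗ LinearMap.applyₗ v, ?_⟩
      rw [hx]; ext u; rfl
    · rintro w u g ⟨ψ, hψ⟩
      refine ⟨ψ ∘ₗ LinearMap.mulLeft ℂ (ρ i w) ∘ₗ LinearMap.mulRight ℂ (ρ i u), ?_⟩
      ext x
      rw [h.bact_apply, ← hψ]; simp [mul_assoc]

omit h in
/-- words that shift weights act nilpotently on finite dimensional pieces -/
lemma words_nilp (hC : Cartan q a d) (cd : CD q a d) {M : Type*} [AddCommGroup M] [Module ℂ M] (D : Fin n → Module.End ℂ M) (T : List (Fin n) → Module.End ℂ M) (s : ℤ) (hs : s = 1 ∨ s = -1)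
    (hT : ∀ l μ x, (∀ i, D i x = q ^ (μ i * (d i : ℤ)) • x) → ∀ i, D i (T l x) = q ^ ((μ + s • bw a l) i * (d i : ℤ)) • T l x) (N : Submodule ℂ M) (hN : N.FG) (hTN : ∀ l, ∀ x ∈ N, T l x ∈ N)
    {x : M} {μ : Fin n → ℤ} (hxN : x ∈ N) (hx : ∀ i, D i x = q ^ (μ i * (d i : ℤ)) • x) : ∃ N : ℕ, ∀ l : List (Fin n), N < l.length → T l x = 0 := by
  let Ω := {ν : Fin n → ℤ // ∃ y ∈ N, y ≠ 0 ∧ ∀ i, D i y = q ^ (ν i * (d i : ℤ)) • y}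
  choose y hyN hy0 hy using fun ν : Ω => ν.2
  have hli : LinearIndependent ℂ (fun ν : Ω => (⟨y ν, hyN ν⟩ : N)) := by
    rw [linearIndependent_iff']
    intro S g hg ν hν
    have := joint_eig D (fun (ν : Ω) i => q ^ (ν.1 i * (d i : ℤ)))
      (fun ν ν' hh => Subtype.ext (hC.eig_inj hh)) S (fun ν => g ν • y ν)
      (fun ν _ k => by rw [map_smul, hy, smul_comm]) (by
        have := congrArg Subtype.val hg
        simpa using this) ν hν
    exact (smul_eq_zero.1 this).resolve_right (hy0 ν)
  have hfd : Module.Finite ℂ N := Module.Finite.iff_fg.2 hN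
  have hfin : Finite Ω := hli.finite
  obtain ⟨B, hB⟩ : ∃ B : ℕ, ∀ ν : Ω, (cd.ht ν.1).natAbs ≤ B := by
    obtain ⟨B, hB⟩ := (Set.finite_range (fun ν : Ω => (cd.ht ν.1).natAbs)).bddAbove
    exact ⟨B, fun ν => hB ⟨ν, rfl⟩⟩
  refine ⟨B + (cd.ht μ).natAbs, fun l hl => ?_⟩
  by_contra hne
  have h1 := hB ⟨μ + s • bw a l, _, hTN l x hxN, hne, hT l μ x hx⟩
  have h2 := cd.ht_bw l
  have h3 := cd.hp_pos
  simp only [map_add, map_zsmul, h2, smul_eq_mul] at h1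
  have h4 : (l.length : ℤ) ≤ cd.hp * l.length := le_mul_of_one_le_left (by positivity) h3
  rcases hs with rfl | rfl
  · rw [one_mul] at h1; omega
  · rw [neg_one_mul] at h1; omega

/-- Hopf module lemma -/
theorem QG.hopf (cd : CD q a d) (J : Submodule ℂ A) (hJ : ∀ x ∈ J, ∀ y, x * y ∈ J) (hU : ∀ u, ∀ x ∈ J, h.lam u x ∈ J) (hne : J ≠ ⊥) : (1 : A) ∈ J := by
  obtain ⟨S, hS⟩ := exists_anti h.C h.rel h.univ
  obtain ⟨f0, hf0, hf00⟩ := Submodule.exists_mem_ne_zero_of_ne_bot hne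
  obtain ⟨u0, hu0⟩ : ∃ u, ι f0 u ≠ 0 := by
    by_contra hcon
    push Not at hcon
    exact hf00 (h.ext fun x => by rw [hcon]; simp)
  set f := h.lam u0 f0 with hf
  have hfJ : f ∈ J := hU u0 f0 hf0
  have hf1 : ι f 1 ≠ 0 := by rw [hf, h.lam_apply, one_mul]; exact hu0
  obtain ⟨N, hN, hfN, hNs⟩ := h.locfin f
  let M : Submodule ℂ A := LinearMap.range (orb h.lam f)
  have hMN : M ≤ N := by rintro _ ⟨u, rfl⟩; exact hNs 1 u f hfN
  have hMJ : M ≤ J := by rintro _ ⟨u, rfl⟩; exact hU u f hfJ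
  have : Module.Finite ℂ N := Module.Finite.iff_fg.2 hN
  have hMf : FiniteDimensional ℂ M := Submodule.finiteDimensional_of_le hMN
  let ev : U → Module.Dual ℂ M := fun x => (LinearMap.applyₗ x) ∘ₗ ι ∘ₗ M.subtype
  have hspan : Submodule.span ℂ (Set.range ev) = ⊤ := by
    have h1 : (Submodule.span ℂ (Set.range ev)).dualCoannihilator = ⊥ := by
      rw [eq_bot_iff]
      intro m hm
      rw [Submodule.mem_dualCoannihilator] at hm
      refine Subtype.ext (h.ext fun x => ?_)
      have := hm _ (subset_span ⟨x, rfl⟩)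
      simpa [ev] using this
    rw [← Subspace.dualCoannihilator_dualAnnihilator_eq (W := Submodule.span ℂ (Set.range ev)), h1]
    simp
  have hθ : ∀ φ : Module.Dual ℂ M, ∃ g : A, ∀ u, ι g u = φ ⟨h.lam u f, ⟨u, rfl⟩⟩ := by
    intro φ
    have hφ : φ ∈ Submodule.span ℂ (Set.range ev) := by rw [hspan]; trivial
    induction hφ using span_induction with
    | zero => exact ⟨0, fun u => by simp⟩
    | add φ φ' _ _ h1 h2 =>
      obtain ⟨g, hg⟩ := h1
      obtain ⟨g', hg'⟩ := h2
      exact ⟨g + g', fun u => by simp [hg, hg']⟩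
    | smul t φ _ h1 =>
      obtain ⟨g, hg⟩ := h1
      exact ⟨t • g, fun u => by simp [hg]⟩
    | mem φ hφ =>
      obtain ⟨x, rfl⟩ := hφ
      exact ⟨h.ra x f, fun u => by simp [ev]⟩
  let b := Module.finBasis ℂ M
  choose θ hθ' using fun k => hθ (b.coord k)
  choose g hg using fun k => h.anti_stable cd hS (θ k)
  have key : ∑ k, (b k : A) * g k = ι f 1 • 1 := by
    refine h.ext fun x => ?_
    have e1 : ∀ T : U ⊗[ℂ] U, ∑ k, TensorProduct.lid ℂ ℂ (TensorProduct.map (ι (b k : A)) (ι (g k)) T) = ι f (mS S T) := by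
      intro T
      induction T using TensorProduct.induction_on with
      | zero => simp
      | add X Y h1 h2 => simp only [map_add, sum_add_distrib, h1, h2]
      | tmul x y =>
        rw [mS_tmul, ← h.lam_apply]
        have h2 : h.lam (unop (S y)) f = ∑ k, ι (g k) y • (b k : A) := by
          have := b.sum_repr ⟨h.lam (unop (S y)) f, ⟨_, rfl⟩⟩
          have := congrArg Subtype.val this
          simp only [Submodule.coe_sum, Submodule.coe_smul] at this
          rw [← this]
          refine sum_congr rfl fun k _ => ?_
          rw [hg, hθ']; rfl
        rw [h2]
        simp [mul_comm]
    rw [map_sum, LinearMap.sum_apply]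
    simp only [h.mul_apply]
    rw [e1, anti_right h.uRel h.cop h.eE h.eF h.eK hS]
    simp [h.one, mul_comm]
  have : ι f 1 • (1 : A) ∈ J := by
    rw [← key]
    exact Submodule.sum_mem _ fun k _ => hJ _ (hMJ (b k).2) _
  exact (Submodule.smul_mem_iff _ hf1).1 this

end

/-! ## An abstract noetherianity criterion -/

section noeth

variable {A : Type*} [Ring A] [Algebra ℂ A] {N : ℕ} (u : Fin N → A) (w : Fin N → ℕ)

/-- `q`-commutation up to lower order terms -/
def QComm : Prop := ∀ i j, ∃ c : ℂ, c ≠ 0 ∧ u i * u j - c • (u j * u i) ∈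
  Submodule.span ℂ {x : A | ∃ s t, w s + w t < w i + w j ∧ x = u s * u t}

/-- products of words -/
def wpr (l : List (Fin N)) : A := (l.map u).prod
/-- weights of words -/
def wwt (l : List (Fin N)) : ℕ := (l.map w).sum
/-- low weight part -/
def Wlow (k : ℕ) : Submodule ℂ A := Submodule.span ℂ {x : A | ∃ l, wwt w l < k ∧ x = wpr u l}

variable {u w}

lemma Wlow_mul_left (l : List (Fin N)) {k : ℕ} {x : A} (hx : x ∈ Wlow u w k) : wpr u l * x ∈ Wlow u w (wwt w l + k) := by
  induction hx using span_induction with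
  | zero => rw [mul_zero]; exact zero_mem _
  | add x y _ _ h1 h2 => rw [mul_add]; exact add_mem h1 h2
  | smul t x _ h1 => rw [mul_smul_comm]; exact smul_mem _ _ h1
  | mem x hx =>
    obtain ⟨l', hl', rfl⟩ := hx
    refine subset_span ⟨l ++ l', ?_, ?_⟩
    · simp only [wwt, List.map_append, List.sum_append] at *; omega
    · simp [wpr]

lemma Wlow_mul_right (l : List (Fin N)) {k : ℕ} {x : A} (hx : x ∈ Wlow u w k) : x * wpr u l ∈ Wlow u w (k + wwt w l) := by
  induction hx using span_induction with
  | zero => rw [zero_mul]; exact zero_mem _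
  | add x y _ _ h1 h2 => rw [add_mul]; exact add_mem h1 h2
  | smul t x _ h1 => rw [smul_mul_assoc]; exact smul_mem _ _ h1
  | mem x hx =>
    obtain ⟨l', hl', rfl⟩ := hx
    refine subset_span ⟨l' ++ l, ?_, ?_⟩
    · simp only [wwt, List.map_append, List.sum_append] at *; omega
    · simp [wpr]

lemma QComm.perm (H : QComm u w) {l l' : List (Fin N)} (hl : l.Perm l') : ∃ c : ℂ, c ≠ 0 ∧ wpr u l - c • wpr u l' ∈ Wlow u w (wwt w l) := by
  induction hl with
  | nil => exact ⟨1, one_ne_zero, by simp⟩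
  | @cons x l l' _ ih =>
    obtain ⟨c, hc, h1⟩ := ih
    refine ⟨c, hc, ?_⟩
    have := Wlow_mul_left [x] h1
    simp only [wpr, wwt, List.map_cons, List.map_nil, List.prod_cons, List.prod_nil, List.sum_cons, List.sum_nil, mul_one, add_zero] at this ⊢
    rwa [mul_sub, mul_smul_comm] at this
  | swap x y l =>
    obtain ⟨c, hc, h1⟩ := H y x
    refine ⟨c, hc, ?_⟩
    have h2 : u y * u x - c • (u x * u y) ∈ Wlow u w (w y + w x) := by
      refine Submodule.span_mono ?_ h1
      rintro _ ⟨s, t, hst, rfl⟩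
      exact ⟨[s, t], by simpa [wwt] using hst, by simp [wpr]⟩
    have := Wlow_mul_right l h2
    simp only [wpr, wwt, List.map_cons, List.prod_cons, List.sum_cons] at this ⊢
    rw [sub_mul, smul_mul_assoc] at this
    simpa only [mul_assoc, add_assoc] using this
  | @trans l1 l2 l3 h12 _ ih1 ih2 =>
    obtain ⟨c, hc, h1⟩ := ih1
    obtain ⟨c', hc', h2⟩ := ih2
    refine ⟨c * c', mul_ne_zero hc hc', ?_⟩
    have hw : wwt w l2 = wwt w l1 := ((h12.map w).sum_eq).symm
    rw [hw] at h2
    have := add_mem h1 (smul_mem _ c h2)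
    rwa [smul_sub, sub_add_sub_cancel, smul_smul] at this

/-- normal form word -/
def nfw (e : Fin N → ℕ) : List (Fin N) := (List.finRange N).flatMap fun i => List.replicate (e i) i

lemma count_nfw (e : Fin N → ℕ) (j : Fin N) : (nfw e).count j = e j := by
  rw [nfw, List.count_flatMap]
  have : (List.count j ∘ fun i => List.replicate (e i) i) = fun i => if i = j then e i else 0 := by
    funext i; simp [List.count_replicate]
  rw [this]
  have h2 := List.sum_ofFn (f := fun i => if i = j then e i else 0)
  rw [List.ofFn_eq_map] at h2
  rw [h2]; simp

lemma perm_nfw (l : List (Fin N)) : l.Perm (nfw fun i => l.count i) := by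
  rw [List.perm_iff_count]; intro j; rw [count_nfw]

variable (w) in
/-- monomial order key -/
def mkey (e : Fin N → ℕ) : ℕ ×ₗ Lex (Fin N → ℕ) := toLex (∑ i, e i * w i, toLex e)

lemma wwt_nfw (l : List (Fin N)) : wwt w l = ∑ i, l.count i * w i := by
  induction l with
  | nil => simp [wwt]
  | cons x l ih =>
    have : wwt w (x :: l) = w x + wwt w l := by simp [wwt]
    rw [this, ih]
    simp only [List.count_cons, add_mul, sum_add_distrib]
    simp [add_comm]

lemma mkey_lt {e e' : Fin N → ℕ} (f : Fin N → ℕ) (h : mkey w e < mkey w e') : mkey w (e + f) < mkey w (e' + f) := by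
  have : ∀ e, mkey w (e + f) = mkey w e + mkey w f := fun e => by
    simp [mkey, add_mul, sum_add_distrib]; rfl
  rw [this, this]
  exact (add_lt_add_iff_right _).2 h

variable (u w) in
/-- lower part for the monomial order -/
def Mlow (e : Fin N → ℕ) : Submodule ℂ A :=
  Submodule.span ℂ {x : A | ∃ e', mkey w e' < mkey w e ∧ x = wpr u (nfw e')}

lemma QComm.low (H : QComm u w) (k : ℕ) : Wlow u w k ≤ Submodule.span ℂ {x : A | ∃ e' : Fin N → ℕ, ∑ i, e' i * w i < k ∧ x = wpr u (nfw e')} := by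
  induction k using Nat.strong_induction_on with
  | _ k ih =>
    refine Submodule.span_le.2 ?_
    rintro _ ⟨l, hl, rfl⟩
    obtain ⟨c, hc, h1⟩ := H.perm (perm_nfw l)
    have h2 := ih _ hl h1
    have h3 : wpr u l = (wpr u l - c • wpr u (nfw fun i => l.count i)) + c • wpr u (nfw fun i => l.count i) := by abel
    rw [h3]
    refine add_mem (Submodule.span_mono ?_ h2) (smul_mem _ _ (subset_span
      ⟨_, ?_, rfl⟩))
    · rintro _ ⟨e, he, rfl⟩; exact ⟨e, he.trans hl, rfl⟩
    · rw [wwt_nfw] at hl; exact hl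

lemma QComm.lead (H : QComm u w) (l : List (Fin N)) : ∃ c : ℂ, c ≠ 0 ∧ wpr u l - c • wpr u (nfw fun i => l.count i) ∈ Mlow u w (fun i => l.count i) := by
  obtain ⟨c, hc, h1⟩ := H.perm (perm_nfw l)
  refine ⟨c, hc, Submodule.span_mono ?_ (H.low _ h1)⟩
  rintro _ ⟨e, he, rfl⟩
  refine ⟨e, ?_, rfl⟩
  rw [wwt_nfw] at he
  exact Prod.Lex.toLex_lt_toLex.2 (Or.inl he)

lemma QComm.step (H : QComm u w) (j : Fin N) (e : Fin N → ℕ) : ∃ c : ℂ, c ≠ 0 ∧ u j * wpr u (nfw e) - c • wpr u (nfw (e + Pi.single j 1)) ∈ Mlow u w (e + Pi.single j 1) := by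
  obtain ⟨c, hc, h1⟩ := H.lead (j :: nfw e)
  have : (fun i => (j :: nfw e).count i) = e + Pi.single j 1 := by
    funext i
    simp only [List.count_cons, count_nfw, Pi.add_apply, Pi.single_apply, beq_iff_eq]
    simp only [eq_comm]
  rw [this] at h1
  exact ⟨c, hc, by simpa [wpr] using h1⟩

lemma QComm.Mlow_mul (H : QComm u w) (j : Fin N) {e : Fin N → ℕ} {x : A} (hx : x ∈ Mlow u w e) : u j * x ∈ Mlow u w (e + Pi.single j 1) := by
  induction hx using span_induction with
  | zero => rw [mul_zero]; exact zero_mem _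
  | add x y _ _ h1 h2 => rw [mul_add]; exact add_mem h1 h2
  | smul t x _ h1 => rw [mul_smul_comm]; exact smul_mem _ _ h1
  | mem x hx =>
    obtain ⟨e', he, rfl⟩ := hx
    obtain ⟨c, hc, h1⟩ := H.step j e'
    have hlt := mkey_lt (Pi.single j 1) he
    rw [← sub_add_cancel (u j * wpr u (nfw e')) (c • wpr u (nfw (e' + Pi.single j 1)))]
    refine add_mem (Submodule.span_mono ?_ h1) (smul_mem _ _ (subset_span ⟨_, hlt, rfl⟩))
    rintro _ ⟨e2, he2, rfl⟩; exact ⟨e2, he2.trans hlt, rfl⟩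

variable (u w) in
/-- leading exponents -/
def LEx (I : Submodule A A) : Set (Fin N → ℕ) :=
  {e | ∃ x ∈ I, ∃ c : ℂ, c ≠ 0 ∧ x - c • wpr u (nfw e) ∈ Mlow u w e}

lemma LEx_mono {I J : Submodule A A} (h : I ≤ J) : LEx u w I ⊆ LEx u w J := by
  rintro e ⟨x, hx, r⟩; exact ⟨x, h hx, r⟩

lemma QComm.LEx_single (H : QComm u w) {I : Submodule A A} {e : Fin N → ℕ} (he : e ∈ LEx u w I) (j : Fin N) : e + Pi.single j 1 ∈ LEx u w I := by
  obtain ⟨x, hx, c, hc, h1⟩ := he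
  obtain ⟨c', hc', h2⟩ := H.step j e
  refine ⟨u j * x, I.smul_mem _ hx, c * c', mul_ne_zero hc hc', ?_⟩
  have := add_mem (H.Mlow_mul j h1) (smul_mem _ c h2)
  rwa [mul_sub, mul_smul_comm, smul_sub, sub_add_sub_cancel, smul_smul] at this

lemma QComm.LEx_add (H : QComm u w) {I : Submodule A A} (f : Fin N → ℕ) : ∀ {e : Fin N → ℕ}, e ∈ LEx u w I → e + f ∈ LEx u w I := by
  intro e he
  have key : ∀ s : Finset (Fin N), e + ∑ j ∈ s, f j • (Pi.single j 1 : Fin N → ℕ) ∈ LEx u w I := by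
    intro s
    induction s using Finset.induction_on with
    | empty => simpa using he
    | insert j s hj ih =>
      rw [Finset.sum_insert hj, add_left_comm, add_comm]
      generalize e + ∑ j ∈ s, f j • (Pi.single j 1 : Fin N → ℕ) = g at ih
      induction f j with
      | zero => simpa using ih
      | succ k ih2 => rw [add_smul, one_smul, ← add_assoc]; exact H.LEx_single ih2 j
  have := key Finset.univ
  convert this
  funext i; simp [Finset.sum_apply, Pi.single_apply]

lemma span_cases {p : (Fin N → ℕ) → Prop} {x : A} (hx : x ∈ Submodule.span ℂ {x : A | ∃ e', p e' ∧ x = wpr u (nfw e')}) : x = 0 ∨ ∃ e', p e' ∧ ∃ c : ℂ, x - c • wpr u (nfw e') ∈ Mlow u w e' := by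
  have mono : ∀ {e1 e2 : Fin N → ℕ}, mkey w e1 ≤ mkey w e2 → Mlow u w e1 ≤ Mlow u w e2 := by
    intro e1 e2 h12
    refine Submodule.span_mono ?_
    rintro _ ⟨e, he, rfl⟩; exact ⟨e, he.trans_le h12, rfl⟩
  induction hx using span_induction with
  | zero => left; rfl
  | smul t x _ h1 =>
    rcases h1 with rfl | ⟨e', he, c, h1⟩
    · left; simp
    · right; exact ⟨e', he, t * c, by rw [mul_smul, ← smul_sub]; exact smul_mem _ _ h1⟩
  | mem x hx =>
    obtain ⟨e', he, rfl⟩ := hx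
    right; exact ⟨e', he, 1, by simp⟩
  | add x y _ _ h1 h2 =>
    rcases h1 with rfl | ⟨e1, he1, c1, h1⟩
    · simpa using h2
    rcases h2 with rfl | ⟨e2, he2, c2, h2⟩
    · right; simpa using ⟨e1, he1, c1, h1⟩
    right
    have low : ∀ {e1 e2 : Fin N → ℕ} {c : ℂ} {x : A}, mkey w e1 < mkey w e2 → x - c • wpr u (nfw e1) ∈ Mlow u w e1 → x ∈ Mlow u w e2 := by
      intro e1 e2 c x h12 hx
      rw [← sub_add_cancel x (c • wpr u (nfw e1))]
      exact add_mem (mono h12.le hx) (smul_mem _ _ (subset_span ⟨_, h12, rfl⟩))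
    rcases lt_trichotomy (mkey w e1) (mkey w e2) with h12 | h12 | h12
    · refine ⟨e2, he2, c2, ?_⟩
      rw [add_sub_assoc]; exact add_mem (low h12 h1) h2
    · have : e1 = e2 := by
        have := congrArg (fun z => (ofLex z).2) h12
        exact this
      subst this
      refine ⟨e1, he1, c1 + c2, ?_⟩
      rw [add_smul, add_sub_add_comm]; exact add_mem h1 h2
    · refine ⟨e1, he1, c1, ?_⟩
      rw [add_sub_right_comm]; exact add_mem h1 (low h12 h2)

lemma QComm.top (H : QComm u w) (hgen : Algebra.adjoin ℂ (Set.range u) = ⊤) (x : A) : x = 0 ∨ ∃ e, ∃ c : ℂ, x - c • wpr u (nfw e) ∈ Mlow u w e := by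
  -- `x` is a combination of words
  have h1 : x ∈ Submodule.span ℂ (Set.range (wpr u)) := by
    have hx : x ∈ Algebra.adjoin ℂ (Set.range u) := by rw [hgen]; trivial
    rw [← Subalgebra.mem_toSubmodule, Algebra.adjoin_eq_span] at hx
    refine Submodule.span_mono ?_ hx
    intro y hy
    induction hy using Submonoid.closure_induction with
    | mem y hy => obtain ⟨j, rfl⟩ := hy; exact ⟨[j], by simp [wpr]⟩
    | one => exact ⟨[], by simp [wpr]⟩
    | mul y z _ _ hy hz =>
      obtain ⟨l, rfl⟩ := hy; obtain ⟨l', rfl⟩ := hz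
      exact ⟨l ++ l', by simp [wpr]⟩
  have h2 : ∃ k, x ∈ Wlow u w k := by
    induction h1 using span_induction with
    | zero => exact ⟨0, zero_mem _⟩
    | smul t x _ h1 => obtain ⟨k, hk⟩ := h1; exact ⟨k, smul_mem _ _ hk⟩
    | mem x hx => obtain ⟨l, rfl⟩ := hx; exact ⟨_, subset_span ⟨l, Nat.lt_succ_self _, rfl⟩⟩
    | add x y _ _ h1 h2 =>
      obtain ⟨k, hk⟩ := h1
      obtain ⟨k', hk'⟩ := h2
      have mono : ∀ {a b : ℕ}, a ≤ b → Wlow u w a ≤ Wlow u w b := by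
        intro a b hab
        refine Submodule.span_mono ?_
        rintro _ ⟨e, he, rfl⟩; exact ⟨e, he.trans_le hab, rfl⟩
      exact ⟨k + k', add_mem (mono (by omega) hk) (mono (by omega) hk')⟩
  obtain ⟨k, hk⟩ := h2
  have h3 := H.low k hk
  rcases span_cases (w := w) h3 with h4 | ⟨e', _, r⟩
  · left; exact h4
  · right; exact ⟨e', r⟩

theorem QComm.noeth (H : QComm u w) (hgen : Algebra.adjoin ℂ (Set.range u) = ⊤) : IsNoetherianRing A := by
  have key : ∀ I J : Submodule A A, I ≤ J → LEx u w J ⊆ LEx u w I → J ≤ I := by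
    intro I J hIJ hLE
    have wf : WellFounded (fun e e' : Fin N → ℕ => mkey w e < mkey w e') := InvImage.wf (mkey w) wellFounded_lt
    have main : ∀ e : Fin N → ℕ, ∀ x ∈ J, ∀ c : ℂ, x - c • wpr u (nfw e) ∈ Mlow u w e → x ∈ I := by
      intro e
      induction e using wf.induction with
      | _ e ih =>
        intro x hx c hxc
        have low : ∀ x ∈ J, x ∈ Mlow u w e → x ∈ I := by
          intro x hx hxe
          rcases span_cases hxe with rfl | ⟨e', he', c', hc'⟩
          · exact I.zero_mem
          · exact ih e' he' x hx c' hc'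
        by_cases hc : c = 0
        · subst hc; rw [zero_smul, sub_zero] at hxc; exact low x hx hxc
        · obtain ⟨y, hy, t, ht, hyt⟩ := hLE ⟨x, hx, c, hc, hxc⟩
          have hsm : ∀ (z : ℂ) (y : A) (L : Submodule A A), y ∈ L → z • y ∈ L := fun z y L hy => by
            rw [Algebra.smul_def]; exact L.smul_mem _ hy
          have h1 : x - (c * t⁻¹) • y ∈ I := by
            refine low _ (J.sub_mem hx (hsm _ _ _ (hIJ hy))) ?_
            have := sub_mem hxc (smul_mem _ (c * t⁻¹) hyt)
            rwa [smul_sub, smul_smul, mul_assoc, inv_mul_cancel₀ ht, mul_one, sub_sub_sub_cancel_right] at this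
          have := I.add_mem h1 (hsm (c * t⁻¹) y I hy)
          rwa [sub_add_cancel] at this
    intro x hx
    rcases H.top hgen x with rfl | ⟨e, c, hc⟩
    · exact I.zero_mem
    · exact main e x hx c hc
  rw [isNoetherianRing_iff, isNoetherian_iff', wellFoundedGT_iff_monotone_chain_condition']
  intro f
  by_contra hcon0
  push Not at hcon0
  choose g hg1 hg2 using hcon0
  have h1 : ∀ k, ∃ e, e ∈ LEx u w (f (g k)) ∧ e ∉ LEx u w (f k) := by
    intro k
    by_contra hcon
    push Not at hcon
    exact absurd (key _ _ (hg2 k).le hcon) (hg2 k).not_ge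
  have hsub : ∃ s : ℕ → ℕ, ∀ i j, i < j → g (s i) ≤ s j := by
    have hmono : StrictMono (fun k => (fun z => z + g z + 1)^[k] 0) := strictMono_nat_of_lt_succ fun k => by
      simp only [Function.iterate_succ_apply']; omega
    refine ⟨fun k => (fun z => z + g z + 1)^[k] 0, fun i j hij => ?_⟩
    refine le_trans ?_ (hmono.monotone (Nat.succ_le_of_lt hij))
    simp only [Nat.succ_eq_add_one, Function.iterate_succ_apply']; omega
  obtain ⟨s, hs⟩ := hsub
  choose e' he1' he2' using h1
  obtain ⟨i, j, hij, hle⟩ := wellQuasiOrdered_le (e' ∘ s)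
  set e := e' ∘ s
  have he2 : ∀ j, e j ∉ LEx u w (f (s j)) := fun j => he2' _
  have h3 := LEx_mono (f.monotone (hs i j hij)) (he1' (s i))
  have h4 := H.LEx_add (e j - e i) (e := e i) h3
  rw [add_tsub_cancel_of_le hle] at h4
  exact he2 j h4

lemma QComm.opp (H : QComm u w) : QComm (fun i => op (u i)) w := by
  intro i j
  obtain ⟨c, hc, h1⟩ := H j i
  refine ⟨c, hc, ?_⟩
  have h2 := Submodule.mem_map_of_mem (f := (opLinearEquiv ℂ : A ≃ₗ[ℂ] Aᵐᵒᵖ).toLinearMap) h1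
  rw [Submodule.map_span] at h2
  refine Submodule.span_mono ?_ h2
  rintro _ ⟨_, ⟨s, t, hst, rfl⟩, rfl⟩
  exact ⟨t, s, by omega, rfl⟩

theorem QComm.noeth_op (H : QComm u w) (hgen : Algebra.adjoin ℂ (Set.range u) = ⊤) : IsNoetherianRing Aᵐᵒᵖ := by
  refine H.opp.noeth ?_
  rw [eq_top_iff]
  intro x _
  have hx : unop x ∈ Algebra.adjoin ℂ (Set.range u) := by rw [hgen]; trivial
  rw [← op_unop x]
  generalize unop x = y at hx
  induction hx using Algebra.adjoin_induction with
  | mem y hy => obtain ⟨j, rfl⟩ := hy; exact Algebra.subset_adjoin ⟨j, rfl⟩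
  | algebraMap r => exact Subalgebra.algebraMap_mem _ r
  | add x y _ _ h1 h2 => rw [op_add]; exact Subalgebra.add_mem _ h1 h2
  | mul x y _ _ h1 h2 => rw [op_mul]; exact Subalgebra.mul_mem _ h2 h1

end noeth

/-! ## Commutation relations in `A` and noetherianity -/

section

lemma DB.tt (db : DB q a d) : ∃ t t' : Fin (db.r 0) → ℂ, (∀ k, db.h 0 k = t k • sg []) ∧ (∀ k, db.h' 0 k = t' k • sg []) ∧ ∑ k, t k * t' k = 1 := by
  refine ⟨fun k => db.h 0 k [], fun k => db.h' 0 k [], fun k => Wt_zero (db.h_mem 0 k), fun k => Wt_zero (db.h'_mem 0 k), ?_⟩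
  have h1 := db.exp 0 (sg []) (sg_mem []) (sg [])
  have h2 : Gf q a d (sg []) (sg []) = 1 := by simp [Gw]
  rw [h2] at h1
  rw [h1]
  refine sum_congr rfl fun k _ => ?_
  conv_rhs => rw [Wt_zero (db.h_mem 0 k), Wt_zero (db.h'_mem 0 k)]
  simp only [map_smul, LinearMap.smul_apply, h2]; simp [mul_comm]

lemma ht_degw (cd : CD q a d) {c : Fin n → ℤ} {u : Wd n} (hu : u ∈ Wt c) (hc : c ≠ 0) (hu0 : u ≠ 0) : 0 < cd.ht (degw a c) := by
  by_contra hcon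
  refine hu0 (Wt_induct (p := fun u => u = 0) rfl (fun u v h1 h2 => by rw [h1, h2, add_zero])
    (fun x u h1 => by rw [h1, smul_zero]) (fun l hl => ?_) hu)
  subst hl
  exfalso
  apply hcon
  have : degw a (deg l) = bw a l := (bw_deg a l).symm
  rw [this, cd.ht_bw]
  have h1 : 0 < l.length := by
    rcases l with _ | ⟨x, l⟩
    · exact absurd rfl hc
    · simp
  have := cd.hp_pos
  positivity

variable (h : QG q a d E F K Δ ε ρ ι)

theorem QG.R_rel (cd : CD q a d) (db : DB q a d) {M M' : Type*} [AddCommGroup M] [Module ℂ M] [AddCommGroup M'] [Module ℂ M'] {σ : U →ₐ[ℂ] Module.End ℂ M} {σ' : U →ₐ[ℂ] Module.End ℂ M'}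
    (hM : SR q d K σ) (hM' : SR q d K σ') {μ μ' ν ν' : Fin n → ℤ} {ξ : Module.Dual ℂ M} {η : Module.Dual ℂ M'} {v : M} {w : M'} (hξ : dwt q d K σ μ ξ) (hη : dwt q d K σ' μ' η) (hv : v ∈ wsp q d K σ ν)
    (hw : w ∈ wsp q d K σ' ν') {f g : A} (hf : ι f = mc σ ξ v) (hg : ι g = mc σ' η w) : ∃ S : Finset (Fin n → ℤ), 0 ∉ S ∧
    cd.χ μ μ' • (f * g) + ∑ c ∈ S, ∑ k, cd.χ μ μ' • (h.ra (wev F (db.h c k)) f * h.ra (wev E (db.h' c k)) g) = cd.χ ν ν' • (g * f) + ∑ c ∈ S, ∑ k, cd.χ (ν - degw a c) (ν' + degw a c) •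
      (h.lam (wev E (db.h' c k)) g * h.lam (wev F (db.h c k)) f) := by
  obtain ⟨S, hS, hS0⟩ := exists_RD h.C h.uRel cd hM hM'
  have key := _root_.R_rel h.C h.uRel cd db h.cop hM hM' hS hξ hη hv hw
  refine ⟨S.erase 0, by simp, ?_⟩
  have e1 : ∀ x : U, mc σ (ξ ∘ₗ σ x) v = ι (h.ra x f) := fun x => by
    ext y; rw [h.ra_apply, hf]; simp
  have e2 : ∀ x : U, mc σ' (η ∘ₗ σ' x) w = ι (h.ra x g) := fun x => by
    ext y; rw [h.ra_apply, hg]; simp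
  have e3 : ∀ x : U, mc σ ξ (σ x v) = ι (h.lam x f) := fun x => by
    ext y; rw [h.lam_apply, hf]; simp
  have e4 : ∀ x : U, mc σ' η (σ' x w) = ι (h.lam x g) := fun x => by
    ext y; rw [h.lam_apply, hg]; simp
  simp only [e1, e2, e3, e4, ← h.mul, ← map_smul, ← map_sum] at key
  have key := h.inj key
  rw [← Finset.add_sum_erase _ _ hS0, ← Finset.add_sum_erase _ _ hS0] at key
  obtain ⟨t, t', h1, h2, h3⟩ := db.tt
  have one : ∀ G : Fin n → U, wev G (sg []) = 1 := fun G => by simp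
  have ra1 : h.ra 1 = 1 := by simp [QG.ra]
  have z1 : ∑ k, cd.χ μ μ' • (h.ra (wev F (db.h 0 k)) f * h.ra (wev E (db.h' 0 k)) g) = cd.χ μ μ' • (f * g) := by
    simp only [h1, h2, map_smul, one, h.ra_smul, ra1, LinearMap.smul_apply, Module.End.one_apply, smul_mul_smul_comm]
    rw [← smul_sum, ← Finset.sum_smul, h3, one_smul]
  have z2 : ∑ k, cd.χ (ν - degw a 0) (ν' + degw a 0) •
      (h.lam (wev E (db.h' 0 k)) g * h.lam (wev F (db.h 0 k)) f) = cd.χ ν ν' • (g * f) := by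
    have : degw a (0 : Fin n → ℤ) = 0 := by simp [degw]
    simp only [h1, h2, map_smul, one, map_one, LinearMap.smul_apply, Module.End.one_apply, smul_mul_smul_comm, this]
    simp only [mul_comm (t' _)]
    rw [← smul_sum, ← Finset.sum_smul, h3, one_smul, sub_zero, add_zero]
  rw [z1, z2] at key
  exact key

/-- expansions in a weight basis -/
lemma mc_span (hC : Cartan q a d) {M : Type*} [AddCommGroup M] [Module ℂ M] {σ : U →ₐ[ℂ] Module.End ℂ M}
    {m : ℕ} {b : Module.Basis (Fin m) ℂ M} {β : Fin m → (Fin n → ℤ)} (hb : ∀ k, b k ∈ wsp q d K σ (β k))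
    {μ ν : Fin n → ℤ} {ξ : Module.Dual ℂ M} {v : M} (hξ : dwt q d K σ μ ξ) (hv : v ∈ wsp q d K σ ν) : mc σ ξ v ∈ Submodule.span ℂ {φ | ∃ k l, β k = μ ∧ β l = ν ∧ φ = mc σ (b.coord k) (b l)} := by
  rw [mc_expand b]
  refine Submodule.sum_mem _ fun k _ => Submodule.sum_mem _ fun l _ => ?_
  by_cases h1 : β k = μ
  · by_cases h2 : β l = ν
    · exact smul_mem _ _ (subset_span ⟨k, l, h1, h2, rfl⟩)
    · rw [repr_wt hC hb hv l h2, mul_zero, zero_smul]; exact zero_mem _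
  · rw [hξ _ h1 _ (hb k), zero_mul, zero_smul]; exact zero_mem _

lemma dwt_F (hC : Cartan q a d) (hU : URel q a d E F K) {M : Type*} [AddCommGroup M] [Module ℂ M] {σ : U →ₐ[ℂ] Module.End ℂ M}
    {μ c : Fin n → ℤ} {ξ : Module.Dual ℂ M} (hξ : dwt q d K σ μ ξ) {u : Wd n} (hu : u ∈ Wt c) : dwt q d K σ (μ + degw a c) (ξ ∘ₗ σ (wev F u)) := fun ν hν x hx => by
  refine hξ _ (fun h0 => hν ?_) _ (wevF_mem hC hU σ hu hx)
  rw [← h0]; abel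

lemma dwt_E (hC : Cartan q a d) (hU : URel q a d E F K) {M : Type*} [AddCommGroup M] [Module ℂ M] {σ : U →ₐ[ℂ] Module.End ℂ M}
    {μ c : Fin n → ℤ} {ξ : Module.Dual ℂ M} (hξ : dwt q d K σ μ ξ) {u : Wd n} (hu : u ∈ Wt c) : dwt q d K σ (μ - degw a c) (ξ ∘ₗ σ (wev E u)) := fun ν hν x hx => by
  refine hξ _ (fun h0 => hν ?_) _ (wevE_mem hC hU σ hu hx)
  rw [← h0]; abel

lemma conv_tensor {M M' : Type*} [AddCommGroup M] [Module ℂ M] [AddCommGroup M'] [Module ℂ M'] [FiniteDimensional ℂ M] [FiniteDimensional ℂ M']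
    {σ : U →ₐ[ℂ] Module.End ℂ M} {σ' : U →ₐ[ℂ] Module.End ℂ M'} (ζ : Module.Dual ℂ (M ⊗[ℂ] M')) (z : M ⊗[ℂ] M') :
    mc ((tact σ σ').comp Δ) ζ z ∈ Submodule.span ℂ {φ | ∃ ξ η v w, φ = conv Δ (mc σ ξ v) (mc σ' η w)} := by
  have h1 : ζ ∈ Submodule.span ℂ {ζ | ∃ ξ η, ζ = tf (M := M) (M' := M') ξ η} := by
    obtain ⟨y, rfl⟩ := (TensorProduct.dualDistribEquiv ℂ M M').surjective ζ
    induction y using TensorProduct.induction_on with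
    | zero => rw [map_zero]; exact zero_mem _
    | add x y h1 h2 => rw [map_add]; exact add_mem h1 h2
    | tmul ξ η =>
      refine subset_span ⟨ξ, η, TensorProduct.ext' fun x y => ?_⟩
      simp [TensorProduct.dualDistribEquiv, TensorProduct.dualDistribEquivOfBasis]
  induction h1 using span_induction with
  | zero => convert Submodule.zero_mem _ using 1; ext; simp
  | add x y _ _ h1 h2 => convert add_mem h1 h2 using 1; ext; simp
  | smul t x _ h1 => convert smul_mem _ t h1 using 1; ext; simp
  | mem ζ hζ =>
    obtain ⟨ξ, η, rfl⟩ := hζ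
    induction z using TensorProduct.induction_on with
    | zero => convert Submodule.zero_mem _ using 1; ext; simp
    | add x y h1 h2 => convert add_mem h1 h2 using 1; ext; simp
    | tmul x y =>
      refine subset_span ⟨ξ, η, x, y, ?_⟩
      ext u; rw [conv_mc]; rfl

include h in
/-- `A` is generated by coefficients of any choice of fundamental representations -/
theorem QG.fgen (cd : CD q a d) (B : Subalgebra ℂ A) (iF : Fin n → I) (vF : ∀ j, V (iF j)) (hv0 : ∀ j, vF j ≠ 0) (hv : ∀ j, vF j ∈ wsp q d K (ρ (iF j)) (Pi.single j 1))
    (hvE : ∀ j k, ρ (iF j) (E k) (vF j) = 0) (hB : ∀ j ξ v x, ι x = mc (ρ (iF j)) ξ v → x ∈ B) : B = ⊤ := by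
  have key : ∀ (m : ℕ) (c : Fin n → ℕ), ∑ j, c j = m → ∀ i, ∀ z : V i, z ≠ 0 → z ∈ wsp q d K (ρ i) (fun j => (c j : ℤ)) → (∀ j, ρ i (E j) z = 0) → ∀ ξ v x, ι x = mc (ρ i) ξ v → x ∈ B := by
    intro m
    induction m with
    | zero =>
      intro c hc i z hz0 hz hzE ξ v x hx
      have hc0 : c = 0 := by
        funext j; simp at hc; exact hc j
      subst hc0
      let τ : U →ₐ[ℂ] Module.End ℂ ℂ := (Algebra.lmul ℂ ℂ).comp ε
      obtain ⟨ζ, y, hy⟩ := hw_coef h.C h.uRel cd (ρ := τ) (m := (1 : ℂ)) (μ := fun j => ((0 : Fin n → ℕ) j : ℤ))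
        (mem_wsp.2 fun i => by simp [τ, h.eK]) (fun i => by simp [τ, h.eE]) one_ne_zero (h.sr i).simp hz hzE hz0 ξ v
      have : x = (ζ y) • 1 := h.ext fun u => by
        rw [hx, hy]
        have h2 := map_smul ζ (ε u) y
        simp [h.one, τ] at h2 ⊢; rw [h2]; ring
      rw [this]; exact B.smul_mem B.one_mem _
    | succ m ih =>
      intro c hc i z hz0 hz hzE ξ v x hx
      obtain ⟨j, hj⟩ : ∃ j, 0 < c j := by
        by_contra hcon
        push Not at hcon
        have : ∑ j, c j = 0 := sum_eq_zero fun j _ => Nat.le_zero.1 (hcon j)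
        omega
      obtain ⟨c', rfl⟩ : ∃ c', c = c' + Pi.single j 1 := ⟨c - Pi.single j 1, by
        funext k; by_cases hk : k = j
        · subst hk; simp; omega
        · simp [hk]⟩
      have hc' : ∑ j, c' j = m := by
        simp [sum_add_distrib] at hc; exact hc
      obtain ⟨i', z', hz0', hz', hzE'⟩ := h.hw c'
      have fd1 := (h.sr i').fd
      have fd2 := (h.sr (iF j)).fd
      obtain ⟨ζ, y, hy⟩ := hw_coef h.C h.uRel cd (ρ := (tact (ρ i') (ρ (iF j))).comp Δ) (m := z' ⊗ₜ vF j)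
        (μ := fun k => ((c' + Pi.single j 1 : Fin n → ℕ) k : ℤ))
        (mem_wsp.2 fun k => by
          simp only [AlgHom.comp_apply, h.cop.dK, tact_tmul, TensorProduct.map_tmul]
          rw [mem_wsp.1 hz', mem_wsp.1 (hv j), TensorProduct.smul_tmul_smul, ← zpow_add₀ h.C.q0, ← add_mul]
          congr 4
          by_cases hk : k = j
          · subst hk; simp
          · simp [hk])
        (fun k => by simp [h.cop.dE, hzE', hvE]) (by
          intro h0
          refine hz0' ((Module.forall_dual_apply_eq_zero_iff ℂ z').1 fun ξ => ?_)
          by_contra h1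
          refine hv0 j ((Module.forall_dual_apply_eq_zero_iff ℂ (vF j)).1 fun η => ?_)
          have h2 := congrArg (tf ξ η) h0
          rw [tf_tmul, map_zero] at h2
          exact (mul_eq_zero.1 h2).resolve_left h1) (h.sr i).simp hz hzE hz0 ξ v
      have h3 := conv_tensor (Δ := Δ) (σ := ρ i') (σ' := ρ (iF j)) ζ y
      rw [← hy, ← hx] at h3
      have h4 : Submodule.span ℂ {φ | ∃ ξ η v w, φ = conv Δ (mc (ρ i') ξ v) (mc (ρ (iF j)) η w)} ≤
          (Subalgebra.toSubmodule B).map ι := by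
        refine Submodule.span_le.2 ?_
        rintro _ ⟨ξ, η, v, w, rfl⟩
        obtain ⟨x1, hx1⟩ := h.coef i' ξ v
        obtain ⟨x2, hx2⟩ := h.coef (iF j) η w
        refine ⟨x1 * x2, B.mul_mem (ih c' hc' i' z' hz0' hz' hzE' _ _ _ hx1) (hB _ _ _ _ hx2), ?_⟩
        rw [h.mul, hx1, hx2]
      obtain ⟨x', hx', he⟩ := h4 h3
      rwa [← h.inj he]
  refine h.gen B fun i ξ v x hx => ?_
  obtain ⟨μ, z, hz0, hz, hzE⟩ := (h.sr i).exists_hw h.C h.uRel cd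
  obtain ⟨c, rfl⟩ := (h.sr i).dom h.C h.uRel cd hz hzE hz0
  exact key _ c rfl i z hz0 hz hzE ξ v x hx

end

section
/-- the ordering function on generators -/
def Wfun (M x y : ℤ) : ℤ := -M^2*y^2 + M*x*y - x^2

lemma Wfun_R {B M x y x' y' β : ℤ} (hM : M = 4*B+1) (hB : 0 ≤ B) (hx : |x| ≤ B) (hx' : |x'| ≤ B) (hβ : 0 < β) (hy : y ≤ y') : Wfun M x' (y'+β) + Wfun M x (y-β) < Wfun M x y + Wfun M x' y' := by
  rw [abs_le] at hx hx'
  have h1 : Wfun M x' (y'+β) + Wfun M x (y-β) - (Wfun M x y + Wfun M x' y') = -(M*β) * (2*M*(y'-y) + 2*M*β - (x'-x)) := by unfold Wfun; ring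
  have hM0 : 0 < M := by omega
  have h2 : 0 < 2*M*(y'-y) + 2*M*β - (x'-x) := by
    have : 0 ≤ 2*M*(y'-y) := mul_nonneg (by omega) (by omega)
    have : 2*M*1 ≤ 2*M*β := mul_le_mul_of_nonneg_left (by omega) (by omega)
    omega
  have := mul_pos (mul_pos hM0 hβ) h2
  linarith

lemma Wfun_L {B M x y x' y' β : ℤ} (hM : M = 4*B+1) (hB : 0 ≤ B) (hx : |x| ≤ B) (hx' : |x'| ≤ B) (hβ : 0 < β) (hy : y < y' ∨ (y = y' ∧ x' ≤ x)) :
    Wfun M (x+β) y + Wfun M (x'-β) y' < Wfun M x y + Wfun M x' y' := by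
  rw [abs_le] at hx hx'
  have h1 : Wfun M (x+β) y + Wfun M (x'-β) y' - (Wfun M x y + Wfun M x' y') = -β * (M*(y'-y) + 2*(x-x') + 2*β) := by unfold Wfun; ring
  have h2 : 0 < M*(y'-y) + 2*(x-x') + 2*β := by
    rcases hy with hy | ⟨rfl, hy⟩
    · have : M*1 ≤ M*(y'-y) := mul_le_mul_of_nonneg_left (by omega) (by omega)
      omega
    · have : M*(y-y) = 0 := by ring
      omega
  have := mul_pos hβ h2
  linarith

variable (h : QG q a d E F K Δ ε ρ ι)

include h in
theorem QG.qcomm (cd : CD q a d) : ∃ (N : ℕ) (u : Fin N → A) (w : Fin N → ℕ), QComm u w ∧ Algebra.adjoin ℂ (Set.range u) = ⊤ := by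
  classical
  obtain ⟨db⟩ := exists_DB q a d
  have hw := fun j : Fin n => h.hw (Pi.single j 1)
  choose iF vF hv0 hv hvE using hw
  have hbas : ∀ j, ∃ (m : ℕ) (b : Module.Basis (Fin m) ℂ (V (iF j))) (β : Fin m → (Fin n → ℤ)), ∀ k, b k ∈ wsp q d K (ρ (iF j)) (β k) := fun j => by
    have := (h.sr (iF j)).fd
    exact exists_wt_basis _ (h.sr (iF j)).sum
  choose m b β hb using hbas
  have hcoef := fun (j : Fin n) (k l : Fin (m j)) => h.coef (iF j) ((b j).coord k) (b j l)
  choose c hc using hcoef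
  let T := Σ j : Fin n, Fin (m j) × Fin (m j)
  let u : T → A := fun t => c t.1 t.2.1 t.2.2
  let X : T → (Fin n → ℤ) := fun t => β t.1 t.2.1
  let Y : T → (Fin n → ℤ) := fun t => β t.1 t.2.2
  -- expansion
  have hspan : ∀ (j : Fin n) (μ ν : Fin n → ℤ) (ξ : Module.Dual ℂ (V (iF j))) (v : V (iF j)) (x : A), dwt q d K (ρ (iF j)) μ ξ → v ∈ wsp q d K (ρ (iF j)) ν → ι x = mc (ρ (iF j)) ξ v →
      x ∈ Submodule.span ℂ {x | ∃ t, X t = μ ∧ Y t = ν ∧ x = u t} := by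
    intro j μ ν ξ v x hξ hv hx
    have h1 := mc_span h.C (hb j) hξ hv
    rw [← hx] at h1
    have h2 : Submodule.span ℂ {φ | ∃ k l, β j k = μ ∧ β j l = ν ∧ φ = mc (ρ (iF j)) ((b j).coord k) (b j l)} ≤
        (Submodule.span ℂ {x | ∃ t, X t = μ ∧ Y t = ν ∧ x = u t}).map ι := by
      refine Submodule.span_le.2 ?_
      rintro _ ⟨k, l, hk, hl, rfl⟩
      exact ⟨c j k l, subset_span ⟨⟨j, k, l⟩, hk, hl, rfl⟩, hc j k l⟩
    obtain ⟨x', hx', he⟩ := h2 h1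
    rwa [← h.inj he]
  have hmul : ∀ {μ ν μ' ν' : Fin n → ℤ} {x y : A} {p : T → T → Prop}, x ∈ Submodule.span ℂ {x | ∃ t, X t = μ ∧ Y t = ν ∧ x = u t} → y ∈ Submodule.span ℂ {x | ∃ t, X t = μ' ∧ Y t = ν' ∧ x = u t} →
      (∀ s t, X s = μ → Y s = ν → X t = μ' → Y t = ν' → p s t) → x * y ∈ Submodule.span ℂ {x | ∃ s t, p s t ∧ x = u s * u t} := by
    intro μ ν μ' ν' x y p hx hy hp
    have := Submodule.mul_mem_mul hx hy
    rw [Submodule.span_mul_span] at this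
    refine Submodule.span_mono ?_ this
    rintro _ ⟨_, ⟨s, hs, hs', rfl⟩, _, ⟨t, ht, ht', rfl⟩, rfl⟩
    exact ⟨s, t, hp s t hs hs' ht ht', rfl⟩
  let B : ℤ := ∑ t, (|cd.ht (X t)| + |cd.ht (Y t)|)
  have hB : 0 ≤ B := Finset.sum_nonneg fun t _ => by positivity
  have hBX : ∀ t, |cd.ht (X t)| ≤ B := fun t => by
    have := Finset.single_le_sum (f := fun t => (|cd.ht (X t)| + |cd.ht (Y t)|)) (fun t _ => by positivity) (Finset.mem_univ t)
    have h2 := abs_nonneg (cd.ht (Y t))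
    change _ ≤ B at this; omega
  let M := 4*B+1
  let W : T → ℤ := fun t => Wfun M (cd.ht (X t)) (cd.ht (Y t))
  let C : ℤ := ∑ t, |W t|
  have hCW : ∀ t, 0 ≤ C + W t := fun t => by
    have := Finset.single_le_sum (f := fun t => |W t|) (fun t _ => by positivity) (Finset.mem_univ t)
    have h2 := neg_abs_le (W t)
    change _ ≤ C at this; omega
  let w : T → ℕ := fun t => (C + W t).toNat
  have hwW : ∀ {s t s' t'}, W s + W t < W s' + W t' → w s + w t < w s' + w t' := by
    intro s t s' t' hh
    have h1 := hCW s
    have h2 := hCW t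
    have h3 := hCW s'
    have h4 := hCW t'
    simp only [w]; omega
  have main : ∀ s t : T, (cd.ht (Y s) < cd.ht (Y t) ∨ (cd.ht (Y s) = cd.ht (Y t) ∧ cd.ht (X t) ≤ cd.ht (X s))) → ∃ c : ℂ, c ≠ 0 ∧ u s * u t - c • (u t * u s) ∈
        Submodule.span ℂ {x | ∃ s' t', w s' + w t' < w s + w t ∧ x = u s' * u t'} := by
    rintro ⟨j, k, l⟩ ⟨j', k', l'⟩ hst
    obtain ⟨S, hS0, hS⟩ := h.R_rel cd db (h.sr (iF j)) (h.sr (iF j')) (dwt_coord h.C (hb j) k)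
      (dwt_coord h.C (hb j') k') (hb j l) (hb j' l') (hc j k l) (hc j' k' l')
    set x1 := cd.χ (β j k) (β j' k') with hx1
    set x2 := cd.χ (β j l) (β j' l') with hx2
    have hx10 : x1 ≠ 0 := cd.χ_ne _ _
    have hx20 : x2 ≠ 0 := cd.χ_ne _ _
    refine ⟨x1⁻¹ * x2, mul_ne_zero (inv_ne_zero hx10) hx20, ?_⟩
    set L := Submodule.span ℂ {x | ∃ s' t', w s' + w t' < w ⟨j, k, l⟩ + w ⟨j', k', l'⟩ ∧ x = u s' * u t'} with hL
    have h1 : ∀ c' ∈ S, ∀ r, h.ra (wev F (db.h c' r)) (c j k l) * h.ra (wev E (db.h' c' r)) (c j' k' l') ∈ L := by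
      intro c' hc' r
      by_cases h0 : db.h c' r = 0
      · rw [h0, map_zero]; simp [QG.ra]
      have hβ := ht_degw cd (db.h_mem c' r) (fun hh => hS0 (hh ▸ hc')) h0
      refine hmul (hspan j _ _ _ _ _ (dwt_F h.C h.uRel (dwt_coord h.C (hb j) k) (db.h_mem c' r)) (hb j l) ?_)
        (hspan j' _ _ _ _ _ (dwt_E h.C h.uRel (dwt_coord h.C (hb j') k') (db.h'_mem c' r)) (hb j' l') ?_) ?_
      · ext y; rw [h.ra_apply, hc]; simp
      · ext y; rw [h.ra_apply, hc]; simp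
      · intro s t e1 e2 e3 e4
        apply hwW
        simp only [W, e1, e2, e3, e4, map_add, map_sub]
        exact Wfun_L rfl hB (hBX ⟨j, k, l⟩) (hBX ⟨j', k', l'⟩) hβ hst
    have h2 : ∀ c' ∈ S, ∀ r, h.lam (wev E (db.h' c' r)) (c j' k' l') * h.lam (wev F (db.h c' r)) (c j k l) ∈ L := by
      intro c' hc' r
      by_cases h0 : db.h c' r = 0
      · rw [h0, map_zero]; simp
      have hβ := ht_degw cd (db.h_mem c' r) (fun hh => hS0 (hh ▸ hc')) h0
      refine hmul (hspan j' _ _ _ _ _ (dwt_coord h.C (hb j') k') (wevE_mem h.C h.uRel _ (db.h'_mem c' r) (hb j' l')) ?_)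
        (hspan j _ _ _ _ _ (dwt_coord h.C (hb j) k) (wevF_mem h.C h.uRel _ (db.h_mem c' r) (hb j l)) ?_) ?_
      · ext y; rw [h.lam_apply, hc]; simp
      · ext y; rw [h.lam_apply, hc]; simp
      · intro s t e1 e2 e3 e4
        apply hwW
        simp only [W, e1, e2, e3, e4, map_add, map_sub]
        refine Wfun_R rfl hB (hBX ⟨j, k, l⟩) (hBX ⟨j', k', l'⟩) hβ ?_
        rcases hst with h | h
        · exact h.le
        · exact h.1.le
    have h3 : x1 • (c j k l * c j' k' l') - x2 • (c j' k' l' * c j k l) ∈ L := by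
      have : x1 • (c j k l * c j' k' l') - x2 • (c j' k' l' * c j k l) = _ - _ := sub_eq_sub_iff_add_eq_add.2 (hS.trans (add_comm _ _))
      rw [this]
      exact L.sub_mem (L.sum_mem fun c' hc' => L.sum_mem fun r _ => L.smul_mem _ (h2 c' hc' r))
        (L.sum_mem fun c' hc' => L.sum_mem fun r _ => L.smul_mem _ (h1 c' hc' r))
    have h4 := L.smul_mem x1⁻¹ h3
    rw [smul_sub, smul_smul, smul_smul, inv_mul_cancel₀ hx10, one_smul] at h4
    exact h4
  have main' : ∀ s t : T, ∃ c : ℂ, c ≠ 0 ∧ u s * u t - c • (u t * u s) ∈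
        Submodule.span ℂ {x | ∃ s' t', w s' + w t' < w s + w t ∧ x = u s' * u t'} := by
    intro s t
    by_cases hst : cd.ht (Y s) < cd.ht (Y t) ∨ (cd.ht (Y s) = cd.ht (Y t) ∧ cd.ht (X t) ≤ cd.ht (X s))
    · exact main s t hst
    · obtain ⟨x, hx, h1⟩ := main t s (by omega)
      refine ⟨x⁻¹, inv_ne_zero hx, ?_⟩
      have h2 := smul_mem _ (-x⁻¹) h1
      rw [smul_sub, smul_smul, neg_mul, inv_mul_cancel₀ hx, add_comm (w t)] at h2
      convert h2 using 1
      simp only [neg_smul, one_smul]; abel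
  let e := Fintype.equivFin T
  refine ⟨Fintype.card T, u ∘ e.symm, w ∘ e.symm, fun i j => ?_, ?_⟩
  · obtain ⟨x, hx, h1⟩ := main' (e.symm i) (e.symm j)
    refine ⟨x, hx, Submodule.span_mono ?_ h1⟩
    rintro _ ⟨s, t, h1, rfl⟩
    exact ⟨e s, e t, by simpa using h1, by simp⟩
  · refine h.fgen cd _ iF vF hv0 (fun j => ?_) hvE fun j ξ v x hx => ?_
    · convert hv j using 2
      funext k; by_cases hk : k = j
      · subst hk; simp
      · simp [hk]
    · have h1 : ι x ∈ (Subalgebra.toSubmodule (Algebra.adjoin ℂ (Set.range (u ∘ e.symm)))).map ι := by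
        rw [hx, mc_expand (b j) ξ v]
        refine Submodule.sum_mem _ fun k _ => Submodule.sum_mem _ fun l _ => smul_mem _ _ ?_
        refine ⟨c j k l, Algebra.subset_adjoin ⟨e ⟨j, k, l⟩, ?_⟩, hc j k l⟩
        rw [Function.comp_apply, Equiv.symm_apply_apply]
      obtain ⟨x', hx', he⟩ := h1
      rwa [← h.inj he]

include h in
theorem QG.noeth (cd : CD q a d) : IsNoetherianRing A := by
  obtain ⟨N, u, w, h1, h2⟩ := h.qcomm cd
  exact h1.noeth h2

include h in
theorem QG.noeth_op (cd : CD q a d) : IsNoetherianRing Aᵐᵒᵖ := by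
  obtain ⟨N, u, w, h1, h2⟩ := h.qcomm cd
  exact h1.noeth_op h2

end

open Polynomial

/-! ## `A` is a domain -/

section graded

variable {M : Type*} [AddCommGroup M] [Module ℂ M] {κ Γ : Type*}

/-- stable subspaces contain the components of their elements -/
lemma comp_mem (D : κ → Module.End ℂ M) (e : Γ → κ → ℂ) (he : Function.Injective e) (J : Submodule ℂ M) (hJ : ∀ k, ∀ x ∈ J, D k x ∈ J) (s : Finset Γ)
    (x : Γ → M) (hx : ∀ g ∈ s, ∀ k, D k (x g) = e g k • x g) (h0 : ∑ g ∈ s, x g ∈ J) : ∀ g ∈ s, x g ∈ J := by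
  intro g hg
  have := joint_eig (fun k => J.mapQ J (D k) (hJ k)) e he s (fun g => J.mkQ (x g))
    (fun g hg k => by
      rw [Submodule.mkQ_apply, Submodule.mapQ_apply, hx g hg k]; rfl)
    (by rw [← map_sum]; exact (Submodule.Quotient.mk_eq_zero J).2 h0) g hg
  simpa using this

/-- decomposition of an element, away from a subspace -/
lemma exists_comp (w : Γ → Submodule ℂ M) (J : Submodule ℂ M) (x : M) (hx : x ∈ ⨆ g, w g) : ∃ (s : Finset Γ) (y : Γ → M), (∀ g, y g ∈ w g) ∧ (∀ g ∈ s, y g ∉ J) ∧ x - ∑ g ∈ s, y g ∈ J := by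
  classical
  rw [Submodule.mem_iSup_iff_exists_finsupp] at hx
  obtain ⟨f, hf, hsum⟩ := hx
  refine ⟨f.support.filter (fun g => f g ∉ J), f, hf, fun g hg => (Finset.mem_filter.1 hg).2, ?_⟩
  rw [← hsum, Finsupp.sum, ← Finset.sum_filter_add_sum_filter_not f.support (fun g => f g ∉ J), add_sub_cancel_left]
  exact J.sum_mem fun g hg => not_not.1 (Finset.mem_filter.1 hg).2

/-- homogeneous complete primeness implies complete primeness -/
lemma graded_prime {A : Type*} [Ring A] [Algebra ℂ A] [Add Γ] [UniqueSums Γ] (D : κ → Module.End ℂ A) (e : Γ → κ → ℂ) (he : Function.Injective e) (w : Γ → Submodule ℂ A)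
    (hw : ∀ g x, x ∈ w g ↔ ∀ k, D k x = e g k • x) (hmul : ∀ g g' x y, x ∈ w g → y ∈ w g' → x * y ∈ w (g + g')) (htop : (⨆ g, w g) = ⊤) (J : Submodule ℂ A) (hJ : ∀ k, ∀ x ∈ J, D k x ∈ J)
    (hJl : ∀ x, ∀ y ∈ J, x * y ∈ J) (hJr : ∀ x, ∀ y ∈ J, y * x ∈ J) (hp : ∀ g g' x y, x ∈ w g → y ∈ w g' → x * y ∈ J → x ∈ J ∨ y ∈ J) {x y : A} (hxy : x * y ∈ J) : x ∈ J ∨ y ∈ J := by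
  classical
  by_contra hcon
  push Not at hcon
  obtain ⟨s, f, hf, hf', hfx⟩ := exists_comp w J x (by rw [htop]; trivial)
  obtain ⟨t, g, hg, hg', hgy⟩ := exists_comp w J y (by rw [htop]; trivial)
  have hs : s.Nonempty := by
    rw [Finset.nonempty_iff_ne_empty]; rintro rfl; exact hcon.1 (by simpa using hfx)
  have ht : t.Nonempty := by
    rw [Finset.nonempty_iff_ne_empty]; rintro rfl; exact hcon.2 (by simpa using hgy)
  have h1 : (∑ i ∈ s, f i) * (∑ j ∈ t, g j) ∈ J := by
    have : (∑ i ∈ s, f i) * (∑ j ∈ t, g j) = x * y - (x - ∑ i ∈ s, f i) * y - (∑ i ∈ s, f i) * (y - ∑ j ∈ t, g j) := by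
      noncomm_ring
    rw [this]
    exact J.sub_mem (J.sub_mem hxy (hJr _ _ hfx)) (hJl _ _ hgy)
  rw [Finset.sum_mul_sum, ← Finset.sum_product'] at h1
  rw [← Finset.sum_fiberwise_of_maps_to (t := (s ×ˢ t).image fun p => p.1 + p.2)
    (g := fun p => p.1 + p.2) (fun p hp => Finset.mem_image_of_mem _ hp)] at h1
  obtain ⟨i, hi, j, hj, hu⟩ := UniqueSums.uniqueAdd_of_nonempty hs ht
  have h2 := comp_mem D e he J hJ _ _ (fun γ hγ => (hw _ _).1 (Submodule.sum_mem _ fun p hp => by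
    rw [← (Finset.mem_filter.1 hp).2]; exact hmul _ _ _ _ (hf _) (hg _))) h1 (i + j)
    (Finset.mem_image.2 ⟨(i, j), Finset.mk_mem_product hi hj, rfl⟩)
  have h3 : (s ×ˢ t).filter (fun p => p.1 + p.2 = i + j) = {(i, j)} := by
    ext ⟨i', j'⟩
    simp only [Finset.mem_filter, Finset.mem_product, Finset.mem_singleton, Prod.mk.injEq]
    constructor
    · rintro ⟨⟨h1, h2⟩, h3⟩; exact hu h1 h2 h3
    · rintro ⟨rfl, rfl⟩; exact ⟨⟨hi, hj⟩, rfl⟩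
  rw [h3, Finset.sum_singleton] at h2
  rcases hp _ _ _ _ (hf i) (hg j) h2 with h | h
  · exact hf' i hi h
  · exact hg' j hj h

end graded

section skew

/-- Gaussian polynomials -/
noncomputable def gp : ℕ → ℕ → ℕ[X]
  | 0, _ => 1
  | _, 0 => 1
  | r+1, s+1 => X ^ (s+1) * gp r (s+1) + gp (r+1) s
termination_by r s => r + s

lemma gp_ne (r s : ℕ) : gp r s ≠ 0 := by
  intro h
  have : ∀ m r s, r + s = m → 0 < (gp r s).eval 1 := by
    intro m
    induction m with
    | zero => intro r s h; obtain rfl : r = 0 := by omega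
              simp [gp]
    | succ m ih =>
      intro r s h
      rcases r with _ | r
      · simp [gp]
      rcases s with _ | s
      · simp [gp]
      rw [gp]; simp only [eval_add, eval_mul, eval_pow, eval_X, one_pow, one_mul]
      have := ih r (s+1) (by omega)
      omega
  have := this _ r s rfl
  rw [h] at this; simp at this

variable {A : Type*} [AddCommGroup A] [Module ℂ A]

lemma skew_top (m : A →ₗ[ℂ] A →ₗ[ℂ] A) (D k : Module.End ℂ A) (hD : ∀ x y, D (m x y) = m (D x) y + m (k x) (D y))
    (t : ℂ) (hk : ∀ x, k (D x) = t • D (k x)) : ∀ (N r s : ℕ), r + s = N → ∀ (x : ℂ) (f g : A), k f = x • f → (D ^ (r+1)) f = 0 → (D ^ (s+1)) g = 0 →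
    (D ^ (r+s)) (m f g) = (x ^ s * (gp r s).eval₂ (Nat.castRingHom ℂ) t) • m ((D ^ r) f) ((D ^ s) g) := by
  intro N
  induction N with
  | zero =>
    intro r s h x f g hf h1 h2
    obtain rfl : r = 0 := by omega
    obtain rfl : s = 0 := by omega
    simp [gp]
  | succ N ih =>
    intro r s h x f g hf h1 h2
    have hkD : k (D f) = (t * x) • D f := by rw [hk, hf, map_smul, smul_smul]
    have e1 : ∀ (j : ℕ) (y : A), (D ^ (j+1)) y = (D ^ j) (D y) := fun j y => by rw [pow_succ]; rfl
    have e2 : m (k f) (D g) = x • m f (D g) := by rw [hf]; simp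
    rcases r with _ | r
    · obtain ⟨s, rfl⟩ : ∃ s', s = s' + 1 := ⟨N, by omega⟩
      rw [e1] at h1 h2
      have h1' : D f = 0 := by simpa using h1
      rw [show 0 + (s+1) = (0 + s) + 1 by omega, e1, hD, h1', e2, map_zero, LinearMap.zero_apply, zero_add ((x : ℂ) • _), map_smul,
        ih 0 s (by omega) x f (D g) hf (by simpa using h1') h2, smul_smul, e1]
      simp [gp, pow_succ, mul_comm]
    · rcases s with _ | s
      · rw [e1] at h1 h2
        have h2' : D g = 0 := by simpa using h2
        have i1 := ih r 0 (by omega) (t*x) (D f) g hkD h1 (by simpa using h2')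
        rw [← e1, add_zero r] at i1
        rw [add_zero, e1, hD, h2', map_zero, add_zero, i1]
        rcases r with _ | r <;> simp [gp]
      · have i1 := ih r (s+1) (by omega) (t*x) (D f) g hkD (by rw [← e1]; exact h1) h2
        have i2 := ih (r+1) s (by omega) x f (D g) hf h1 (by rw [← e1]; exact h2)
        rw [show r + 1 + (s+1) = (r + (s+1)) + 1 by omega, e1, hD, e2, map_add, i1, map_smul, show r + (s+1) = r + 1 + s by omega, i2, ← e1, ← e1, smul_smul, ← add_smul]
        congr 1
        rw [gp]; simp only [eval₂_add, eval₂_mul, eval₂_pow, eval₂_X, mul_pow]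
        ring

/-- iterated nilpotency -/
def NilD {ι : Type*} (D : ι → Module.End ℂ A) : ℕ → A → Prop
  | 0, f => f = 0
  | N+1, f => ∀ i, NilD D N (D i f)

lemma NilD.zero {ι : Type*} {D : ι → Module.End ℂ A} (N : ℕ) : NilD D N 0 := by
  induction N with
  | zero => rfl
  | succ N ih => intro i; rw [map_zero]; exact ih

lemma NilD.pow {ι : Type*} {D : ι → Module.End ℂ A} (i : ι) {N r : ℕ} {f : A} (h : NilD D (N+r) f) : NilD D N ((D i ^ r) f) := by
  induction r generalizing f with
  | zero => simpa using h
  | succ r ih => rw [pow_succ]; exact ih (h i)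

lemma NilD.of_words {ι : Type*} {D : ι → Module.End ℂ A} {N : ℕ} {f : A} (h : ∀ l : List ι, l.length = N → (l.map D).prod f = 0) : NilD D N f := by
  induction N generalizing f with
  | zero => exact h [] rfl
  | succ N ih =>
    intro i
    refine ih fun l hl => ?_
    have := h (l ++ [i]) (by simp [hl])
    simpa using this

lemma NilD.top {ι : Type*} {D : ι → Module.End ℂ A} (i : ι) {N : ℕ} {f : A} (h : NilD D N f) (h0 : f ≠ 0) : ∃ r, r ≤ N ∧ (D i ^ r) f ≠ 0 ∧ (D i ^ (r+1)) f = 0 ∧ NilD D (N - r) ((D i ^ r) f) := by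
  classical
  have hN : (D i ^ N) f = 0 := NilD.pow (N := 0) i (by rwa [zero_add])
  have hex : ∃ r, (D i ^ (r+1)) f = 0 := by
    rcases N with _ | N
    · exact absurd hN h0
    · exact ⟨N, hN⟩
  refine ⟨Nat.find hex, ?_, ?_, Nat.find_spec hex, ?_⟩
  · rcases N with _ | N
    · exact absurd hN h0
    · have := Nat.find_min' hex hN; omega
  · intro hr
    rcases hh : Nat.find hex with _ | r
    · rw [hh] at hr; exact h0 hr
    · have := Nat.find_min hex (m := r) (by omega)
      rw [hh] at hr; exact this hr
  · apply NilD.pow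
    have : Nat.find hex ≤ N := by
      rcases N with _ | N
      · exact absurd hN h0
      · have := Nat.find_min' hex hN; omega
    rwa [Nat.sub_add_cancel this]

/-- reduce a vanishing product to invariants of skew derivations -/
lemma skew_reduce {ι : Type*} (m : A →ₗ[ℂ] A →ₗ[ℂ] A) (D k : ι → Module.End ℂ A) (hD : ∀ i x y, D i (m x y) = m (D i x) y + m (k i x) (D i y)) (t : ι → ℂ)
    (ht : ∀ i (P : ℕ[X]), P ≠ 0 → P.eval₂ (Nat.castRingHom ℂ) (t i) ≠ 0) (hk : ∀ i x, k i (D i x) = t i • D i (k i x)) (P : A → Prop) (hP : ∀ i f, P f → P (D i f))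
    (hPk : ∀ i f, P f → ∃ x : ℂ, x ≠ 0 ∧ k i f = x • f) (hnil : ∀ f, P f → ∃ N, NilD D N f) {f g : A} (hf : P f) (hg : P g) (hf0 : f ≠ 0) (hg0 : g ≠ 0) (hfg : m f g = 0) :
    ∃ f g, P f ∧ P g ∧ f ≠ 0 ∧ g ≠ 0 ∧ m f g = 0 ∧ (∀ i, D i f = 0) ∧ (∀ i, D i g = 0) := by
  obtain ⟨Nf, hNf⟩ := hnil f hf
  obtain ⟨Ng, hNg⟩ := hnil g hg
  obtain ⟨N, hN⟩ : ∃ N, Nf + Ng ≤ N := ⟨_, le_rfl⟩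
  induction N generalizing f g Nf Ng with
  | zero =>
    obtain rfl : Nf = 0 := by omega
    exact absurd hNf hf0
  | succ N ih =>
    by_cases hall : (∀ i, D i f = 0) ∧ (∀ i, D i g = 0)
    · exact ⟨f, g, hf, hg, hf0, hg0, hfg, hall.1, hall.2⟩
    obtain ⟨i, hi⟩ : ∃ i, ¬ (D i f = 0 ∧ D i g = 0) := by
      by_contra hcon; push Not at hcon; exact hall ⟨fun i => (hcon i).1, fun i => (hcon i).2⟩
    obtain ⟨r, hr, h1, h2, h3⟩ := hNf.top i hf0
    obtain ⟨s, hs, h1', h2', h3'⟩ := hNg.top i hg0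
    have hPp : ∀ (r : ℕ) f, P f → P ((D i ^ r) f) := by
      intro r; induction r with
      | zero => intro f hf; simpa using hf
      | succ r ih => intro f hf; rw [pow_succ]; exact ih _ (hP i f hf)
    obtain ⟨x, hx0, hx⟩ := hPk i f hf
    have key := skew_top m (D i) (k i) (hD i) (t i) (hk i) _ r s rfl x f g hx h2 h2'
    rw [hfg, map_zero] at key
    have h4 := (smul_eq_zero.1 key.symm).resolve_left
      (mul_ne_zero (pow_ne_zero _ hx0) (ht i _ (gp_ne r s)))
    refine ih (hPp r f hf) (hPp s g hg) h1 h1' h4 _ h3 _ h3' ?_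
    have : r ≠ 0 ∨ s ≠ 0 := by
      by_contra hcon
      push Not at hcon
      obtain ⟨rfl, rfl⟩ := hcon
      exact hi ⟨by simpa using h2, by simpa using h2'⟩
    omega

end skew

section

lemma nilD_of (hC : Cartan q a d) (cd : CD q a d) {M : Type*} [AddCommGroup M] [Module ℂ M] (D X : Fin n → Module.End ℂ M) (s : ℤ) (hs : s = 1 ∨ s = -1)
    (hX : ∀ l μ x, (∀ i, D i x = q ^ (μ i * (d i : ℤ)) • x) → ∀ i, D i (X l x) = q ^ ((μ + s • rt a l) i * (d i : ℤ)) • X l x) (N : Submodule ℂ M) (hN : N.FG) (hXN : ∀ l, ∀ x ∈ N, X l x ∈ N)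
    {x : M} {μ : Fin n → ℤ} (hxN : x ∈ N) (hx : ∀ i, D i x = q ^ (μ i * (d i : ℤ)) • x) : ∃ N : ℕ, NilD X N x := by
  obtain ⟨N, hN⟩ := words_nilp hC cd D (fun l => (l.map X).prod) s hs (fun l => by
    induction l with
    | nil => intro μ x hx i; simpa using hx i
    | cons j l ih =>
      intro μ x hx
      have := hX j _ _ (ih μ x hx)
      intro i
      rw [List.map_cons, List.prod_cons, mul_apply, this i]
      congr 3; simp; ring) N hN (fun l => by
    induction l with
    | nil => intro x hx; simpa using hx
    | cons j l ih => intro x hx; rw [List.map_cons, List.prod_cons, mul_apply]; exact hXN _ _ (ih x hx)) hxN hx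
  exact ⟨N+1, NilD.of_words fun l hl => hN l (by omega)⟩

variable (h : QG q a d E F K Δ ε ρ ι)

lemma QG.lamE_BW {μ ν : Fin n → ℤ} {f : A} (hf : f ∈ h.BW μ ν) (i : Fin n) : h.lam (E i) f ∈ h.BW μ (ν + rt a i) := by
  rw [h.mem_BW] at hf ⊢
  refine ⟨fun j => ?_, fun j => ?_⟩
  · rw [← Module.End.mul_apply, ← map_mul, h.uRel.KE, map_smul, map_mul, LinearMap.smul_apply, Module.End.mul_apply, hf.1, map_smul, smul_smul, ← zpow_add₀ h.C.q0]
    congr 2; simp [rt]; ring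
  · rw [← h.lam_ra, hf.2, map_smul]

lemma QG.lamF_BW {μ ν : Fin n → ℤ} {f : A} (hf : f ∈ h.BW μ ν) (i : Fin n) : h.lam (F i) f ∈ h.BW μ (ν - rt a i) := by
  rw [h.mem_BW] at hf ⊢
  refine ⟨fun j => ?_, fun j => ?_⟩
  · rw [← Module.End.mul_apply, ← map_mul, h.uRel.KF, map_smul, map_mul, LinearMap.smul_apply, Module.End.mul_apply, hf.1, map_smul, smul_smul, ← zpow_add₀ h.C.q0]
    congr 2; simp [rt]; ring
  · rw [← h.lam_ra, hf.2, map_smul]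

lemma QG.raF_BW {μ ν : Fin n → ℤ} {f : A} (hf : f ∈ h.BW μ ν) (i : Fin n) : h.ra (F i) f ∈ h.BW (μ + rt a i) ν := by
  rw [h.mem_BW] at hf ⊢
  refine ⟨fun j => ?_, fun j => ?_⟩
  · rw [h.lam_ra, hf.1, map_smul]
  · have h1 : F i * (K j : U) = q ^ ((d j : ℤ) * a j i) • ((K j : U) * F i) := by
      rw [h.uRel.KF, smul_smul, ← zpow_add₀ h.C.q0]; simp
    rw [← Module.End.mul_apply, ← h.ra_mul, h1, h.ra_smul, h.ra_mul, LinearMap.smul_apply, Module.End.mul_apply, hf.2, map_smul, smul_smul, ← zpow_add₀ h.C.q0]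
    congr 2; simp [rt]; ring

lemma QG.ra_one : h.ra 1 = 1 := by simp [QG.ra]

lemma QG.lam_inv {μ ν : Fin n → ℤ} {f : A} (hf : f ∈ h.BW μ ν) (i : Fin n) : h.lam ⇃(K i) f = q ^ (-(ν i * (d i : ℤ))) • f := by
  have h1 := congrArg (h.lam ⇃(K i)) ((h.mem_BW.1 hf).1 i)
  rw [← Module.End.mul_apply, ← map_mul, Units.inv_mul, map_one, map_smul] at h1
  rw [zpow_neg]
  conv_rhs => rw [← Module.End.one_apply (R := ℂ) f, h1]
  rw [smul_smul, inv_mul_cancel₀ (zpow_ne_zero _ h.C.q0), one_smul]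

lemma QG.ra_inv {μ ν : Fin n → ℤ} {f : A} (hf : f ∈ h.BW μ ν) (i : Fin n) : h.ra ⇃(K i) f = q ^ (-(μ i * (d i : ℤ))) • f := by
  have h1 := congrArg (h.ra ⇃(K i)) ((h.mem_BW.1 hf).2 i)
  rw [← Module.End.mul_apply, ← h.ra_mul, Units.mul_inv, h.ra_one, map_smul] at h1
  rw [zpow_neg]
  conv_rhs => rw [← Module.End.one_apply (R := ℂ) f, h1]
  rw [smul_smul, inv_mul_cancel₀ (zpow_ne_zero _ h.C.q0), one_smul]

lemma QG.nilE (cd : CD q a d) {μ ν : Fin n → ℤ} {f : A} (hf : f ∈ h.BW μ ν) : ∃ N, NilD (fun i => h.lam (E i)) N f := by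
  obtain ⟨N, h1, h2, h3⟩ := h.locfin f
  refine nilD_of h.C cd (fun i => h.lam (K i : U)) (fun i => h.lam (E i)) 1 (Or.inl rfl) (fun l ν x hx => ?_) N h1
    (fun l x hx => h3 1 (E l) x hx) h2 (h.mem_BW.1 hf).1
  have := (repWM h.C h.uRel h.lam).E_mem l ν x (mem_wsp.2 hx)
  rw [one_smul]; exact mem_wsp.1 this

lemma QG.nilF (cd : CD q a d) {μ ν : Fin n → ℤ} {f : A} (hf : f ∈ h.BW μ ν) : ∃ N, NilD (fun i => h.lam (F i)) N f := by
  obtain ⟨N, h1, h2, h3⟩ := h.locfin f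
  refine nilD_of h.C cd (fun i => h.lam (K i : U)) (fun i => h.lam (F i)) (-1) (Or.inr rfl) (fun l ν x hx => ?_) N h1
    (fun l x hx => h3 1 (F l) x hx) h2 (h.mem_BW.1 hf).1
  have := (repWM h.C h.uRel h.lam).F_mem l ν x (mem_wsp.2 hx)
  rw [neg_one_smul, ← sub_eq_add_neg]; exact mem_wsp.1 this

lemma QG.nilRF (cd : CD q a d) {μ ν : Fin n → ℤ} {f : A} (hf : f ∈ h.BW μ ν) : ∃ N, NilD (fun i => h.ra (F i)) N f := by
  obtain ⟨N, h1, h2, h3⟩ := h.locfin f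
  refine nilD_of h.C cd (fun i => h.ra (K i : U)) (fun i => h.ra (F i)) 1 (Or.inl rfl) (fun l μ x hx i => ?_) N h1
    (fun l x hx => h3 (F l) 1 x hx) h2 (h.mem_BW.1 hf).2
  have h1 : F l * (K i : U) = q ^ ((d i : ℤ) * a i l) • ((K i : U) * F l) := by
    rw [h.uRel.KF, smul_smul, ← zpow_add₀ h.C.q0]; simp
  rw [← Module.End.mul_apply, ← h.ra_mul, h1, h.ra_smul, h.ra_mul, LinearMap.smul_apply, Module.End.mul_apply, hx, map_smul, smul_smul, ← zpow_add₀ h.C.q0]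
  congr 2; simp [rt]; ring

lemma QG.eval_one_ne {μ ν : Fin n → ℤ} {f : A} (hf : f ∈ h.BW μ ν) (hf0 : f ≠ 0) (hE : ∀ i, h.lam (E i) f = 0) (hF : ∀ i, h.ra (F i) f = 0) : ι f 1 ≠ 0 := by
  intro h0
  refine hf0 (h.ext fun u => ?_)
  have h1 := hw_span_stable h.C h.uRel h.lam (mem_wsp.2 (h.mem_BW.1 hf).1) hE u
    (y := f) (subset_span ⟨[], by simp [WM.Fw]⟩)
  have h2 : Submodule.span ℂ (Set.range fun l => (repWM h.C h.uRel h.lam).Fw l f) ≤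
      LinearMap.ker ((LinearMap.applyₗ (1 : U)) ∘ₗ ι) := by
    refine Submodule.span_le.2 ?_
    rintro _ ⟨l, rfl⟩
    rcases l with _ | ⟨i, l⟩
    · simpa [WM.Fw] using h0
    · have : ∀ l : List (Fin n), (repWM h.C h.uRel h.lam).Fw l = h.lam (l.map F).prod := fun l => by
        rw [map_list_prod, List.map_map]; rfl
      simp only [SetLike.mem_coe, LinearMap.mem_ker, LinearMap.comp_apply, LinearMap.applyₗ_apply_apply, this]
      rw [h.lam_apply, one_mul, List.map_cons, List.prod_cons, ← h.ra_apply, hF]; simp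
  have h3 := h2 h1
  simp only [LinearMap.mem_ker, LinearMap.comp_apply, LinearMap.applyₗ_apply_apply, h.lam_apply, one_mul] at h3
  rw [h3]; simp

/-- torus operators -/
noncomputable def QG.tor : Fin n ⊕ Fin n → Module.End ℂ A
  | .inl i => h.ra (K i : U)
  | .inr i => h.lam (K i : U)

/-- torus eigenvalues -/
noncomputable def tev (q : ℂ) {n : ℕ} (d : Fin n → ℕ) (p : (Fin n → ℤ) × (Fin n → ℤ)) : Fin n ⊕ Fin n → ℂ
  | .inl i => q ^ (p.1 i * (d i : ℤ))
  | .inr i => q ^ (p.2 i * (d i : ℤ))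

lemma tev_inj (hC : Cartan q a d) : Function.Injective (tev q d) := by
  intro p p' hp
  have := hC.eig_inj (a₁ := p.1) (a₂ := p'.1) (funext fun i => congrFun hp (.inl i))
  have := hC.eig_inj (a₁ := p.2) (a₂ := p'.2) (funext fun i => congrFun hp (.inr i))
  exact Prod.ext ‹_› ‹_›

lemma QG.mem_tor (p : (Fin n → ℤ) × (Fin n → ℤ)) (f : A) : f ∈ h.BW p.1 p.2 ↔ ∀ k, h.tor k f = tev q d p k • f := by
  rw [h.mem_BW]
  constructor
  · rintro ⟨h1, h2⟩ (i | i)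
    · exact h2 i
    · exact h1 i
  · intro hh
    exact ⟨fun i => hh (.inr i), fun i => hh (.inl i)⟩

/-- primeness for graded ideals of `A` -/
lemma QG.gprime (J : Submodule ℂ A) (hJ : ∀ k, ∀ x ∈ J, h.tor k x ∈ J) (hJl : ∀ x, ∀ y ∈ J, x * y ∈ J) (hJr : ∀ x, ∀ y ∈ J, y * x ∈ J)
    (hp : ∀ μ ν μ' ν' x y, x ∈ h.BW μ ν → y ∈ h.BW μ' ν' → x * y ∈ J → x ∈ J ∨ y ∈ J) {x y : A} (hxy : x * y ∈ J) : x ∈ J ∨ y ∈ J :=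
  graded_prime h.tor (tev q d) (tev_inj h.C) (fun p => h.BW p.1 p.2) h.mem_tor
    (fun _ _ _ _ => h.mul_BW) h.sum_BW J hJ hJl hJr (fun _ _ _ _ => hp _ _ _ _ _ _) hxy

include h in
theorem QG.noZero (cd : CD q a d) {f g : A} (hfg : f * g = 0) : f = 0 ∨ g = 0 := by
  have htr : ∀ i, ∀ (P : ℕ[X]), P ≠ 0 → P.eval₂ (Nat.castRingHom ℂ) (q ^ (2 * (d i : ℤ))) ≠ 0 := fun i P hP => by
    have := tr_nat_poly (tr_pow h.C.hq (m := 2 * d i) (by have := h.C.d_pos i; omega)) P hP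
    exact_mod_cast this
  have htr' : ∀ i, ∀ (P : ℕ[X]), P ≠ 0 → P.eval₂ (Nat.castRingHom ℂ) (q ^ (-(2 * (d i : ℤ)))) ≠ 0 := fun i P hP => by
    have h1 : Transcendental ℚ (q ^ (2 * d i))⁻¹ := fun hh => 
      tr_pow h.C.hq (m := 2 * d i) (by have := h.C.d_pos i; omega) (IsAlgebraic.inv_iff.1 hh)
    have := tr_nat_poly h1 P hP
    rw [zpow_neg]; exact_mod_cast this
  have main : ∀ μ ν μ' ν' (x y : A), x ∈ h.BW μ ν → y ∈ h.BW μ' ν' → x * y = 0 → x = 0 ∨ y = 0 := by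
    intro μ ν μ' ν' x y hx hy hxy
    by_contra hcon
    push Not at hcon
    obtain ⟨f, g, ⟨μ1, ν1, hf⟩, ⟨μ2, ν2, hg⟩, hf0, hg0, hfg, hDf, hDg⟩ := skew_reduce (LinearMap.mul ℂ A) (fun i => h.lam (E i))
      (fun i => h.lam (K i : U)) (fun i x y => by
        have := h.lam_two (h.cop.dE i) x y
        simpa using this) (fun i => q ^ (2 * (d i : ℤ))) htr (fun i x => by
        rw [← Module.End.mul_apply, ← map_mul, h.uRel.KE, h.C.diag, mul_comm (d i : ℤ)]; simp)
      (fun f => ∃ μ ν, f ∈ h.BW μ ν) (fun i f ⟨μ, ν, hf⟩ => ⟨_, _, h.lamE_BW hf i⟩)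
      (fun i f ⟨μ, ν, hf⟩ => ⟨_, zpow_ne_zero _ h.C.q0, (h.mem_BW.1 hf).1 i⟩) (fun f ⟨μ, ν, hf⟩ => h.nilE cd hf)
      ⟨_, _, hx⟩ ⟨_, _, hy⟩ hcon.1 hcon.2 hxy
    obtain ⟨g', f', ⟨⟨μ1', ν1', hg'⟩, hEg⟩, ⟨⟨μ2', ν2', hf'⟩, hEf⟩, hg0', hf0', hfg', hDg', hDf'⟩ := skew_reduce (LinearMap.mul ℂ A).flip
      (fun i => h.ra (F i))
      (fun i => h.ra ⇃(K i)) (fun i x y => by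
        have := h.ra_two (h.cop.dF i) y x
        rw [h.ra_one] at this
        simp only [LinearMap.flip_apply, LinearMap.mul_apply', this, Module.End.one_apply]; exact add_comm _ _)
      (fun i => q ^ (-(2 * (d i : ℤ)))) htr' (fun i x => by
        have e : F i * ⇃(K i) = q ^ (-(2 * (d i : ℤ))) • (⇃(K i) * F i) := by
          have h1 := h.uRel.KF i i
          rw [h.C.diag, mul_comm (d i : ℤ)] at h1
          have h2 := congrArg (fun z => ⇃(K i) * z * ⇃(K i)) h1
          simpa [mul_assoc] using h2
        rw [← Module.End.mul_apply, ← h.ra_mul, e, h.ra_smul, h.ra_mul]; rfl)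
      (fun f => (∃ μ ν, f ∈ h.BW μ ν) ∧ ∀ i, h.lam (E i) f = 0)
      (fun i f ⟨⟨μ, ν, hf⟩, hE⟩ => ⟨⟨_, _, h.raF_BW hf i⟩, fun j => by rw [h.lam_ra, hE, map_zero]⟩)
      (fun i f ⟨⟨μ, ν, hf⟩, _⟩ => ⟨_, zpow_ne_zero _ h.C.q0, h.ra_inv hf i⟩) (fun f ⟨⟨μ, ν, hf⟩, _⟩ => h.nilRF cd hf)
      ⟨⟨_, _, hg⟩, hDg⟩ ⟨⟨_, _, hf⟩, hDf⟩ hg0 hf0 hfg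
    have e1 := h.eval_one_ne hf' hf0' hEf hDf'
    have e2 := h.eval_one_ne hg' hg0' hEg hDg'
    have e3 : ι (f' * g') 1 = ι f' 1 * ι g' 1 := by
      rw [h.mul_apply, map_one, Algebra.TensorProduct.one_def]; simp
    have e4 : f' * g' = 0 := hfg'
    rw [e4] at e3
    exact mul_ne_zero e1 e2 (by rw [← e3]; simp)
  have := h.gprime ⊥ (fun k x hx => by simp at hx; simp [hx]) (fun x y hy => by simp at hy; simp [hy])
    (fun x y hy => by simp at hy; simp [hy]) (fun μ ν μ' ν' x y hx hy hxy => by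
      simpa using main μ ν μ' ν' x y hx hy (by simpa using hxy)) (x := f) (y := g) (by simpa using hfg)
  simpa using this

include h in
theorem QG.domain (cd : CD q a d) : IsDomain A := by
  have : NoZeroDivisors A := ⟨fun {a b} hab => h.noZero cd hab⟩
  have : Nontrivial A := ⟨1, 0, fun h1 => by
    have := h.one; rw [h1, map_zero] at this
    have := congrArg (fun φ => φ 1) this; simp at this⟩
  exact NoZeroDivisors.to_isDomain A

end

/-! ## The normal elements `c_i` -/

section

variable (h : QG q a d E F K Δ ε ρ ι)

/-- the extremal coefficient of the `i`-th fundamental representation -/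
structure QG.Cp (cd : CD q a d) (i : Fin n) (c : A) (m : Fin n → ℤ) : Prop where
  ne : c ≠ 0
  wt : c ∈ h.BW m (Pi.single i 1)
  E : ∀ j, h.lam (E j) c = 0
  F : ∀ j, j ≠ i → h.lam (F j) c = 0
  rel : ∀ μ ν f, f ∈ h.BW μ ν → cd.χ μ m • (f * c) = cd.χ ν (Pi.single i 1) • (c * f)

lemma word_kill {A : Type*} [AddCommGroup A] [Module ℂ A] {c : Fin n → ℤ} (hc : c ≠ 0) {u : Wd n} (hu : u ∈ Wt c)
    (φ : U →ₗ[ℂ] A) (h1 : ∀ j l, φ ((List.map E (j :: l)).prod) = 0) : φ (wev E u) = 0 := by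
  refine Wt_induct (p := fun u => φ (wev E u) = 0) (by simp) (fun u v h1 h2 => by rw [map_add, map_add, h1, h2, add_zero])
    (fun x u h => by rw [map_smul, map_smul, h, smul_zero]) (fun l hl => ?_) hu
  cases l with
  | nil => exact (hc hl.symm).elim
  | cons j l => rw [wev_sg]; exact h1 j l

lemma QG.exists_Cp (cd : CD q a d) (i : Fin n) : ∃ c m, h.Cp cd i c m := by
  obtain ⟨i0, v, hv0, hv, hvE⟩ := h.hw (Pi.single i 1)
  have hv : v ∈ wsp q d K (ρ i0) (Pi.single i 1) := by
    convert hv using 2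
    funext j; by_cases hj : j = i
    · subst hj; simp
    · simp [hj]
  have hsr := h.sr i0
  have := hsr.fd
  have := hsr.nt
  obtain ⟨m, b, β, hb⟩ := exists_wt_basis _ hsr.sum
  have hne : Nonempty (Fin m) := b.index_nonempty
  obtain ⟨k, -, hk⟩ := Finset.exists_min_image Finset.univ (fun k => cd.ht (β k)) ⟨hne.some, Finset.mem_univ _⟩
  have hξ := dwt_coord h.C hb k
  have hξE : ∀ j, b.coord k ∘ₗ ρ i0 (E j) = 0 := fun j => b.ext fun l => by
    have h1 := (repWM h.C h.uRel (ρ i0)).E_mem j _ _ (hb l)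
    refine hξ _ (fun h0 => ?_) _ h1
    have h2 := hk l (Finset.mem_univ _)
    rw [← h0, map_add, cd.ht_rt] at h2
    have := cd.hp_pos
    omega
  obtain ⟨c, hc⟩ := h.coef i0 (b.coord k) v
  have hE : ∀ j, h.lam (E j) c = 0 := fun j => h.ext fun x => by
    rw [h.lam_apply, hc]; simp [hvE]
  have hrE : ∀ j, h.ra (E j) c = 0 := fun j => h.ext fun x => by
    rw [h.ra_apply, hc]
    have := congrArg (fun φ : Module.Dual ℂ (V i0) => φ (ρ i0 x v)) (hξE j)
    simpa using this
  refine ⟨c, β k, ?_, h.coef_BW hsr.sum hξ hv hc, hE, ?_, ?_⟩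
  · rintro rfl
    obtain ⟨u, hu⟩ := simp_orbit hsr.simp hv0 (b k)
    have := congrArg (fun φ : U →ₗ[ℂ] ℂ => φ u) hc
    simp [hu] at this
  · intro j hj
    have hFv : ρ i0 (F j) v = 0 := by
      by_contra h0
      have hw := (repWM h.C h.uRel (ρ i0)).F_mem j _ _ hv
      obtain ⟨l, hl⟩ := hw_weights h.C h.uRel hsr.simp hw (fun l => by
        have := (repWM h.C h.uRel (ρ i0)).comm l j _ v hv
        change ρ i0 (E l) (ρ i0 (F j) v) - ρ i0 (F j) (ρ i0 (E l) v) = _ at this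
        rw [hvE, map_zero, sub_zero] at this
        change ρ i0 (E l) (ρ i0 (F j) v) = 0
        rw [this]
        split_ifs with h1
        · subst h1; simp [hj, br]
        · rfl) h0 hv hv0
      have h2 := congrArg cd.ht hl
      rw [map_sub, map_sub, cd.ht_rt, ht_bw_of cd.ht_rt] at h2
      have := cd.hp_pos
      nlinarith
    exact h.ext fun x => by rw [h.lam_apply, hc]; simp [hFv]
  · obtain ⟨db⟩ := exists_DB q a d
    let W : (Fin n → ℤ) × (Fin n → ℤ) → Submodule ℂ A := fun p =>
      h.BW p.1 p.2 ⊓ LinearMap.ker (cd.χ p.1 (β k) • LinearMap.mulRight ℂ c - cd.χ p.2 (Pi.single i 1) • LinearMap.mulLeft ℂ c)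
    have hW : ∀ p f, f ∈ W p ↔ f ∈ h.BW p.1 p.2 ∧ cd.χ p.1 (β k) • (f * c) = cd.χ p.2 (Pi.single i 1) • (c * f) := fun p f => by
      simp [W, sub_eq_zero]
    have key : ∀ f, f ∈ ⨆ p, W p := by
      have χ0 : ∀ ν, cd.χ 0 ν = 1 := fun ν => by
        have := cd.χ_add_left 0 0 ν
        rw [add_zero] at this
        exact mul_left_cancel₀ (cd.χ_ne 0 ν) (by rw [← this, mul_one])
      refine fun f => h.induct (fun x => x ∈ ⨆ p, W p) ?_
        (fun x y => Submodule.add_mem _) (fun t x => smul_mem _ t) ?_ ?_ f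
      · exact mem_iSup_of_mem (0, 0) ((hW _ _).2 ⟨h.one_BW, by simp [χ0]⟩)
      · intro x y hx hy
        induction hx using Submodule.iSup_induction' with
        | zero => rw [zero_mul]; exact zero_mem _
        | add x x' _ _ h1 h2 => rw [add_mul]; exact add_mem h1 h2
        | mem p x hx =>
          induction hy using Submodule.iSup_induction' with
          | zero => rw [mul_zero]; exact zero_mem _
          | add y y' _ _ h1 h2 => rw [mul_add]; exact add_mem h1 h2
          | mem p' y hy =>
            rw [hW] at hx hy
            refine mem_iSup_of_mem (p + p') ((hW _ _).2 ⟨h.mul_BW hx.1 hy.1, ?_⟩)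
            change cd.χ (p.1 + p'.1) _ • _ = cd.χ (p.2 + p'.2) _ • _
            rw [cd.χ_add_left, cd.χ_add_left, mul_assoc x, mul_smul, ← mul_smul_comm (cd.χ p'.1 _), hy.2, mul_smul_comm,
              smul_comm, ← mul_assoc x, ← smul_mul_assoc, hx.2, smul_mul_assoc, smul_smul, mul_assoc, mul_comm (cd.χ p.2 _)]
      · intro i1 ξ' v' x hx
        have := (h.sr i1).fd
        obtain ⟨m', b', β', hb'⟩ := exists_wt_basis _ (h.sr i1).sum
        choose y hy using fun k l => h.coef i1 (b'.coord k) (b' l)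
        have : x = ∑ k, ∑ l, (ξ' (b' k) * b'.repr v' l) • y k l := h.inj (by
          rw [hx, mc_expand b']; simp only [map_sum, map_smul, hy])
        rw [this]
        refine Submodule.sum_mem _ fun k1 _ => Submodule.sum_mem _ fun l _ => smul_mem _ _ ?_
        refine mem_iSup_of_mem (β' k1, β' l) ((hW _ _).2 ⟨h.coef_BW (h.sr i1).sum (dwt_coord h.C hb' k1) (hb' l) (hy k1 l), ?_⟩)
        obtain ⟨S, hS0, hS⟩ := h.R_rel cd db (h.sr i1) hsr (dwt_coord h.C hb' k1) hξ (hb' l) hv (hy k1 l) hc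
        have e1 : ∀ s ∈ S, ∀ k, h.ra (wev E (db.h' s k)) c = 0 := fun s hs k => by
          refine word_kill (E := E) (fun h0 => hS0 (h0 ▸ hs)) (db.h'_mem s k)
            ⟨⟨fun u => h.ra u c, fun u v => by rw [h.ra_add]; rfl⟩, fun t u => by change h.ra (t • u) c = t • h.ra u c; rw [h.ra_smul]; rfl⟩ (fun j l => ?_)
          change h.ra _ c = 0
          rw [List.map_cons, List.prod_cons, h.ra_mul, Module.End.mul_apply, hrE, map_zero]
        have e2 : ∀ s ∈ S, ∀ k, h.lam (wev E (db.h' s k)) c = 0 := fun s hs k => by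
          refine word_kill (E := E) (fun h0 => hS0 (h0 ▸ hs)) (db.h'_mem s k)
            ⟨⟨fun u => h.lam u c, fun u v => by rw [map_add]; rfl⟩, fun t u => by change h.lam (t • u) c = t • h.lam u c; rw [map_smul]; rfl⟩ (fun j l => ?_)
          change h.lam _ c = 0
          obtain ⟨l', j', hl⟩ := List.eq_nil_or_concat (j :: l) |>.resolve_left (by simp)
          rw [hl, List.concat_eq_append, List.map_append, List.prod_append, map_mul, Module.End.mul_apply]
          simp [hE]
        rw [sum_eq_zero (fun s hs => sum_eq_zero fun k _ => by rw [e1 s hs k]; simp),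
          sum_eq_zero (fun s hs => sum_eq_zero fun k _ => by rw [e2 s hs k]; simp), add_zero, add_zero] at hS
        exact hS
    intro μ ν f hf
    by_contra hcon
    obtain ⟨s, y, h1, h2, h3⟩ := exists_comp W ⊥ f (key f)
    rw [Submodule.mem_bot, sub_eq_zero] at h3
    classical
    have h4 : ∑ p ∈ insert (μ, ν) s, ((if p ∈ s then y p else 0) - (if p = (μ, ν) then f else 0)) = 0 := by
      rw [sum_sub_distrib, Finset.sum_ite_eq' , if_pos (Finset.mem_insert_self _ _), ← Finset.sum_filter, h3]
      rw [sub_eq_zero]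
      refine sum_congr ?_ fun _ _ => rfl
      ext p; simp
    have h5 := joint_eig h.tor (tev q d) (tev_inj h.C) _ _ (fun p hp => (h.mem_tor p _).1 (by
      refine sub_mem ?_ ?_
      · split_ifs
        · exact ((hW _ _).1 (h1 p)).1
        · exact zero_mem _
      · split_ifs with h6
        · rw [h6]; exact hf
        · exact zero_mem _)) h4 (μ, ν) (Finset.mem_insert_self _ _)
    rw [if_pos rfl, sub_eq_zero] at h5
    apply hcon
    rw [← h5]
    split_ifs
    · exact ((hW _ _).1 (h1 (μ, ν))).2
    · simp

lemma QG.Cp.inner {h : QG q a d E F K Δ ε ρ ι} {cd : CD q a d} {i : Fin n} {c : A} {m : Fin n → ℤ} (hc : h.Cp cd i c m) {μ ν : Fin n → ℤ} {f : A} (hf : f ∈ h.BW μ ν) :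
    (1 - (qi q d i)⁻¹ ^ 2) • (c * h.lam (F i) f) = (cd.χ μ m * (cd.χ ν (Pi.single i 1))⁻¹) • (f * h.lam (F i) c) - h.lam (F i) c * h.lam ⇃(K i) f := by
  have h0 := hc.rel μ ν f hf
  have h1 := congrArg (h.lam (F i)) h0
  have h2 := hc.rel _ _ _ (h.lamF_BW hf i)
  have h3 : cd.χ (ν - rt a i) (Pi.single i 1) = cd.χ ν (Pi.single i 1) * (qi q d i)⁻¹ := by
    have := cd.χ_add_left (ν - rt a i) (rt a i) (Pi.single i 1)
    rw [sub_add_cancel, cd.χ_rt_left] at this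
    rw [this, qi]; simp
    rw [mul_assoc, mul_inv_cancel₀ (pow_ne_zero _ h.C.q0), mul_one]
  rw [map_smul, map_smul, h.lam_two (h.cop.dF i), h.lam_two (h.cop.dF i), map_one, Module.End.one_apply, Module.End.one_apply, h.lam_inv hc.wt i] at h1
  have h4 : (q ^ (-((Pi.single i 1 : Fin n → ℤ) i * (d i : ℤ)))) = (qi q d i)⁻¹ := by
    simp [qi]
  rw [h4, mul_smul_comm, smul_add, smul_comm, h2, h3] at h1
  have hx := cd.χ_ne ν (Pi.single i 1)
  have h5 : cd.χ ν (Pi.single i 1) • ((1 - (qi q d i)⁻¹ ^ 2) • (c * h.lam (F i) f)) = cd.χ ν (Pi.single i 1) • 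
    ((cd.χ μ m * (cd.χ ν (Pi.single i 1))⁻¹) • (f * h.lam (F i) c) - h.lam (F i) c * h.lam ⇃(K i) f) := by
    rw [smul_sub, mul_comm (cd.χ μ m), smul_smul (cd.χ ν _) (_ * _), mul_inv_cancel_left₀ hx]
    rw [← sub_eq_zero] at h1 ⊢
    rw [← neg_eq_zero, ← h1]
    module
  exact smul_right_injective _ hx h5

end

/-! ## The division ring of fractions -/

/-- `j` embeds `A` in its division ring of fractions -/
structure Fr {A D : Type} [Ring A] [Algebra ℂ A] [DivisionRing D] [Algebra ℂ D] (j : A →ₐ[ℂ] D) : Prop where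
  inj : Function.Injective j
  rf : ∀ x, ∃ a s, s ≠ 0 ∧ x * j s = j a
  lf : ∀ x, ∃ a s, s ≠ 0 ∧ j s * x = j a
  ext : ∀ σ : A →ₐ[ℂ] A, Function.Injective σ → ∃ τ : D →ₐ[ℂ] D, ∀ a, τ (j a) = j (σ a)

open nonZeroDivisors in
lemma exists_Fr (A : Type) [Ring A] [Algebra ℂ A] [IsDomain A] [IsNoetherianRing A] [IsNoetherianRing Aᵐᵒᵖ] : ∃ (D : Type) (_ : DivisionRing D) (_ : Algebra ℂ D) (j : A →ₐ[ℂ] D), Fr j := by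
  obtain ⟨_⟩ : Nonempty (OreLocalization.OreSet A⁰) := nonempty_oreSet_of_strongRankCondition
  obtain ⟨hop⟩ : Nonempty (OreLocalization.OreSet Aᵐᵒᵖ⁰) := nonempty_oreSet_of_strongRankCondition
  let j : A →ₐ[ℂ] OreLocalization A⁰ A :=
    { (OreLocalization.numeratorRingHom : A →+* OreLocalization A⁰ A) with
      commutes' := fun r => rfl }
  have hj : ∀ a, j a = OreLocalization.numeratorHom a := fun a => rfl
  have inj : Function.Injective j := OreLocalization.numeratorHom_inj (fun x hx => by
    intro y hy; exact (mul_eq_zero.1 hy).resolve_left (nonZeroDivisors.ne_zero hx))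
  have hj0 : ∀ {s}, s ≠ 0 → j s ≠ 0 := fun hs h0 => hs (inj (by rw [h0, map_zero]))
  have lf : ∀ x, ∃ a s, s ≠ 0 ∧ j s * x = j a := fun x => by
    induction x using OreLocalization.ind with
    | _ r s =>
      refine ⟨r, s, nonZeroDivisors.ne_zero s.2, ?_⟩
      rw [hj, hj, OreLocalization.numeratorHom_apply, OreLocalization.numeratorHom_apply]
      rw [OreLocalization.oreDiv_mul_char (s : A) r 1 s 1 1 (by simp)]
      simp
  refine ⟨_, inferInstance, inferInstance, j, inj, fun x => ?_, lf, fun σ hσ => ?_⟩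
  · obtain ⟨a, s, hs, hx⟩ := lf x
    obtain ⟨r', s', h'⟩ := (OreLocalization.nonempty_oreSet_iff_of_noZeroDivisors (S := Aᵐᵒᵖ⁰)).1 ⟨hop⟩ (op a)
      ⟨op s, mem_nonZeroDivisors_of_ne_zero (by simpa using hs)⟩
    have h2 : a * unop (s' : Aᵐᵒᵖ) = s * unop r' := congrArg unop h'
    have hs' : unop (s' : Aᵐᵒᵖ) ≠ 0 := by simpa using nonZeroDivisors.ne_zero s'.2
    refine ⟨unop r', unop (s' : Aᵐᵒᵖ), hs', mul_left_cancel₀ (hj0 hs) ?_⟩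
    rw [← mul_assoc, hx, ← map_mul, h2, map_mul]
  · let f : A →+* OreLocalization A⁰ A := (j.comp σ : A →+* OreLocalization A⁰ A)
    have hf : ∀ s : A⁰, f s ≠ 0 := fun s => hj0 (fun h0 => nonZeroDivisors.ne_zero s.2 (hσ ((show σ s = 0 from h0).trans (map_zero σ).symm)))
    let fS : A⁰ →* (OreLocalization A⁰ A)ˣ :=
      { toFun := fun s => Units.mk0 (f s) (hf s)
        map_one' := by ext; simp
        map_mul' := fun x y => by ext; simp }
    let τ := OreLocalization.universalHom f fS (fun s => rfl)
    have hτ : ∀ a, τ (j a) = j (σ a) := fun a => OreLocalization.universalHom_commutes f fS _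
    have hr : ∀ r, τ (algebraMap ℂ _ r) = algebraMap ℂ _ r := fun r => by
      have := hτ (algebraMap ℂ A r)
      rwa [σ.commutes, j.commutes] at this
    exact ⟨{ τ with commutes' := hr }, hτ⟩

section
variable {A D : Type} [Ring A] [Algebra ℂ A] [DivisionRing D] [Algebra ℂ D] {j : A →ₐ[ℂ] D} (hj : Fr j)
include hj

lemma Fr.ne {s : A} (hs : s ≠ 0) : j s ≠ 0 := fun h0 => hs (hj.inj (by rw [h0, map_zero]))

lemma Fr.skew0 (α β : D →ₐ[ℂ] D) (Φ : D → D) (hΦ : ∀ x y, Φ (x * y) = Φ x * α y + β x * Φ y) (h0 : ∀ a, Φ (j a) = 0) (x : D) : Φ x = 0 := by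
  obtain ⟨a, s, hs, hx⟩ := hj.rf x
  have := hΦ x (j s)
  rw [hx, h0, h0, mul_zero, add_zero] at this
  exact (mul_eq_zero.1 this.symm).resolve_right (by simpa using hj.ne hs)

lemma Fr.hom_ext (α β : D →ₐ[ℂ] D) (h0 : ∀ a, α (j a) = β (j a)) (x : D) : α x = β x :=
  sub_eq_zero.1 (hj.skew0 α β (fun x => α x - β x) (fun x y => by
    simp only [map_mul, sub_mul, mul_sub]; abel) (fun a => by simp [h0]) x)

/-- common denominators -/
lemma Fr.common (s : Finset D) : ∃ t, t ≠ 0 ∧ ∀ x ∈ s, ∃ a, x * j t = j a := by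
  classical
  induction s using Finset.induction_on with
  | empty => exact ⟨1, fun h0 => one_ne_zero (α := D) (by rw [← map_one j, h0, map_zero]), by simp⟩
  | insert x s _ ih =>
    obtain ⟨t, ht, h1⟩ := ih
    obtain ⟨a, u, hu, h2⟩ := hj.rf (x * j t)
    refine ⟨t * u, fun h0 => ?_, fun z hz => ?_⟩
    · have := congrArg j h0
      rw [map_mul, map_zero] at this
      exact mul_ne_zero (hj.ne ht) (hj.ne hu) this
    · rcases Finset.mem_insert.1 hz with rfl | hz
      · exact ⟨a, by rw [map_mul, ← mul_assoc, h2]⟩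
      · obtain ⟨b, hb⟩ := h1 z hz
        exact ⟨b * u, by rw [map_mul, ← mul_assoc, hb, map_mul]⟩
end

/-! ## Extending the operators to the division ring -/

lemma inner_div {D : Type*} [DivisionRing D] [Algebra ℂ D] {κ s r : ℂ} (hκ : κ ≠ 0) (hr : r ≠ 0) {f c g e k : D} (hc : c ≠ 0)
    (h1 : s • (f * c) = r • (c * f)) (h2 : κ • (c * g) = (s * r⁻¹) • (f * e) - e * k) : g = κ⁻¹ • (f * (c⁻¹ * e) - c⁻¹ * e * k) := by
  have h3 : (s * r⁻¹) • f = c * f * c⁻¹ := by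
    have := congrArg (fun z => r⁻¹ • (z * c⁻¹)) h1
    simp only [smul_mul_assoc, smul_smul, inv_mul_cancel₀ hr, one_smul, mul_assoc f, mul_inv_cancel₀ hc, mul_one] at this
    rw [mul_comm, this]
  rw [← smul_mul_assoc (s * r⁻¹), h3] at h2
  have h4 := congrArg (fun z => κ⁻¹ • (c⁻¹ * z)) h2
  simp only [mul_smul_comm, smul_smul, inv_mul_cancel₀ hκ, one_smul, inv_mul_cancel_left₀ hc] at h4
  rw [h4, mul_sub]
  simp only [mul_assoc, inv_mul_cancel_left₀ hc]

section

variable (h : QG q a d E F K Δ ε ρ ι)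

lemma QG.opp_lam (u : U) (f : A) : h.opp.lam u (op f) = op (h.lam u f) := h.opp.ext fun x => by
  rw [h.opp.lam_apply, iop_op, iop_op, h.lam_apply]

lemma QG.opp_BW {μ ν : Fin n → ℤ} {f : A} : op f ∈ h.opp.BW μ ν ↔ f ∈ h.BW (-μ) (-ν) := by
  have key : ∀ (T T' : Module.End ℂ A) (_ : T * T' = 1) (_ : T' * T = 1) (z : ℤ) (x : A), T' x = q ^ z • x ↔ T x = q ^ (-z) • x := fun T T' h1 h2 z x => by
    have e1 : ∀ y, T (T' y) = y := fun y => by rw [← Module.End.mul_apply, h1]; rfl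
    have e2 : ∀ y, T' (T y) = y := fun y => by rw [← Module.End.mul_apply, h2]; rfl
    constructor
    · intro hh
      have := congrArg T hh
      rw [e1, map_smul] at this
      rw [zpow_neg]; conv_rhs => rw [this]
      rw [smul_smul, inv_mul_cancel₀ (zpow_ne_zero _ h.C.q0), one_smul]
    · intro hh
      have := congrArg T' hh
      rw [e2, map_smul] at this
      conv_rhs => rw [this]
      rw [smul_smul, ← zpow_add₀ h.C.q0, add_neg_cancel, zpow_zero, one_smul]
  have e3 : ∀ u, h.opp.ra u (op f) = op (h.ra u f) := fun u => h.opp.ext fun x => by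
    rw [h.opp.ra_apply, iop_op, iop_op, h.ra_apply]
  rw [h.opp.mem_BW, h.mem_BW]
  simp only [h.opp_lam, e3, ← op_smul, op_inj]
  refine and_congr (forall_congr' fun i => ?_) (forall_congr' fun i => ?_)
  · rw [key (h.lam (K i : U)) _ (by rw [← map_mul]; simp) (by rw [← map_mul]; simp)]
    simp
  · rw [key (h.ra (K i : U)) _ (by rw [← h.ra_mul]; simp [h.ra_one]) (by rw [← h.ra_mul]; simp [h.ra_one])]
    simp

variable {D : Type} [DivisionRing D] [Algebra ℂ D]

/-- the data used on the division ring -/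
structure Ops (cd : CD q a d) (j : A →ₐ[ℂ] D) where
  fr : Fr j
  c : Fin n → A
  c' : Fin n → A
  m : Fin n → Fin n → ℤ
  m' : Fin n → Fin n → ℤ
  hc : ∀ i, h.Cp cd i (c i) (m i)
  hc' : ∀ i, h.opp.Cp cd i (op (c' i)) (m' i)
  T : Fin n ⊕ Fin n → D →ₐ[ℂ] D
  T_j : ∀ k f, T k (j f) = j (h.tor k f)
  Ti : Fin n → D →ₐ[ℂ] D
  Ti_j : ∀ i f, Ti i (j f) = j (h.lam ⇃(K i) f)

lemma QG.exists_Ops (cd : CD q a d) {j : A →ₐ[ℂ] D} (hj : Fr j) {c : Fin n → A} {m : Fin n → Fin n → ℤ} (hc : ∀ i, h.Cp cd i (c i) (m i)) : ∃ o : Ops h cd j, o.c = c := by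
  have key : ∀ T T' : Module.End ℂ A, T' * T = 1 → T 1 = 1 → (∀ x y, T (x * y) = T x * T y) → ∃ τ : D →ₐ[ℂ] D, ∀ f, τ (j f) = j (T f) := fun T T' h1 h2 h3 => by
    have := hj.ext (AlgHom.ofLinearMap T h2 h3) (fun x y hxy => by
      have := congrArg T' (show T x = T y from hxy)
      rwa [← Module.End.mul_apply, ← Module.End.mul_apply, h1] at this)
    exact this
  have k1 : ∀ k, ∃ τ : D →ₐ[ℂ] D, ∀ f, τ (j f) = j (h.tor k f) := by
    rintro (i | i)
    · exact key _ (h.ra ⇃(K i)) (by change _ * h.ra _ = 1; rw [← h.ra_mul]; simp [h.ra_one])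
        (by change h.ra _ _ = _; rw [h.ra_unit, h.eK, one_smul]) (h.ra_one' (h.cop.dK i))
    · exact key _ (h.lam ⇃(K i)) (by change _ * h.lam _ = 1; rw [← map_mul]; simp)
        (by change h.lam _ _ = _; rw [h.lam_unit, h.eK, one_smul]) (h.lam_one' (h.cop.dK i))
  have k2 : ∀ i, ∃ τ : D →ₐ[ℂ] D, ∀ f, τ (j f) = j (h.lam ⇃(K i) f) := fun i =>
    key _ (h.lam (K i : U)) (by rw [← map_mul]; simp)
        (by rw [h.lam_unit, h.eKi, one_smul]) (h.lam_one' (h.cop.dKi i))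
  choose c' m' hc' using h.opp.exists_Cp cd
  choose T hT using k1
  choose Ti hTi using k2
  exact ⟨⟨hj, c, fun i => unop (c' i), m, m', hc, hc', T, hT, Ti, hTi⟩, rfl⟩

variable {h} {cd : CD q a d} {j : A →ₐ[ℂ] D} (o : Ops h cd j)

/-- weight spaces in `D` -/
def Ops.W (p : (Fin n → ℤ) × (Fin n → ℤ)) : Submodule ℂ D where
  carrier := {x | ∀ k, o.T k x = tev q d p k • x}
  add_mem' hx hy k := by rw [map_add, hx k, hy k, smul_add]
  zero_mem' k := by simp
  smul_mem' t x hx k := by rw [map_smul, hx k, smul_comm]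

lemma tev_add (q0 : q ≠ 0) (p p' : (Fin n → ℤ) × (Fin n → ℤ)) (k) : tev q d (p + p') k = tev q d p k * tev q d p' k := by
  rcases k with i | i <;> simp [tev, add_mul, zpow_add₀ q0]
lemma tev_neg (p : (Fin n → ℤ) × (Fin n → ℤ)) (k) : tev q d (-p) k = (tev q d p k)⁻¹ := by
  rcases k with i | i <;> simp [tev]
lemma tev_zero (k) : tev q d (0 : (Fin n → ℤ) × (Fin n → ℤ)) k = 1 := by
  rcases k with i | i <;> simp [tev]

lemma Ops.W_mul {p p' : (Fin n → ℤ) × (Fin n → ℤ)} {x y : D} (hx : x ∈ o.W p) (hy : y ∈ o.W p') : x * y ∈ o.W (p + p') := fun k => by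
  rw [map_mul, hx k, hy k, smul_mul_smul_comm, tev_add h.C.q0]

lemma Ops.W_one : 1 ∈ o.W 0 := fun k => by rw [map_one, tev_zero, one_smul]

lemma Ops.W_inv {p : (Fin n → ℤ) × (Fin n → ℤ)} {x : D} (hx : x ∈ o.W p) : x⁻¹ ∈ o.W (-p) := fun k => by
  rw [map_inv₀, hx k, tev_neg, smul_inv₀]

lemma Ops.W_j {p : (Fin n → ℤ) × (Fin n → ℤ)} {f : A} : j f ∈ o.W p ↔ f ∈ h.BW p.1 p.2 := by
  rw [h.mem_tor]
  refine forall_congr' fun k => ?_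
  rw [o.T_j, ← map_smul]
  exact o.fr.inj.eq_iff

lemma Ops.Ti_T (i : Fin n) (x : D) : o.Ti i (o.T (.inr i) x) = x :=
  o.fr.hom_ext ((o.Ti i).comp (o.T (.inr i))) (AlgHom.id ℂ D) (fun f => by
    simp only [AlgHom.comp_apply, o.T_j, o.Ti_j, AlgHom.id_apply]
    change j (h.lam _ (h.lam _ f)) = _
    rw [← mul_apply, ← map_mul]; simp) x

lemma Ops.Ti_W {p : (Fin n → ℤ) × (Fin n → ℤ)} {x : D} (hx : x ∈ o.W p) (i : Fin n) : o.Ti i x = q ^ (-(p.2 i * (d i : ℤ))) • x := by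
  have h1 := congrArg (o.Ti i) (hx (.inr i))
  rw [o.Ti_T, map_smul] at h1
  conv_rhs => rw [h1]
  rw [smul_smul, tev, ← zpow_add₀ h.C.q0, neg_add_cancel, zpow_zero, one_smul]

/-- the elements `y_i`, `y_i'` giving inner skew derivations -/
noncomputable def Ops.y (i : Fin n) : D := (j (o.c i))⁻¹ * j (h.lam (F i) (o.c i))
noncomputable def Ops.y' (i : Fin n) : D := j (h.lam (E i) (o.c' i)) * (j (o.c' i))⁻¹

/-- constant -/
noncomputable def hh (q : ℂ) {n : ℕ} (d : Fin n → ℕ) (i : Fin n) : ℂ := (1 - (qi q d i)⁻¹ ^ 2)⁻¹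

lemma hh_ne (hC : Cartan q a d) (i : Fin n) : 1 - (qi q d i)⁻¹ ^ 2 ≠ 0 := fun h0 => (hC.nru i).2 (-2) (by norm_num) (by
  rw [sub_eq_zero] at h0
  rw [zpow_neg, ← inv_zpow]; exact h0.symm)

noncomputable def Ops.Fd (i : Fin n) : Module.End ℂ D :=
  hh q d i • (LinearMap.mulRight ℂ (o.y i) - LinearMap.mulLeft ℂ (o.y i) ∘ₗ (o.Ti i).toLinearMap)
noncomputable def Ops.Ed (i : Fin n) : Module.End ℂ D :=
  hh q d i • (LinearMap.mulLeft ℂ (o.y' i) - LinearMap.mulRight ℂ (o.y' i) ∘ₗ (o.T (.inr i)).toLinearMap)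

lemma Ops.Fd_def (i : Fin n) (x : D) : o.Fd i x = hh q d i • (x * o.y i - o.y i * o.Ti i x) := rfl
lemma Ops.Ed_def (i : Fin n) (x : D) : o.Ed i x = hh q d i • (o.y' i * x - o.T (.inr i) x * o.y' i) := rfl

lemma Ops.Fd_mul (i : Fin n) (x y : D) : o.Fd i (x * y) = o.Fd i x * o.Ti i y + x * o.Fd i y := by
  simp only [o.Fd_def, map_mul, smul_mul_assoc, mul_smul_comm, ← smul_add]
  congr 1; noncomm_ring
lemma Ops.Ed_mul (i : Fin n) (x y : D) : o.Ed i (x * y) = o.Ed i x * y + o.T (.inr i) x * o.Ed i y := by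
  simp only [o.Ed_def, map_mul, smul_mul_assoc, mul_smul_comm, ← smul_add]
  congr 1; noncomm_ring

lemma Ops.hom_induct {P : A → Prop} (hP : ∀ μ ν f, f ∈ h.BW μ ν → P f) (h0 : P 0) (hadd : ∀ f g, P f → P g → P (f + g)) (f : A) : P f := by
  have hf : f ∈ ⨆ p : (Fin n → ℤ) × (Fin n → ℤ), h.BW p.1 p.2 := by rw [h.sum_BW]; trivial
  induction hf using Submodule.iSup_induction' with
  | mem p x hx => exact hP _ _ _ hx
  | zero => exact h0
  | add x y _ _ h1 h2 => exact hadd _ _ h1 h2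

lemma Ops.Fd_j (i : Fin n) (f : A) : o.Fd i (j f) = j (h.lam (F i) f) := by
  refine Ops.hom_induct (h := h) (P := fun f => o.Fd i (j f) = j (h.lam (F i) f)) (fun μ ν f hf => ?_) (by simp)
    (fun f g h1 h2 => by simp only [map_add, h1, h2]) f
  rw [o.Fd_def, o.Ti_j]
  refine (inner_div (s := cd.χ μ (o.m i)) (hh_ne h.C i) (cd.χ_ne ν (Pi.single i 1)) (o.fr.ne (o.hc i).ne) ?_ ?_).symm
  · have := congrArg j ((o.hc i).rel μ ν f hf)
    simpa only [map_smul, map_mul] using this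
  · have := congrArg j ((o.hc i).inner hf)
    simpa only [map_smul, map_mul, map_sub] using this

lemma Ops.c'_ne (i : Fin n) : o.c' i ≠ 0 := fun h0 => (o.hc' i).ne (by rw [h0]; rfl)

lemma Ops.Ed_j (i : Fin n) (f : A) : o.Ed i (j f) = j (h.lam (E i) f) := by
  refine Ops.hom_induct (h := h) (P := fun f => o.Ed i (j f) = j (h.lam (E i) f)) (fun μ ν f hf => ?_) (by simp)
    (fun f g h1 h2 => by simp only [map_add, h1, h2]) f
  have hf' : op f ∈ h.opp.BW (-μ) (-ν) := h.opp_BW.2 (by simpa using hf)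
  rw [o.Ed_def, o.T_j]
  have h1 := congrArg (fun z => op (j (unop z))) ((o.hc' i).rel _ _ _ hf')
  have h2 := congrArg (fun z => op (j (unop z))) ((o.hc' i).inner hf')
  simp only [h.opp_lam, unop_smul, unop_mul, unop_op, unop_sub, map_smul, map_mul, map_sub, op_smul, op_sub, op_mul, inv_inv] at h1 h2
  have := inner_div (hh_ne h.C i) (cd.χ_ne (-ν) (Pi.single i 1)) (by simpa using o.fr.ne (o.c'_ne i)) h1 h2
  have := congrArg unop this
  simp only [unop_op, unop_smul, unop_sub, unop_mul, unop_inv] at this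
  exact this.symm

lemma Ops.W_y (i : Fin n) : o.y i ∈ o.W (0, -rt a i) := by
  have h1 := o.W_mul (o.W_inv (o.W_j (p := (_, _)).2 (o.hc i).wt)) (o.W_j (p := (_, _)).2 (h.lamF_BW (o.hc i).wt i))
  have e : ((0 : Fin n → ℤ), -rt a i) = -(o.m i, Pi.single i 1) + (o.m i, Pi.single i 1 - rt a i) := Prod.ext (by simp) (by simp [sub_eq_add_neg])
  rw [e]; exact h1

lemma Ops.W_c' (i : Fin n) : o.c' i ∈ h.BW (-o.m' i) (-Pi.single i 1) := h.opp_BW.1 (o.hc' i).wt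

lemma Ops.W_y' (i : Fin n) : o.y' i ∈ o.W (0, rt a i) := by
  have h1 := o.W_mul (o.W_j (p := (_, _)).2 (h.lamE_BW (o.W_c' i) i)) (o.W_inv (o.W_j (p := (_, _)).2 (o.W_c' i)))
  have e : ((0 : Fin n → ℤ), rt a i) = (-o.m' i, -Pi.single i 1 + rt a i) + -(-o.m' i, -Pi.single i 1) := Prod.ext (by simp) (by simp)
  rw [e]; exact h1

lemma Ops.W_Fd {μ ν : Fin n → ℤ} {x : D} (hx : x ∈ o.W (μ, ν)) (i : Fin n) : o.Fd i x ∈ o.W (μ, ν - rt a i) := by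
  rw [o.Fd_def, o.Ti_W hx]
  refine smul_mem _ _ (sub_mem ?_ ?_)
  · convert o.W_mul hx (o.W_y i) using 2; ext <;> simp [sub_eq_add_neg]
  · rw [mul_smul_comm]; refine smul_mem _ _ ?_
    convert o.W_mul (o.W_y i) hx using 2; ext <;> simp [sub_eq_add_neg, add_comm]

lemma Ops.W_Ed {μ ν : Fin n → ℤ} {x : D} (hx : x ∈ o.W (μ, ν)) (i : Fin n) : o.Ed i x ∈ o.W (μ, ν + rt a i) := by
  rw [o.Ed_def, hx]
  refine smul_mem _ _ (sub_mem ?_ ?_)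
  · convert o.W_mul (o.W_y' i) hx using 2; ext <;> simp [add_comm]
  · rw [smul_mul_assoc]; refine smul_mem _ _ ?_
    convert o.W_mul hx (o.W_y' i) using 2; ext <;> simp

lemma Ops.TT (k l) (x : D) : o.T k (o.T l x) = o.T l (o.T k x) :=
  o.fr.hom_ext ((o.T k).comp (o.T l)) ((o.T l).comp (o.T k)) (fun f => by
    refine Ops.hom_induct (h := h) (P := fun f => o.T k (o.T l (j f)) = o.T l (o.T k (j f))) (fun μ ν f hf => ?_) (by simp)
      (fun f g h1 h2 => by simp only [map_add, h1, h2]) f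
    have := o.W_j (p := (μ, ν)).2 hf
    rw [this l, map_smul, this k, map_smul, this l, smul_comm]) x

lemma Ops.T_Ti (i : Fin n) (x : D) : o.T (.inr i) (o.Ti i x) = x :=
  o.fr.hom_ext ((o.T (.inr i)).comp (o.Ti i)) (AlgHom.id ℂ D) (fun f => by
    simp only [AlgHom.comp_apply, o.T_j, o.Ti_j, AlgHom.id_apply]
    change j (h.lam _ (h.lam _ f)) = _
    rw [← mul_apply, ← map_mul]; simp) x

lemma Ops.T_Fd (l i : Fin n) (x : D) : o.T (.inr l) (o.Fd i x) = q ^ (-((d l : ℤ) * a l i)) • o.Fd i (o.T (.inr l) x) := by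
  have h1 : o.T (.inr l) (o.y i) = q ^ (-((d l : ℤ) * a l i)) • o.y i := by
    rw [o.W_y i]; simp only [tev, Pi.neg_apply, rt]; congr 2; ring
  have h2 : o.T (.inr l) (o.Ti i x) = o.Ti i (o.T (.inr l) x) := by
    conv_rhs => rw [← o.T_Ti i x, o.TT, o.Ti_T]
  simp only [o.Fd_def, map_smul, map_sub, map_mul, h1, h2, mul_smul_comm, smul_mul_assoc, ← smul_sub]
  rw [smul_comm]

lemma Ops.Ti_Ed (l i : Fin n) (x : D) : o.Ed i (o.Ti l x) = q ^ ((d l : ℤ) * a l i) • o.Ti l (o.Ed i x) := by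
  have h1 : o.Ti l (o.y' i) = q ^ (-((d l : ℤ) * a l i)) • o.y' i := by
    rw [o.Ti_W (o.W_y' i)]; simp only [rt]; congr 2; ring
  have h2 : o.T (.inr i) (o.Ti l x) = o.Ti l (o.T (.inr i) x) := by
    conv_rhs => rw [← o.T_Ti l x, o.TT, o.Ti_T]
  simp only [o.Ed_def, map_smul, map_sub, map_mul, h1, h2, mul_smul_comm, smul_mul_assoc, ← smul_sub]
  rw [smul_comm (q ^ _) (hh q d i), smul_smul (q ^ _) (q ^ _), ← zpow_add₀ h.C.q0, add_neg_cancel, zpow_zero, one_smul]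

lemma Ops.comm (i l : Fin n) (x : D) : o.Ed i (o.Fd l x) - o.Fd l (o.Ed i x) = if i = l then (q ^ (d i : ℤ) - q ^ (-(d i : ℤ)))⁻¹ • (o.T (.inr i) x - o.Ti i x) else 0 := by
  rw [← sub_eq_zero]
  refine o.fr.skew0 (o.Ti l) (o.T (.inr i)) (fun x => o.Ed i (o.Fd l x) - o.Fd l (o.Ed i x) - 
    if i = l then (q ^ (d i : ℤ) - q ^ (-(d i : ℤ)))⁻¹ • (o.T (.inr i) x - o.Ti i x) else 0) (fun x y => ?_) (fun f => ?_) x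
  · have h1 : (d i : ℤ) * a i l = (d l : ℤ) * a l i := h.C.symm i l
    have h2 : o.T (.inr i) (o.Fd l x) * o.Ed i (o.Ti l y) = o.Fd l (o.T (.inr i) x) * o.Ti l (o.Ed i y) := by
      rw [o.T_Fd, o.Ti_Ed, smul_mul_smul_comm, ← zpow_add₀ h.C.q0, h1, neg_add_cancel, zpow_zero, one_smul]
    simp only [o.Fd_mul, o.Ed_mul, map_add, h2]
    split_ifs with hil
    · subst hil
      simp only [map_mul, smul_sub, sub_mul, mul_sub, smul_mul_assoc, mul_smul_comm]
      abel
    · simp only [sub_mul, mul_sub, sub_zero]; abel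
  · have := congrArg (fun u => j (h.lam u f)) (h.uRel.EF i l)
    simp only [map_sub, map_mul, LinearMap.sub_apply, mul_apply] at this
    simp only [o.Fd_j, o.Ed_j, this, o.Ti_j, o.T_j]
    split_ifs
    · simp only [map_smul, map_sub, LinearMap.smul_apply, LinearMap.sub_apply]
      exact sub_self _
    · simp

/-- the weight module structure on `D` -/
noncomputable def Ops.wm (μ : Fin n → ℤ) : WM (qi q d) a D where
  wt ν := o.W (μ, ν)
  E := o.Ed
  F := o.Fd
  E_mem i ν x hx := o.W_Ed hx i
  F_mem i ν x hx := o.W_Fd hx i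
  comm i l ν x hx := by
    rw [o.comm]
    split_ifs
    · rw [hx, o.Ti_W hx, ← sub_smul, smul_smul]
      simp only [br, qi, tev, ← zpow_mul, mul_comm (d i : ℤ), div_eq_inv_mul, ← zpow_neg, neg_mul]
    · rfl
end

/-! ## Strings of eigenspaces -/

section
variable {M : Type*} [AddCommGroup M] [Module ℂ M]

/-- sums of eigenspaces with eigenvalues `θ, Q²θ, …` -/
def SN (τ : Module.End ℂ M) (Q : ℂ) : ℕ → ℂ → Submodule ℂ M
  | 0, _ => ⊥
  | R+1, θ => Module.End.eigenspace τ θ ⊔ SN τ Q R (Q ^ 2 * θ)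

variable {τ : Module.End ℂ M} {Q : ℂ}

lemma SN_succ {R : ℕ} {θ : ℂ} {x : M} : x ∈ SN τ Q (R+1) θ ↔ ∃ e s, τ e = θ • e ∧ s ∈ SN τ Q R (Q ^ 2 * θ) ∧ e + s = x := by
  rw [SN, Submodule.mem_sup]
  simp only [Module.End.mem_eigenspace_iff]
  constructor
  · rintro ⟨e, he, s, hs, rfl⟩; exact ⟨e, s, he, hs, rfl⟩
  · rintro ⟨e, s, he, hs, rfl⟩; exact ⟨e, he, s, hs, rfl⟩

lemma SN_eig {θ : ℂ} {x : M} (hx : τ x = θ • x) (R : ℕ) : x ∈ SN τ Q (R+1) θ := SN_succ.2 ⟨x, 0, hx, zero_mem _, add_zero _⟩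

lemma SN_shift {R : ℕ} {θ : ℂ} {x : M} (hx : x ∈ SN τ Q R (Q ^ 2 * θ)) : x ∈ SN τ Q (R+1) θ :=
  SN_succ.2 ⟨0, x, by simp, hx, zero_add _⟩

lemma SN_mono {R : ℕ} (k : ℕ) {θ : ℂ} {x : M} (hx : x ∈ SN τ Q R θ) : x ∈ SN τ Q (R+k) θ := by
  induction R generalizing θ x with
  | zero => obtain rfl : x = 0 := hx; exact zero_mem _
  | succ R ih =>
    obtain ⟨e, s, he, hs, rfl⟩ := SN_succ.1 hx
    rw [Nat.add_right_comm]
    exact SN_succ.2 ⟨e, s, he, ih hs, rfl⟩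

/-- the union -/
def SS (τ : Module.End ℂ M) (Q : ℂ) (θ : ℂ) : Submodule ℂ M where
  carrier := {x | ∃ R, x ∈ SN τ Q R θ}
  add_mem' := by
    rintro x y ⟨R, hx⟩ ⟨R', hy⟩
    exact ⟨R + R', add_mem (SN_mono _ hx) (by rw [add_comm]; exact SN_mono _ hy)⟩
  zero_mem' := ⟨0, zero_mem _⟩
  smul_mem' c x := by rintro ⟨R, hx⟩; exact ⟨R, smul_mem _ _ hx⟩

lemma SN_map (B : Module.End ℂ M) (hB : ∀ x, τ (B x) = B (τ x)) {R : ℕ} {θ : ℂ} {x : M} (hx : x ∈ SN τ Q R θ) : B x ∈ SN τ Q R θ := by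
  induction R generalizing θ x with
  | zero => obtain rfl : x = 0 := hx; rw [map_zero]; exact zero_mem _
  | succ R ih =>
    obtain ⟨e, s, he, hs, rfl⟩ := SN_succ.1 hx
    exact SN_succ.2 ⟨B e, B s, by rw [hB, he, map_smul], ih hs, by rw [map_add]⟩

lemma SN_sub {R : ℕ} {θ θ' : ℂ} {x : M} (hx : x ∈ SN τ Q R θ) : τ x - θ' • x ∈ SN τ Q R θ :=
  SN_map (τ - θ' • 1) (fun x => by simp) hx

lemma SN_down {R : ℕ} {θ : ℂ} {x : M} (hx : x ∈ SN τ Q (R+1) θ) : τ x - θ • x ∈ SN τ Q R (Q ^ 2 * θ) := by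
  obtain ⟨e, s, he, hs, rfl⟩ := SN_succ.1 hx
  have := SN_sub (θ' := θ) hs
  rw [map_add, he, smul_add]; convert this using 1; abel

lemma SS_down {θ : ℂ} {x : M} (hx : x ∈ SS τ Q θ) : τ x - θ • x ∈ SS τ Q (Q ^ 2 * θ) := by
  obtain ⟨R, hR⟩ := hx
  exact ⟨R, SN_down (SN_mono 1 hR)⟩

lemma SN_ne {θ θ' : ℂ} (h : ∀ r : ℕ, (Q ^ 2) ^ r * θ ≠ θ') : ∀ r : ℕ, (Q ^ 2) ^ r * (Q ^ 2 * θ) ≠ θ' := fun r => by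
  rw [← mul_assoc, ← pow_succ]; exact h _

lemma SN_solve {R : ℕ} {θ θ' : ℂ} (h : ∀ r : ℕ, (Q ^ 2) ^ r * θ ≠ θ') {u : M} (hu : u ∈ SN τ Q R θ) : ∃ s ∈ SN τ Q R θ, τ s - θ' • s = u := by
  induction R generalizing θ u with
  | zero => obtain rfl : u = 0 := hu; exact ⟨0, zero_mem _, by simp⟩
  | succ R ih =>
    obtain ⟨e, s, he, hs, rfl⟩ := SN_succ.1 hu
    obtain ⟨s', hs', rfl⟩ := ih (SN_ne h) hs
    have h0 : θ - θ' ≠ 0 := sub_ne_zero.2 (by simpa using h 0)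
    refine ⟨(θ - θ')⁻¹ • e + s', SN_succ.2 ⟨_, _, by rw [map_smul, he, smul_comm], hs', rfl⟩, ?_⟩
    have : θ • (θ - θ')⁻¹ • e - θ' • (θ - θ')⁻¹ • e = e := by
      rw [← sub_smul, smul_smul, mul_inv_cancel₀ h0, one_smul]
    rw [map_add, map_smul, he, smul_comm _ θ, smul_add]
    conv_rhs => rw [← this]
    abel

lemma SN_disj {R : ℕ} {θ θ' : ℂ} (h : ∀ r : ℕ, (Q ^ 2) ^ r * θ ≠ θ') {x : M} (hx : x ∈ SN τ Q R θ) (he : τ x = θ' • x) : x = 0 := by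
  induction R generalizing θ with
  | zero => exact hx
  | succ R ih =>
    have := SN_down hx
    rw [he, ← sub_smul] at this
    have h0 : θ' - θ ≠ 0 := sub_ne_zero.2 (by simpa using (h 0).symm)
    exact ih (SN_ne h) ((Submodule.smul_mem_iff _ h0).1 this)
end

section
variable {D : Type*} [DivisionRing D] [Algebra ℂ D]

/-- conjugation -/
noncomputable def tau (y : D) : Module.End ℂ D := LinearMap.mulLeft ℂ y⁻¹ ∘ₗ LinearMap.mulRight ℂ y

lemma tau_apply (y x : D) : tau y x = y⁻¹ * (x * y) := rfl

lemma tau_mul {y : D} (hy : y ≠ 0) (x x' : D) : tau y (x * x') = tau y x * tau y x' := by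
  simp only [tau_apply, mul_assoc, mul_inv_cancel_left₀ hy]

lemma SN_mul {y : D} (hy : y ≠ 0) {Q θ θ' : ℂ} {R R' : ℕ} {x x' : D} (hx : x ∈ SN (tau y) Q R θ) (hx' : x' ∈ SN (tau y) Q R' θ') : x * x' ∈ SN (tau y) Q (R + R') (θ * θ') := by
  have A : ∀ {R' θ' θ} {e x' : D}, tau y e = θ • e → x' ∈ SN (tau y) Q R' θ' → e * x' ∈ SN (tau y) Q R' (θ * θ') := by
    intro R'
    induction R' with
    | zero => intro θ' θ e x' _ hx; obtain rfl : x' = 0 := hx; rw [mul_zero]; exact zero_mem _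
    | succ R ih =>
      intro θ' θ e x' he hx
      obtain ⟨e', s, he', hs, rfl⟩ := SN_succ.1 hx
      refine SN_succ.2 ⟨e * e', e * s, by rw [tau_mul hy, he, he', smul_mul_smul_comm], ?_, by rw [mul_add]⟩
      rw [mul_left_comm]; exact ih he hs
  induction R generalizing θ x with
  | zero => obtain rfl : x = 0 := hx; rw [zero_mul]; exact zero_mem _
  | succ R ih =>
    obtain ⟨e, s, he, hs, rfl⟩ := SN_succ.1 hx
    rw [add_mul]
    refine add_mem ?_ ?_
    · rw [add_comm]; exact SN_mono _ (A he hx')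
    · have := ih hs
      rw [mul_assoc] at this
      rw [Nat.add_right_comm]; exact SN_shift this

lemma SS_mul {y : D} (hy : y ≠ 0) {Q θ θ' : ℂ} {x x' : D} (hx : x ∈ SS (tau y) Q θ) (hx' : x' ∈ SS (tau y) Q θ') : x * x' ∈ SS (tau y) Q (θ * θ') := by
  obtain ⟨R, hR⟩ := hx
  obtain ⟨R', hR'⟩ := hx'
  exact ⟨_, SN_mul hy hR hR'⟩

/-- the key step for primality -/
lemma SS_prime {y : D} (hy : y ≠ 0) {Q θ θ' : ℂ} (hQ : ∀ r : ℕ, (Q ^ 2) ^ (r + 1) ≠ 1) (h0 : θ ≠ 0) (h0' : θ' ≠ 0) {f g : D} (hf : f ∈ SS (tau y) Q θ) (hg : g ∈ SS (tau y) Q θ')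
    (hfg : f * g ∈ SS (tau y) Q (Q ^ 2 * (θ * θ'))) : f ∈ SS (tau y) Q (Q ^ 2 * θ) ∨ g ∈ SS (tau y) Q (Q ^ 2 * θ') := by
  obtain ⟨R, hR⟩ := hf
  obtain ⟨R', hR'⟩ := hg
  obtain ⟨f0, f', h1, h2, rfl⟩ := SN_succ.1 (SN_mono 1 hR)
  obtain ⟨g0, g', h3, h4, rfl⟩ := SN_succ.1 (SN_mono 1 hR')
  have e1 : f0 * g0 ∈ SS (tau y) Q (Q ^ 2 * (θ * θ')) := by
    have : f0 * g0 = (f0 + f') * (g0 + g') - f0 * g' - f' * (g0 + g') := by noncomm_ring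
    rw [this]
    refine sub_mem (sub_mem hfg ?_) ?_
    · rw [mul_left_comm]; exact SS_mul hy ⟨_, SN_eig h1 0⟩ ⟨_, h4⟩
    · rw [← mul_assoc]; exact SS_mul hy ⟨_, h2⟩ ⟨_, hR'⟩
  obtain ⟨R2, e2⟩ := e1
  have := SN_disj (θ' := θ * θ') (fun r hr => by
    rw [← mul_assoc, ← pow_succ] at hr
    exact hQ r (mul_right_cancel₀ (mul_ne_zero h0 h0') (hr.trans (one_mul _).symm))) e2 (by rw [tau_mul hy, h1, h3, smul_mul_smul_comm])
  rcases mul_eq_zero.1 this with rfl | rfl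
  · left; rw [zero_add]; exact ⟨_, h2⟩
  · right; rw [zero_add]; exact ⟨_, h4⟩
end

variable {h : QG q a d E F K Δ ε ρ ι}
variable {D : Type} [DivisionRing D] [Algebra ℂ D]
variable {cd : CD q a d} {j : A →ₐ[ℂ] D} (o : Ops h cd j)

/-- the local finiteness spaces -/
noncomputable def Ops.X (i : Fin n) (p : (Fin n → ℤ) × (Fin n → ℤ)) : Submodule ℂ D :=
  o.W p ⊓ SS (tau (o.y i)) (qi q d i) (qi q d i ^ (-(p.2 i)))

lemma Cp_F_ne {i : Fin n} {c : A} {m : Fin n → ℤ} (hc : h.Cp cd i c m) : h.lam (F i) c ≠ 0 := fun h0 => by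
  have := congrArg (fun u => h.lam u c) (h.uRel.EF i i)
  simp only [map_sub, map_mul, LinearMap.sub_apply, mul_apply, h0, hc.E, map_zero, sub_zero, if_true, map_smul, LinearMap.smul_apply] at this
  have h1 := (h.mem_BW.1 hc.wt).1 i
  have h2 := wsp_inv (K := K) (ρ := h.lam) h.C (mem_wsp.2 (h.mem_BW.1 hc.wt).1) i
  rw [h1, h2, ← sub_smul, smul_smul] at this
  have h3 := (smul_eq_zero.1 this.symm).resolve_right hc.ne
  have h4 := (h.C.nru i).kap
  simp only [Pi.single_eq_same, one_mul] at h3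
  rcases mul_eq_zero.1 h3 with h5 | h5
  · exact h4 (by simpa [qi] using inv_eq_zero.1 h5)
  · exact h4 (by simpa [qi] using h5)

lemma Cp_comm {i : Fin n} {c : A} {m : Fin n → ℤ} (hc : h.Cp cd i c m) [IsDomain A] : c * h.lam (F i) c = qi q d i • (h.lam (F i) c * c) := by
  have h1 := hc.rel _ _ _ hc.wt
  have h2 := hc.rel _ _ _ (h.lamF_BW hc.wt i)
  have h3 : cd.χ m m = cd.χ (Pi.single i 1) (Pi.single i 1) := by
    have := sub_eq_zero.2 h1
    rw [← sub_smul] at this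
    exact sub_eq_zero.1 ((smul_eq_zero.1 this).resolve_right (mul_ne_zero hc.ne hc.ne))
  have h4 : cd.χ (Pi.single i 1) (Pi.single i 1) = cd.χ (Pi.single i 1 - rt a i) (Pi.single i 1) * qi q d i := by
    have := cd.χ_add_left (Pi.single i 1 - rt a i) (rt a i) (Pi.single i 1)
    rw [sub_add_cancel, cd.χ_rt_left] at this
    rw [this]; simp [qi]
  rw [h3, h4, mul_smul] at h2
  exact (smul_right_injective A (cd.χ_ne _ _) h2).symm

lemma Ops.y_ne (i : Fin n) : o.y i ≠ 0 := mul_ne_zero (inv_ne_zero (o.fr.ne (o.hc i).ne)) (o.fr.ne (Cp_F_ne (o.hc i)))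

lemma Ops.tau_c [IsDomain A] (i : Fin n) : tau (o.y i) (j (o.c i)) = qi q d i • j (o.c i) := by
  have h0 := o.fr.ne (o.hc i).ne
  have h1 := o.fr.ne (Cp_F_ne (o.hc i))
  have h2 := congrArg j (Cp_comm (o.hc i))
  rw [map_mul, map_smul, map_mul] at h2
  rw [tau_apply, Ops.y, mul_inv_rev, inv_inv, mul_inv_cancel_left₀ h0, mul_assoc, h2, mul_smul_comm, inv_mul_cancel_left₀ h1]

lemma Ops.Fd_tau {i : Fin n} {p : (Fin n → ℤ) × (Fin n → ℤ)} {x : D} (hx : x ∈ o.W p) : o.Fd i x = hh q d i • (o.y i * (tau (o.y i) x - qi q d i ^ (-(p.2 i)) • x)) := by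
  rw [o.Fd_def, o.Ti_W hx, mul_sub, tau_apply, mul_inv_cancel_left₀ (o.y_ne i), qi, ← zpow_mul]
  congr 6; ring

lemma Ops.qi_ne (o : Ops h cd j) (i : Fin n) : qi q d i ≠ 0 := (h.C.nru i).1

lemma Ops.th (o : Ops h cd j) (i : Fin n) (ν : Fin n → ℤ) : qi q d i ^ (-((ν - rt a i) i)) = qi q d i ^ 2 * qi q d i ^ (-ν i) := by
  rw [← zpow_natCast, ← zpow_add₀ (o.qi_ne i)]; congr 1
  simp [rt, h.C.diag]; ring

lemma Ops.tau_y (i : Fin n) (x : D) : tau (o.y i) (o.y i * x) = o.y i * tau (o.y i) x := by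
  rw [tau_mul (o.y_ne i)]; congr 1
  rw [tau_apply, inv_mul_cancel_left₀ (o.y_ne i)]

lemma Ops.tau_y' (i : Fin n) (x : D) : tau (o.y i) ((o.y i)⁻¹ * x) = (o.y i)⁻¹ * tau (o.y i) x := by
  rw [tau_mul (o.y_ne i)]; congr 1
  rw [tau_apply, inv_mul_cancel₀ (o.y_ne i), mul_one]

lemma Ops.X_Fd {i : Fin n} {μ ν : Fin n → ℤ} {x : D} (hx : x ∈ o.X i (μ, ν)) : o.Fd i x ∈ o.X i (μ, ν - rt a i) := by
  refine ⟨o.W_Fd hx.1 i, ?_⟩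
  rw [o.Fd_tau hx.1, o.th]
  obtain ⟨R, hR⟩ := SS_down hx.2
  exact smul_mem _ _ ⟨R, SN_map (LinearMap.mulLeft ℂ (o.y i)) (fun x => o.tau_y i x) hR⟩

lemma Ops.X_nil {i : Fin n} {μ ν : Fin n → ℤ} {x : D} (hx : x ∈ o.X i (μ, ν)) : ∃ k, (o.Fd i ^ k) x = 0 := by
  obtain ⟨hw, R, hR⟩ := hx
  refine ⟨R, ?_⟩
  induction R generalizing ν x with
  | zero => exact hR
  | succ R ih =>
    rw [pow_succ]
    refine ih (ν := ν - rt a i) (o.W_Fd hw i) ?_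
    rw [o.Fd_tau hw, o.th]
    exact smul_mem _ _ (SN_map (LinearMap.mulLeft ℂ (o.y i)) (fun x => o.tau_y i x) (SN_down hR))

lemma Ops.qi_r (o : Ops h cd j) (i : Fin n) (r : ℕ) : (qi q d i ^ 2) ^ (r + 1) ≠ 1 := by
  rw [← pow_mul, ← zpow_natCast]
  exact (h.C.nru i).2 _ (by positivity)

lemma Ops.X_of_nil {i : Fin n} {μ ν : Fin n → ℤ} {x : D} (hw : x ∈ o.W (μ, ν)) (k : ℕ) (hk : (o.Fd i ^ k) x = 0) : x ∈ o.X i (μ, ν) := by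
  refine ⟨hw, k, ?_⟩
  induction k generalizing ν x with
  | zero => exact hk
  | succ k ih =>
    have h1 := ih (o.W_Fd hw i) hk
    rw [o.Fd_tau hw, o.th] at h1
    have h2 := SN_map (LinearMap.mulLeft ℂ (o.y i)⁻¹) (fun x => o.tau_y' i x) ((Submodule.smul_mem_iff _ (inv_ne_zero (hh_ne h.C i))).1 h1)
    rw [LinearMap.mulLeft_apply, inv_mul_cancel_left₀ (o.y_ne i)] at h2
    obtain ⟨s, hs, h3⟩ := SN_solve (θ' := qi q d i ^ (-ν i)) (fun r hr => by
      rw [← mul_assoc, ← pow_succ] at hr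
      exact o.qi_r i r (mul_right_cancel₀ (zpow_ne_zero _ (o.qi_ne i)) (hr.trans (one_mul _).symm))) h2
    refine SN_succ.2 ⟨x - s, s, ?_, hs, sub_add_cancel _ _⟩
    rw [map_sub, smul_sub]
    exact sub_eq_sub_iff_sub_eq_sub.2 h3.symm

lemma Ops.X_mul {i : Fin n} {p p' : (Fin n → ℤ) × (Fin n → ℤ)} {x y : D} (hx : x ∈ o.X i p) (hy : y ∈ o.X i p') : x * y ∈ o.X i (p + p') := by
  refine ⟨o.W_mul hx.1 hy.1, ?_⟩
  have := SS_mul (o.y_ne i) hx.2 hy.2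
  rw [← zpow_add₀ (o.qi_ne i)] at this
  convert this using 2; simp; ring

lemma Ops.X_j {i : Fin n} {μ ν : Fin n → ℤ} {f : A} (hf : f ∈ h.BW μ ν) : j f ∈ o.X i (μ, ν) := by
  obtain ⟨N, hN⟩ := h.nilF cd hf
  refine o.X_of_nil (o.W_j.2 hf) N ?_
  have h1 : ∀ (k : ℕ) f, (o.Fd i ^ k) (j f) = j ((h.lam (F i) ^ k) f) := fun k => by
    induction k with
    | zero => intro f; simp
    | succ k ih => intro f; rw [pow_succ, pow_succ, mul_apply, mul_apply, o.Fd_j, ih]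
  rw [h1, NilD.pow (D := fun i => h.lam (F i)) (N := 0) i (by rwa [zero_add]), map_zero]

lemma Ops.Fd_inv {i : Fin n} {x : D} (hx0 : x ≠ 0) (hx : o.Fd i x = 0) : o.Fd i x⁻¹ = 0 := by
  have h1 := o.Fd_mul i x x⁻¹
  rw [mul_inv_cancel₀ hx0, hx, zero_mul, zero_add, o.Fd_def, map_one, one_mul, mul_one, sub_self, smul_zero] at h1
  exact (mul_eq_zero.1 h1.symm).resolve_left hx0

lemma Ops.X_inv {i : Fin n} {μ ν : Fin n → ℤ} {f : A} (hf : f ∈ h.BW μ ν) (h0 : f ≠ 0) (hF : h.lam (F i) f = 0) : (j f)⁻¹ ∈ o.X i (-(μ, ν)) :=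
  o.X_of_nil (o.W_inv (o.W_j.2 hf)) 1 (by rw [pow_one]; exact o.Fd_inv (o.fr.ne h0) (by rw [o.Fd_j, hF, map_zero]))

lemma Ops.X_y {i l : Fin n} (hl : i ≠ l) : o.y l ∈ o.X i (0, -rt a l) := by
  have h1 := o.X_mul (i := i) (o.X_inv (o.hc l).wt (o.hc l).ne ((o.hc l).F i hl)) (o.X_j (h.lamF_BW (o.hc l).wt l))
  have e : ((0 : Fin n → ℤ), -rt a l) = -(o.m l, Pi.single l 1) + (o.m l, Pi.single l 1 - rt a l) := Prod.ext (by simp) (by simp [sub_eq_add_neg])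
  rw [e]; exact h1

lemma Ops.F_c' (i l : Fin n) : h.lam (F i) (o.c' l) = 0 := by
  have := (o.hc' l).E i
  rw [h.opp_lam] at this
  exact op_injective this

lemma Ops.X_y' (i l : Fin n) : o.y' l ∈ o.X i (0, rt a l) := by
  have h1 := o.X_mul (i := i) (o.X_j (h.lamE_BW (o.W_c' l) l)) (o.X_inv (o.W_c' l) (o.c'_ne l) (o.F_c' i l))
  have e : ((0 : Fin n → ℤ), rt a l) = (-o.m' l, -Pi.single l 1 + rt a l) + -(-o.m' l, -Pi.single l 1) := Prod.ext (by simp) (by simp)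
  rw [e]; exact h1

lemma Ops.X_Fd' {i : Fin n} (l : Fin n) {μ ν : Fin n → ℤ} {x : D} (hx : x ∈ o.X i (μ, ν)) : o.Fd l x ∈ o.X i (μ, ν - rt a l) := by
  by_cases hl : i = l
  · subst hl; exact o.X_Fd hx
  rw [o.Fd_def, o.Ti_W hx.1]
  refine smul_mem _ _ (sub_mem ?_ ?_)
  · convert o.X_mul hx (o.X_y hl) using 2; ext <;> simp [sub_eq_add_neg]
  · rw [mul_smul_comm]; refine smul_mem _ _ ?_
    convert o.X_mul (o.X_y hl) hx using 2; ext <;> simp [sub_eq_add_neg, add_comm]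

lemma Ops.X_Ed {i : Fin n} (l : Fin n) {μ ν : Fin n → ℤ} {x : D} (hx : x ∈ o.X i (μ, ν)) : o.Ed l x ∈ o.X i (μ, ν + rt a l) := by
  rw [o.Ed_def, hx.1]
  refine smul_mem _ _ (sub_mem ?_ ?_)
  · convert o.X_mul (o.X_y' i l) hx using 2; ext <;> simp [add_comm]
  · rw [smul_mul_assoc]; refine smul_mem _ _ ?_
    convert o.X_mul hx (o.X_y' i l) using 2; ext <;> simp

/-- the integrality criterion -/
lemma Ops.int {b : D} {μ ν : Fin n → ℤ} (hb : ∀ i, b ∈ o.X i (μ, ν)) (hbw : b ∈ o.W (μ, ν)) {N : ℕ} (hN : NilD o.Ed N b) : ∃ f, b = j f := by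
  classical
  let Ew : List (Fin n) → Module.End ℂ D := fun l => (l.map o.Ed).prod
  let Fw : List (Fin n) → Module.End ℂ D := fun l => (l.map o.Fd).prod
  let z : List (Fin n) × List (Fin n) → D := fun l => Fw l.1 (Ew l.2 b)
  let wz : List (Fin n) × List (Fin n) → (Fin n → ℤ) := fun l => ν + bw a l.2 - bw a l.1
  have hEw0 : ∀ l : List (Fin n), N ≤ l.length → Ew l b = 0 := by
    have key : ∀ (N : ℕ) (b : D) (l : List (Fin n)), NilD o.Ed N b → N ≤ l.length → Ew l b = 0 := by
      intro N
      induction N with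
      | zero => intro b l hb _; obtain rfl : b = 0 := hb; simp
      | succ N ih =>
        intro b l hb hl
        induction l using List.reverseRecOn with
        | nil => simp at hl
        | append_singleton l i _ =>
          have := ih (o.Ed i b) l (hb i) (by simpa using hl)
          simpa [Ew] using this
    exact fun l => key N b l hN
  have gen : ∀ (Y : (Fin n → ℤ) → Submodule ℂ D), (∀ i ν x, x ∈ Y ν → o.Fd i x ∈ Y (ν - rt a i)) → (∀ i ν x, x ∈ Y ν → o.Ed i x ∈ Y (ν + rt a i)) → b ∈ Y ν → ∀ l, z l ∈ Y (wz l) := by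
    rintro Y hF hE hb ⟨l1, l2⟩
    have h2 : Ew l2 b ∈ Y (ν + bw a l2) := by
      induction l2 with
      | nil => simpa [Ew] using hb
      | cons i l ih =>
        have := hE i _ _ ih
        rw [bw_cons, add_left_comm, add_comm]
        simpa [Ew] using this
    change Fw l1 (Ew l2 b) ∈ Y (ν + bw a l2 - bw a l1)
    induction l1 with
    | nil => simpa [Fw] using h2
    | cons i l ih =>
      have := hF i _ _ ih
      rw [bw_cons, add_comm (rt a i), ← sub_sub]
      simpa [Fw] using this
  have hzW : ∀ l, z l ∈ o.W (μ, wz l) := gen (fun ν => o.W (μ, ν)) (fun i ν x hx => o.W_Fd hx i) (fun i ν x hx => o.W_Ed hx i) hbw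
  have hzX : ∀ i l, z l ∈ o.X i (μ, wz l) := fun i => gen (fun ν => o.X i (μ, ν)) (fun l ν x hx => o.X_Fd' l hx) (fun l ν x hx => o.X_Ed l hx) (hb i)
  have hz0 : ∀ l, N ≤ l.2.length → z l = 0 := fun l hl => by simp only [z, hEw0 l.2 hl, map_zero]
  set M := Submodule.span ℂ (Set.range z) with hM
  have stab : ∀ (B : Module.End ℂ D), (∀ l, B (z l) ∈ M) → ∀ x ∈ M, B x ∈ M := fun B hB x hx => by
    have : M ≤ M.comap B := by rw [hM, Submodule.span_le]; rintro _ ⟨l, rfl⟩; exact hB l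
    exact this hx
  have hMF : ∀ i, ∀ x ∈ M, o.Fd i x ∈ M := fun i => stab _ fun l => subset_span ⟨(i :: l.1, l.2), by simp [z, Fw]⟩
  have hMT : ∀ i, ∀ x ∈ M, o.T (.inr i) x ∈ M := fun i => stab (o.T (.inr i)).toLinearMap fun l => by
    rw [AlgHom.toLinearMap_apply, hzW l]; exact smul_mem _ _ (subset_span ⟨_, rfl⟩)
  have hMTi : ∀ i, ∀ x ∈ M, o.Ti i x ∈ M := fun i => stab (o.Ti i).toLinearMap fun l => by
    rw [AlgHom.toLinearMap_apply, o.Ti_W (hzW l)]; exact smul_mem _ _ (subset_span ⟨_, rfl⟩)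
  have hME : ∀ i, ∀ x ∈ M, o.Ed i x ∈ M := fun i => stab _ fun l => by
    obtain ⟨l1, l2⟩ := l
    induction l1 with
    | nil => exact subset_span ⟨([], i :: l2), by simp [z, Fw, Ew]⟩
    | cons k l ih =>
      have e : z (k :: l, l2) = o.Fd k (z (l, l2)) := by simp [z, Fw]
      rw [e, sub_eq_iff_eq_add.1 (o.comm i k (z (l, l2)))]
      refine M.add_mem ?_ (hMF _ _ ih)
      have hm : z (l, l2) ∈ M := subset_span ⟨_, rfl⟩
      split_ifs
      · exact M.smul_mem _ (M.sub_mem (hMT _ _ hm) (hMTi _ _ hm))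
      · exact M.zero_mem
  -- weights
  have hwt : ∀ ν' x, x ∈ M → x ∈ o.W (μ, ν') → x ≠ 0 → ∃ l, l.2.length < N ∧ ν' = wz l := by
    intro ν' x hx hxw hx0
    by_contra hcon
    refine hx0 (joint_eig_iSup (fun k => (o.T k).toLinearMap) (tev q d) (tev_inj h.C) o.W (fun g x hx k => hx k)
      {p | ∃ l, l.2.length < N ∧ p = (μ, wz l)} (μ, ν') ?_ x hxw ?_)
    · rintro ⟨l, hl, he⟩; exact hcon ⟨l, hl, (Prod.ext_iff.1 he).2⟩
    · revert hx
      suffices M ≤ _ from fun hx => this hx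
      rw [hM, Submodule.span_le]
      rintro _ ⟨l, rfl⟩
      by_cases hl : l.2.length < N
      · exact mem_iSup_of_mem (μ, wz l) (mem_iSup_of_mem ⟨l, hl, rfl⟩ (hzW l))
      · rw [hz0 l (not_lt.1 hl)]; exact zero_mem _
  have hbd : ∀ ν' x, x ∈ M → x ∈ o.W (μ, ν') → x ≠ 0 → cd.ht ν' ≤ cd.ht ν + N * cd.hp := by
    intro ν' x hx hxw hx0
    obtain ⟨l, hl, rfl⟩ := hwt ν' x hx hxw hx0
    simp only [wz, map_add, map_sub, ht_bw_of cd.ht_rt]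
    have h1 : (l.2.length : ℤ) * cd.hp ≤ N * cd.hp := mul_le_mul_of_nonneg_right (by exact_mod_cast hl.le) cd.hp_pos.le
    have h2 : 0 ≤ (l.1.length : ℤ) * cd.hp := mul_nonneg (by positivity) cd.hp_pos.le
    linarith
  have nil : ∀ (B : Module.End ℂ D), (∀ l, ∃ k, (B ^ k) (z l) = 0) → ∀ x ∈ M, ∃ k, (B ^ k) x = 0 := fun B hB x hx => by
    have : M ≤ Module.End.maxGenEigenspace B 0 := by
      rw [hM, Submodule.span_le]; rintro _ ⟨l, rfl⟩
      rw [SetLike.mem_coe, Module.End.mem_maxGenEigenspace]; simpa using hB l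
    simpa using (Module.End.mem_maxGenEigenspace _ _ _).1 (this hx)
  have hnE : ∀ i, ∀ x ∈ M, ∃ k, (o.Ed i ^ k) x = 0 := fun i => nil _ fun l => by
    have h1 : ∀ k : ℕ, (o.Ed i ^ k) (z l) ∈ M ∧ (o.Ed i ^ k) (z l) ∈ o.W (μ, wz l + k • rt a i) := fun k => by
      induction k with
      | zero => exact ⟨subset_span ⟨l, rfl⟩, by simpa using hzW l⟩
      | succ k ih =>
        rw [pow_succ', mul_apply]
        refine ⟨hME _ _ ih.1, ?_⟩
        rw [succ_nsmul, ← add_assoc]; exact o.W_Ed ih.2 i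
    by_contra hcon
    push Not at hcon
    set k := (cd.ht ν + N * cd.hp - cd.ht (wz l)).toNat + 1 with hk
    have := hbd _ _ (h1 k).1 (h1 k).2 (hcon k)
    rw [map_add, map_nsmul, cd.ht_rt, nsmul_eq_mul] at this
    have h3 : (k : ℤ) ≤ k * cd.hp := le_mul_of_one_le_right (by positivity) cd.hp_pos
    have h4 := Int.self_le_toNat (cd.ht ν + N * cd.hp - cd.ht (wz l))
    push_cast [hk] at h3 this
    linarith
  have hnF : ∀ i, ∀ x ∈ M, ∃ k, (o.Fd i ^ k) x = 0 := fun i => nil _ fun l => o.X_nil (hzX i l)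
  obtain ⟨B, hB⟩ := cd.fin {ν' | ∃ x, x ∈ M ∧ x ∈ o.W (μ, ν') ∧ x ≠ 0} (by
    rintro i ν' ⟨x, hx, hxw, hx0⟩
    obtain ⟨x', h1, h2, h3⟩ := WM.refl (W := o.wm μ) h.C.nru h.C.diag (hME i) (hMF i) (hnE i) (hnF i) hxw hx hx0
    exact ⟨x', h2, h1, h3⟩) ⟨_, by rintro ν' ⟨x, hx, hxw, hx0⟩; exact hbd ν' x hx hxw hx0⟩
  -- finite dimensionality
  obtain ⟨L, hL⟩ : ∃ L : ℕ, ∀ l, L ≤ l.1.length → z l = 0 := by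
    refine ⟨(cd.ht ν + N * cd.hp - B).toNat + 1, fun l hl => ?_⟩
    by_contra h0
    have hl2 : l.2.length < N := by
      by_contra h2; exact h0 (hz0 l (not_lt.1 h2))
    have h1 := hB (wz l) ⟨z l, subset_span ⟨l, rfl⟩, hzW l, h0⟩
    simp only [wz, map_add, map_sub, ht_bw_of cd.ht_rt] at h1
    have h2 : (l.2.length : ℤ) * cd.hp ≤ N * cd.hp := mul_le_mul_of_nonneg_right (by exact_mod_cast hl2.le) cd.hp_pos.le
    have h3 : (l.1.length : ℤ) ≤ l.1.length * cd.hp := le_mul_of_one_le_right (by positivity) cd.hp_pos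
    have h4 := Int.self_le_toNat (cd.ht ν + N * cd.hp - B)
    have h5 : (((cd.ht ν + N * cd.hp - B).toNat : ℤ) + 1) ≤ l.1.length := by exact_mod_cast hl
    linarith
  have hfin : (Set.range z).Finite := by
    refine ((((List.finite_length_lt (Fin n) L).prod (List.finite_length_lt (Fin n) N)).image z).union (Set.finite_singleton 0)).subset ?_
    rintro _ ⟨l, rfl⟩
    by_cases h1 : l.1.length < L
    · by_cases h2 : l.2.length < N
      · exact Or.inl ⟨l, ⟨h1, h2⟩, rfl⟩
      · exact Or.inr (hz0 l (not_lt.1 h2))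
    · exact Or.inr (hL l (not_lt.1 h1))
  obtain ⟨t, ht0, ht⟩ := o.fr.common hfin.toFinset
  -- the denominators
  let J : Submodule ℂ A :=
    { carrier := {x | ∀ m ∈ M, ∃ f, m * j x = j f}
      zero_mem' := fun m _ => ⟨0, by simp⟩
      add_mem' := fun {x y} hx hy m hm => by
        obtain ⟨f, hf⟩ := hx m hm
        obtain ⟨g, hg⟩ := hy m hm
        exact ⟨f + g, by rw [map_add, mul_add, hf, hg, map_add]⟩
      smul_mem' := fun r x hx m hm => by
        obtain ⟨f, hf⟩ := hx m hm
        exact ⟨r • f, by rw [map_smul, mul_smul_comm, hf, map_smul]⟩ }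
  have htJ : t ∈ J := fun m hm => by
    have : M ≤ (LinearMap.range j.toLinearMap).comap (LinearMap.mulRight ℂ (j t)) := by
      rw [hM, Submodule.span_le]; rintro _ ⟨l, rfl⟩
      obtain ⟨f, hf⟩ := ht (z l) (hfin.mem_toFinset.2 ⟨l, rfl⟩)
      exact ⟨f, hf.symm⟩
    obtain ⟨f, hf⟩ := this hm
    exact ⟨f, hf.symm⟩
  have hK : ∀ i, ∀ x ∈ J, h.lam (K i : U) x ∈ J := fun i x hx m hm => by
    obtain ⟨f, hf⟩ := hx _ (hMTi i m hm)
    refine ⟨h.lam (K i : U) f, ?_⟩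
    have := congrArg (o.T (.inr i)) hf
    rw [map_mul, o.T_Ti, o.T_j, o.T_j] at this
    exact this
  have hKi : ∀ i, ∀ x ∈ J, h.lam ⇃(K i) x ∈ J := fun i x hx m hm => by
    obtain ⟨f, hf⟩ := hx _ (hMT i m hm)
    refine ⟨h.lam ⇃(K i) f, ?_⟩
    have := congrArg (o.Ti i) hf
    rw [map_mul, o.Ti_T, o.Ti_j, o.Ti_j] at this
    exact this
  have hJF : ∀ i, ∀ x ∈ J, h.lam (F i) x ∈ J := fun i x hx m hm => by
    obtain ⟨f, hf⟩ := hx m hm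
    obtain ⟨g, hg⟩ := hKi i x hx _ (hMF i m hm)
    refine ⟨h.lam (F i) f - g, ?_⟩
    have := congrArg (o.Fd i) hf
    rw [o.Fd_mul, o.Ti_j, hg, o.Fd_j, o.Fd_j] at this
    rw [map_sub, ← this, add_sub_cancel_left]
  have hJE : ∀ i, ∀ x ∈ J, h.lam (E i) x ∈ J := fun i x hx m hm => by
    obtain ⟨f, hf⟩ := hx _ (hMTi i m hm)
    obtain ⟨g, hg⟩ := hx _ (hME i _ (hMTi i m hm))
    refine ⟨h.lam (E i) f - g, ?_⟩
    have := congrArg (o.Ed i) hf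
    rw [o.Ed_mul, hg, o.T_Ti, o.Ed_j, o.Ed_j] at this
    rw [map_sub, ← this, add_sub_cancel_left]
  have h1 : (1 : A) ∈ J := by
    refine h.hopf cd J (fun x hx y m hm => ?_) (fun u => ?_) (fun hb => ht0 (by rwa [hb, Submodule.mem_bot] at htJ))
    · obtain ⟨f, hf⟩ := hx m hm
      exact ⟨f * y, by rw [map_mul, ← mul_assoc, hf, map_mul]⟩
    · let S : Subalgebra ℂ U :=
        { carrier := {u | ∀ x ∈ J, h.lam u x ∈ J}
          mul_mem' := fun {u v} hu hv x hx => by rw [map_mul]; exact hu _ (hv _ hx)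
          add_mem' := fun {u v} hu hv x hx => by rw [map_add]; exact J.add_mem (hu _ hx) (hv _ hx)
          algebraMap_mem' := fun r x hx => by rw [AlgHom.commutes]; exact J.smul_mem r hx }
      exact h.uRel.induct S hJE hJF hK hKi u
  have hbM : b ∈ M := subset_span ⟨([], []), by simp [z, Fw, Ew]⟩
  obtain ⟨f, hf⟩ := h1 b hbM
  exact ⟨f, by rw [← hf, map_one, mul_one]⟩

lemma Ops.Ed_inv_mul {i : Fin n} {x : D} (hx0 : x ≠ 0) (hx : o.Ed i x = 0) (f : D) : o.Ed i (f * x⁻¹) = o.Ed i f * x⁻¹ := by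
  have h1 := o.Ed_mul i x x⁻¹
  rw [mul_inv_cancel₀ hx0, hx, zero_mul, zero_add, o.Ed_def, map_one, one_mul, mul_one, sub_self, smul_zero] at h1
  have hT : o.T (.inr i) x ≠ 0 := (_root_.map_ne_zero _).2 hx0
  rw [o.Ed_mul, (mul_eq_zero.1 h1.symm).resolve_left hT, mul_zero, add_zero]

lemma Ops.nil_inv {x : D} (hx0 : x ≠ 0) (hx : ∀ l, o.Ed l x = 0) {N : ℕ} {f : A} (hN : NilD (fun i => h.lam (E i)) N f) : NilD o.Ed N (j f * x⁻¹) := by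
  induction N generalizing f with
  | zero => obtain rfl : f = 0 := hN; simp [NilD]
  | succ N ih =>
    intro l
    rw [o.Ed_inv_mul hx0 (hx l), o.Ed_j]
    exact ih (hN l)

lemma Ops.div_c [IsDomain A] {i : Fin n} {μ ν : Fin n → ℤ} {f : A} (hf : f ∈ h.BW μ ν) (hs : j f ∈ SS (tau (o.y i)) (qi q d i) (qi q d i ^ 2 * qi q d i ^ (-(ν i)))) : ∃ g, f = g * o.c i := by
  have hc := o.hc i
  have hc0 := o.fr.ne hc.ne
  obtain ⟨N, hN⟩ := h.nilE cd hf
  have hw : j f * (j (o.c i))⁻¹ ∈ o.W ((μ, ν) + -(o.m i, Pi.single i 1)) := o.W_mul (o.W_j.2 hf) (o.W_inv (o.W_j.2 hc.wt))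
  suffices hh : ∃ g, j f * (j (o.c i))⁻¹ = j g by
    obtain ⟨g, hg⟩ := hh
    refine ⟨g, o.fr.inj ?_⟩
    rw [map_mul, ← hg, inv_mul_cancel_right₀ hc0]
  refine o.int (μ := μ + -o.m i) (ν := ν + -Pi.single i 1) (b := j f * (j (o.c i))⁻¹) (N := N) (fun l => ?_) hw ?_
  · by_cases hl : l = i
    · subst hl
      refine ⟨hw, ?_⟩
      have h1 : (j (o.c l))⁻¹ ∈ SS (tau (o.y l)) (qi q d l) (qi q d l)⁻¹ := ⟨1, SN_eig (by
        have h2 := o.tau_c l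
        have h3 : tau (o.y l) ((j (o.c l)) * (j (o.c l))⁻¹) = 1 := by
          rw [mul_inv_cancel₀ hc0, tau_apply, one_mul, inv_mul_cancel₀ (o.y_ne l)]
        rw [tau_mul (o.y_ne l), h2] at h3
        rw [eq_inv_of_mul_eq_one_right h3, smul_inv₀]) 0⟩
      have := SS_mul (o.y_ne l) hs h1
      convert this using 2
      simp only [Pi.add_apply, Pi.neg_apply, Pi.single_eq_same, neg_add, neg_neg, zpow_add₀ (o.qi_ne l), zpow_one]
      rw [mul_right_comm, pow_two, mul_assoc (qi q d l), mul_inv_cancel₀ (o.qi_ne l), mul_one, mul_comm]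
      exact Iff.rfl
    · have := o.X_mul (i := l) (o.X_j hf) (o.X_inv hc.wt hc.ne (hc.F l hl))
      simpa only [Prod.neg_mk, Prod.mk_add_mk] using this
  · exact o.nil_inv hc0 (fun l => by rw [o.Ed_j, hc.E, map_zero]) hN

lemma Cp_norm {i : Fin n} {c : A} {m : Fin n → ℤ} (hc : h.Cp cd i c m) (f : A) : (∃ g, c * f = g * c) ∧ (∃ g, f * c = c * g) := by
  refine Ops.hom_induct (h := h) (P := fun f => (∃ g, c * f = g * c) ∧ (∃ g, f * c = c * g)) (fun μ ν f hf => ?_) ⟨⟨0, by simp⟩, ⟨0, by simp⟩⟩ (fun f g h1 h2 => ?_) f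
  · have h1 := hc.rel μ ν f hf
    constructor
    · refine ⟨((cd.χ ν (Pi.single i 1))⁻¹ * cd.χ μ m) • f, ?_⟩
      rw [smul_mul_assoc, mul_smul, h1, smul_smul, inv_mul_cancel₀ (cd.χ_ne _ _), one_smul]
    · refine ⟨((cd.χ μ m)⁻¹ * cd.χ ν (Pi.single i 1)) • f, ?_⟩
      rw [mul_smul_comm, mul_smul, ← h1, smul_smul, inv_mul_cancel₀ (cd.χ_ne _ _), one_smul]
  · obtain ⟨⟨x, hx⟩, ⟨y, hy⟩⟩ := h1
    obtain ⟨⟨x', hx'⟩, ⟨y', hy'⟩⟩ := h2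
    exact ⟨⟨x + x', by rw [mul_add, hx, hx', add_mul]⟩, ⟨y + y', by rw [add_mul, hy, hy', mul_add]⟩⟩

/-- the principal left ideal is graded -/
lemma Cp_tor {p : (Fin n → ℤ) × (Fin n → ℤ)} {c : A} (hc : c ∈ h.BW p.1 p.2) (k) (f : A) : ∃ t : ℂ, t ≠ 0 ∧ h.tor k (f * c) = t • (h.tor k f * c) := by
  refine ⟨tev q d p k, by rcases k with k | k <;> exact zpow_ne_zero _ h.C.q0, ?_⟩
  have e : h.tor k (f * c) = h.tor k f * h.tor k c := by
    rcases k with k | k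
    · exact h.ra_one' (h.cop.dK k) f c
    · exact h.lam_one' (h.cop.dK k) f c
  rw [e, (h.mem_tor p c).1 hc k, mul_smul_comm]

theorem Ops.prime_c [IsDomain A] (i : Fin n) {x y : A} (hxy : ∃ g, x * y = g * o.c i) : (∃ g, x = g * o.c i) ∨ (∃ g, y = g * o.c i) := by
  have hc := o.hc i
  let J : Submodule ℂ A := LinearMap.range (LinearMap.mulRight ℂ (o.c i))
  have hJ : ∀ x, x ∈ J ↔ ∃ g, x = g * o.c i := fun x => ⟨fun ⟨g, hg⟩ => ⟨g, hg.symm⟩, fun ⟨g, hg⟩ => ⟨g, hg.symm⟩⟩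
  have := h.gprime J (fun k x hx => ?_) (fun x y hy => ?_) (fun x y hy => ?_) (fun μ ν μ' ν' x y hx hy hxy => ?_) (x := x) (y := y) ((hJ _).2 hxy)
  · simpa only [hJ] using this
  · obtain ⟨g, rfl⟩ := (hJ _).1 hx
    obtain ⟨t, -, ht⟩ := Cp_tor (p := (_, _)) hc.wt k g
    rw [ht]; exact J.smul_mem _ ⟨_, rfl⟩
  · obtain ⟨g, rfl⟩ := (hJ _).1 hy
    exact (hJ _).2 ⟨x * g, (mul_assoc _ _ _).symm⟩
  · obtain ⟨g, rfl⟩ := (hJ _).1 hy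
    obtain ⟨g', hg'⟩ := (Cp_norm hc x).1
    exact (hJ _).2 ⟨g * g', by rw [mul_assoc, hg', mul_assoc]⟩
  · obtain ⟨g, hg⟩ := (hJ _).1 hxy
    have hgw : g ∈ h.BW (μ + μ' - o.m i) (ν + ν' - Pi.single i 1) := by
      refine (o.W_j (p := (_, _))).1 ?_
      have h1 := o.W_mul (o.W_j (p := (_, _)).2 (h.mul_BW hx hy)) (o.W_inv (o.W_j (p := (_, _)).2 hc.wt))
      rw [hg, map_mul, mul_inv_cancel_right₀ (o.fr.ne hc.ne)] at h1
      rw [sub_eq_add_neg, sub_eq_add_neg]; exact h1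
    have h2 : j x * j y ∈ SS (tau (o.y i)) (qi q d i) (qi q d i ^ 2 * (qi q d i ^ (-(ν i)) * qi q d i ^ (-(ν' i)))) := by
      rw [← map_mul, hg, map_mul]
      have h3 := SS_mul (o.y_ne i) (o.X_j (i := i) hgw).2 ⟨1, SN_eig (Q := qi q d i) (o.tau_c i) 0⟩
      convert h3 using 2
      have := o.qi_ne i
      simp only [Pi.add_apply, Pi.sub_apply, Pi.single_eq_same, neg_add, zpow_add₀ this, sub_eq_add_neg, neg_neg, zpow_one]
      ring
    rcases SS_prime (o.y_ne i) (o.qi_r i) (zpow_ne_zero _ (o.qi_ne i)) (zpow_ne_zero _ (o.qi_ne i)) (o.X_j (i := i) hx).2 (o.X_j (i := i) hy).2 h2 with h4 | h4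
    · exact Or.inl ((hJ _).2 (o.div_c hx h4))
    · exact Or.inr ((hJ _).2 (o.div_c hy h4))

theorem QG.Cp.prime {i : Fin n} {c : A} {m : Fin n → ℤ} (hc : h.Cp cd i c m) {x y : A} (hxy : ∃ g, x * y = g * c) : (∃ g, x = g * c) ∨ (∃ g, y = g * c) := by
  have := h.noeth cd; have := h.noeth_op cd; have := h.domain cd
  obtain ⟨D, _, _, j, hj⟩ := exists_Fr A
  have : ∀ k, ∃ e m', h.Cp cd k e m' ∧ (k = i → e = c) := fun k => by
    by_cases hk : k = i
    · subst hk; exact ⟨c, m, hc, fun _ => rfl⟩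
    · obtain ⟨e, m', he⟩ := h.exists_Cp cd k
      exact ⟨e, m', he, fun h0 => absurd h0 hk⟩
  choose e m' he hei using this
  obtain ⟨o, ho⟩ := h.exists_Ops cd hj he
  have : o.c i = c := by rw [ho]; exact hei i rfl
  rw [← this] at hxy ⊢
  exact o.prime_c i hxy

/-- the normal elements -/
def Ops.z : Fin n ⊕ Fin n → A := Sum.elim o.c o.c'

lemma Ops.z_norm (k) (f : A) : (∃ g, o.z k * f = g * o.z k) ∧ (∃ g, f * o.z k = o.z k * g) := by
  rcases k with k | k
  · exact Cp_norm (o.hc k) f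
  · obtain ⟨⟨g, hg⟩, ⟨g', hg'⟩⟩ := Cp_norm (o.hc' k) (op f)
    exact ⟨⟨unop g', congrArg unop hg'⟩, ⟨unop g, congrArg unop hg⟩⟩

lemma Ops.z_prime (k) {x y : A} (hxy : ∃ g, x * y = g * o.z k) : (∃ g, x = g * o.z k) ∨ (∃ g, y = g * o.z k) := by
  rcases k with k | k
  · exact (o.hc k).prime hxy
  · obtain ⟨g, hg⟩ := hxy
    obtain ⟨g', hg'⟩ := (o.z_norm (.inr k) g).2
    have key : ∀ w : Aᵐᵒᵖ, (∃ e, w = e * op (o.c' k)) → ∃ e, unop w = e * o.c' k := fun w ⟨e, he⟩ => by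
      obtain ⟨e', he'⟩ := (o.z_norm (.inr k) (unop e)).1
      exact ⟨e', (congrArg unop he).trans he'⟩
    exact ((o.hc' k).prime (x := op y) (y := op x) ⟨op g', congrArg op (hg.trans hg')⟩).symm.imp (key _) (key _)

lemma Ops.z_ne (k) : o.z k ≠ 0 := by
  rcases k with k | k
  · exact (o.hc k).ne
  · exact o.c'_ne k

lemma Ops.z_wt (k) : ∃ p, j (o.z k) ∈ o.W p := by
  rcases k with k | k
  · exact ⟨(_, _), o.W_j.2 (o.hc k).wt⟩
  · exact ⟨(_, _), o.W_j.2 (o.W_c' k)⟩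

/-- the multiplicative set -/
def Ops.S : Submonoid A := Submonoid.closure (Set.range o.z)

lemma Ops.S_q {s : A} (hs : s ∈ o.S) {p} {f : A} (hf : j f ∈ o.W p) : ∃ t : ℂ, t ≠ 0 ∧ s * f = t • (f * s) := by
  refine Submonoid.closure_induction (motive := fun s _ => ∃ t : ℂ, t ≠ 0 ∧ s * f = t • (f * s)) ?_ ⟨1, one_ne_zero, by simp⟩ ?_ hs
  · rintro _ ⟨k | k, rfl⟩
    · refine ⟨(cd.χ p.2 (Pi.single k 1))⁻¹ * cd.χ p.1 (o.m k), mul_ne_zero (inv_ne_zero (cd.χ_ne _ _)) (cd.χ_ne _ _), ?_⟩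
      have := (o.hc k).rel _ _ f (o.W_j.1 hf)
      change o.c k * f = _ • (f * o.c k)
      rw [mul_smul, this, smul_smul, inv_mul_cancel₀ (cd.χ_ne _ _), one_smul]
    · refine ⟨(cd.χ (-p.1) (o.m' k))⁻¹ * cd.χ (-p.2) (Pi.single k 1), mul_ne_zero (inv_ne_zero (cd.χ_ne _ _)) (cd.χ_ne _ _), ?_⟩
      have := (o.hc' k).rel (-p.1) (-p.2) (op f) (h.opp_BW.2 (by rw [neg_neg, neg_neg]; exact o.W_j.1 hf))
      have : cd.χ (-p.1) (o.m' k) • (o.c' k * f) = cd.χ (-p.2) (Pi.single k 1) • (f * o.c' k) := congrArg unop this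
      change o.c' k * f = _ • (f * o.c' k)
      rw [mul_smul, ← this, smul_smul, inv_mul_cancel₀ (cd.χ_ne _ _), one_smul]
  · rintro x y - - ⟨t, ht, h1⟩ ⟨t', ht', h2⟩
    exact ⟨t' * t, mul_ne_zero ht' ht, by rw [mul_assoc, h2, mul_smul_comm, ← mul_assoc, h1, smul_mul_assoc, smul_smul, mul_assoc]⟩

lemma Ops.S_wt {s : A} (hs : s ∈ o.S) : ∃ p, j s ∈ o.W p := by
  refine Submonoid.closure_induction (motive := fun s _ => ∃ p, j s ∈ o.W p) ?_ ⟨0, by rw [map_one]; exact o.W_one⟩ ?_ hs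
  · rintro _ ⟨k, rfl⟩; exact o.z_wt k
  · rintro x y - - ⟨t, ht⟩ ⟨t', ht'⟩
    exact ⟨_, by rw [map_mul]; exact o.W_mul ht ht'⟩

/-- every nonzero homogeneous ideal meets `S` -/
theorem Ops.simple (B : (Fin n → ℤ) × (Fin n → ℤ) → Submodule ℂ A) (hB : ∀ p, ∀ x ∈ B p, j x ∈ o.W p)
    (hl : ∀ p p' x y, j x ∈ o.W p → y ∈ B p' → x * y ∈ B (p + p')) (hr : ∀ p p' x y, x ∈ B p → j y ∈ o.W p' → x * y ∈ B (p + p')) {p b} (hb : b ∈ B p) (hb0 : b ≠ 0) : ∃ p, ∃ s ∈ o.S, s ∈ B p := by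
  have swap : ∀ {s p x p' b}, s ∈ o.S → j x ∈ o.W p → s * b ∈ B p' → s * (x * b) ∈ B (p + p') := fun {s p x p' b} hs hx hsb => by
    obtain ⟨t, -, ht⟩ := o.S_q hs hx
    rw [← mul_assoc, ht, smul_mul_assoc, mul_assoc]
    exact (B _).smul_mem _ (hl _ _ _ _ hx hsb)
  let H : Set A := {x | ∃ p, j x ∈ o.W p ∧ ∃ s ∈ o.S, ∃ p', s * x ∈ B p'}
  let J : Submodule ℂ A := Submodule.span ℂ H
  have hJ : ∀ x ∈ J, ∀ y, x * y ∈ J := fun x hx y => by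
    refine Ops.hom_induct (h := h) (P := fun y => x * y ∈ J) (fun μ ν y hy => ?_) (by simp) (fun f g h1 h2 => by rw [mul_add]; exact J.add_mem h1 h2) y
    refine span_induction (p := fun x _ => x * y ∈ J) ?_ (by simp) (fun f g _ _ h1 h2 => by rw [add_mul]; exact J.add_mem h1 h2)
      (fun t x _ hx => by rw [smul_mul_assoc]; exact J.smul_mem _ hx) hx
    rintro x ⟨p, hx, s, hs, p', hsx⟩
    have hy := (o.W_j (p := (μ, ν))).2 hy
    exact subset_span ⟨_, by rw [map_mul]; exact o.W_mul hx hy, s, hs, _, by rw [← mul_assoc]; exact hr _ _ _ _ hsx hy⟩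
  have hlam : ∀ u : U, (∀ x ∈ H, h.lam u x ∈ J) → ∀ x ∈ J, h.lam u x ∈ J := fun u hu x hx =>
    span_induction (p := fun x _ => h.lam u x ∈ J) hu (by simp) (fun f g _ _ h1 h2 => by rw [map_add]; exact J.add_mem h1 h2)
      (fun t x _ hx => by rw [map_smul]; exact J.smul_mem _ hx) hx
  have one : (1 : A) ∈ J := by
    refine h.hopf cd J hJ (fun u => ?_) ?_
    · let SA : Subalgebra ℂ U :=
        { carrier := {u | ∀ x ∈ J, h.lam u x ∈ J}
          mul_mem' := fun {u v} hu hv x hx => by rw [map_mul]; exact hu _ (hv x hx)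
          add_mem' := fun {u v} hu hv x hx => by rw [map_add]; exact J.add_mem (hu x hx) (hv x hx)
          algebraMap_mem' := fun r x hx => by rw [AlgHom.commutes]; exact J.smul_mem r hx }
      refine h.uRel.induct SA (fun i => hlam _ ?_) (fun i => hlam _ ?_) (fun i => hlam _ ?_) (fun i => hlam _ ?_) u
      · rintro x ⟨p, hx, s, hs, p', hsx⟩
        have hx' := o.W_j.1 hx
        obtain ⟨r, hcW⟩ : ∃ r, j (h.lam (E i) (o.c' i)) ∈ o.W r := ⟨(_, _), o.W_j.2 (h.lamE_BW (o.W_c' i) i)⟩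
        have hy : j (h.lam (E i) x) ∈ o.W (_, _) := o.W_j.2 (h.lamE_BW hx' i)
        have h1 := (o.hc' i).inner (h.opp_BW.2 (show x ∈ h.BW (-(-p.1)) (-(-p.2)) by rw [neg_neg, neg_neg]; exact hx'))
        rw [h.opp_lam, h.opp_lam, inv_inv, h.opp_lam, (h.mem_BW.1 hx').1 i] at h1
        have h1 := congrArg unop h1
        simp only [unop_smul, unop_mul, unop_op, unop_sub] at h1
        obtain ⟨t, ht, h2⟩ := o.S_q (Submonoid.subset_closure ⟨.inr i, rfl⟩) hy
        refine subset_span ⟨(_, _), hy, s * o.c' i, mul_mem hs (Submonoid.subset_closure ⟨.inr i, rfl⟩), p' + r, ?_⟩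
        rw [mul_assoc, show o.c' i * h.lam (E i) x = t • (h.lam (E i) x * o.c' i) from h2, mul_smul_comm]
        refine (B _).smul_mem _ (((B _).smul_mem_iff (hh_ne h.C i)).1 ?_)
        rw [← mul_smul_comm, h1, mul_sub, mul_smul_comm, smul_mul_assoc, mul_smul_comm]
        refine (B _).sub_mem ((B _).smul_mem _ ?_) ((B _).smul_mem _ ?_)
        · have := swap hs hcW hsx
          rwa [add_comm] at this
        · rw [← mul_assoc]; exact hr _ _ _ _ hsx hcW
      · rintro x ⟨p, hx, s, hs, p', hsx⟩
        have hx' := o.W_j.1 hx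
        obtain ⟨r, hcW⟩ : ∃ r, j (h.lam (F i) (o.c i)) ∈ o.W r := ⟨(_, _), o.W_j.2 (h.lamF_BW (o.hc i).wt i)⟩
        have hy : j (h.lam (F i) x) ∈ o.W (_, _) := o.W_j.2 (h.lamF_BW hx' i)
        have h1 := (o.hc i).inner hx'
        refine subset_span ⟨(_, _), hy, s * o.c i, mul_mem hs (Submonoid.subset_closure ⟨.inl i, rfl⟩), p' + r, ?_⟩
        rw [mul_assoc]
        refine ((B _).smul_mem_iff (hh_ne h.C i)).1 ?_
        rw [← mul_smul_comm, h1, mul_sub, h.lam_inv hx', mul_smul_comm, mul_smul_comm, mul_smul_comm]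
        refine (B _).sub_mem ((B _).smul_mem _ ?_) ((B _).smul_mem _ ?_)
        · rw [← mul_assoc]; exact hr _ _ _ _ hsx hcW
        · have := swap hs hcW hsx
          rwa [add_comm] at this
      · rintro x hx
        obtain ⟨p, hxp, -⟩ := id hx
        rw [(h.mem_BW.1 (o.W_j.1 hxp)).1 i]
        exact J.smul_mem _ (subset_span hx)
      · rintro x hx
        obtain ⟨p, hxp, -⟩ := id hx
        rw [h.lam_inv (o.W_j.1 hxp) i]
        exact J.smul_mem _ (subset_span hx)
    · intro h0
      have : b ∈ J := subset_span ⟨p, hB _ _ hb, 1, one_mem _, p, by rwa [one_mul]⟩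
      rw [h0] at this; exact hb0 this
  have hI : ∀ s ∈ o.S, ∀ x ∈ ⨆ p, B p, s * x ∈ ⨆ p, B p := fun s hs x hx => by
    obtain ⟨p, hp⟩ := o.S_wt hs
    refine Submodule.iSup_induction B (motive := fun x => s * x ∈ ⨆ p, B p) hx
      (fun p' x hx => mem_iSup_of_mem _ (hl _ _ _ _ hp hx)) (by simp) (fun x y h1 h2 => by rw [mul_add]; exact add_mem h1 h2)
  have key : ∀ x ∈ J, ∃ s ∈ o.S, s * x ∈ ⨆ p, B p := fun x hx => by
    refine span_induction (p := fun x _ => ∃ s ∈ o.S, s * x ∈ ⨆ p, B p) ?_ ⟨1, one_mem _, by simp⟩ ?_ ?_ hx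
    · rintro x ⟨p, hx, s, hs, p', hsx⟩
      exact ⟨s, hs, mem_iSup_of_mem _ hsx⟩
    · rintro x y - - ⟨s, hs, h1⟩ ⟨s', hs', h2⟩
      refine ⟨s * s', mul_mem hs hs', ?_⟩
      rw [mul_add]
      refine add_mem ?_ (by rw [mul_assoc]; exact hI _ hs _ h2)
      obtain ⟨p, hp⟩ := o.S_wt hs'
      obtain ⟨t, -, ht⟩ := o.S_q hs hp
      rw [ht, smul_mul_assoc, mul_assoc]
      exact smul_mem _ _ (hI _ hs' _ h1)
    · rintro t x - ⟨s, hs, h1⟩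
      exact ⟨s, hs, by rw [mul_smul_comm]; exact smul_mem _ _ h1⟩
  obtain ⟨s, hs, h1⟩ := key 1 one
  rw [mul_one] at h1
  obtain ⟨p, hp⟩ := o.S_wt hs
  refine ⟨p, s, hs, ?_⟩
  classical
  obtain ⟨f, hf, hsum⟩ := (Submodule.mem_iSup_iff_exists_finsupp _ _).1 h1
  have := joint_eig h.tor (tev q d) (tev_inj h.C) (insert p f.support) (fun g => f g - if g = p then s else 0)
    (fun g _ => (h.mem_tor g _).1 (o.W_j.1 (by
      rw [map_sub]
      refine sub_mem (hB _ _ (hf g)) ?_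
      split_ifs with hg
      · rwa [hg]
      · simp))) (by
      rw [sum_sub_distrib, Finset.sum_ite_eq', if_pos (Finset.mem_insert_self _ _), ← hsum, Finsupp.sum, sub_eq_zero]
      exact (Finset.sum_subset (Finset.subset_insert _ _) (fun x _ hx => by simpa using hx)).symm) p (Finset.mem_insert_self _ _)
  rw [if_pos rfl, sub_eq_zero] at this
  rw [← this]; exact hf p

/-! ## Factoriality from graded simplicity -/

section

variable {A D Γ κ : Type} [Ring A] [Algebra ℂ A] [DivisionRing D] [Algebra ℂ D] [AddCommGroup Γ]

/-- the abstract setting -/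
structure HS (j : A →ₐ[ℂ] D) (W : Γ → Submodule ℂ D) (z : κ → A) : Prop where
  fr : Fr j
  mul : ∀ {p p' x y}, x ∈ W p → y ∈ W p' → x * y ∈ W (p + p')
  one : 1 ∈ W 0
  inv : ∀ {p x}, x ∈ W p → x⁻¹ ∈ W (-p)
  ind : ∀ (s : Finset Γ) (x : Γ → D) (θ : Γ), (∀ g ∈ s, x g ∈ W (g + θ)) → ∑ g ∈ s, x g = 0 → ∀ g ∈ s, x g = 0
  cmp : ∀ (s : Finset Γ) (x : Γ → D) (θ : Γ), (∀ g ∈ s, x g ∈ W (g + θ)) → ∑ g ∈ s, x g ∈ Set.range j → ∀ g ∈ s, x g ∈ Set.range j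
  dec : ∀ f : A, ∃ (s : Finset Γ) (x : Γ → A), (∀ g, j (x g) ∈ W g) ∧ ∑ g ∈ s, x g = f
  ne : ∀ k, z k ≠ 0
  wt : ∀ k, ∃ p, j (z k) ∈ W p
  norm : ∀ k f, (∃ g, z k * f = g * z k) ∧ (∃ g, f * z k = z k * g)
  prime : ∀ k x y, (∃ g, x * y = g * z k) → (∃ g, x = g * z k) ∨ (∃ g, y = g * z k)
  simple : ∀ B : Γ → Submodule ℂ A, (∀ p, ∀ x ∈ B p, j x ∈ W p) → (∀ p p' x y, j x ∈ W p → y ∈ B p' → x * y ∈ B (p + p')) →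
    (∀ p p' x y, x ∈ B p → j y ∈ W p' → x * y ∈ B (p + p')) → ∀ p b, b ∈ B p → b ≠ 0 → ∃ p, ∃ s ∈ Submonoid.closure (Set.range z), s ∈ B p

variable {j : A →ₐ[ℂ] D} {W : Γ → Submodule ℂ D} {z : κ → A} (H : HS j W z)
include H

local notation "𝕊" => Submonoid.closure (Set.range z)

lemma HS.S_wt {s : A} (hs : s ∈ 𝕊) : ∃ p, j s ∈ W p := by
  refine Submonoid.closure_induction (motive := fun s _ => ∃ p, j s ∈ W p) ?_ ⟨0, by rw [map_one]; exact H.one⟩ ?_ hs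
  · rintro _ ⟨k, rfl⟩; exact H.wt k
  · rintro x y - - ⟨t, ht⟩ ⟨t', ht'⟩
    exact ⟨_, by rw [map_mul]; exact H.mul ht ht'⟩

lemma HS.S_ne {s : A} (hs : s ∈ 𝕊) : j s ≠ 0 := by
  refine Submonoid.closure_induction (motive := fun s _ => j s ≠ 0) ?_ (by simp) ?_ hs
  · rintro _ ⟨k, rfl⟩; exact H.fr.ne (H.ne k)
  · rintro x y - - h1 h2
    rw [map_mul]; exact mul_ne_zero h1 h2

lemma HS.S_nl {s : A} (hs : s ∈ 𝕊) : ∀ f, ∃ g, s * f = g * s := by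
  refine Submonoid.closure_induction (motive := fun s _ => ∀ f, ∃ g, s * f = g * s) ?_ (fun f => ⟨f, by simp⟩) ?_ hs
  · rintro _ ⟨k, rfl⟩ f; exact (H.norm k f).1
  · rintro x y - - h1 h2 f
    obtain ⟨g, hg⟩ := h2 f
    obtain ⟨g', hg'⟩ := h1 g
    exact ⟨g', by rw [mul_assoc, hg, ← mul_assoc, hg', mul_assoc]⟩

lemma HS.S_nr {s : A} (hs : s ∈ 𝕊) : ∀ f, ∃ g, f * s = s * g := by
  refine Submonoid.closure_induction (motive := fun s _ => ∀ f, ∃ g, f * s = s * g) ?_ (fun f => ⟨f, by simp⟩) ?_ hs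
  · rintro _ ⟨k, rfl⟩ f; exact (H.norm k f).2
  · rintro x y - - h1 h2 f
    obtain ⟨g, hg⟩ := h1 f
    obtain ⟨g', hg'⟩ := h2 g
    exact ⟨g', by rw [← mul_assoc, hg, mul_assoc, hg', mul_assoc]⟩

/-- the localization -/
def HS.T : Subalgebra ℂ D where
  carrier := {x | ∃ s ∈ 𝕊, ∃ f, x * j s = j f}
  mul_mem' := by
    rintro x y ⟨s, hs, f, hf⟩ ⟨s', hs', f', hf'⟩
    obtain ⟨g, hg⟩ := H.S_nr hs f'
    refine ⟨s' * s, mul_mem hs' hs, f * g, ?_⟩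
    rw [map_mul, mul_assoc, ← mul_assoc y, hf', ← map_mul, hg, map_mul, ← mul_assoc, hf, map_mul]
  add_mem' := by
    rintro x y ⟨s, hs, f, hf⟩ ⟨s', hs', f', hf'⟩
    obtain ⟨g, hg⟩ := H.S_nr hs' s
    refine ⟨s * s', mul_mem hs hs', f * s' + f' * g, ?_⟩
    rw [add_mul, map_add, map_mul, map_mul, map_mul, ← mul_assoc, hf, ← hf', mul_assoc y, ← map_mul, ← map_mul, ← map_mul, hg]
  algebraMap_mem' := fun r => ⟨1, one_mem _, algebraMap ℂ A r, by simp⟩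

lemma HS.T_j (f : A) : j f ∈ H.T := ⟨1, one_mem _, f, by simp⟩

lemma HS.T_inv {s : A} (hs : s ∈ 𝕊) : (j s)⁻¹ ∈ H.T := ⟨s, hs, 1, by rw [inv_mul_cancel₀ (H.S_ne hs), map_one]⟩

lemma HS.T_dec {x : D} (hx : x ∈ H.T) : ∃ (s : Finset Γ) (y : Γ → D) (θ : Γ), (∀ g, y g ∈ H.T ∧ y g ∈ W (g + θ)) ∧ ∑ g ∈ s, y g = x := by
  obtain ⟨s, hs, f, hf⟩ := hx
  obtain ⟨t, y, hy, rfl⟩ := H.dec f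
  obtain ⟨p, hp⟩ := H.S_wt hs
  refine ⟨t, fun g => j (y g) * (j s)⁻¹, -p, fun g => ⟨mul_mem (H.T_j _) (H.T_inv hs), H.mul (hy g) (H.inv hp)⟩, ?_⟩
  rw [← Finset.sum_mul, ← map_sum, ← hf, mul_inv_cancel_right₀ (H.S_ne hs)]

/-- normalization of a component -/
lemma HS.normalize (I : Submodule ℂ D) (hl : ∀ f, ∀ x ∈ I, j f * x ∈ I) (hr : ∀ t ∈ H.T, ∀ x ∈ I, x * t ∈ I) (G : Finset Γ) (x : Γ → D) (δ : Γ)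
    (hx : ∀ g ∈ G, x g ∈ H.T ∧ x g ∈ W (g + δ)) (hI : ∑ g ∈ G, x g ∈ I) (g0 : Γ) (hg : g0 ∈ G) (h0 : x g0 ≠ 0) :
    ∃ y : Γ → D, (∀ g ∈ G, y g ∈ H.T ∧ y g ∈ W (g - g0)) ∧ ∑ g ∈ G, y g ∈ I ∧ y g0 = 1 := by
  let B : Γ → Submodule ℂ A := fun p =>
    { carrier := {b | ∃ y : Γ → D, (∀ g ∈ G, y g ∈ H.T ∧ y g ∈ W (g + (p - g0))) ∧ ∑ g ∈ G, y g ∈ I ∧ y g0 = j b}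
      add_mem' := by
        rintro b b' ⟨y, h1, h2, h3⟩ ⟨y', h1', h2', h3'⟩
        exact ⟨y + y', fun g hg => ⟨add_mem (h1 g hg).1 (h1' g hg).1, add_mem (h1 g hg).2 (h1' g hg).2⟩, by simpa [sum_add_distrib] using add_mem h2 h2', by simp [h3, h3']⟩
      zero_mem' := ⟨0, fun g hg => ⟨zero_mem _, zero_mem _⟩, by simp, by simp⟩
      smul_mem' := by
        rintro t b ⟨y, h1, h2, h3⟩
        exact ⟨t • y, fun g hg => ⟨H.T.smul_mem (h1 g hg).1 t, smul_mem _ _ (h1 g hg).2⟩, by simpa [smul_sum] using I.smul_mem t h2, by simp [h3]⟩ }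
  obtain ⟨s, hs, f, hf⟩ := (hx g0 hg).1
  obtain ⟨p, hp⟩ := H.S_wt hs
  obtain ⟨p', s', hs', y, h1, h2, h3⟩ := H.simple B (fun p b ⟨y, h1, h2, h3⟩ => by
      have := (h1 g0 hg).2
      rwa [h3, add_sub_cancel] at this)
    (fun p p' u b hu ⟨y, h1, h2, h3⟩ => ⟨fun g => j u * y g, fun g hg => ⟨mul_mem (H.T_j _) (h1 g hg).1, by
      have := H.mul hu (h1 g hg).2
      rwa [show p + (g + (p' - g0)) = g + (p + p' - g0) by abel] at this⟩, by rw [← Finset.mul_sum]; exact hl _ _ h2, by simp only [h3, map_mul]⟩)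
    (fun p p' b u ⟨y, h1, h2, h3⟩ hu => ⟨fun g => y g * j u, fun g hg => ⟨mul_mem (h1 g hg).1 (H.T_j _), by
      have := H.mul (h1 g hg).2 hu
      rwa [show g + (p - g0) + p' = g + (p + p' - g0) by abel] at this⟩, by rw [← Finset.sum_mul]; exact hr _ (H.T_j _) _ h2, by simp only [h3, map_mul]⟩)
    (g0 + δ + p) f ⟨fun g => x g * j s, fun g hg => ⟨mul_mem (hx g hg).1 (H.T_j _), by
      have := H.mul (hx g hg).2 hp
      rwa [show g + δ + p = g + (g0 + δ + p - g0) by abel] at this⟩, by rw [← Finset.sum_mul]; exact hr _ (H.T_j _) _ hI, hf⟩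
    (fun hf0 => by rw [hf0, map_zero] at hf; exact mul_ne_zero h0 (H.S_ne hs) hf)
  have hW := (h1 g0 hg).2
  rw [h3, add_sub_cancel] at hW
  refine ⟨fun g => y g * (j s')⁻¹, fun g hg => ⟨mul_mem (h1 g hg).1 (H.T_inv hs'), ?_⟩, by rw [← Finset.sum_mul]; exact hr _ (H.T_inv hs') _ h2, by simp only [h3, mul_inv_cancel₀ (H.S_ne hs')]⟩
  have := H.mul (h1 g hg).2 (H.inv hW)
  rwa [show g + (p' - g0) + -p' = g - g0 by abel] at this

/-- an element commuting with homogeneous elements is central -/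
lemma HS.central {x : D} (hx : ∀ p r, j r ∈ W p → j r * x = x * j r) : x ∈ Subring.center D := by
  have h1 : ∀ r, j r * x = x * j r := fun r => by
    obtain ⟨s, y, hy, rfl⟩ := H.dec r
    rw [map_sum, Finset.sum_mul, Finset.mul_sum]
    exact sum_congr rfl fun g _ => hx g _ (hy g)
  refine Subring.mem_center_iff.2 fun d => ?_
  obtain ⟨f, s, hs, hd⟩ := H.fr.lf d
  refine mul_left_cancel₀ (H.fr.ne hs) ?_
  rw [← mul_assoc, hd, h1, ← mul_assoc, h1, mul_assoc, hd]

/-- ideals are centrally generated -/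
lemma HS.claim (I J : Submodule ℂ D) (hl : ∀ f, ∀ x ∈ I, j f * x ∈ I) (hr : ∀ t ∈ H.T, ∀ x ∈ I, x * t ∈ I)
    (hJ : ∀ t ∈ H.T, ∀ x ∈ J, x * t ∈ J) (hIJ : ∀ x ∈ I, x ∈ Subring.center D → x ∈ J) (G : Finset Γ) : ∀ (x : Γ → D) (δ : Γ),
    (∀ g ∈ G, x g ∈ H.T ∧ x g ∈ W (g + δ)) → ∑ g ∈ G, x g ∈ I → ∑ g ∈ G, x g ∈ J := by
  classical
  induction G using Finset.strongInduction with
  | H G ih =>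
  intro x δ hx hI
  by_cases hz : ∀ g ∈ G, x g = 0
  · rw [sum_eq_zero hz]; exact zero_mem _
  push Not at hz
  obtain ⟨g0, hg0, h0⟩ := hz
  have red : ∀ g1 ∈ G, ∀ y : Γ → D, (∀ g ∈ G, y g ∈ H.T ∧ y g ∈ W (g - g1)) → ∑ g ∈ G, y g ∈ I → ∑ g ∈ G, y g ∈ J → y g1 = 1 → ∑ g ∈ G, x g ∈ J := fun g1 hg1 y hy hyI hyJ hy1 => by
    have e : ∑ g ∈ G.erase g1, (x g - y g * x g1) = ∑ g ∈ G, x g - (∑ g ∈ G, y g) * x g1 := by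
      rw [Finset.sum_erase _ (by rw [hy1, one_mul, sub_self]), sum_sub_distrib, Finset.sum_mul]
    have := ih _ (Finset.erase_ssubset hg1) (fun g => x g - y g * x g1) δ (fun g hg => ?_) (by
      rw [e]; exact sub_mem hI (hr _ (hx g1 hg1).1 _ hyI))
    · rw [e] at this
      simpa using add_mem this (hJ _ (hx g1 hg1).1 _ hyJ)
    · have hg := Finset.mem_of_mem_erase hg
      refine ⟨sub_mem (hx g hg).1 (mul_mem (hy g hg).1 (hx g1 hg1).1), sub_mem (hx g hg).2 ?_⟩
      have := H.mul (hy g hg).2 (hx g1 hg1).2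
      rwa [show g - g1 + (g1 + δ) = g + δ by abel] at this
  obtain ⟨y, hy, hyI, hy1⟩ := H.normalize I hl hr G x δ hx hI g0 hg0 h0
  by_cases hc : ∑ g ∈ G, y g ∈ Subring.center D
  · exact red g0 hg0 y hy hyI (hIJ _ hyI hc) hy1
  have : ∃ p r, j r ∈ W p ∧ j r * ∑ g ∈ G, y g ≠ (∑ g ∈ G, y g) * j r := by
    by_contra hcon
    push Not at hcon
    exact hc (H.central hcon)
  obtain ⟨p, r, hrW, hne⟩ := this
  let v : Γ → D := fun g => j r * y g - y g * j r
  have hv : ∑ g ∈ G.erase g0, v g = j r * ∑ g ∈ G, y g - (∑ g ∈ G, y g) * j r := by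
    rw [Finset.sum_erase _ (by simp only [v]; rw [hy1, mul_one, one_mul, sub_self]), sum_sub_distrib, Finset.sum_mul, Finset.mul_sum]
  obtain ⟨g1, hg1, h1⟩ : ∃ g1 ∈ G.erase g0, v g1 ≠ 0 := by
    by_contra hcon
    push Not at hcon
    rw [sum_eq_zero hcon] at hv
    exact hne (sub_eq_zero.1 hv.symm)
  obtain ⟨y', hy', hyI', hy1'⟩ := H.normalize I hl hr (G.erase g0) v (p - g0) (fun g hg => by
    have hg := hy g (Finset.mem_of_mem_erase hg)
    have e1 := H.mul hrW hg.2
    have e2 := H.mul hg.2 hrW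
    rw [show p + (g - g0) = g + (p - g0) by abel] at e1
    rw [show (g - g0) + p = g + (p - g0) by abel] at e2
    exact ⟨sub_mem (mul_mem (H.T_j _) hg.1) (mul_mem hg.1 (H.T_j _)), sub_mem e1 e2⟩)
    (by rw [hv]; exact sub_mem (hl _ _ hyI) (hr _ (H.T_j _) _ hyI)) g1 hg1 h1
  have hyJ' := ih _ (Finset.erase_ssubset hg0) y' (-g1) (fun g hg => by rw [← sub_eq_add_neg]; exact hy' g hg) hyI'
  have e : ∑ g ∈ G, (if g = g0 then 0 else y' g) = ∑ g ∈ G.erase g0, y' g := by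
    rw [← Finset.sum_erase G (a := g0) (by simp)]
    exact sum_congr rfl fun g hg => if_neg (Finset.ne_of_mem_erase hg)
  refine red g1 (Finset.mem_of_mem_erase hg1) (fun g => if g = g0 then 0 else y' g) (fun g hg => ?_) (by rwa [e]) (by rwa [e])
    (by simp only [if_neg (Finset.ne_of_mem_erase hg1), hy1'])
  by_cases hgg : g = g0
  · simp only [if_pos hgg]; exact ⟨zero_mem _, zero_mem _⟩
  · simp only [if_neg hgg]; exact hy' g (Finset.mem_erase.2 ⟨hgg, hg⟩)

lemma HS.claim' (I J : Submodule ℂ D) (hl : ∀ f, ∀ x ∈ I, j f * x ∈ I) (hr : ∀ t ∈ H.T, ∀ x ∈ I, x * t ∈ I)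
    (hJ : ∀ t ∈ H.T, ∀ x ∈ J, x * t ∈ J) (hIJ : ∀ x ∈ I, x ∈ Subring.center D → x ∈ J) {x : D} (hx : x ∈ I) (hxT : x ∈ H.T) : x ∈ J := by
  obtain ⟨s, y, θ, hy, rfl⟩ := H.T_dec hxT
  exact H.claim I J hl hr hJ hIJ s y θ (fun g _ => hy g) hx

/-- components of central elements are central -/
lemma HS.center_comp (G : Finset Γ) (x : Γ → D) (θ : Γ) (hx : ∀ g ∈ G, x g ∈ W (g + θ)) (hc : ∑ g ∈ G, x g ∈ Subring.center D) :
    ∀ g ∈ G, x g ∈ Subring.center D := fun g hg => H.central fun p r hr => sub_eq_zero.1 <|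
  H.ind G (fun g => j r * x g - x g * j r) (p + θ) (fun g hg => by
    have e1 := H.mul hr (hx g hg)
    have e2 := H.mul (hx g hg) hr
    rw [show p + (g + θ) = g + (p + θ) by abel] at e1
    rw [show (g + θ) + p = g + (p + θ) by abel] at e2
    exact sub_mem e1 e2) (by
    rw [sum_sub_distrib, ← Finset.mul_sum, ← Finset.sum_mul, Subring.mem_center_iff.1 hc, sub_self]) g hg

/-- homogeneous central elements lie in `T` -/
lemma HS.center_T {x : D} {θ : Γ} (hx : x ∈ W θ) (hc : x ∈ Subring.center D) : x ∈ H.T := by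
  have hc := Subring.mem_center_iff.1 hc
  let B : Γ → Submodule ℂ A := fun p =>
    { carrier := {b | j b ∈ W p ∧ j b * x ∈ Set.range j}
      add_mem' := by
        rintro b b' ⟨h1, f, h2⟩ ⟨h1', f', h2'⟩
        exact ⟨by rw [map_add]; exact add_mem h1 h1', f + f', by rw [map_add, map_add, add_mul, h2, h2']⟩
      zero_mem' := ⟨by simp, 0, by simp⟩
      smul_mem' := by
        rintro t b ⟨h1, f, h2⟩
        exact ⟨by rw [map_smul]; exact smul_mem _ _ h1, t • f, by rw [map_smul, map_smul, smul_mul_assoc, h2]⟩ }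
  obtain ⟨f, s, hs, hf⟩ := H.fr.lf x
  obtain ⟨G, y, hy, rfl⟩ := H.dec s
  obtain ⟨g, hg, hg0⟩ := Finset.exists_ne_zero_of_sum_ne_zero hs
  have := H.cmp G (fun g => j (y g) * x) θ (fun g _ => H.mul (hy g) hx) ⟨f, by rw [← hf, map_sum, Finset.sum_mul]⟩ g hg
  obtain ⟨p, s, hs, -, e, he⟩ := H.simple B (fun p b hb => hb.1)
    (fun p p' u b hu ⟨h1, f, h2⟩ => ⟨by rw [map_mul]; exact H.mul hu h1, u * f, by rw [map_mul, map_mul, h2, mul_assoc]⟩)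
    (fun p p' b u ⟨h1, f, h2⟩ hu => ⟨by rw [map_mul]; exact H.mul h1 hu, f * u, by rw [map_mul, map_mul, h2, mul_assoc, ← hc, mul_assoc]⟩)
    g (y g) ⟨hy g, this⟩ hg0
  exact ⟨s, hs, e, by rw [he, hc]⟩

/-- the central part of `T` is a localized polynomial ring -/
lemma HS.center_ufd [Module.Free ℤ Γ] [Module.Finite ℤ Γ] : ∃ (R : Type) (_ : CommRing R) (_ : IsDomain R) (_ : UniqueFactorizationMonoid R) (φ : R →+* Subring.center D), Function.Injective φ ∧
      (∀ r, (φ r : D) ∈ H.T) ∧ ∀ x : Subring.center D, (x : D) ∈ H.T → ∃ m r, φ m ≠ 0 ∧ (φ m : D)⁻¹ ∈ H.T ∧ x * φ m = φ r := by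
  classical
  let k : Subfield (Subring.center D) :=
    { carrier := {x | (x : D) ∈ W 0}
      mul_mem' := fun {x y} hx hy => by
        have := H.mul (show (x : D) ∈ W 0 from hx) (show (y : D) ∈ W 0 from hy)
        rwa [add_zero] at this
      one_mem' := H.one
      add_mem' := fun hx hy => add_mem (S := Submodule ℂ D) hx hy
      zero_mem' := zero_mem (W 0)
      neg_mem' := fun hx => neg_mem (S := Submodule ℂ D) hx
      inv_mem' := fun x hx => by
        have := H.inv (show (x : D) ∈ W 0 from hx)
        rwa [neg_zero] at this }
  let L : Submodule ℤ Γ := AddSubgroup.toIntSubmodule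
    { carrier := {θ | ∃ x : Subring.center D, x ≠ 0 ∧ (x : D) ∈ W θ}
      add_mem' := fun ⟨x, hx, h1⟩ ⟨y, hy, h2⟩ => ⟨x * y, mul_ne_zero hx hy, H.mul h1 h2⟩
      zero_mem' := ⟨1, one_ne_zero, H.one⟩
      neg_mem' := fun ⟨x, hx, h1⟩ => ⟨x⁻¹, inv_ne_zero hx, H.inv h1⟩ }
  let b := Module.finBasis ℤ L
  have hu : ∀ i, ∃ x : Subring.center D, x ≠ 0 ∧ (x : D) ∈ W (b i) := fun i => (b i).2
  choose u hu0 hu using hu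
  let φ := MvPolynomial.aeval (R := k) u
  let wt : (Fin (Module.finrank ℤ L) →₀ ℕ) → Γ := fun α => ((∑ i, (α i : ℤ) • b i : L) : Γ)
  let U : (Fin (Module.finrank ℤ L) →₀ ℕ) → Subring.center D := fun α => ∏ i, u i ^ α i
  have hφU : ∀ α c, φ (MvPolynomial.monomial α c) = c * U α := fun α c => by
    rw [MvPolynomial.aeval_monomial, Finsupp.prod_fintype _ _ (fun i => pow_zero _)]; rfl
  have hU0 : ∀ α, U α ≠ 0 := fun α => Finset.prod_ne_zero_iff.2 fun i _ => pow_ne_zero _ (hu0 i)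
  have hUW : ∀ α, (U α : D) ∈ W (wt α) := fun α => by
    have hp : ∀ i (m : ℕ), ((u i ^ m : Subring.center D) : D) ∈ W (((m : ℤ) • b i : L) : Γ) := fun i m => by
      induction m with
      | zero => simpa using H.one
      | succ m ih =>
        have := H.mul ih (hu i)
        rw [pow_succ]
        rwa [← Submodule.coe_add, ← add_one_zsmul, ← Nat.cast_succ] at this
    have : ∀ s : Finset (Fin (Module.finrank ℤ L)), ((∏ i ∈ s, u i ^ α i : Subring.center D) : D) ∈ W ((∑ i ∈ s, (α i : ℤ) • b i : L) : Γ) := fun s => by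
      induction s using Finset.induction_on with
      | empty => simpa using H.one
      | insert i s hi ih =>
        rw [Finset.prod_insert hi, Finset.sum_insert hi]
        exact H.mul (hp i _) ih
    exact this Finset.univ
  have hwt : Function.Injective wt := fun α β h => by
    have h1 : ∑ i, (α i : ℤ) • b i = ∑ i, (β i : ℤ) • b i := Subtype.ext h
    rw [← b.equivFun_symm_apply, ← b.equivFun_symm_apply] at h1
    ext i
    exact Nat.cast_injective (congrFun (b.equivFun.symm.injective h1) i)
  have hT : ∀ {x : Subring.center D} {θ}, (x : D) ∈ W θ → (x : D) ∈ H.T := fun {x θ} hx => H.center_T hx x.2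
  have hm : ∀ α, φ (MvPolynomial.monomial α 1) = U α := fun α => by rw [hφU]; exact one_mul _
  refine ⟨MvPolynomial (Fin (Module.finrank ℤ L)) k, inferInstance, inferInstance, inferInstance, φ.toRingHom, ?_, fun r => ?_, fun x hx => ?_⟩
  · refine (injective_iff_map_eq_zero _).2 fun p hp => ?_
    let t : (Fin (Module.finrank ℤ L) →₀ ℕ) → Subring.center D := fun α => (MvPolynomial.coeff α p).1 * U α
    have h1 : ∑ α ∈ p.support, (t α : D) = 0 := by
      have h2 : φ p = 0 := hp
      rw [p.as_sum, map_sum] at h2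
      simp only [hφU] at h2
      rw [← AddSubmonoidClass.coe_finset_sum, h2]; rfl
    have h3 := H.ind (p.support.image wt) (fun g => (t (Function.invFun wt g) : D)) 0
      (fun g hg => by
        obtain ⟨α, -, rfl⟩ := Finset.mem_image.1 hg
        rw [Function.leftInverse_invFun hwt α, add_comm]
        exact H.mul (p.coeff α).2 (hUW α))
      (by rw [Finset.sum_image hwt.injOn]; simpa only [Function.leftInverse_invFun hwt _] using h1)
    by_contra hp0
    obtain ⟨α, hα⟩ := Finset.nonempty_iff_ne_empty.2 (fun h0 => hp0 (MvPolynomial.support_eq_empty.1 h0))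
    have h4 := h3 (wt α) (Finset.mem_image_of_mem _ hα)
    rw [Function.leftInverse_invFun hwt α] at h4
    have h5 : (MvPolynomial.coeff α p).1 * U α = 0 := Subtype.ext h4
    exact MvPolynomial.mem_support_iff.1 hα (Subtype.ext ((mul_eq_zero.1 h5).resolve_right (hU0 α)))
  · induction r using MvPolynomial.induction_on' with
    | monomial α c =>
      change (φ _ : D) ∈ _
      rw [hφU]
      exact mul_mem (hT c.2) (hT (hUW α))
    | add p p' h1 h2 => rw [map_add]; exact add_mem h1 h2
  · suffices key : ∃ δ r, x * φ (MvPolynomial.monomial δ 1) = φ r by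
      obtain ⟨δ, r, h1⟩ := key
      refine ⟨MvPolynomial.monomial δ 1, r, ?_, ?_, h1⟩
      · exact (hm δ).trans_ne (hU0 δ)
      · change ((φ _ : Subring.center D) : D)⁻¹ ∈ _
        rw [hm]
        exact hT (x := (U δ)⁻¹) (H.inv (hUW δ))
    obtain ⟨G, y, θ, hy, hsum⟩ := H.T_dec hx
    have hc := H.center_comp G y θ (fun g _ => (hy g).2) (by rw [hsum]; exact x.2)
    have key : ∀ s ⊆ G, ∀ x : Subring.center D, (x : D) = ∑ g ∈ s, y g → ∃ δ r, x * φ (MvPolynomial.monomial δ 1) = φ r := fun s => by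
      induction s using Finset.induction_on with
      | empty => exact fun _ x hx => ⟨0, 0, by rw [show x = 0 from Subtype.ext hx, zero_mul, map_zero]⟩
      | insert g s hg ih =>
        intro hs x hx
        rw [Finset.sum_insert hg] at hx
        let e : Subring.center D := ⟨y g, hc g (hs (Finset.mem_insert_self _ _))⟩
        obtain ⟨δ, r, h1⟩ := ih (fun _ h => hs (Finset.mem_insert_of_mem h)) (x - e) (by change (x : D) - y g = _; rw [hx, add_sub_cancel_left])
        obtain ⟨δ', r', h2⟩ : ∃ δ r, e * φ (MvPolynomial.monomial δ 1) = φ r := by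
          by_cases he : e = 0
          · exact ⟨0, 0, by rw [he, zero_mul, map_zero]⟩
          have heL : g + θ ∈ L := ⟨e, he, (hy g).2⟩
          let v := b.repr ⟨_, heL⟩
          let α : Fin (Module.finrank ℤ L) →₀ ℕ := Finsupp.equivFunOnFinite.symm fun i => (v i).toNat
          let δ : Fin (Module.finrank ℤ L) →₀ ℕ := Finsupp.equivFunOnFinite.symm fun i => (-v i).toNat
          have hw : g + θ + wt δ = wt α := by
            have : (⟨_, heL⟩ : L) + ∑ i, (δ i : ℤ) • b i = ∑ i, (α i : ℤ) • b i := by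
              rw [← b.sum_repr ⟨_, heL⟩, ← sum_add_distrib]
              refine sum_congr rfl fun i _ => ?_
              rw [← add_smul]; congr 1
              change v i + ((-v i).toNat : ℤ) = ((v i).toNat : ℤ)
              omega
            exact congrArg Subtype.val this
          have hk : e * U δ * (U α)⁻¹ ∈ k := by
            have := H.mul (H.mul (hy g).2 (hUW δ)) (H.inv (hUW α))
            rwa [hw, add_neg_cancel] at this
          exact ⟨δ, MvPolynomial.monomial α ⟨_, hk⟩, by rw [hm, hφU]; exact (inv_mul_cancel_right₀ (hU0 α) _).symm⟩
        refine ⟨δ + δ', r * MvPolynomial.monomial δ' 1 + r' * MvPolynomial.monomial δ 1, ?_⟩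
        rw [map_add, map_mul, map_mul, ← h1, ← h2, hm, hm, hm, show U (δ + δ') = U δ * U δ' by
          simp only [U, Finsupp.add_apply, pow_add, Finset.prod_mul_distrib]]
        ring
    exact key G subset_rfl x hsum.symm

/-- a central prime element -/
lemma HS.exists_w [Module.Free ℤ Γ] [Module.Finite ℤ Γ] (I : Submodule ℂ D) (hr : ∀ t ∈ H.T, ∀ x ∈ I, x * t ∈ I) (h1 : (1 : D) ∉ I)
    (hp : ∀ x y : Subring.center D, (x : D) ∈ H.T → (y : D) ∈ H.T → (x * y : D) ∈ I → (x : D) ∈ I ∨ (y : D) ∈ I) {x : Subring.center D} (hxT : (x : D) ∈ H.T) (hx : (x : D) ∈ I) (hx0 : x ≠ 0) :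
    ∃ w : Subring.center D, w ≠ 0 ∧ (w : D) ∈ H.T ∧ (w : D) ∈ I ∧ ∀ x y t : Subring.center D, (x : D) ∈ H.T → (y : D) ∈ H.T → (t : D) ∈ H.T →
      x * y = w * t → (∃ t ∈ H.T, (x : D) = w * t) ∨ (∃ t ∈ H.T, (y : D) = w * t) := by
  obtain ⟨R, _, _, _, φ, inj, hT, hloc⟩ := H.center_ufd
  let Q : Ideal R :=
    { carrier := {r | (φ r : D) ∈ I}
      add_mem' := fun {a b} ha hb => by
        change ((φ (a + b) : Subring.center D) : D) ∈ I
        rw [map_add]; exact add_mem (S := Submodule ℂ D) ha hb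
      zero_mem' := by change ((φ 0 : Subring.center D) : D) ∈ I; rw [map_zero]; exact zero_mem I
      smul_mem' := fun c r hr' => by
        change ((φ (c * r) : Subring.center D) : D) ∈ I
        rw [mul_comm, map_mul]; exact hr _ (hT c) _ hr' }
  have hQ : Q.IsPrime := ⟨fun h0 => h1 (by
      have : (1 : R) ∈ Q := by rw [h0]; trivial
      have : ((φ 1 : Subring.center D) : D) ∈ I := this
      rwa [map_one] at this), fun {a b} hab => hp _ _ (hT a) (hT b) (by
      have : ((φ (a * b) : Subring.center D) : D) ∈ I := hab
      rwa [map_mul] at this)⟩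
  have hQ0 : Q ≠ ⊥ := fun h0 => by
    obtain ⟨m, r, hm, -, h2⟩ := hloc x hxT
    have : r ∈ Q := by
      change (φ r : D) ∈ I
      rw [← h2]; exact hr _ (hT m) _ hx
    rw [h0, Ideal.mem_bot] at this
    rw [this, map_zero] at h2
    exact mul_ne_zero hx0 hm h2
  obtain ⟨π, hπ, hprime⟩ := hQ.exists_mem_prime_of_ne_bot hQ0
  refine ⟨φ π, fun h0 => hprime.ne_zero (inj (h0.trans (map_zero φ).symm)), hT π, hπ, fun x y t hx hy ht hxy => ?_⟩
  obtain ⟨m1, r1, hm1, hi1, e1⟩ := hloc x hx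
  obtain ⟨m2, r2, hm2, hi2, e2⟩ := hloc y hy
  obtain ⟨m3, r3, hm3, hi3, e3⟩ := hloc t ht
  have e : r1 * r2 * m3 = π * (r3 * (m1 * m2)) := inj (by
    simp only [map_mul, ← e1, ← e2, ← e3]
    linear_combination (φ m1 * φ m2 * φ m3) * hxy)
  have key : ∀ (x : Subring.center D) m r, φ m ≠ 0 → (φ m : D)⁻¹ ∈ H.T → x * φ m = φ r → π ∣ r → ∃ t ∈ H.T, (x : D) = φ π * t := by
    rintro x m _ hm hi he ⟨r, rfl⟩
    refine ⟨φ r * (φ m : D)⁻¹, mul_mem (hT r) hi, ?_⟩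
    have : x = φ π * (φ r * (φ m)⁻¹) := by
      rw [map_mul] at he
      rw [← mul_assoc, ← he, mul_inv_cancel_right₀ hm]
    exact congrArg Subtype.val this
  rcases hprime.dvd_or_dvd (Dvd.intro _ e.symm) with h2 | h2
  · rcases hprime.dvd_or_dvd h2 with h2 | h2
    · exact Or.inl (key x m1 r1 hm1 hi1 e1 h2)
    · exact Or.inr (key y m2 r2 hm2 hi2 e2 h2)
  · exfalso
    have h3 : (φ m3 : D) ∈ I := Q.mem_of_dvd h2 hπ
    have := hr _ hi3 _ h3
    rw [mul_inv_cancel₀ (fun h0 => hm3 (Subtype.ext h0))] at this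
    exact h1 this

theorem HS.ufd [Module.Free ℤ Γ] [Module.Finite ℤ Γ] [IsDomain A] [IsNoetherianRing A] (P : TwoSidedIdeal A) (hP : IsPrimeTwoSided P) (hP0 : P ≠ ⊥)
    (hmin : ∀ Q : TwoSidedIdeal A, IsPrimeTwoSided Q → Q ≠ ⊥ → Q ≤ P → Q = P) : ∃ r, IsNormalElem r ∧ P = TwoSidedIdeal.span {r} := by
  have gen : ∀ r ∈ P, (∀ x ∈ P, (∃ b, x = b * r) ∨ ∃ b, x = r * b) → P = TwoSidedIdeal.span {r} := fun r hr hx => by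
    refine le_antisymm (fun x hxP => ?_) (TwoSidedIdeal.span_le.2 (Set.singleton_subset_iff.2 hr))
    have hr' : r ∈ TwoSidedIdeal.span {r} := TwoSidedIdeal.subset_span rfl
    rcases hx x hxP with ⟨b, rfl⟩ | ⟨b, rfl⟩
    · exact TwoSidedIdeal.mul_mem_left _ _ _ hr'
    · exact TwoSidedIdeal.mul_mem_right _ _ _ hr'
  have h1P : (1 : A) ∉ P := fun h1 => hP.1 (TwoSidedIdeal.one_mem_iff _ |>.1 h1)
  have top : ∀ Q : TwoSidedIdeal A, Q ≤ P → Q ≠ ⊤ := fun Q hQ h0 => h1P (hQ (by rw [h0]; trivial))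
  by_cases hz : ∃ k, z k ∈ P
  · obtain ⟨k, hk⟩ := hz
    let Q : TwoSidedIdeal A := TwoSidedIdeal.mk' {x | ∃ g, x = g * z k} ⟨0, by simp⟩
      (by rintro _ _ ⟨g, rfl⟩ ⟨g', rfl⟩; exact ⟨g + g', by rw [add_mul]⟩) (by rintro _ ⟨g, rfl⟩; exact ⟨-g, by simp⟩)
      (by rintro x _ ⟨g, rfl⟩; exact ⟨x * g, by rw [mul_assoc]⟩)
      (by
        rintro _ y ⟨g, rfl⟩
        obtain ⟨e, he⟩ := (H.norm k y).1
        exact ⟨g * e, by rw [mul_assoc, he, mul_assoc]⟩)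
    have hQ : ∀ x, x ∈ Q ↔ ∃ g, x = g * z k := fun x => TwoSidedIdeal.mem_mk' _ _ _ _ _ _ x
    have hle : Q ≤ P := fun x hx => by
      obtain ⟨g, rfl⟩ := (hQ x).1 hx
      exact P.mul_mem_left _ _ hk
    have hQP : Q = P := hmin Q ⟨top Q hle, fun x y hxy => by
        simp only [hQ] at hxy ⊢
        have := hxy 1
        rw [mul_one] at this
        exact H.prime k x y this⟩ (fun h0 => H.ne k (by
        have : z k ∈ Q := (hQ _).2 ⟨1, (one_mul _).symm⟩
        rwa [h0] at this)) hle
    exact ⟨z k, ⟨fun f => (H.norm k f).1, fun f => (H.norm k f).2⟩, gen _ hk fun x hx => Or.inl ((hQ x).1 (by rwa [hQP]))⟩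
  push Not at hz
  have hS : ∀ s ∈ 𝕊, s ∉ P := fun s hs => by
    refine Submonoid.closure_induction (motive := fun s _ => s ∉ P) (by rintro _ ⟨k, rfl⟩; exact hz k) h1P ?_ hs
    intro x y _ hy hx hyP hxy
    refine (hP.2 x y fun r => ?_).elim hx hyP
    obtain ⟨g, hg⟩ := H.S_nr hy r
    rw [mul_assoc, hg, ← mul_assoc]
    exact P.mul_mem_right _ _ hxy
  let PT : Submodule ℂ D :=
    { carrier := {x | ∃ s ∈ 𝕊, ∃ f ∈ P, x * j s = j f}
      add_mem' := by
        rintro x y ⟨s, hs, f, hfP, hf⟩ ⟨s', hs', f', hfP', hf'⟩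
        obtain ⟨g, hg⟩ := H.S_nr hs' s
        refine ⟨s * s', mul_mem hs hs', f * s' + f' * g, P.add_mem (P.mul_mem_right _ _ hfP) (P.mul_mem_right _ _ hfP'), ?_⟩
        rw [add_mul, map_add, map_mul, map_mul, map_mul, ← mul_assoc, hf, ← hf', mul_assoc y, ← map_mul, ← map_mul, ← map_mul, hg]
      zero_mem' := ⟨1, one_mem _, 0, P.zero_mem, by simp⟩
      smul_mem' := by
        rintro t x ⟨s, hs, f, hfP, hf⟩
        exact ⟨s, hs, algebraMap ℂ A t * f, P.mul_mem_left _ _ hfP, by rw [smul_mul_assoc, hf, ← map_smul, Algebra.smul_def]⟩ }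
  have hTP : ∀ x ∈ PT, x ∈ H.T := fun x ⟨s, hs, f, _, hf⟩ => ⟨s, hs, f, hf⟩
  have hjP : ∀ f ∈ P, j f ∈ PT := fun f hf => ⟨1, one_mem _, f, hf, by simp⟩
  have hPj : ∀ x, j x ∈ PT → x ∈ P := fun x ⟨s, hs, f, hfP, hf⟩ => by
    rw [← map_mul] at hf
    refine (hP.2 x s fun r => ?_).resolve_right (hS s hs)
    obtain ⟨g, hg⟩ := H.S_nr hs r
    rw [mul_assoc, hg, ← mul_assoc, H.fr.inj hf]
    exact P.mul_mem_right _ _ hfP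
  have hl : ∀ f, ∀ x ∈ PT, j f * x ∈ PT := fun f x ⟨s, hs, g, hg, hx⟩ =>
    ⟨s, hs, f * g, P.mul_mem_left _ _ hg, by rw [mul_assoc, hx, map_mul]⟩
  have hr : ∀ t ∈ H.T, ∀ x ∈ PT, x * t ∈ PT := by
    rintro t ⟨s', hs', f', hf'⟩ x ⟨s, hs, f, hfP, hf⟩
    obtain ⟨g, hg⟩ := H.S_nr hs f'
    refine ⟨s' * s, mul_mem hs' hs, f * g, P.mul_mem_right _ _ hfP, ?_⟩
    rw [map_mul, mul_assoc, ← mul_assoc t, hf', ← map_mul, hg, map_mul, ← mul_assoc, hf, map_mul]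
  have h1 : (1 : D) ∉ PT := fun h0 => h1P (hPj 1 (by rwa [map_one]))
  -- a central element in the localized prime
  obtain ⟨x0, hx0P, hx0c, hx00⟩ : ∃ x ∈ PT, x ∈ Subring.center D ∧ x ≠ 0 := by
    by_contra hcon
    push Not at hcon
    refine hP0 (le_antisymm (fun f hf => ?_) bot_le)
    have := H.claim' PT ⊥ hl hr (fun t _ x hx => by rw [(Submodule.mem_bot ℂ).1 hx, zero_mul]; exact zero_mem _)
      (fun x hx hc => (Submodule.mem_bot ℂ).2 (hcon x hx hc)) (hjP f hf) (H.T_j f)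
    exact H.fr.inj (((Submodule.mem_bot ℂ).1 this).trans (map_zero j).symm)
  obtain ⟨⟨w, hwc⟩, hw0, hwT, hwP, hw⟩ := H.exists_w PT hr h1 (fun x y ⟨s, hs, f, hf⟩ ⟨s', hs', f', hf'⟩ hxy => by
    have hy := Subring.mem_center_iff.1 y.2
    have key : ∀ {x : D} {s f}, s ∈ 𝕊 → x * j s = j f → f ∈ P → x ∈ PT := fun hs hf hfP => ⟨_, hs, _, hfP, hf⟩
    refine (hP.2 f f' fun r => hPj _ ?_).imp (key hs hf) (key hs' hf')
    rw [map_mul, map_mul, ← hf, ← hf', show (x : D) * j s * j r * (y * j s') = x * (y * (j s * j r)) * j s' by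
      rw [← hy (j s * j r)]; noncomm_ring, ← mul_assoc (x : D), ← map_mul, mul_assoc _ _ (j s'), ← map_mul]
    exact hr _ (H.T_j _) _ hxy) (x := ⟨x0, hx0c⟩) (hTP _ hx0P) hx0P (fun h0 => hx00 (congrArg Subtype.val h0))
  have hw0 : w ≠ 0 := fun h0 => hw0 (Subtype.ext h0)
  have hwc' : ∀ x, x * w = w * x := Subring.mem_center_iff.1 hwc
  let J : Submodule ℂ D := H.T.toSubmodule.map (LinearMap.mulLeft ℂ w)
  have hJm : ∀ x, x ∈ J ↔ ∃ t ∈ H.T, x = w * t := fun x => ⟨fun ⟨t, ht, e⟩ => ⟨t, ht, e.symm⟩, fun ⟨t, ht, e⟩ => ⟨t, ht, e.symm⟩⟩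
  have hJr : ∀ t ∈ H.T, ∀ x ∈ J, x * t ∈ J := fun t ht x hx => by
    obtain ⟨t', ht', rfl⟩ := (hJm x).1 hx
    exact (hJm _).2 ⟨t' * t, mul_mem ht' ht, mul_assoc _ _ _⟩
  have hJl : ∀ t ∈ H.T, ∀ x ∈ J, t * x ∈ J := fun t ht x hx => by
    obtain ⟨t', ht', rfl⟩ := (hJm x).1 hx
    exact (hJm _).2 ⟨t * t', mul_mem ht ht', by rw [← mul_assoc, hwc', mul_assoc]⟩
  have hJP : ∀ x, j x ∈ J → x ∈ P := fun x hx => by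
    obtain ⟨t, ht, e⟩ := (hJm _).1 hx
    exact hPj x (by rw [e]; exact hr _ ht _ hwP)
  let Q : TwoSidedIdeal A := TwoSidedIdeal.mk' {x | j x ∈ J} (by simp) (fun h1 h2 => by simpa using J.add_mem h1 h2) (fun h1 => by simpa using h1)
    (fun h1 => by simpa using hJl _ (H.T_j _) _ h1) (fun h1 => by simpa using hJr _ (H.T_j _) _ h1)
  have hQ : ∀ x, x ∈ Q ↔ j x ∈ J := fun x => TwoSidedIdeal.mem_mk' _ _ _ _ _ _ x
  have hle : Q ≤ P := fun x hx => hJP x ((hQ x).1 hx)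
  obtain ⟨s, hs, f, hf⟩ := id hwT
  have hwJ : w ∈ J := (hJm _).2 ⟨1, one_mem _, (mul_one w).symm⟩
  have hf0 : f ≠ 0 := fun h0 => mul_ne_zero hw0 (H.S_ne hs) (by rw [hf, h0, map_zero])
  have hQP : Q = P := by
    refine hmin Q ⟨top Q hle, fun x y hxy => ?_⟩ (fun h0 => hf0 ?_) hle
    · simp only [hQ, map_mul] at hxy ⊢
      by_contra! hcon
      have hYm : ∀ t, t ∈ (⨅ r : A, J.comap (LinearMap.mulLeft ℂ (j x * j r))) ↔ ∀ r, j x * j r * t ∈ J := fun t => by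
        rw [Submodule.mem_iInf]; rfl
      obtain ⟨η, hη, hηc, hηT, hηJ⟩ : ∃ η ∈ (⨅ r : A, J.comap (LinearMap.mulLeft ℂ (j x * j r))), η ∈ Subring.center D ∧ η ∈ H.T ∧ η ∉ J := by
        by_contra! hc
        refine hcon.2 (H.claim' ((⨅ r : A, J.comap (LinearMap.mulLeft ℂ (j x * j r))) ⊓ H.T.toSubmodule) J (fun f t ht => ⟨(hYm _).2 fun r => ?_, H.T.mul_mem (H.T_j f) ht.2⟩)
          (fun t' ht' t ht => ⟨(hYm _).2 fun r => ?_, H.T.mul_mem ht.2 ht'⟩) hJr (fun t ht htc => hc t ht.1 htc ht.2) ⟨(hYm _).2 hxy, H.T_j y⟩ (H.T_j y))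
        · have := (hYm _).1 ht.1 (r * f)
          rwa [map_mul, ← mul_assoc, mul_assoc _ (j f)] at this
        · rw [← mul_assoc]
          exact hJr _ ht' _ ((hYm _).1 ht.1 r)
      have hη1 := (hYm _).1 hη 1
      rw [map_one, mul_one] at hη1
      have hηc' := Subring.mem_center_iff.1 hηc
      obtain ⟨ξ, hξ, hξc, hξT, hξJ⟩ : ∃ ξ ∈ J.comap (LinearMap.mulRight ℂ η), ξ ∈ Subring.center D ∧ ξ ∈ H.T ∧ ξ ∉ J := by
        by_contra! hc
        refine hcon.1 (H.claim' (J.comap (LinearMap.mulRight ℂ η) ⊓ H.T.toSubmodule) J (fun f t ht => ⟨?_, H.T.mul_mem (H.T_j f) ht.2⟩)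
          (fun t' ht' t ht => ⟨?_, H.T.mul_mem ht.2 ht'⟩) hJr (fun t ht htc => hc t ht.1 htc ht.2) ⟨hη1, H.T_j x⟩ (H.T_j x))
        · show j f * t * η ∈ J
          rw [mul_assoc]
          exact hJl _ (H.T_j f) _ ht.1
        · show t * t' * η ∈ J
          rw [mul_assoc, hηc', ← mul_assoc]
          exact hJr _ ht' _ ht.1
      obtain ⟨t, ht, e⟩ := (hJm _).1 (show ξ * η ∈ J from hξ)
      have htc : t ∈ Subring.center D := by
        rw [show t = w⁻¹ * (ξ * η) by rw [e, inv_mul_cancel_left₀ hw0]]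
        exact mul_mem (Set.inv_mem_center hwc) (mul_mem hξc hηc)
      exact (hw ⟨ξ, hξc⟩ ⟨η, hηc⟩ ⟨t, htc⟩ hξT hηT ht (Subtype.ext e)).elim (fun h => hξJ ((hJm _).2 h)) (fun h => hηJ ((hJm _).2 h))
    · have : f ∈ Q := (hQ f).2 (by rw [← hf]; exact hJr _ (H.T_j _) _ hwJ)
      rwa [h0] at this
  -- the generator
  let good : A → Prop := fun a => a ≠ 0 ∧ ∃ v, j a = v * w ∧ v ∈ H.T ∧ v⁻¹ ∈ H.T ∧ (∀ f, ∃ g, v * j f = j g * v) ∧ ∀ f, ∃ g, j f * v = v * j g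
  obtain ⟨_, ⟨a, ⟨ha0, v, hav, hvT, hviT, hvl, hvr⟩, rfl⟩, hmax⟩ := set_has_maximal_iff_noetherian.2 ‹IsNoetherianRing A›
    ((fun a : A => Ideal.span {a}) '' {a | good a}) ⟨_, f, ⟨hf0, j s, by rw [← hf, hwc'], H.T_j s, H.T_inv hs,
      fun g => (H.S_nl hs g).imp fun _ e => by rw [← map_mul, e, map_mul], fun g => (H.S_nr hs g).imp fun _ e => by rw [← map_mul, e, map_mul]⟩, rfl⟩
  have hv0 : v ≠ 0 := fun h0 => H.fr.ne ha0 (by rw [hav, h0, zero_mul])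
  have haP : a ∈ P := hJP a ((hJm _).2 ⟨v, hvT, by rw [hav, hwc']⟩)
  have hunit : ∀ k a', a = z k * a' → ∃ b, b * z k = 1 := fun k a' e => by
    have hk : j (z k) ≠ 0 := H.fr.ne (H.ne k)
    have hks : z k ∈ 𝕊 := Submonoid.subset_closure ⟨k, rfl⟩
    have ha'0 : a' ≠ 0 := fun h0 => ha0 (by rw [e, h0, mul_zero])
    have hg : good a' := by
      refine ⟨ha'0, (j (z k))⁻¹ * v, ?_, mul_mem (H.T_inv hks) hvT, ?_, fun f => ?_, fun f => ?_⟩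
      · rw [mul_assoc, ← hav, e, map_mul, inv_mul_cancel_left₀ hk]
      · rw [mul_inv_rev, inv_inv]
        exact mul_mem hviT (H.T_j _)
      · obtain ⟨g, hg⟩ := hvl f
        obtain ⟨g', hg'⟩ := (H.norm k g).2
        refine ⟨g', ?_⟩
        rw [mul_assoc, hg, inv_mul_eq_iff_eq_mul₀ hk, ← mul_assoc, ← mul_assoc, ← map_mul, ← hg', map_mul, mul_assoc (j g), mul_inv_cancel₀ hk, mul_one]
      · obtain ⟨g, hg⟩ := (H.norm k f).1
        obtain ⟨g', hg'⟩ := hvr g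
        refine ⟨g', ?_⟩
        rw [mul_assoc, ← hg', ← mul_assoc, ← mul_assoc, ← mul_left_inj' (inv_ne_zero hv0)]
        rw [mul_assoc _ v, mul_inv_cancel₀ hv0, mul_one, mul_assoc _ v, mul_inv_cancel₀ hv0, mul_one, eq_inv_mul_iff_mul_eq₀ hk, ← mul_assoc, ← map_mul, hg, map_mul,
          mul_assoc, mul_inv_cancel₀ hk, mul_one]
    have hle' : Ideal.span {a} ≤ Ideal.span {a'} := (Ideal.span_singleton_le_iff_mem _).2 (Ideal.mem_span_singleton'.2 ⟨z k, e.symm⟩)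
    have := hmax _ ⟨a', hg, rfl⟩
    have h2 : a' ∈ Ideal.span {a} := by
      by_contra hn
      exact this (lt_of_le_not_ge hle' fun h => hn (h (Ideal.subset_span rfl)))
    obtain ⟨b, hb⟩ := Ideal.mem_span_singleton'.1 h2
    exact ⟨b, mul_right_cancel₀ ha'0 (by rw [one_mul, mul_assoc, ← e, hb])⟩
  have strip : ∀ s ∈ 𝕊, ∀ x b, x * s = a * b → ∃ b', x = a * b' := fun s hs => by
    refine Submonoid.closure_induction (motive := fun s _ => ∀ x b, x * s = a * b → ∃ b', x = a * b') ?_ (fun x b e => ⟨b, by rw [← e, mul_one]⟩) ?_ hs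
    · rintro _ ⟨k, rfl⟩ x b e
      rcases H.prime k a b ⟨x, e.symm⟩ with ⟨g, hg⟩ | ⟨g, hg⟩
      · obtain ⟨g', hg'⟩ := (H.norm k g).2
        obtain ⟨u, hu⟩ := hunit k g' (by rw [hg, hg'])
        have hu' : z k * u = 1 := mul_right_cancel₀ (H.ne k) (by rw [mul_assoc, hu, mul_one, one_mul])
        exact ⟨b * u, by rw [← mul_assoc, ← e, mul_assoc, hu', mul_one]⟩
      · exact ⟨g, mul_right_cancel₀ (H.ne k) (by rw [e, hg, mul_assoc])⟩
    · intro s s' _ _ h1 h2 x b e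
      obtain ⟨b', hb'⟩ := h2 (x * s) b (by rw [mul_assoc, e])
      exact h1 x b' hb'
  refine ⟨a, ⟨fun x => ?_, fun x => ?_⟩, gen a haP fun x hx => Or.inr ?_⟩
  · obtain ⟨g, hg⟩ := hvl x
    exact ⟨g, H.fr.inj (by rw [map_mul, map_mul, hav, mul_assoc, ← hwc', ← mul_assoc, hg, mul_assoc])⟩
  · obtain ⟨g, hg⟩ := hvr x
    exact ⟨g, H.fr.inj (by rw [map_mul, map_mul, hav, ← mul_assoc, hg, mul_assoc, hwc', mul_assoc])⟩
  · obtain ⟨t, ht, e⟩ := (hJm _).1 ((hQ x).1 (by rwa [hQP]))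
    obtain ⟨s', hs', b, hb⟩ := mul_mem hviT ht
    refine strip s' hs' x b (H.fr.inj ?_)
    rw [map_mul, map_mul, e, ← hb, hav, hwc' v, mul_assoc w, mul_assoc v⁻¹, mul_assoc w, mul_inv_cancel_left₀ hv0]
end

lemma Ops.hs : HS j o.W o.z := by
  have C : ∀ J : Submodule ℂ D, (∀ k, ∀ x ∈ J, o.T k x ∈ J) → ∀ (s : Finset ((Fin n → ℤ) × (Fin n → ℤ))) (x : (Fin n → ℤ) × (Fin n → ℤ) → D) θ,
      (∀ g ∈ s, x g ∈ o.W (g + θ)) → ∑ g ∈ s, x g ∈ J → ∀ g ∈ s, x g ∈ J := fun J hJ s x θ hx h0 =>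
    comp_mem (fun k => (o.T k).toLinearMap) (fun g => tev q d (g + θ)) (fun g g' e => add_right_cancel (tev_inj h.C e)) J hJ s x hx h0
  exact
    { fr := o.fr
      mul := o.W_mul
      one := o.W_one
      inv := o.W_inv
      ind := fun s x θ hx h0 => C ⊥ (by simp) s x θ hx h0
      cmp := fun s x θ hx h0 => C (LinearMap.range j.toLinearMap) (by rintro k _ ⟨f, rfl⟩; exact ⟨_, (o.T_j k f).symm⟩) s x θ hx h0
      dec := fun f => by
        have hf : f ∈ ⨆ p : (Fin n → ℤ) × (Fin n → ℤ), h.BW p.1 p.2 := by rw [h.sum_BW]; trivial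
        obtain ⟨x, hx, rfl⟩ := (Submodule.mem_iSup_iff_exists_finsupp _ _).1 hf
        exact ⟨x.support, x, fun g => o.W_j.2 (hx g), rfl⟩
      ne := o.z_ne
      wt := o.z_wt
      norm := o.z_norm
      prime := fun k _ _ => o.z_prime k
      simple := fun B h1 h2 h3 _ _ h4 h5 => o.simple B h1 h2 h3 h4 h5 }

include h in
theorem QG.ufd (cd : CD q a d) : ∀ P : TwoSidedIdeal A, IsPrimeTwoSided P →
    (P ≠ ⊥ ∧ ∀ Q : TwoSidedIdeal A, IsPrimeTwoSided Q → Q ≠ ⊥ → Q ≤ P → Q = P) → ∃ r : A, IsNormalElem r ∧ P = TwoSidedIdeal.span {r} := by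
  have := h.noeth cd; have := h.noeth_op cd; have := h.domain cd
  obtain ⟨D, _, _, j, hj⟩ := exists_Fr A
  choose c m hc using h.exists_Cp cd
  obtain ⟨o, -⟩ := h.exists_Ops cd hj hc
  exact fun P h1 h2 => o.hs.ufd P h1 h2.1 h2.2

end

end

theorem OqG_noetherian_UFD
    -- the deformation parameter: a transcendental complex number
    (q : ℂ) (hq : Transcendental ℚ q)
    -- Cartan data of the complex semisimple Lie algebra 𝔤 of rank n
    (n : ℕ) (hn : 0 < n) (a : Fin n → Fin n → ℤ) (d : Fin n → ℕ)
    (ha_diag : ∀ i, a i i = 2) (ha_off : ∀ i j, i ≠ j → a i j ≤ 0)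
    (ha_zero : ∀ i j, a i j = 0 ↔ a j i = 0)
    (hd_pos : ∀ i, 0 < d i)
    (ha_symm : ∀ i j, (d i : ℤ) * a i j = (d j : ℤ) * a j i)
    -- the quantised enveloping algebra U = U_q(𝔤): carries elements E i, F i and units K i
    -- satisfying the defining relations, and is universal for these relations
    (U : Type) [Ring U] [Algebra ℂ U]
    (E F : Fin n → U) (K : Fin n → Uˣ)
    (hrel : UqRels q a d U E F K)
    (hUuniv : ∀ (B : Type) [Ring B] [Algebra ℂ B] (E' F' : Fin n → B) (K' : Fin n → Bˣ),
      UqRels q a d B E' F' K' → ∃! φ : U →ₐ[ℂ] B,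
        (∀ i, φ (E i) = E' i) ∧ (∀ i, φ (F i) = F' i) ∧ (∀ i, φ (K i : U) = (K' i : B)))
    -- the Hopf algebra structure of U_q(𝔤)
    (Δ : U →ₐ[ℂ] U ⊗[ℂ] U) (ε : U →ₐ[ℂ] ℂ)
    (hΔE : ∀ i, Δ (E i) = E i ⊗ₜ 1 + (K i : U) ⊗ₜ E i)
    (hΔF : ∀ i, Δ (F i) = F i ⊗ₜ (((K i)⁻¹ : Uˣ) : U) + 1 ⊗ₜ F i)
    (hΔK : ∀ i, Δ (K i : U) = (K i : U) ⊗ₜ (K i : U))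
    (hεE : ∀ i, ε (E i) = 0) (hεF : ∀ i, ε (F i) = 0) (hεK : ∀ i, ε (K i : U) = 1)
    -- the simple finite-dimensional modules V(λ) of highest weight λ = ∑ c i ϖ i ∈ P⁺
    (V : (Fin n → ℕ) → Type) [∀ c, AddCommGroup (V c)] [∀ c, Module ℂ (V c)]
    (ρ : ∀ c, U →ₐ[ℂ] Module.End ℂ (V c))
    (hfd : ∀ c, FiniteDimensional ℂ (V c))
    (hsimple : ∀ c (N : Submodule ℂ (V c)), (∀ (u : U), ∀ v ∈ N, ρ c u v ∈ N) → N = ⊥ ∨ N = ⊤)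
    (hhw : ∀ c, ∃ v : V c, v ≠ 0 ∧ v ∈ wtSp q d K (ρ c) (fun i => (c i : ℤ)) ∧
      ∀ i, ρ c (E i) v = 0)
    (hwtsum : ∀ c, (⨆ μ : Fin n → ℤ, wtSp q d K (ρ c) μ) = ⊤)
    -- the quantised coordinate ring A = O_q(G): an algebra of linear forms on U (via the
    -- injection ι into the dual space, multiplication being convolution through Δ),
    -- generated by the coordinate functions cf c ξ v = c^λ_{ξ,v} : u ↦ ξ (u · v)
    (A : Type) [Ring A] [Algebra ℂ A]
    (ι : A →ₗ[ℂ] (U →ₗ[ℂ] ℂ)) (hιinj : Function.Injective ι)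
    (hι1 : ι 1 = ε.toLinearMap)
    (hιmul : ∀ x y : A, ι (x * y) =
      (TensorProduct.lid ℂ ℂ).toLinearMap ∘ₗ (TensorProduct.map (ι x) (ι y)) ∘ₗ Δ.toLinearMap)
    (cf : ∀ c : Fin n → ℕ, Module.Dual ℂ (V c) → V c → A)
    (hcf : ∀ c ξ v u, ι (cf c ξ v) u = ξ (ρ c u v))
    (hAgen : Algebra.adjoin ℂ {x : A | ∃ c ξ v, x = cf c ξ v} = ⊤) :
    -- O_q(G) is a noetherian domain in which every height one prime ideal is generated
    -- by a normal element
    IsNoetherianRing A ∧ IsNoetherianRing Aᵐᵒᵖ ∧ IsDomain A ∧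
    ∀ P : TwoSidedIdeal A, IsPrimeTwoSided P →
      (P ≠ ⊥ ∧ ∀ Q : TwoSidedIdeal A, IsPrimeTwoSided Q → Q ≠ ⊥ → Q ≤ P → Q = P) →
      ∃ r : A, IsNormalElem r ∧ P = TwoSidedIdeal.span {r} := by
  have hC : Cartan q a d := ⟨hq, ha_diag, hd_pos, ha_symm⟩
  have hU : URel q a d E F K := URel.of_univ hrel hUuniv
  have hV : Fam q d E K ρ := ⟨hfd, hsimple, hhw, hwtsum⟩
  obtain ⟨cd⟩ := exists_CD hC hU hV
  have hcf' : ∀ c ξ v, ι (cf c ξ v) = mc (ρ c) ξ v := fun c ξ v => LinearMap.ext fun u => hcf c ξ v u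
  have h : QG q a d E F K Δ ε ρ ι :=
    { C := hC
      rel := hrel
      univ := hUuniv
      cop := ⟨hΔE, hΔF, hΔK⟩
      eE := hεE
      eF := hεF
      eK := hεK
      sr := fun c => ⟨hfd c, hsimple c, hwtsum c, by
        obtain ⟨v, hv, -⟩ := hhw c
        exact ⟨v, 0, hv⟩⟩
      hw := fun c => ⟨c, hhw c⟩
      lw := lw_of hC hrel hUuniv cd hV
      inj := hιinj
      one := hι1
      mul := hιmul
      coef := fun c ξ v => ⟨_, hcf' c ξ v⟩
      gen := fun B hB => by
        rw [eq_top_iff, ← hAgen]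
        refine Algebra.adjoin_le ?_
        rintro _ ⟨c, ξ, v, rfl⟩
        exact hB c ξ v _ (hcf' c ξ v) }
  exact ⟨h.noeth cd, h.noeth_op cd, h.domain cd, h.ufd cd⟩
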